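/- Let d ≥ 3 and let F, G be binary forms of degree d with rational coefficients and nonzero discriminant (i.e. F, G ∈ Bin(d,ℚ)). Suppose that Aut(F,ℚ) is conjugate in GL(2,ℚ) to the group D₄, and that F(ℤ²) = G(ℤ²). Then there exists γ = [[a,b],[c,d]] ∈ GL(2,ℤ) (an integer matrix with ad − bc = ±1) such that F(aX + bY, cX + dY) = G(X,Y). Equivalently, there is no extraordinary binary form F with Aut(F,ℚ) ≅_{GL(2,ℚ)} D₄. -/

import Mathlib

open MvPolynomial in
/-- The action `F ∘ γ` of a matrix `γ = [[a,b],[c,d]]` on a binary form: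
`(F ∘ γ)(X, Y) = F(aX + bY, cX + dY)`. -/
noncomputable def compForm (F : MvPolynomial (Fin 2) ℚ) (γ : Matrix (Fin 2) (Fin 2) ℚ) :
    MvPolynomial (Fin 2) ℚ :=
  aeval (fun i => C (γ i 0) * X 0 + C (γ i 1) * X 1) F

/-- `F ∈ Bin(d, ℚ)`: a binary form of degree `d` with rational coefficients and
nonzero discriminant (equivalently, squarefree as a polynomial). -/
def IsBinForm (d : ℕ) (F : MvPolynomial (Fin 2) ℚ) : Prop :=
  F.IsHomogeneous d ∧ Squarefree F

/-- The set of values `F(ℤ²) = {F(x,y) : (x,y) ∈ ℤ²}`. -/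
def valueSet (F : MvPolynomial (Fin 2) ℚ) : Set ℚ :=
  {q | ∃ x y : ℤ, MvPolynomial.eval ![(x : ℚ), (y : ℚ)] F = q}

/-- `Aut(F, ℚ) = {γ ∈ GL(2,ℚ) : F ∘ γ = F}`, as a set of invertible rational matrices. -/
def AutQ (F : MvPolynomial (Fin 2) ℚ) : Set (Matrix (Fin 2) (Fin 2) ℚ) :=
  {γ | γ.det ≠ 0 ∧ compForm F γ = F}

/-- The subgroup `D₄ ⊆ GL(2, ℚ)` generated by `[[0,1],[1,0]]` and `[[0,1],[-1,0]]`,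
as a set of matrices.  (Both generators have finite multiplicative order, so the
multiplicative closure coincides with the generated subgroup.) -/
def D4 : Set (Matrix (Fin 2) (Fin 2) ℚ) :=
  (Submonoid.closure {!![0, 1; 1, 0], !![0, 1; -1, 0]} : Submonoid (Matrix (Fin 2) (Fin 2) ℚ))

section PartP1
/-- homogeneous evaluation -/
def hev {R : Type*} [CommRing R] (d : ℕ) (c : ℕ → ℤ) (x y : R) : R :=
  ∑ i ∈ Finset.range (d+1), (c i : R) * x^i * y^(d-i)

theorem hev_zero {R : Type*} [CommRing R] (c : ℕ → ℤ) (x y : R) : hev 0 c x y = c 0 := by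
  simp [hev]

theorem hev_succ {R : Type*} [CommRing R] (d : ℕ) (c : ℕ → ℤ) (x y : R) :
    hev (d+1) c x y = x * hev d (fun i => c (i+1)) x y + c 0 * y^(d+1) := by
  unfold hev
  rw [Finset.sum_range_succ', Finset.mul_sum]
  congr 1
  · apply Finset.sum_congr rfl
    intro i hi
    rw [Nat.add_sub_add_right]; ring
  · simp

theorem hev_add {R : Type*} [CommRing R] (d : ℕ) (c c' : ℕ → ℤ) (x y : R) :
    hev d (fun i => c i + c' i) x y = hev d c x y + hev d c' x y := by
  unfold hev
  rw [← Finset.sum_add_distrib]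
  apply Finset.sum_congr rfl
  intro i _
  push_cast; ring

theorem hev_smul {R : Type*} [CommRing R] (d : ℕ) (k : ℤ) (c : ℕ → ℤ) (x y : R) :
    hev d (fun i => k * c i) x y = k * hev d c x y := by
  unfold hev
  rw [Finset.mul_sum]
  apply Finset.sum_congr rfl
  intro i _
  push_cast; ring

theorem hev_map {R S : Type*} [CommRing R] [CommRing S] (φ : R →+* S) (d : ℕ) (c : ℕ → ℤ) (x y : R) :
    hev d c (φ x) (φ y) = φ (hev d c x y) := by
  simp [hev]

theorem hev_intCast {R : Type*} [CommRing R] (d : ℕ) (c : ℕ → ℤ) (x y : ℤ) :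
    hev d c (x:R) (y:R) = ((hev d c x y : ℤ) : R) := by
  simpa using hev_map (Int.castRingHom R) d c x y

theorem hev_scale {R : Type*} [CommRing R] (d : ℕ) (c : ℕ → ℤ) (k x y : R) :
    hev d c (k * x) (k * y) = k^d * hev d c x y := by
  unfold hev
  rw [Finset.mul_sum]
  apply Finset.sum_congr rfl
  intro i hi
  have : i ≤ d := by simp at hi; omega
  obtain ⟨j, rfl⟩ := Nat.exists_eq_add_of_le this
  simp only [Nat.add_sub_cancel_left]
  ring

/-- multiplication by linear form -/
theorem hev_mul_lin (d : ℕ) (a b : ℤ) (c : ℕ → ℤ) :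
    ∃ c' : ℕ → ℤ, ∀ (R : Type) [CommRing R] (x y : R),
      hev (d+1) c' x y = (a * x + b * y) * hev d c x y := by
  refine ⟨fun i => (if i = 0 then 0 else a * c (i-1)) + (if i ≤ d then b * c i else 0), ?_⟩
  intro R _ x y
  rw [hev_add (c := fun i => (if i = 0 then 0 else a * c (i-1)))
    (c' := fun i => (if i ≤ d then b * c i else 0)), hev_succ]
  have h1 : hev d (fun i => (if i + 1 = 0 then (0:ℤ) else a * c (i+1-1))) x y = a * hev d c x y := by
    rw [← hev_smul]; simp
  have h2 : hev (d+1) (fun i => (if i ≤ d then b * c i else 0)) x y = y * (b * hev d c x y) := by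
    unfold hev
    rw [Finset.sum_range_succ]
    simp only [Finset.mul_sum]
    have : ¬ (d + 1 ≤ d) := by omega
    simp only [this, if_false]
    simp only [Int.cast_zero, zero_mul, add_zero]
    apply Finset.sum_congr rfl
    intro i hi
    have hi' : i ≤ d := by simp at hi; omega
    simp only [hi', if_true]
    have : d + 1 - i = (d - i) + 1 := by omega
    rw [this]; push_cast; ring
  rw [h1, h2]; simp; ring

theorem hev_comp (d : ℕ) (a b e f : ℤ) (c : ℕ → ℤ) :
    ∃ c' : ℕ → ℤ, ∀ (R : Type) [CommRing R] (x y : R),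
      hev d c' x y = hev d c (a * x + b * y) (e * x + f * y) := by
  induction d generalizing c with
  | zero => exact ⟨c, fun R _ x y => by simp [hev_zero]⟩
  | succ d ih =>
    obtain ⟨c1, h1⟩ := ih (fun i => c (i+1))
    obtain ⟨c2, h2⟩ := hev_mul_lin d a b c1
    have hp : ∀ n : ℕ, ∃ c3 : ℕ → ℤ, ∀ (R : Type) [CommRing R] (x y : R),
      hev n c3 x y = (e * x + f * y)^n := by
      intro n
      induction n with
      | zero => exact ⟨fun _ => 1, fun R _ x y => by simp [hev_zero]⟩
      | succ n ih =>
        obtain ⟨c3, h3⟩ := ih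
        obtain ⟨c4, h4⟩ := hev_mul_lin n e f c3
        exact ⟨c4, fun R _ x y => by rw [h4, h3]; ring⟩
    obtain ⟨c3, h3⟩ := hp (d+1)
    refine ⟨fun i => c2 i + c 0 * c3 i, fun R _ x y => ?_⟩
    rw [hev_add (c := c2) (c' := fun i => c 0 * c3 i), hev_smul, h2, h1, h3, hev_succ]

/-- polynomial attached -/
theorem hev_poly {R : Type*} [CommRing R] (d : ℕ) (c : ℕ → ℤ) (y : R) :
    ∃ P : Polynomial R, P.natDegree ≤ d ∧ (∀ i ≤ d, P.coeff i = c i * y^(d-i)) ∧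
      ∀ x, P.eval x = hev d c x y := by
  refine ⟨∑ i ∈ Finset.range (d+1), Polynomial.monomial i ((c i : R) * y^(d-i)), ?_, ?_, ?_⟩
  · apply Polynomial.natDegree_sum_le_of_forall_le
    intro i hi
    refine (Polynomial.natDegree_monomial_le _).trans ?_
    simp at hi; omega
  · intro i hi
    rw [Polynomial.finsetSum_coeff]
    simp only [Polynomial.coeff_monomial]
    rw [Finset.sum_ite_eq']
    simp; omega
  · intro x
    rw [Polynomial.eval_finsetSum]
    simp only [Polynomial.eval_monomial, hev]
    apply Finset.sum_congr rfl
    intro i _; ring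

theorem hev_swap {R : Type*} [CommRing R] (d : ℕ) (c : ℕ → ℤ) (x y : R) :
    hev d (fun i => c (d - i)) x y = hev d c y x := by
  unfold hev
  rw [← Finset.sum_range_reflect]
  apply Finset.sum_congr rfl
  intro i hi
  have hi' : i ≤ d := by simp at hi; omega
  have h1 : d + 1 - 1 - i = d - i := by omega
  have h2 : d - (d - i) = i := by omega
  simp only [h1, h2]; ring
end PartP1

section PartP7
theorem s7_core (p : ℕ) [Fact p.Prime] (κ a b r r' : ℚ) (ha : padicNorm p a ≤ 1)
    (hb : padicNorm p b ≤ 1) (hr : padicNorm p r ≤ 1) (hr' : padicNorm p r' ≤ 1) (hκ : 0 < κ) :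
    ∃ x1 x2 : ℚ, padicNorm p x1 ≤ 1 ∧ padicNorm p x2 ≤ 1 ∧
    (padicNorm p (a*x1+(r-r')*x2) ≤ κ → padicNorm p (b*x2) ≤ κ →
      padicNorm p a ≤ κ ∧ padicNorm p (r-r') ≤ κ ∧ padicNorm p b ≤ κ) ∧
    (padicNorm p (a*x1+(r+r')*x2) ≤ κ → padicNorm p (b*x2) ≤ κ →
      padicNorm p a ≤ κ ∧ padicNorm p (r+r') ≤ κ ∧ padicNorm p b ≤ κ) ∧
    (padicNorm p (-r'*a*x1+(1-r'*r)*x2) ≤ κ → padicNorm p (b*(a*x1+r*x2)) ≤ κ →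
      padicNorm p (r'*a) ≤ κ ∧ padicNorm p (1-r'*r) ≤ κ ∧ padicNorm p (b*a) ≤ κ ∧
        padicNorm p (b*r) ≤ κ) ∧
    (padicNorm p (r'*a*x1+(1+r'*r)*x2) ≤ κ → padicNorm p (b*(a*x1+r*x2)) ≤ κ →
      padicNorm p (r'*a) ≤ κ ∧ padicNorm p (1+r'*r) ≤ κ ∧ padicNorm p (b*a) ≤ κ ∧
        padicNorm p (b*r) ≤ κ) := by
  have add : ∀ {z w : ℚ} {c : ℚ}, padicNorm p z ≤ c → padicNorm p w ≤ c → padicNorm p (z+w) ≤ c :=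
    fun h1 h2 => (padicNorm.nonarchimedean).trans (max_le h1 h2)
  have neg : ∀ {z c : ℚ}, padicNorm p z ≤ c → padicNorm p (-z) ≤ c := fun h => by
    rwa [padicNorm.neg]
  have sub : ∀ {z w : ℚ} {c : ℚ}, padicNorm p z ≤ c → padicNorm p w ≤ c → padicNorm p (z-w) ≤ c :=
    fun h1 h2 => by rw [sub_eq_add_neg]; exact add h1 (neg h2)
  have mulO : ∀ {z w c : ℚ}, padicNorm p z ≤ 1 → padicNorm p w ≤ c → padicNorm p (z*w) ≤ c :=
    fun {z w c} h1 h2 => by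
      rw [padicNorm.mul]
      have := padicNorm.nonneg (p := p) z
      have := padicNorm.nonneg (p := p) w
      nlinarith
  have one : padicNorm p 1 = 1 := padicNorm.one
  have two : padicNorm p 2 ≤ 1 := by
    have := padicNorm.of_int (p := p) 2; simpa using this
  -- cancel unit
  have unit : ∀ {z w c : ℚ}, padicNorm p w < 1 → padicNorm p (z*(1+w)) ≤ c → padicNorm p z ≤ c := by
    intro z w c hw h
    have h1 : padicNorm p (1+w) = 1 := by
      rw [padicNorm.add_eq_max_of_ne, one, max_eq_left hw.le]
      rw [one]; exact hw.ne'
    rwa [padicNorm.mul, h1, mul_one] at h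
  by_cases h1 : 1 ≤ κ
  · have c1 : ∀ {z}, padicNorm p z ≤ 1 → padicNorm p z ≤ κ := fun h => h.trans h1
    have rr := mulO hr' hr
    have ra := mulO hr' ha
    have ba := mulO hb ha
    have br := mulO hb hr
    refine ⟨0, 0, by simp, by simp, ?_, ?_, ?_, ?_⟩ <;> intro _ _
    · exact ⟨c1 ha, c1 (sub hr hr'), c1 hb⟩
    · exact ⟨c1 ha, c1 (add hr hr'), c1 hb⟩
    · exact ⟨c1 ra, c1 (sub one.le rr), c1 ba, c1 br⟩
    · exact ⟨c1 ra, c1 (add one.le rr), c1 ba, c1 br⟩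
  push Not at h1
  by_cases hbJ : padicNorm p b ≤ κ
  swap
  · refine ⟨0, 1, by simp, by simp, ?_, ?_, ?_, ?_⟩ <;> intro h2 h3
    · exact absurd (by simpa using h3) hbJ
    · exact absurd (by simpa using h3) hbJ
    · exfalso; apply hbJ
      have e : b = b * (1 - r'*r) + r' * (b * r) := by ring
      rw [e]
      exact add (mulO hb (by simpa using h2)) (mulO hr' (by simpa using h3))
    · exfalso; apply hbJ
      have e : b = b * (1 + r'*r) - r' * (b * r) := by ring
      rw [e]
      exact sub (mulO hb (by simpa using h2)) (mulO hr' (by simpa using h3))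
  by_cases haJ : padicNorm p a ≤ κ
  · refine ⟨0, 1, by simp, by simp, ?_, ?_, ?_, ?_⟩ <;> intro h2 h3
    · exact ⟨haJ, by simpa using h2, hbJ⟩
    · exact ⟨haJ, by simpa using h2, hbJ⟩
    · exact ⟨mulO hr' haJ, by simpa using h2, mulO hb haJ, by rw [mul_comm]; exact mulO hr hbJ⟩
    · exact ⟨mulO hr' haJ, by simpa using h2, mulO hb haJ, by rw [mul_comm]; exact mulO hr hbJ⟩
  by_cases hu : padicNorm p r' = 1
  · have hra : ¬ padicNorm p (r'*a) ≤ κ := by rw [padicNorm.mul, hu, one_mul]; exact haJ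
    refine ⟨1, 0, by simp, by simp, ?_, ?_, ?_, ?_⟩ <;> intro h2 h3 <;> exfalso
    · exact haJ (by simpa using h2)
    · exact haJ (by simpa using h2)
    · apply hra; simpa using h2
    · apply hra; simpa using h2
  have hr'1 : padicNorm p r' < 1 := lt_of_le_of_ne hr' hu
  have lt1 : ∀ {z : ℚ}, padicNorm p z ≤ 1 → padicNorm p (r'*z) < 1 := fun {z} hz => by
    rw [padicNorm.mul]
    have := padicNorm.nonneg (p := p) z
    have := padicNorm.nonneg (p := p) r'
    nlinarith
  have oneJ : ¬ padicNorm p 1 ≤ κ := by rw [one]; exact not_le.mpr h1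
  have finish : ∀ i : ℚ, padicNorm p i ≤ 1 → ¬ padicNorm p (a*i+(r-r')) ≤ κ →
      ¬ padicNorm p (a*i+(r+r')) ≤ κ → ∃ x1 x2 : ℚ, padicNorm p x1 ≤ 1 ∧ padicNorm p x2 ≤ 1 ∧
    (padicNorm p (a*x1+(r-r')*x2) ≤ κ → padicNorm p (b*x2) ≤ κ →
      padicNorm p a ≤ κ ∧ padicNorm p (r-r') ≤ κ ∧ padicNorm p b ≤ κ) ∧
    (padicNorm p (a*x1+(r+r')*x2) ≤ κ → padicNorm p (b*x2) ≤ κ →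
      padicNorm p a ≤ κ ∧ padicNorm p (r+r') ≤ κ ∧ padicNorm p b ≤ κ) ∧
    (padicNorm p (-r'*a*x1+(1-r'*r)*x2) ≤ κ → padicNorm p (b*(a*x1+r*x2)) ≤ κ →
      padicNorm p (r'*a) ≤ κ ∧ padicNorm p (1-r'*r) ≤ κ ∧ padicNorm p (b*a) ≤ κ ∧
        padicNorm p (b*r) ≤ κ) ∧
    (padicNorm p (r'*a*x1+(1+r'*r)*x2) ≤ κ → padicNorm p (b*(a*x1+r*x2)) ≤ κ →
      padicNorm p (r'*a) ≤ κ ∧ padicNorm p (1+r'*r) ≤ κ ∧ padicNorm p (b*a) ≤ κ ∧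
        padicNorm p (b*r) ≤ κ) := by
    intro i hi e1 e2
    refine ⟨i, 1, hi, by simp, ?_, ?_, ?_, ?_⟩ <;> intro h2 h3 <;> exfalso
    · exact e1 (by simpa using h2)
    · exact e2 (by simpa using h2)
    · apply oneJ
      apply unit (w := r' * (-(a*i) - r)) (lt1 (sub (neg (mulO ha hi)) hr))
      convert h2 using 2; ring
    · apply oneJ
      apply unit (w := r' * (a*i + r)) (lt1 (add (mulO ha hi) hr))
      convert h2 using 2; ring
  by_cases A0 : padicNorm p (a*0+(r-r')) ≤ κ
  · -- s at 1, 2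
    have A1 : ¬ padicNorm p (a*1+(r-r')) ≤ κ := fun h => haJ (by
      convert sub h A0 using 2; ring)
    by_cases B1 : padicNorm p (a*1+(r+r')) ≤ κ
    swap
    · exact finish 1 (by simp) A1 B1
    by_cases h2a : padicNorm p (2*a) ≤ κ
    swap
    · refine finish 2 two (fun h => h2a ?_) (fun h => haJ ?_)
      · convert sub h A0 using 2; ring
      · convert sub h B1 using 2; ring
    have key : padicNorm p (a + 2 * r') ≤ κ := by
      convert sub B1 A0 using 2; ring
    have two' : ¬ padicNorm p 2 ≤ κ := fun h => haJ (by
      convert sub key (mulO hr' h) using 2; ring)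
    refine ⟨1, 2, by simp, two, ?_, ?_, ?_, ?_⟩ <;> intro h2 h3 <;> exfalso
    · apply haJ; convert sub h2 (mulO two A0) using 2; ring
    · apply haJ; convert sub (mulO two B1) h2 using 2; ring
    · apply two'
      apply unit (w := r' * (r' - r)) (lt1 (sub hr' hr))
      convert add h2 (mulO hr' key) using 2; ring
    · apply two'
      apply unit (w := r' * (-r' + r)) (lt1 (add (neg hr') hr))
      convert sub h2 (mulO hr' key) using 2; ring
  · by_cases B0 : padicNorm p (a*0+(r+r')) ≤ κ
    swap
    · exact finish 0 (by simp) A0 B0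
    have B1 : ¬ padicNorm p (a*1+(r+r')) ≤ κ := fun h => haJ (by
      convert sub h B0 using 2; ring)
    by_cases A1 : padicNorm p (a*1+(r-r')) ≤ κ
    swap
    · exact finish 1 (by simp) A1 B1
    by_cases h2a : padicNorm p (2*a) ≤ κ
    swap
    · refine finish 2 two (fun h => haJ ?_) (fun h => h2a ?_)
      · convert sub h A1 using 2; ring
      · convert sub h B0 using 2; ring
    have key : padicNorm p (a - 2 * r') ≤ κ := by
      convert sub A1 B0 using 2; ring
    have two' : ¬ padicNorm p 2 ≤ κ := fun h => haJ (by
      convert add key (mulO hr' h) using 2; ring)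
    refine ⟨1, 2, by simp, two, ?_, ?_, ?_, ?_⟩ <;> intro h2 h3 <;> exfalso
    · apply haJ; convert sub (mulO two A1) h2 using 2; ring
    · apply haJ; convert sub h2 (mulO two B0) using 2; ring
    · apply two'
      apply unit (w := r' * (-r' - r)) (lt1 (sub (neg hr') hr))
      convert add h2 (mulO hr' key) using 2; ring
    · apply two'
      apply unit (w := r' * (r' + r)) (lt1 (add hr' hr))
      convert sub h2 (mulO hr' key) using 2; ring
end PartP7

section PartP7b
open Matrix

/-- swap -/
def sW : Matrix (Fin 2) (Fin 2) ℚ := !![0,1;1,0]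
def sS : Matrix (Fin 2) (Fin 2) ℚ := !![1,0;0,-1]

def T8 : Set (Matrix (Fin 2) (Fin 2) ℚ) :=
  {M | M = 1 ∨ M = sS ∨ M = sW ∨ M = sS * sW ∨ M = -1 ∨ M = -sS ∨ M = -sW ∨ M = -(sS * sW)}

theorem sW_sq : sW * sW = 1 := by
  ext i j; fin_cases i <;> fin_cases j <;> simp [sW, Matrix.mul_apply, Fin.sum_univ_two]

theorem sS_sq : sS * sS = 1 := by
  ext i j; fin_cases i <;> fin_cases j <;> simp [sS, Matrix.mul_apply, Fin.sum_univ_two]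

theorem sW_sS : sW * sS = -(sS * sW) := by
  ext i j; fin_cases i <;> fin_cases j <;> simp [sS, sW, Matrix.mul_apply, Fin.sum_univ_two]

theorem T8_mul_sW {M} (h : M ∈ T8) : M * sW ∈ T8 := by
  have e : sS * sW * sW = sS := by rw [Matrix.mul_assoc, sW_sq, Matrix.mul_one]
  rcases h with rfl | rfl | rfl | rfl | rfl | rfl | rfl | rfl <;>
    simp [T8, sW_sq, e]

theorem T8_sW_mul {M} (h : M ∈ T8) : sW * M ∈ T8 := by
  have e : sW * (sS * sW) = -sS := by
    rw [← Matrix.mul_assoc, sW_sS, Matrix.neg_mul, Matrix.mul_assoc, sW_sq, Matrix.mul_one]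
  rcases h with rfl | rfl | rfl | rfl | rfl | rfl | rfl | rfl <;>
    simp [T8, sW_sq, e, sW_sS]

def pInt (p : ℕ) (M : Matrix (Fin 2) (Fin 2) ℚ) : Prop := ∀ i j, padicNorm p (M i j) ≤ 1
def pIntV (p : ℕ) (x : Fin 2 → ℚ) : Prop := ∀ i, padicNorm p (x i) ≤ 1

theorem pInt_mulVec (p : ℕ) [Fact p.Prime] {M : Matrix (Fin 2) (Fin 2) ℚ} {x : Fin 2 → ℚ}
    (hM : pInt p M) (hx : pIntV p x) : pIntV p (M *ᵥ x) := by
  intro i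
  simp only [Matrix.mulVec, dotProduct, Fin.sum_univ_two]
  refine (padicNorm.nonarchimedean).trans (max_le ?_ ?_) <;> rw [padicNorm.mul] <;>
    exact mul_le_one₀ (hM _ _) (padicNorm.nonneg _) (hx _)

theorem pInt_mul (p : ℕ) [Fact p.Prime] {M M' : Matrix (Fin 2) (Fin 2) ℚ}
    (hM : pInt p M) (hx : pInt p M') : pInt p (M * M') := by
  intro i j
  simp only [Matrix.mul_apply, Fin.sum_univ_two]
  refine (padicNorm.nonarchimedean).trans (max_le ?_ ?_) <;> rw [padicNorm.mul] <;>
    exact mul_le_one₀ (hM _ _) (padicNorm.nonneg _) (hx _ _)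

def LocP (p : ℕ) (X Y : Matrix (Fin 2) (Fin 2) ℚ) : Prop :=
  ∃ x, pIntV p x ∧ ∀ τ ∈ T8, pIntV p ((X * τ * Y) *ᵥ x) → pInt p (X * τ * Y)

theorem LocP_right (p : ℕ) [Fact p.Prime] {X Y U V : Matrix (Fin 2) (Fin 2) ℚ} (hU : pInt p U)
    (hV : pInt p V) (hUV : U * V = 1) (h : LocP p X (Y * U)) : LocP p X Y := by
  obtain ⟨x, hx, hh⟩ := h
  refine ⟨U *ᵥ x, pInt_mulVec p hU hx, fun τ hτ hi => ?_⟩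
  have := hh τ hτ (by rwa [← Matrix.mul_assoc, ← Matrix.mulVec_mulVec])
  have h2 := pInt_mul p this hV
  rwa [← Matrix.mul_assoc, Matrix.mul_assoc _ U V, hUV, Matrix.mul_one] at h2

theorem LocP_left (p : ℕ) [Fact p.Prime] {X Y U V : Matrix (Fin 2) (Fin 2) ℚ} (hU : pInt p U)
    (hV : pInt p V) (hUV : V * U = 1) (h : LocP p (U * X) Y) : LocP p X Y := by
  obtain ⟨x, hx, hh⟩ := h
  refine ⟨x, hx, fun τ hτ hi => ?_⟩
  have e : U * X * τ * Y = U * (X * τ * Y) := by simp only [Matrix.mul_assoc]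
  have := hh τ hτ (by rw [e, ← Matrix.mulVec_mulVec]; exact pInt_mulVec p hU hi)
  have h2 := pInt_mul p hV this
  rwa [e, ← Matrix.mul_assoc, hUV, Matrix.one_mul] at h2

theorem LocP_midY (p : ℕ) {X Y : Matrix (Fin 2) (Fin 2) ℚ} (h : LocP p X (sW * Y)) : LocP p X Y := by
  obtain ⟨x, hx, hh⟩ := h
  refine ⟨x, hx, fun τ hτ hi => ?_⟩
  have e : X * (τ * sW) * (sW * Y) = X * τ * Y := by
    rw [Matrix.mul_assoc X, Matrix.mul_assoc τ, ← Matrix.mul_assoc sW, sW_sq, Matrix.one_mul,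
      ← Matrix.mul_assoc]
  have := hh (τ * sW) (T8_mul_sW hτ)
  rw [e] at this
  exact this hi

theorem LocP_midX (p : ℕ) {X Y : Matrix (Fin 2) (Fin 2) ℚ} (h : LocP p (X * sW) Y) : LocP p X Y := by
  obtain ⟨x, hx, hh⟩ := h
  refine ⟨x, hx, fun τ hτ hi => ?_⟩
  have e : (X * sW) * (sW * τ) * Y = X * τ * Y := by
    rw [Matrix.mul_assoc X, ← Matrix.mul_assoc sW, sW_sq, Matrix.one_mul]
  have := hh (sW * τ) (T8_sW_mul hτ)
  rw [e] at this
  exact this hi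

theorem pInt_sW (p : ℕ) : pInt p sW := by
  intro i j; fin_cases i <;> fin_cases j <;> simp [sW]

theorem pInt_neg (p : ℕ) {M : Matrix (Fin 2) (Fin 2) ℚ} : pInt p (-M) ↔ pInt p M := by
  simp [pInt]

theorem pIntV_neg (p : ℕ) {x : Fin 2 → ℚ} : pIntV p (-x) ↔ pIntV p x := by
  simp [pIntV]

theorem pInt_lit (p : ℕ) (a b c e : ℚ) : pInt p !![a,b;c,e] ↔
    padicNorm p a ≤ 1 ∧ padicNorm p b ≤ 1 ∧ padicNorm p c ≤ 1 ∧ padicNorm p e ≤ 1 := by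
  constructor
  · intro h
    exact ⟨h 0 0, h 0 1, h 1 0, h 1 1⟩
  · rintro ⟨h1, h2, h3, h4⟩ i j
    fin_cases i <;> fin_cases j
    · exact h1
    · exact h2
    · exact h3
    · exact h4

theorem pIntV_lit (p : ℕ) (a b c e x y : ℚ) : pIntV p (!![a,b;c,e] *ᵥ ![x,y]) ↔
    padicNorm p (a*x+b*y) ≤ 1 ∧ padicNorm p (c*x+e*y) ≤ 1 := by
  have e1 : (!![a,b;c,e] *ᵥ ![x,y]) = ![a*x+b*y, c*x+e*y] := by
    ext i; fin_cases i <;> simp [Matrix.mulVec, dotProduct, Fin.sum_univ_two]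
  rw [e1]
  constructor
  · intro h
    exact ⟨h 0, h 1⟩
  · rintro ⟨h1, h2⟩ i
    fin_cases i
    · exact h1
    · exact h2

/-- normal form case -/
theorem LocP_nf (p : ℕ) [Fact p.Prime] (x y a b r r' : ℚ) (hx : x ≠ 0) (hy : y ≠ 0)
    (ha : padicNorm p a ≤ 1)
    (hb : padicNorm p b ≤ 1) (hr : padicNorm p r ≤ 1) (hr' : padicNorm p r' ≤ 1) :
    LocP p !![x, -(x*r'); 0, x*b] !![y*a, y*r; 0, y] := by
  have hxy : 0 < padicNorm p (x*y) :=
    lt_of_le_of_ne (padicNorm.nonneg _) (Ne.symm (padicNorm.nonzero (mul_ne_zero hx hy)))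
  obtain ⟨x1, x2, h1, h2, k1, k2, k3, k4⟩ := s7_core p (padicNorm p (x*y))⁻¹ a b r r' ha hb hr hr'
    (by positivity)
  have conv : ∀ z w : ℚ, w = x*y*z → (padicNorm p w ≤ 1 ↔ padicNorm p z ≤ (padicNorm p (x*y))⁻¹) := by
    rintro z w rfl
    rw [show padicNorm p (x*y*z) = padicNorm p (x*y) * padicNorm p z from padicNorm.mul _ _,
      ← one_div, le_div_iff₀ hxy, mul_comm]
  have n0 : padicNorm p 0 ≤ 1 := by simp
  have ng : ∀ {z c : ℚ}, padicNorm p z ≤ c → padicNorm p (-z) ≤ c := fun h => by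
    rwa [padicNorm.neg]
  have main : ∀ τ, (τ = 1 ∨ τ = sS ∨ τ = sW ∨ τ = sS * sW) →
      pIntV p ((!![x, -(x*r'); 0, x*b] * τ * !![y*a, y*r; 0, y]) *ᵥ ![x1, x2]) →
      pInt p (!![x, -(x*r'); 0, x*b] * τ * !![y*a, y*r; 0, y]) := by
    rintro τ (rfl | rfl | rfl | rfl)
    · have e : (!![x, -(x*r'); 0, x*b] * 1 * !![y*a, y*r; 0, y]) =
        !![x*y*a, x*y*(r-r'); 0, x*y*b] := by
        ext i j; fin_cases i <;> fin_cases j <;> simp <;> ring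
      rw [e, pInt_lit, pIntV_lit]
      rintro ⟨g0, g1⟩
      obtain ⟨q1, q2, q3⟩ := k1 ((conv _ _ (by ring)).1 g0) ((conv _ _ (by ring)).1 g1)
      exact ⟨(conv _ _ rfl).2 q1, (conv _ _ rfl).2 q2, n0, (conv _ _ rfl).2 q3⟩
    · have e : (!![x, -(x*r'); 0, x*b] * sS * !![y*a, y*r; 0, y]) =
        !![x*y*a, x*y*(r+r'); 0, x*y*(-b)] := by
        ext i j; fin_cases i <;> fin_cases j <;> simp [sS, Matrix.mul_apply, Fin.sum_univ_two] <;> ring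
      rw [e, pInt_lit, pIntV_lit]
      rintro ⟨g0, g1⟩
      obtain ⟨q1, q2, q3⟩ := k2 ((conv _ _ (by ring)).1 g0)
        (by have := ng ((conv (-(b*x2)) _ (by ring)).1 g1); rwa [neg_neg] at this)
      exact ⟨(conv _ _ rfl).2 q1, (conv _ _ rfl).2 q2, n0, (conv _ _ rfl).2 (ng q3)⟩
    · have e : (!![x, -(x*r'); 0, x*b] * sW * !![y*a, y*r; 0, y]) =
        !![x*y*(-(r'*a)), x*y*(1-r'*r); x*y*(b*a), x*y*(b*r)] := by
        ext i j; fin_cases i <;> fin_cases j <;> simp [sW, Matrix.mul_apply, Fin.sum_univ_two] <;> ring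
      rw [e, pInt_lit, pIntV_lit]
      rintro ⟨g0, g1⟩
      obtain ⟨q1, q2, q3, q4⟩ := k3 ((conv _ _ (by ring)).1 g0) ((conv _ _ (by ring)).1 g1)
      exact ⟨(conv _ _ rfl).2 (ng q1), (conv _ _ rfl).2 q2, (conv _ _ rfl).2 q3, (conv _ _ rfl).2 q4⟩
    · have e : (!![x, -(x*r'); 0, x*b] * (sS * sW) * !![y*a, y*r; 0, y]) =
        !![x*y*(r'*a), x*y*(1+r'*r); x*y*(-(b*a)), x*y*(-(b*r))] := by
        ext i j; fin_cases i <;> fin_cases j <;> simp [sW, sS, Matrix.mul_apply, Fin.sum_univ_two] <;> ring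
      rw [e, pInt_lit, pIntV_lit]
      rintro ⟨g0, g1⟩
      obtain ⟨q1, q2, q3, q4⟩ := k4 ((conv _ _ (by ring)).1 g0)
        (by have := ng ((conv (-(b*(a*x1+r*x2))) _ (by ring)).1 g1); rwa [neg_neg] at this)
      exact ⟨(conv _ _ rfl).2 q1, (conv _ _ rfl).2 q2, (conv _ _ rfl).2 (ng q3), (conv _ _ rfl).2 (ng q4)⟩
  refine ⟨![x1, x2], ?_, ?_⟩
  · intro i
    fin_cases i
    · exact h1
    · exact h2
  intro τ hτ
  rcases hτ with rfl | rfl | rfl | rfl | rfl | rfl | rfl | rfl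
  · exact main _ (Or.inl rfl)
  · exact main _ (Or.inr (Or.inl rfl))
  · exact main _ (Or.inr (Or.inr (Or.inl rfl)))
  · exact main _ (Or.inr (Or.inr (Or.inr rfl)))
  · rw [Matrix.mul_neg, Matrix.neg_mul, Matrix.neg_mulVec, pInt_neg, pIntV_neg]
    exact main _ (Or.inl rfl)
  · rw [Matrix.mul_neg, Matrix.neg_mul, Matrix.neg_mulVec, pInt_neg, pIntV_neg]
    exact main _ (Or.inr (Or.inl rfl))
  · rw [Matrix.mul_neg, Matrix.neg_mul, Matrix.neg_mulVec, pInt_neg, pIntV_neg]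
    exact main _ (Or.inr (Or.inr (Or.inl rfl)))
  · rw [Matrix.mul_neg, Matrix.neg_mul, Matrix.neg_mulVec, pInt_neg, pIntV_neg]
    exact main _ (Or.inr (Or.inr (Or.inr rfl)))

/-- pivot to the corner -/
theorem exists_max_entry (p : ℕ) (Y : Matrix (Fin 2) (Fin 2) ℚ) :
    ∃ i j, ∀ i' j', padicNorm p (Y i' j') ≤ padicNorm p (Y i j) := by
  obtain ⟨⟨i, j⟩, -, h⟩ := Finset.exists_max_image (Finset.univ : Finset (Fin 2 × Fin 2))
    (fun x => padicNorm p (Y x.1 x.2)) Finset.univ_nonempty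
  exact ⟨i, j, fun i' j' => h (i', j') (Finset.mem_univ _)⟩

theorem div_norm (p : ℕ) [Fact p.Prime] {u v : ℚ} (_hv : v ≠ 0) (h : padicNorm p u ≤ padicNorm p v) :
    padicNorm p (u / v) ≤ 1 := by
  rw [padicNorm.div]
  exact div_le_one_of_le₀ h (padicNorm.nonneg _)

theorem lit_eta (Y : Matrix (Fin 2) (Fin 2) ℚ) : Y = !![Y 0 0, Y 0 1; Y 1 0, Y 1 1] := by
  ext i j; fin_cases i <;> fin_cases j <;> rfl

theorem LocP_Y (p : ℕ) [Fact p.Prime] (x b r' : ℚ) (hx : x ≠ 0)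
    (hb : padicNorm p b ≤ 1) (hr' : padicNorm p r' ≤ 1) (Y : Matrix (Fin 2) (Fin 2) ℚ)
    (hY : Y ≠ 0) : LocP p !![x, -(x*r'); 0, x*b] Y := by
  -- pivot at (1,1)
  have corner : ∀ Y : Matrix (Fin 2) (Fin 2) ℚ, Y ≠ 0 →
      (∀ i' j', padicNorm p (Y i' j') ≤ padicNorm p (Y 1 1)) →
      LocP p !![x, -(x*r'); 0, x*b] Y := by
    intro Y hY hmax
    have h0 : Y 1 1 ≠ 0 := by
      intro h
      apply hY
      ext i j
      have := hmax i j
      rw [h, padicNorm.zero] at this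
      exact padicNorm.zero_of_padicNorm_eq_zero (le_antisymm this (padicNorm.nonneg _))
    have d10 := div_norm p h0 (hmax 1 0)
    have d01 := div_norm p h0 (hmax 0 1)
    have d00 := div_norm p h0 (hmax 0 0)
    apply LocP_right p (U := !![1, 0; -(Y 1 0 / Y 1 1), 1]) (V := !![1, 0; (Y 1 0 / Y 1 1), 1])
    · rw [pInt_lit]; simp [padicNorm.neg, padicNorm.div] at d10 ⊢; exact d10
    · rw [pInt_lit]; simp [padicNorm.div] at d10 ⊢; exact d10
    · ext i j; fin_cases i <;> fin_cases j <;> simp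
    have e : Y * !![1, 0; -(Y 1 0 / Y 1 1), 1] =
        !![Y 1 1 * (Y 0 0 / Y 1 1 - (Y 0 1 / Y 1 1) * (Y 1 0 / Y 1 1)), Y 1 1 * (Y 0 1 / Y 1 1); 0, Y 1 1] := by
      ext i j
      fin_cases i <;> fin_cases j <;> simp [Matrix.mul_apply, Fin.sum_univ_two] <;> field_simp <;> ring
    rw [e]
    apply LocP_nf p x _ _ b _ r' hx h0 _ hb d01 hr'
    refine (padicNorm.sub).trans (max_le d00 ?_)
    rw [padicNorm.mul]
    exact mul_le_one₀ d01 (padicNorm.nonneg _) d10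
  have hW : sW * sW = 1 := sW_sq
  have nzL : ∀ Y : Matrix (Fin 2) (Fin 2) ℚ, Y ≠ 0 → sW * Y ≠ 0 := by
    intro Y hY h; apply hY
    rw [← Matrix.one_mul Y, ← hW, Matrix.mul_assoc, h, Matrix.mul_zero]
  have nzR : ∀ Y : Matrix (Fin 2) (Fin 2) ℚ, Y ≠ 0 → Y * sW ≠ 0 := by
    intro Y hY h; apply hY
    rw [← Matrix.mul_one Y, ← hW, ← Matrix.mul_assoc, h, Matrix.zero_mul]
  have col1 : ∀ Y : Matrix (Fin 2) (Fin 2) ℚ, Y ≠ 0 → ∀ j,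
      (∀ i' j', padicNorm p (Y i' j') ≤ padicNorm p (Y 1 j)) →
      LocP p !![x, -(x*r'); 0, x*b] Y := by
    intro Y hY j hj
    fin_cases j
    · apply LocP_right p (pInt_sW p) (pInt_sW p) hW
      apply corner _ (nzR Y hY)
      intro i' j'
      have := hj i' (1 - j')
      fin_cases j' <;> simpa [sW, Matrix.mul_apply, Fin.sum_univ_two] using this
    · exact corner Y hY hj
  obtain ⟨i, j, hij⟩ := exists_max_entry p Y
  fin_cases i
  · apply LocP_midY
    apply col1 _ (nzL Y hY) j
    intro i' j'
    have := hij (1 - i') j'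
    fin_cases i' <;> simpa [sW, Matrix.mul_apply, Fin.sum_univ_two] using this
  · exact col1 Y hY j hij

theorem LocP_all (p : ℕ) [Fact p.Prime] (X Y : Matrix (Fin 2) (Fin 2) ℚ)
    (hX : X ≠ 0) (hY : Y ≠ 0) : LocP p X Y := by
  have corner : ∀ X : Matrix (Fin 2) (Fin 2) ℚ, X ≠ 0 →
      (∀ i' j', padicNorm p (X i' j') ≤ padicNorm p (X 0 0)) → LocP p X Y := by
    intro X hX hmax
    have h0 : X 0 0 ≠ 0 := by
      intro h
      apply hX
      ext i j
      have := hmax i j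
      rw [h, padicNorm.zero] at this
      exact padicNorm.zero_of_padicNorm_eq_zero (le_antisymm this (padicNorm.nonneg _))
    have d10 := div_norm p h0 (hmax 1 0)
    have d01 := div_norm p h0 (hmax 0 1)
    have d11 := div_norm p h0 (hmax 1 1)
    apply LocP_left p (U := !![1, 0; -(X 1 0 / X 0 0), 1]) (V := !![1, 0; (X 1 0 / X 0 0), 1])
    · rw [pInt_lit]; simp [padicNorm.neg, padicNorm.div] at d10 ⊢; exact d10
    · rw [pInt_lit]; simp [padicNorm.div] at d10 ⊢; exact d10
    · ext i j; fin_cases i <;> fin_cases j <;> simp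
    have e : !![1, 0; -(X 1 0 / X 0 0), 1] * X =
        !![X 0 0, -(X 0 0 * (-(X 0 1 / X 0 0))); 0,
          X 0 0 * (X 1 1 / X 0 0 - (X 0 1 / X 0 0) * (X 1 0 / X 0 0))] := by
      ext i j
      fin_cases i <;> fin_cases j <;> simp [Matrix.mul_apply, Fin.sum_univ_two] <;> field_simp <;> ring
    rw [e]
    apply LocP_Y p _ _ _ h0 _ _ _ hY
    · refine (padicNorm.sub).trans (max_le d11 ?_)
      rw [padicNorm.mul]
      exact mul_le_one₀ d01 (padicNorm.nonneg _) d10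
    · rw [padicNorm.neg]; exact d01
  have hW : sW * sW = 1 := sW_sq
  have nzL : ∀ Y : Matrix (Fin 2) (Fin 2) ℚ, Y ≠ 0 → sW * Y ≠ 0 := by
    intro Y hY h; apply hY
    rw [← Matrix.one_mul Y, ← hW, Matrix.mul_assoc, h, Matrix.mul_zero]
  have nzR : ∀ Y : Matrix (Fin 2) (Fin 2) ℚ, Y ≠ 0 → Y * sW ≠ 0 := by
    intro Y hY h; apply hY
    rw [← Matrix.mul_one Y, ← hW, ← Matrix.mul_assoc, h, Matrix.zero_mul]
  have col1 : ∀ X : Matrix (Fin 2) (Fin 2) ℚ, X ≠ 0 → ∀ j,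
      (∀ i' j', padicNorm p (X i' j') ≤ padicNorm p (X 0 j)) → LocP p X Y := by
    intro X hX j hj
    fin_cases j
    · exact corner X hX hj
    · apply LocP_midX
      apply corner _ (nzR X hX)
      intro i' j'
      have := hj i' (1 - j')
      fin_cases j' <;> simpa [sW, Matrix.mul_apply, Fin.sum_univ_two] using this
  obtain ⟨i, j, hij⟩ := exists_max_entry p X
  fin_cases i
  · exact col1 X hX j hij
  · apply LocP_left p (pInt_sW p) (pInt_sW p) hW
    apply col1 _ (nzL X hX) j
    intro i' j'
    have := hij (1 - i') j'
    fin_cases i' <;> simpa [sW, Matrix.mul_apply, Fin.sum_univ_two] using this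
end PartP7b

section PartP7c
open Matrix

theorem common_den (s : Set ℚ) (hs : s.Finite) : ∃ D : ℕ, 0 < D ∧ ∀ q ∈ s, ∃ n : ℤ, (D:ℚ) * q = n := by
  induction s, hs using Set.Finite.induction_on with
  | empty => exact ⟨1, by simp, by simp⟩
  | @insert a s _ _ ih =>
    obtain ⟨D, hD, h⟩ := ih
    refine ⟨D * a.den, Nat.mul_pos hD a.pos, ?_⟩
    rintro q (rfl | hq)
    · refine ⟨D * q.num, ?_⟩
      have := Rat.den_mul_eq_num q
      push_cast
      rw [mul_assoc, this]
    · obtain ⟨n, hn⟩ := h q hq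
      refine ⟨n * a.den, ?_⟩
      push_cast
      rw [← hn]; ring

theorem T8_finite : T8.Finite := by
  have : T8 = {1, sS, sW, sS * sW, -1, -sS, -sW, -(sS * sW)} := by
    ext M; simp [T8]
  rw [this]
  exact Set.toFinite _

theorem mat_common_den (s : Set (Matrix (Fin 2) (Fin 2) ℚ)) (hs : s.Finite) :
    ∃ D : ℕ, 0 < D ∧ ∀ M ∈ s, ∀ i j, ∃ n : ℤ, (D:ℚ) * M i j = n := by
  obtain ⟨D, hD, h⟩ := common_den
    (⋃ i : Fin 2, ⋃ j : Fin 2, (fun M : Matrix (Fin 2) (Fin 2) ℚ => M i j) '' s)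
    (Set.finite_iUnion fun i => Set.finite_iUnion fun j => hs.image _)
  refine ⟨D, hD, fun M hM i j => h _ ?_⟩
  simp only [Set.mem_iUnion]
  exact ⟨i, j, M, hM, rfl⟩

theorem den_unit (p : ℕ) [hp : Fact p.Prime] (q : ℚ) (h1 : padicNorm p q ≤ 1) : ¬ p ∣ q.den := by
  intro hpd
  have hnum : padicNorm p (q.num : ℚ) = 1 := by
    have : ¬ (p:ℤ) ∣ q.num := by
      intro hh
      have h2 := q.reduced
      have h3 : p ∣ q.num.natAbs := Int.natCast_dvd.1 hh
      have := Nat.dvd_gcd h3 hpd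
      rw [h2] at this
      exact hp.1.one_lt.ne' (Nat.dvd_one.1 this)
    have := (padicNorm.int_eq_one_iff (p := p) q.num).2 this
    simpa using this
  have hden : padicNorm p (q.den : ℚ) < 1 := (padicNorm.nat_lt_one_iff (p := p) q.den).2 hpd
  have := Rat.mul_den_eq_num q
  have e : padicNorm p q * padicNorm p (q.den:ℚ) = 1 := by rw [← padicNorm.mul, this, hnum]
  have := padicNorm.nonneg (p := p) (q.den:ℚ)
  nlinarith

theorem isInt_of_padic (q : ℚ) (h : ∀ p : ℕ, p.Prime → padicNorm p q ≤ 1) : ∃ n : ℤ, q = n := by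
  by_contra hne
  have hd : q.den ≠ 1 := fun h1 => hne ⟨q.num, (Rat.den_eq_one_iff q |>.1 h1).symm⟩
  obtain ⟨p, hp, hpd⟩ := Nat.exists_prime_and_dvd hd
  have := Fact.mk hp
  exact den_unit p q (h p hp) hpd

theorem LocP_int (p : ℕ) [hp : Fact p.Prime] (X Y : Matrix (Fin 2) (Fin 2) ℚ)
    (hX : X ≠ 0) (hY : Y ≠ 0) : ∃ x : Fin 2 → ℤ,
      ∀ τ ∈ T8, ∀ D : ℕ, 0 < D → (∀ i j, ∃ n : ℤ, (D:ℚ) * (X * τ * Y) i j = n) →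
      ∀ z : Fin 2 → ℕ, (∀ i, (p:ℤ) ^ D ∣ (z i : ℤ) - x i) →
      pIntV p ((X * τ * Y) *ᵥ (fun i => (z i : ℚ))) → pInt p (X * τ * Y) := by
  obtain ⟨x, hx, hh⟩ := LocP_all p X Y hX hY
  set b : ℕ := (x 0).den * (x 1).den with hb
  have hbu : padicNorm p (b:ℚ) = 1 := by
    rw [padicNorm.nat_eq_one_iff, hb]
    intro h
    rcases (hp.1.dvd_mul).1 h with h | h
    · exact den_unit p _ (hx 0) h
    · exact den_unit p _ (hx 1) h
  have hy : ∀ i, ∃ n : ℤ, (b:ℚ) * x i = n := by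
    intro i
    fin_cases i
    · refine ⟨(x 1).den * (x 0).num, ?_⟩
      have := Rat.mul_den_eq_num (x 0)
      push_cast
      change (b:ℚ) * x 0 = _
      rw [← this, hb]; push_cast; ring
    · refine ⟨(x 0).den * (x 1).num, ?_⟩
      have := Rat.mul_den_eq_num (x 1)
      push_cast
      change (b:ℚ) * x 1 = _
      rw [← this, hb]; push_cast; ring
  choose y hy using hy
  refine ⟨y, fun τ hτ D hD hDM z hz hi => hh τ hτ ?_⟩
  have e : (X * τ * Y) *ᵥ (fun i => (z i : ℚ)) =
      (b:ℚ) • ((X * τ * Y) *ᵥ x) + (X * τ * Y) *ᵥ (fun i => (z i : ℚ) - y i) := by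
    rw [← Matrix.mulVec_smul, ← Matrix.mulVec_add]
    congr 1
    ext i
    simp [hy]
  have hsmall : pIntV p ((X * τ * Y) *ᵥ (fun i => (z i : ℚ) - y i)) := by
    have hent : ∀ i j, padicNorm p ((X * τ * Y) i j * ((z j : ℚ) - y j)) ≤ 1 := by
      intro i j
      obtain ⟨n, hn⟩ := hDM i j
      obtain ⟨k, hk⟩ := hz j
      have hk' : (z j : ℚ) - y j = (p:ℚ)^D * k := by exact_mod_cast hk
      have hDn : (p:ℚ)^(-(D:ℤ)) ≤ padicNorm p (D:ℚ) := by
        have hval : padicNorm p (D:ℚ) = (p:ℚ) ^ (-(padicValNat p D : ℤ)) := by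
          rw [padicNorm.eq_zpow_of_nonzero (by exact_mod_cast hD.ne'), padicValRat.of_nat]
        rw [hval]
        apply zpow_le_zpow_right₀ (by exact_mod_cast hp.1.one_lt.le)
        have : padicValNat p D ≤ D := (padicValNat_le_nat_log D).trans (Nat.log_le_self _ _)
        omega
      have h3 : padicNorm p (D:ℚ) * padicNorm p ((X * τ * Y) i j) ≤ 1 := by
        rw [← padicNorm.mul, hn]; exact padicNorm.of_int _
      have h4 : padicNorm p ((p:ℚ)^D) = (p:ℚ)^(-(D:ℤ)) := by
        rw [_root_.zpow_neg, _root_.zpow_natCast, ← inv_pow, ← padicNorm.padicNorm_p_of_prime (p := p)]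
        exact map_pow (IsAbsoluteValue.toAbsoluteValue (padicNorm p)) (p:ℚ) D
      rw [hk', padicNorm.mul, padicNorm.mul, h4]
      have h5 : padicNorm p (k:ℚ) ≤ 1 := padicNorm.of_int _
      have h6 := padicNorm.nonneg (p := p) ((X * τ * Y) i j)
      have h7 := padicNorm.nonneg (p := p) (k:ℚ)
      have h8 : (0:ℚ) ≤ (p:ℚ)^(-(D:ℤ)) := by positivity
      have h9 : padicNorm p ((X * τ * Y) i j) * (p:ℚ)^(-(D:ℤ)) ≤ 1 := by nlinarith
      rw [← mul_assoc]
      exact mul_le_one₀ h9 h7 h5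
    intro i
    simp only [Matrix.mulVec, dotProduct, Fin.sum_univ_two]
    exact (padicNorm.nonarchimedean).trans (max_le (hent _ _) (hent _ _))
  intro i
  have h1 := hi i
  have h2 := hsmall i
  have e' := congrFun e i
  simp only [Pi.add_apply, Pi.smul_apply, smul_eq_mul] at e'
  have : padicNorm p ((b:ℚ) * ((X * τ * Y) *ᵥ x) i) ≤ 1 := by
    rw [eq_sub_of_add_eq e'.symm]
    exact (padicNorm.sub).trans (max_le h1 h2)
  rwa [padicNorm.mul, hbu, one_mul] at this

theorem s7_global (X Y : Matrix (Fin 2) (Fin 2) ℚ) (hX : X ≠ 0) (hY : Y ≠ 0)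
    (h : ∀ x : Fin 2 → ℕ, ∃ τ ∈ T8, ∀ i, ∃ n : ℤ, ((X * τ * Y) *ᵥ (fun i => (x i : ℚ))) i = n) :
    ∃ τ ∈ T8, ∀ i j, ∃ n : ℤ, (X * τ * Y) i j = n := by
  obtain ⟨D, hD, hDM⟩ := mat_common_den ((fun τ => X * τ * Y) '' T8) (T8_finite.image _)
  have hloc : ∀ p : ℕ, ∃ x : Fin 2 → ℤ, p.Prime → 
      ∀ τ ∈ T8, ∀ D : ℕ, 0 < D → (∀ i j, ∃ n : ℤ, (D:ℚ) * (X * τ * Y) i j = n) →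
      ∀ z : Fin 2 → ℕ, (∀ i, (p:ℤ) ^ D ∣ (z i : ℤ) - x i) →
      pIntV p ((X * τ * Y) *ᵥ (fun i => (z i : ℚ))) → pInt p (X * τ * Y) := by
    intro p
    by_cases hp : p.Prime
    · have := Fact.mk hp
      obtain ⟨x, hx⟩ := LocP_int p X Y hX hY
      exact ⟨x, fun _ => hx⟩
    · exact ⟨0, fun h => absurd h hp⟩
  choose xp hxp using hloc
  have crt : ∀ i : Fin 2, ∃ k : ℕ, ∀ p ∈ D.primeFactors, (p:ℤ) ^ D ∣ (k : ℤ) - xp p i := by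
    intro i
    obtain ⟨k, hk⟩ := Nat.chineseRemainderOfFinset (fun p => (xp p i % (p:ℤ)^D).toNat) (fun p => p ^ D) D.primeFactors
      (fun p hp => by have := (Nat.prime_of_mem_primeFactors hp).pos; positivity)
      (fun p hp q hq hpq => by
        apply Nat.Coprime.pow
        exact (Nat.coprime_primes (Nat.prime_of_mem_primeFactors hp) (Nat.prime_of_mem_primeFactors hq)).2 hpq)
    refine ⟨k, fun p hp => ?_⟩
    have h1 := (Nat.modEq_iff_dvd.1 (hk p hp).symm)
    have hpp := (Nat.prime_of_mem_primeFactors hp).pos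
    have hpos : (p:ℤ)^D ≠ 0 := by positivity
    rw [Int.toNat_of_nonneg (Int.emod_nonneg _ hpos)] at h1
    push_cast at h1
    have h2 : (p:ℤ)^D ∣ xp p i % (p:ℤ)^D - xp p i := by
      have := Int.dvd_self_sub_emod (x := xp p i) (m := (p:ℤ)^D)
      rw [← dvd_neg]; simpa using this
    have := dvd_add h1 h2
    simpa using this
  choose z hz using crt
  obtain ⟨τ, hτ, hintgl⟩ := h z
  refine ⟨τ, hτ, fun i j => isInt_of_padic _ fun p hp => ?_⟩
  have := Fact.mk hp
  by_cases hpD : p ∣ D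
  · refine hxp p hp τ hτ D hD (hDM _ ⟨τ, hτ, rfl⟩) z (fun i => hz i p ?_) ?_ i j
    · exact Nat.mem_primeFactors.2 ⟨hp, hpD, hD.ne'⟩
    · intro i
      obtain ⟨n, hn⟩ := hintgl i
      rw [hn]; exact padicNorm.of_int _
  · obtain ⟨n, hn⟩ := hDM _ ⟨τ, hτ, rfl⟩ i j
    have h1 : padicNorm p (D:ℚ) = 1 := (padicNorm.nat_eq_one_iff (p := p) D).2 hpD
    have h2 : padicNorm p ((D:ℚ) * (X * τ * Y) i j) ≤ 1 := by
      rw [hn]; exact padicNorm.of_int _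
    rwa [padicNorm.mul, h1, one_mul] at h2
end PartP7c

section PartP8
open Matrix

theorem eval_compForm (F : MvPolynomial (Fin 2) ℚ) (γ : Matrix (Fin 2) (Fin 2) ℚ) (v : Fin 2 → ℚ) :
    MvPolynomial.eval v (compForm F γ) = MvPolynomial.eval (γ *ᵥ v) F := by
  unfold compForm
  rw [MvPolynomial.aeval_def, ← MvPolynomial.coe_eval₂Hom]
  rw [← RingHom.comp_apply]
  apply MvPolynomial.induction_on F (motive := fun F => (((MvPolynomial.eval v).comp (MvPolynomial.eval₂Hom _ _)) F) = _)
  · intro a; simp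
  · intro p q hp hq; rw [map_add, map_add, hp, hq]
  · intro p n hp
    rw [map_mul, map_mul, hp]
    congr 1
    fin_cases n <;> simp

theorem compForm_ext {F G : MvPolynomial (Fin 2) ℚ} (h : ∀ v, MvPolynomial.eval v F = MvPolynomial.eval v G) :
    F = G := MvPolynomial.funext h

theorem compForm_mul (F : MvPolynomial (Fin 2) ℚ) (γ δ : Matrix (Fin 2) (Fin 2) ℚ) :
    compForm F (γ * δ) = compForm (compForm F γ) δ := by
  apply MvPolynomial.funext
  intro v
  simp only [eval_compForm, Matrix.mulVec_mulVec]

theorem compForm_one (F : MvPolynomial (Fin 2) ℚ) : compForm F 1 = F := by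
  apply MvPolynomial.funext
  intro v
  simp only [eval_compForm, Matrix.one_mulVec]

theorem D4_le_T8 : D4 ⊆ T8 := by
  intro M hM
  have hM' : M ∈ Submonoid.closure {!![0, 1; 1, 0], !![(0:ℚ), 1; -1, 0]} := hM
  induction hM' using Submonoid.closure_induction_right with
  | one => exact Or.inl rfl
  | mul_right x hx y hy ih =>
    have ih := ih hx
    rcases hy with rfl | hy
    · exact T8_mul_sW ih
    · have : y = sS * sW := by
        rw [hy]; ext i j; fin_cases i <;> fin_cases j <;> simp [sS, sW]
      rw [this, ← Matrix.mul_assoc]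
      apply T8_mul_sW
      have e : sS * sW * sS = -sW := by
        rw [Matrix.mul_assoc, sW_sS, Matrix.mul_neg, ← Matrix.mul_assoc, sS_sq, Matrix.one_mul]
      rcases ih with rfl | rfl | rfl | rfl | rfl | rfl | rfl | rfl <;>
        simp [T8, sS_sq, e, sW_sS]

theorem T8_le_D4 : T8 ⊆ D4 := by
  set S : Submonoid (Matrix (Fin 2) (Fin 2) ℚ) := Submonoid.closure {!![0, 1; 1, 0], !![(0:ℚ), 1; -1, 0]} with hS
  have h1 : sW ∈ S := Submonoid.subset_closure (Or.inl rfl)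
  have h2' : !![(0:ℚ), 1; -1, 0] ∈ S := Submonoid.subset_closure (Or.inr rfl)
  have h2 : sS * sW ∈ S := by
    convert h2'
    ext i j; fin_cases i <;> fin_cases j <;> simp [sS, sW]
  have h3 : sS ∈ S := by
    have := S.mul_mem h2 h1
    rwa [Matrix.mul_assoc, sW_sq, Matrix.mul_one] at this
  have h4 : -1 ∈ S := by
    have := S.mul_mem h2 h2
    rwa [Matrix.mul_assoc, ← Matrix.mul_assoc sW, sW_sS, Matrix.neg_mul, Matrix.mul_assoc sS, sW_sq, Matrix.mul_one,
      Matrix.mul_neg, sS_sq] at this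
  have hn : ∀ M ∈ S, -M ∈ S := by
    intro M hM
    have := S.mul_mem h4 hM
    rwa [Matrix.neg_mul, Matrix.one_mul] at this
  intro M hM
  change M ∈ S
  rcases hM with rfl | rfl | rfl | rfl | rfl | rfl | rfl | rfl
  · exact S.one_mem
  · exact h3
  · exact h1
  · exact h2
  · exact h4
  · exact hn _ h3
  · exact hn _ h1
  · exact hn _ h2

theorem D4_eq_T8 : D4 = T8 := Set.Subset.antisymm D4_le_T8 T8_le_D4

/-- homogeneous expansions -/
theorem eval_form (d : ℕ) (F : MvPolynomial (Fin 2) ℚ) (hF : F.IsHomogeneous d) :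
    ∃ c : ℕ → ℚ, ∀ x y : ℚ, MvPolynomial.eval ![x, y] F = ∑ i ∈ Finset.range (d+1), c i * x^i * y^(d-i) := by
  refine ⟨fun i => ∑ m ∈ F.support with m 0 = i, F.coeff m, fun x y => ?_⟩
  rw [MvPolynomial.eval_eq']
  have hm : ∀ m ∈ F.support, m 0 + m 1 = d := by
    intro m hm
    have := hF (MvPolynomial.mem_support_iff.mp hm)
    rw [Finsupp.weight_apply, Finsupp.sum_fintype _ _ (by simp)] at this
    simpa using this
  have hmap : ∀ m ∈ F.support, m 0 ∈ Finset.range (d+1) := by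
    intro m h
    have := hm m h
    simp; omega
  rw [← Finset.sum_fiberwise_of_maps_to hmap]
  apply Finset.sum_congr rfl
  intro i hi
  rw [Finset.sum_mul, Finset.sum_mul]
  apply Finset.sum_congr rfl
  intro m h
  simp only [Finset.mem_filter] at h
  have h1 := hm m h.1
  have h2 : m 1 = d - i := by omega
  simp [Fin.prod_univ_two, h.2, h2, mul_assoc]

theorem compForm_homog (d : ℕ) (F : MvPolynomial (Fin 2) ℚ) (hF : F.IsHomogeneous d) (γ : Matrix (Fin 2) (Fin 2) ℚ) :
    (compForm F γ).IsHomogeneous d := by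
  unfold compForm
  have := hF.aeval (S := ℚ) (n := 1) (τ := Fin 2)
    (fun i => MvPolynomial.C (γ i 0) * MvPolynomial.X 0 + MvPolynomial.C (γ i 1) * MvPolynomial.X 1) (by
    intro i
    apply MvPolynomial.IsHomogeneous.add
    · exact MvPolynomial.IsHomogeneous.C_mul (MvPolynomial.isHomogeneous_X _ _) _
    · exact MvPolynomial.IsHomogeneous.C_mul (MvPolynomial.isHomogeneous_X _ _) _)
  rwa [one_mul] at this

theorem eval_scale (d : ℕ) (F : MvPolynomial (Fin 2) ℚ) (hF : F.IsHomogeneous d) (k x y : ℚ) :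
    MvPolynomial.eval ![k * x, k * y] F = k^d * MvPolynomial.eval ![x, y] F := by
  obtain ⟨c, hc⟩ := eval_form d F hF
  rw [hc, hc, Finset.mul_sum]
  apply Finset.sum_congr rfl
  intro i hi
  have : k ^ d = k ^ i * k ^ (d - i) := by rw [← pow_add]; congr 1; simp at hi; omega
  rw [mul_pow, mul_pow, this]
  ring

theorem vec2_eta (v : Fin 2 → ℚ) : v = ![v 0, v 1] := by
  ext i; fin_cases i <;> rfl

/-- homogenisation -/
noncomputable def homz (e : ℕ) (q : Polynomial ℚ) : MvPolynomial (Fin 2) ℚ :=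
  ∑ i ∈ Finset.range (e+1), MvPolynomial.C (q.coeff i) * MvPolynomial.X 0 ^ i * MvPolynomial.X 1 ^ (e - i)

theorem homz_eval (e : ℕ) (q : Polynomial ℚ) (x y : ℚ) :
    MvPolynomial.eval ![x, y] (homz e q) = ∑ i ∈ Finset.range (e+1), q.coeff i * x^i * y^(e-i) := by
  simp [homz]

theorem homz_eval' (e : ℕ) (q : Polynomial ℚ) (hq : q.natDegree ≤ e) (x y : ℚ) (hy : y ≠ 0) :
    MvPolynomial.eval ![x, y] (homz e q) = y^e * q.eval (x / y) := by
  rw [homz_eval, Polynomial.eval_eq_sum_range' (Nat.lt_succ_of_le hq), Finset.mul_sum]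
  apply Finset.sum_congr rfl
  intro i hi
  have : y ^ e = y ^ i * y ^ (e - i) := by rw [← pow_add]; congr 1; simp at hi; omega
  rw [this, div_pow]
  field_simp

theorem homz_mul (e e' : ℕ) (q r : Polynomial ℚ) (hq : q.natDegree ≤ e) (hr : r.natDegree ≤ e') :
    homz (e + e') (q * r) = homz e q * homz e' r := by
  have : (MvPolynomial.X 1 : MvPolynomial (Fin 2) ℚ) ≠ 0 := MvPolynomial.X_ne_zero _
  apply mul_left_cancel₀ this
  apply MvPolynomial.funext
  intro v
  rw [vec2_eta v]
  by_cases hv : v 1 = 0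
  · simp [hv]
  · rw [map_mul, map_mul, map_mul, homz_eval' _ _ _ _ _ hv, homz_eval' _ _ hq _ _ hv, homz_eval' _ _ hr _ _ hv,
      Polynomial.eval_mul]
    · ring
    · exact Polynomial.natDegree_mul_le.trans (by omega)

theorem homz_isUnit (e : ℕ) (q : Polynomial ℚ) (hq : q.natDegree ≤ e) (h : IsUnit (homz e q)) : IsUnit q := by
  rw [MvPolynomial.isUnit_iff_eq_C_of_isReduced] at h
  obtain ⟨a, ha, h⟩ := h
  have : q = Polynomial.C a := by
    apply Polynomial.funext
    intro x
    have := homz_eval' e q hq x 1 one_ne_zero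
    rw [h] at this
    simp at this
    simp [this]
  rw [this]
  exact ha.map Polynomial.C

theorem compForm_mul_left (F G : MvPolynomial (Fin 2) ℚ) (γ : Matrix (Fin 2) (Fin 2) ℚ) :
    compForm (F * G) γ = compForm F γ * compForm G γ := by
  simp [compForm]

theorem compForm_isUnit (F : MvPolynomial (Fin 2) ℚ) (γ : Matrix (Fin 2) (Fin 2) ℚ) (h : IsUnit F) :
    IsUnit (compForm F γ) := by
  unfold compForm; exact h.map _

theorem compForm_squarefree (F : MvPolynomial (Fin 2) ℚ) (γ : Matrix (Fin 2) (Fin 2) ℚ) (hγ : γ.det ≠ 0)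
    (h : Squarefree F) : Squarefree (compForm F γ) := by
  have hu : IsUnit γ.det := isUnit_iff_ne_zero.mpr hγ
  rintro q ⟨r, hr⟩
  have h1 : compForm (compForm F γ) γ⁻¹ = F := by
    rw [← compForm_mul, Matrix.mul_nonsing_inv _ hu, compForm_one]
  have h2 : IsUnit (compForm q γ⁻¹) := by
    apply h
    refine ⟨compForm r γ⁻¹, ?_⟩
    rw [← h1, hr, compForm_mul_left, compForm_mul_left]
  have := compForm_isUnit _ γ h2
  rwa [← compForm_mul, Matrix.nonsing_inv_mul _ hu, compForm_one] at this

theorem toPoly (d : ℕ) (F : MvPolynomial (Fin 2) ℚ) (hF : F.IsHomogeneous d) (hsq : Squarefree F) :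
    ∃ D0 : ℕ, 0 < D0 ∧ ∃ k : ℤ, ∀ m : ℕ, 0 < m → ∃ f : Polynomial ℤ, f.natDegree = d ∧
      Squarefree (f.map (Int.castRingHom ℚ)) ∧
      ∀ x y : ℚ, hev d f.coeff x y = ((m * D0 : ℕ) : ℚ) * MvPolynomial.eval ![x, k * x + y] F := by
  have hk : ∃ k : ℤ, MvPolynomial.eval ![(1:ℚ), (k:ℚ)] F ≠ 0 := by
    by_contra! hcon
    obtain ⟨c, hc⟩ := eval_form d F hF
    set P : Polynomial ℚ := ∑ i ∈ Finset.range (d+1), Polynomial.monomial (d-i) (c i) with hP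
    have hPe : ∀ t : ℚ, P.eval t = MvPolynomial.eval ![(1:ℚ), t] F := by
      intro t
      rw [hc, hP, Polynomial.eval_finsetSum]
      simp
    have hP0 : P = 0 := by
      apply Polynomial.eq_zero_of_infinite_isRoot
      apply Set.Infinite.mono (s := Set.range (fun k : ℤ => (k:ℚ)))
      · rintro _ ⟨k, rfl⟩
        change P.eval _ = 0
        rw [hPe, hcon]
      · exact Set.infinite_range_of_injective Int.cast_injective
    have hF0 : MvPolynomial.X 0 * F = MvPolynomial.X 0 * 0 := by
      apply MvPolynomial.funext
      intro v
      rw [vec2_eta v]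
      by_cases hv : v 0 = 0
      · simp [hv]
      · have h1 := eval_scale d F hF (v 0) 1 (v 1 / v 0)
        rw [← hPe, hP0] at h1
        have h2 : v 0 * (v 1 / v 0) = v 1 := by field_simp
        rw [h2, mul_one] at h1
        simp [h1]
    have := mul_left_cancel₀ (MvPolynomial.X_ne_zero _) hF0
    rw [this] at hsq
    exact not_squarefree_zero hsq
  obtain ⟨k, hk⟩ := hk
  set H := compForm F !![1, 0; (k:ℚ), 1] with hH
  have hHe : ∀ x y : ℚ, MvPolynomial.eval ![x, y] H = MvPolynomial.eval ![x, k * x + y] F := by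
    intro x y
    rw [hH, eval_compForm]
    congr 2
    ext i; fin_cases i <;> simp [Matrix.mulVec, dotProduct, Fin.sum_univ_two]
  have hHh : H.IsHomogeneous d := compForm_homog d F hF _
  have hHs : Squarefree H := compForm_squarefree F _ (by simp) hsq
  obtain ⟨c, hc⟩ := eval_form d H hHh
  obtain ⟨D0, hD0, hden⟩ := common_den (c '' (Set.Iic d)) ((Set.finite_Iic d).image c)
  refine ⟨D0, hD0, k, fun m hm => ?_⟩
  have hn : ∀ i, ∃ n : ℤ, i ≤ d → (n:ℚ) = D0 * c i := by
    intro i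
    by_cases hi : i ≤ d
    · obtain ⟨n, hn⟩ := hden (c i) ⟨i, hi, rfl⟩
      exact ⟨n, fun _ => hn.symm⟩
    · exact ⟨0, fun h => absurd h hi⟩
  choose n hn using hn
  set f : Polynomial ℤ := ∑ i ∈ Finset.range (d+1), Polynomial.monomial i (m * n i) with hf
  have hfc : ∀ i ≤ d, f.coeff i = m * n i := by
    intro i hi
    rw [hf, Polynomial.finsetSum_coeff]
    simp only [Polynomial.coeff_monomial]
    rw [Finset.sum_ite_eq']
    simp; omega
  have hfd : f.natDegree ≤ d := by
    apply Polynomial.natDegree_sum_le_of_forall_le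
    intro i hi
    refine (Polynomial.natDegree_monomial_le _).trans ?_
    simp at hi; omega
  have hcd : c d ≠ 0 := by
    have h1 := hHe 1 0
    rw [hc] at h1
    rw [Finset.sum_eq_single d] at h1
    · simp at h1
      rw [h1]; exact hk
    · intro i hi hid
      have : d - i ≠ 0 := by simp at hi; omega
      simp [this]
    · simp
  have hev' : ∀ x y : ℚ, hev d f.coeff x y = ((m * D0 : ℕ) : ℚ) * MvPolynomial.eval ![x, y] H := by
    intro x y
    rw [hc, Finset.mul_sum, hev]
    apply Finset.sum_congr rfl
    intro i hi
    have hi' : i ≤ d := by simp at hi; omega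
    rw [hfc i hi']
    push_cast
    rw [hn i hi']
    ring
  refine ⟨f, ?_, ?_, ?_⟩
  · apply le_antisymm hfd
    apply Polynomial.le_natDegree_of_ne_zero
    rw [hfc d le_rfl]
    have h1 := hn d le_rfl
    intro h0
    have h2 : ((m:ℚ) * n d) = 0 := by exact_mod_cast h0
    rw [h1] at h2
    have : (m:ℚ) ≠ 0 := by positivity
    have : (D0:ℚ) ≠ 0 := by positivity
    simp_all
  · set p := f.map (Int.castRingHom ℚ) with hp
    have hpd : p.natDegree ≤ d := Polynomial.natDegree_map_le.trans hfd
    have hph : homz d p = MvPolynomial.C ((m * D0 : ℕ) : ℚ) * H := by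
      apply MvPolynomial.funext
      intro v
      rw [vec2_eta v, homz_eval, map_mul, MvPolynomial.eval_C, ← hev', hev]
      apply Finset.sum_congr rfl
      intro i hi
      simp [hp]
    have hu : IsUnit (MvPolynomial.C ((m * D0 : ℕ) : ℚ) : MvPolynomial (Fin 2) ℚ) := by
      apply IsUnit.map
      apply isUnit_iff_ne_zero.mpr
      positivity
    have hps : Squarefree (homz d p) := by
      rw [hph]
      exact (associated_unit_mul_left H _ hu).symm.squarefree_iff.mp hHs
    have hp0 : p ≠ 0 := by
      intro h0
      apply not_squarefree_zero (R := MvPolynomial (Fin 2) ℚ)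
      have : homz d p = 0 := by rw [h0]; simp [homz]
      rwa [this] at hps
    rintro q ⟨r, hr⟩
    have hq0 : q ≠ 0 := by rintro rfl; simp at hr; exact hp0 hr
    have hr0 : r ≠ 0 := by rintro rfl; simp at hr; exact hp0 hr
    have hdeg : p.natDegree = q.natDegree + q.natDegree + r.natDegree := by
      rw [hr, Polynomial.natDegree_mul (mul_ne_zero hq0 hq0) hr0, Polynomial.natDegree_mul hq0 hq0]
    apply homz_isUnit q.natDegree q le_rfl
    apply hps
    refine ⟨homz (d - (q.natDegree + q.natDegree)) r, ?_⟩
    rw [← homz_mul _ _ _ _ le_rfl le_rfl, ← homz_mul, ← hr]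
    · congr 1; omega
    · exact Polynomial.natDegree_mul_le
    · omega
  · intro x y
    rw [hev', hHe]
end PartP8

section PartP4
theorem s4 (m : ℕ) (hm : 0 < m) (t : ℤ) : ∃ a b c e : ℤ, (m:ℤ) ∣ a - t * b ∧ (m:ℤ) ∣ c - t * e ∧
    (a * e - b * c = m ∨ a * e - b * c = -m) ∧ 3 * (a^2 + b^2) * (c^2 + e^2) ≤ 4 * m^2 ∧
    a^2 + b^2 ≤ c^2 + e^2 := by
  classical
  let P : ℕ → Prop := fun n => ∃ a b c e : ℤ, (m:ℤ) ∣ a - t * b ∧ (m:ℤ) ∣ c - t * e ∧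
    (a * e - b * c = m ∨ a * e - b * c = -m) ∧ a^2 + b^2 + (c^2 + e^2) = n
  have hP : ∃ n, P n := by
    refine ⟨(t^2 + 1^2 + ((m:ℤ)^2 + 0^2)).toNat, t, 1, m, 0, by simp, by simp, by right; ring, ?_⟩
    rw [Int.toNat_of_nonneg (by positivity)]
  obtain ⟨a, b, c, e, h1, h2, h3, h4⟩ := Nat.find_spec hP
  have hmin := fun n (h : n < Nat.find hP) => Nat.find_min hP h
  have key : ∀ a' b' c' e' : ℤ, (m:ℤ) ∣ a' - t * b' → (m:ℤ) ∣ c' - t * e' →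
    (a' * e' - b' * c' = m ∨ a' * e' - b' * c' = -m) → a^2 + b^2 + (c^2 + e^2) ≤ a'^2 + b'^2 + (c'^2 + e'^2) := by
    intro a' b' c' e' k1 k2 k3
    by_contra hlt
    push Not at hlt
    have hnn : 0 ≤ a'^2 + b'^2 + (c'^2 + e'^2) := by positivity
    apply hmin (a'^2 + b'^2 + (c'^2 + e'^2)).toNat
    · zify
      rw [Int.toNat_of_nonneg hnn, ← h4]; exact hlt
    · exact ⟨a', b', c', e', k1, k2, k3, by rw [Int.toNat_of_nonneg hnn]⟩
  have l1 := key a b (c - a) (e - b) h1 (by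
    obtain ⟨k, hk⟩ := h1; obtain ⟨k', hk'⟩ := h2; exact ⟨k' - k, by linear_combination hk' - hk⟩) (by
    rcases h3 with h | h
    · left; linear_combination h
    · right; linear_combination h)
  have l2 := key a b (c + a) (e + b) h1 (by
    obtain ⟨k, hk⟩ := h1; obtain ⟨k', hk'⟩ := h2; exact ⟨k' + k, by linear_combination hk' + hk⟩) (by
    rcases h3 with h | h
    · left; linear_combination h
    · right; linear_combination h)
  have l3 := key (a - c) (b - e) c e (by
    obtain ⟨k, hk⟩ := h1; obtain ⟨k', hk'⟩ := h2; exact ⟨k - k', by linear_combination hk - hk'⟩) h2 (by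
    rcases h3 with h | h
    · left; linear_combination h
    · right; linear_combination h)
  have l4 := key (a + c) (b + e) c e (by
    obtain ⟨k, hk⟩ := h1; obtain ⟨k', hk'⟩ := h2; exact ⟨k + k', by linear_combination hk + hk'⟩) h2 (by
    rcases h3 with h | h
    · left; linear_combination h
    · right; linear_combination h)
  have hdet : (a * e - b * c)^2 = (m:ℤ)^2 := by rcases h3 with h | h <;> rw [h]; ring
  have hid : (a^2 + b^2) * (c^2 + e^2) = (m:ℤ)^2 + (a * c + b * e)^2 := by rw [← hdet]; ring
  have q1 : 2 * (a * c + b * e) ≤ a^2 + b^2 := by nlinarith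
  have q2 : -(2 * (a * c + b * e)) ≤ a^2 + b^2 := by nlinarith
  have q3 : 2 * (a * c + b * e) ≤ c^2 + e^2 := by nlinarith
  have q4 : -(2 * (a * c + b * e)) ≤ c^2 + e^2 := by nlinarith
  have hsq : (2 * (a * c + b * e))^2 ≤ (a^2 + b^2) * (c^2 + e^2) := by
    have a1 : |2 * (a * c + b * e)| ≤ a^2 + b^2 := abs_le.mpr ⟨by linarith, q1⟩
    have a2 : |2 * (a * c + b * e)| ≤ c^2 + e^2 := abs_le.mpr ⟨by linarith, q3⟩
    calc (2 * (a * c + b * e))^2 = |2 * (a * c + b * e)| * |2 * (a * c + b * e)| := by rw [abs_mul_abs_self]; ring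
      _ ≤ _ := by gcongr
  have hfin : 3 * ((a^2 + b^2) * (c^2 + e^2)) ≤ 4 * (m:ℤ)^2 := by nlinarith
  rcases le_total (a^2 + b^2) (c^2 + e^2) with h | h
  · exact ⟨a, b, c, e, h1, h2, h3, by linarith, h⟩
  · refine ⟨c, e, a, b, h2, h1, ?_, by linarith, h⟩
    rcases h3 with h | h
    · right; linear_combination -h
    · left; linear_combination -h

/-- coordinates in the lattice -/
theorem s4_coord (m : ℕ) (hm : 0 < m) (t a b c e : ℤ) (h1 : (m:ℤ) ∣ a - t * b) (h2 : (m:ℤ) ∣ c - t * e)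
    (h3 : a * e - b * c = m ∨ a * e - b * c = -m) (x y : ℤ) (h : (m:ℤ) ∣ x - t * y) :
    ∃ u v : ℤ, x = a * u + c * v ∧ y = b * u + e * v ∧ m * |u| = |x * e - y * c| ∧ m * |v| = |a * y - b * x| := by
  have hm' : (m:ℤ) ≠ 0 := by exact_mod_cast hm.ne'
  have d1 : (m:ℤ) ∣ x * e - y * c := by
    obtain ⟨k, hk⟩ := h; obtain ⟨k', hk'⟩ := h2
    exact ⟨k * e - k' * y, by linear_combination e * hk - y * hk'⟩
  have d2 : (m:ℤ) ∣ a * y - b * x := by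
    obtain ⟨k, hk⟩ := h; obtain ⟨k', hk'⟩ := h1
    exact ⟨k' * y - k * b, by linear_combination y * hk' - b * hk⟩
  obtain ⟨u, hu⟩ := d1
  obtain ⟨v, hv⟩ := d2
  have e1 : m * |u| = |x * e - y * c| := by rw [hu, abs_mul]; simp
  have e2 : m * |v| = |a * y - b * x| := by rw [hv, abs_mul]; simp
  rcases h3 with h3 | h3
  · refine ⟨u, v, ?_, ?_, e1, e2⟩
    · apply mul_left_cancel₀ hm'; linear_combination a * hu + c * hv - x * h3
    · apply mul_left_cancel₀ hm'; linear_combination b * hu + e * hv - y * h3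
  · refine ⟨-u, -v, ?_, ?_, by rw [abs_neg]; exact e1, by rw [abs_neg]; exact e2⟩
    · apply mul_left_cancel₀ hm'; linear_combination -a * hu - c * hv + x * h3
    · apply mul_left_cancel₀ hm'; linear_combination -b * hu - e * hv + y * h3
end PartP4

section PartP6
open Finset

theorem card_roots_le' {K : Type*} [Field K] (S : Finset K) (P : Polynomial K) (hP : P ≠ 0) (n : ℕ)
    (hn : P.natDegree ≤ n) (h : ∀ s ∈ S, P.eval s = 0) : S.card ≤ n := by
  classical
  refine le_trans (Polynomial.card_le_degree_of_subset_roots (p := P) ?_) hn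
  intro s hs
  rw [Polynomial.mem_roots hP]
  exact h s hs

theorem hev_div {K : Type*} [Field K] (d : ℕ) (c : ℕ → ℤ) (x y : K) (hy : y ≠ 0) :
    hev d c x y = y ^ d * hev d c (x / y) 1 := by
  rw [← hev_scale]
  congr 1
  · field_simp
  · ring

theorem hev_y0 {K : Type*} [CommRing K] (d : ℕ) (c : ℕ → ℤ) (x : K) :
    hev d c x 0 = c d * x ^ d := by
  rw [hev, Finset.sum_eq_single d]
  · simp
  · intro i hi hid
    have : d - i ≠ 0 := by simp at hi; omega
    simp [this]
  · simp

theorem pow_eq_count {K : Type*} [Field K] (d : ℕ) (hd : 1 ≤ d) (a A : K) (hA : A ≠ 0) (S : Finset K)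
    (h : ∀ s ∈ S, a * s ^ d = A) : S.card ≤ d := by
  apply card_roots_le' S (Polynomial.C a * Polynomial.X ^ d - Polynomial.C A)
  · intro h0
    have := congrArg (fun P => Polynomial.eval 0 P) h0
    simp [show d ≠ 0 by omega] at this
    exact hA this
  · apply (Polynomial.natDegree_sub_le _ _).trans
    simp only [Polynomial.natDegree_C, max_le_iff]
    exact ⟨Polynomial.natDegree_C_mul_X_pow_le _ _, Nat.zero_le _⟩
  · intro s hs
    simp [h s hs]

theorem count_uv {K : Type*} [Field K] [DecidableEq K] (d : ℕ) (hd : 1 ≤ d) (f1 f2 : ℕ → ℤ) (A B : K) (hA : A ≠ 0)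
    (i : ℕ) (hi : i ≤ d) (hne : (f1 i : K) * B - f2 i * A ≠ 0)
    (S : Finset (K × K)) (h1 : ∀ s ∈ S, hev d f1 s.1 s.2 = A) (h2 : ∀ s ∈ S, hev d f2 s.1 s.2 = B) :
    S.card ≤ d ^ 2 + d := by
  have hs : S.card = (S.filter (fun s => s.2 ≠ 0)).card + (S.filter (fun s => ¬ s.2 ≠ 0)).card :=
    (Finset.card_filter_add_card_filter_not _).symm
  rw [hs]
  apply Nat.add_le_add
  · rw [pow_two]
    obtain ⟨P1, hP1, hP1c, hP1e⟩ := hev_poly d f1 (1:K)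
    obtain ⟨P2, hP2, hP2c, hP2e⟩ := hev_poly d f2 (1:K)
    set T := S.filter (fun s => s.2 ≠ 0) with hT
    set H := Polynomial.C B * P1 - Polynomial.C A * P2 with hH
    have hH0 : H ≠ 0 := by
      intro h0
      apply hne
      have := congrArg (fun P => Polynomial.coeff P i) h0
      simp [hH, hP1c i hi, hP2c i hi] at this
      rw [← this]; ring
    have hHd : H.natDegree ≤ d := by
      apply (Polynomial.natDegree_sub_le _ _).trans
      exact max_le ((Polynomial.natDegree_C_mul_le _ _).trans hP1) ((Polynomial.natDegree_C_mul_le _ _).trans hP2)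
    have key : (T.image (fun s => s.1 / s.2)).card ≤ d := by
      apply card_roots_le' _ H hH0 d hHd
      intro l hl
      rw [Finset.mem_image] at hl
      obtain ⟨s, hs, rfl⟩ := hl
      rw [hT, Finset.mem_filter] at hs
      have e1 := h1 s hs.1
      have e2 := h2 s hs.1
      rw [hev_div _ _ _ _ hs.2] at e1 e2
      have hp : s.2 ^ d ≠ 0 := pow_ne_zero _ hs.2
      simp only [hH, Polynomial.eval_sub, Polynomial.eval_mul, Polynomial.eval_C, hP1e, hP2e]
      apply mul_left_cancel₀ hp
      rw [mul_zero, mul_sub, mul_left_comm, mul_left_comm _ A, e1, e2]; ring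
    refine (Finset.card_le_mul_card_image (f := fun s => s.1 / s.2) T d ?_).trans (Nat.mul_le_mul_left _ key)
    intro l hl
    have : (T.filter (fun s => s.1 / s.2 = l)).card = ((T.filter (fun s => s.1 / s.2 = l)).image (fun s => s.2)).card := by
      rw [Finset.card_image_of_injOn]
      intro s hs s' hs' hss
      simp only [coe_filter, Set.mem_ofPred_eq] at hs hs'
      have : s.2 ≠ 0 := (Finset.mem_filter.mp hs.1).2
      have h' : s'.2 ≠ 0 := (Finset.mem_filter.mp hs'.1).2
      have hss : s.2 = s'.2 := hss
      have e := hs.2.trans hs'.2.symm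
      rw [hss] at e
      have : s.1 = s'.1 := by field_simp at e; exact e
      exact Prod.ext this hss
    rw [this]
    apply pow_eq_count d hd (hev d f1 l 1) A hA
    intro v hv
    rw [Finset.mem_image] at hv
    obtain ⟨s, hs, rfl⟩ := hv
    rw [Finset.mem_filter] at hs
    have hs2 := Finset.mem_filter.mp hs.1
    rw [← h1 s hs2.1, hev_div _ _ _ _ hs2.2, hs.2]; ring
  · set T := S.filter (fun s => ¬ s.2 ≠ 0) with hT
    have : T.card = (T.image (fun s => s.1)).card := by
      rw [Finset.card_image_of_injOn]
      intro s hs s' hs' hss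
      have h : ¬ s.2 ≠ 0 := (Finset.mem_filter.mp hs).2
      have h' : ¬ s'.2 ≠ 0 := (Finset.mem_filter.mp hs').2
      push Not at h h'
      exact Prod.ext hss (h.trans h'.symm)
    rw [this]
    apply pow_eq_count d hd (f1 d : K) A hA
    intro u hu
    rw [Finset.mem_image] at hu
    obtain ⟨s, hs, rfl⟩ := hu
    rw [Finset.mem_filter] at hs
    have h0 : s.2 = 0 := by simpa using hs.2
    have := h1 s hs.1
    rw [h0, hev_y0] at this
    exact this

theorem zmod_div_eq (l : ℕ) [Fact l.Prime] (x y t : ℤ) (hy : (y : ZMod l) ≠ 0) (h : (x : ZMod l) / y = (t : ZMod l)) :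
    ∃ k : ℤ, x = y * t + l * k := by
  have : ((x - y * t : ℤ) : ZMod l) = 0 := by
    push_cast; rw [← h]; field_simp; ring
  rw [ZMod.intCast_zmod_eq_zero_iff_dvd] at this
  obtain ⟨k, hk⟩ := this
  exact ⟨k, by linarith⟩

theorem det3_zero (l R C : ℕ) [Fact l.Prime] (hl : 6 * R^2 * C < l^2) (x1 y1 c1 x2 y2 c2 x3 y3 c3 t s : ℤ)
    (hy1 : (y1 : ZMod l) ≠ 0) (hy2 : (y2 : ZMod l) ≠ 0) (hy3 : (y3 : ZMod l) ≠ 0)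
    (h1 : (x1 : ZMod l) / y1 = t) (h2 : (x2 : ZMod l) / y2 = t) (h3 : (x3 : ZMod l) / y3 = t)
    (g1 : (c1 : ZMod l) / y1 = s) (g2 : (c2 : ZMod l) / y2 = s) (g3 : (c3 : ZMod l) / y3 = s)
    (b1 : |x1| ≤ R) (b2 : |x2| ≤ R) (b3 : |x3| ≤ R) (b1' : |y1| ≤ R) (b2' : |y2| ≤ R) (b3' : |y3| ≤ R)
    (k1 : |c1| ≤ C) (k2 : |c2| ≤ C) (k3 : |c3| ≤ C) :
    c3 * (x1 * y2 - x2 * y1) = c1 * (x3 * y2 - x2 * y3) + c2 * (x1 * y3 - x3 * y1) := by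
  obtain ⟨p1, rfl⟩ := zmod_div_eq l x1 y1 t hy1 h1
  obtain ⟨p2, rfl⟩ := zmod_div_eq l x2 y2 t hy2 h2
  obtain ⟨p3, rfl⟩ := zmod_div_eq l x3 y3 t hy3 h3
  obtain ⟨q1, rfl⟩ := zmod_div_eq l c1 y1 s hy1 g1
  obtain ⟨q2, rfl⟩ := zmod_div_eq l c2 y2 s hy2 g2
  obtain ⟨q3, rfl⟩ := zmod_div_eq l c3 y3 s hy3 g3
  rw [← sub_eq_zero]
  have hm : ∀ a b c : ℤ, |a| ≤ C → |b| ≤ R → |c| ≤ R → |a * (b * c)| ≤ R^2 * C := by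
    intro a b c ha hb hc
    rw [abs_mul, abs_mul]
    calc |a| * (|b| * |c|) ≤ C * (R * R) := by gcongr
      _ = R^2 * C := by ring
  have e1 := hm _ _ _ k3 b1 b2'
  have e2 := hm _ _ _ k3 b2 b1'
  have e3 := hm _ _ _ k1 b3 b2'
  have e4 := hm _ _ _ k1 b2 b3'
  have e5 := hm _ _ _ k2 b1 b3'
  have e6 := hm _ _ _ k2 b3 b1'
  have hl' : (6 * R^2 * C : ℤ) < l^2 := by exact_mod_cast hl
  rw [abs_le] at e1 e2 e3 e4 e5 e6
  apply Int.eq_zero_of_abs_lt_dvd (m := (l:ℤ)^2)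
  · refine ⟨q3 * (p1 * y2 - p2 * y1) - q1 * (p3 * y2 - p2 * y3) - q2 * (p1 * y3 - p3 * y1), ?_⟩
    ring
  · rw [abs_lt]
    constructor <;> nlinarith only [hl', e1.1, e1.2, e2.1, e2.2, e3.1, e3.2, e4.1, e4.2, e5.1, e5.2, e6.1, e6.2]
end PartP6

section PartP6b
open Finset

theorem ratio_gcd_inj (a b : ℤ × ℤ) (ha : 0 < a.1) (ha2 : 0 < a.2) (hb : 0 < b.1) (hb2 : 0 < b.2)
    (h : (a.1 : ℚ) / a.2 = b.1 / b.2) (hg : Int.gcd a.1 a.2 = Int.gcd b.1 b.2) : a = b := by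
  have hg0 : 0 < Int.gcd a.1 a.2 := Int.gcd_pos_of_ne_zero_left _ ha.ne'
  obtain ⟨ga, x, y, hga, hco, hx, hy⟩ := Int.exists_gcd_one' hg0
  have hg0' : 0 < Int.gcd b.1 b.2 := Int.gcd_pos_of_ne_zero_left _ hb.ne'
  obtain ⟨gb, x', y', hgb, hco', hx', hy'⟩ := Int.exists_gcd_one' hg0'
  have ea : Int.gcd a.1 a.2 = ga := by rw [hx, hy, Int.gcd_mul_right, hco]; simp
  have eb : Int.gcd b.1 b.2 = gb := by rw [hx', hy', Int.gcd_mul_right, hco']; simp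
  have hgg : ga = gb := by rw [← ea, ← eb, hg]
  have hga' : (0:ℤ) < ga := by exact_mod_cast hga
  have hgb' : (0:ℤ) < gb := by exact_mod_cast hgb
  have hy0 : 0 < y := by
    rw [hy] at ha2; exact pos_of_mul_pos_left ha2 hga'.le
  have hy0' : 0 < y' := by
    rw [hy'] at hb2; exact pos_of_mul_pos_left hb2 hgb'.le
  have hq : (x:ℚ) / y = x' / y' := by
    rw [hx, hy, hx', hy'] at h
    push_cast at h
    have : (ga:ℚ) ≠ 0 := by positivity
    have : (gb:ℚ) ≠ 0 := by positivity
    rwa [mul_div_mul_right _ _ (by assumption), mul_div_mul_right _ _ (by assumption)] at h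
  have := Rat.div_int_inj hy0 hy0' (by simpa [Int.gcd] using hco) (by simpa [Int.gcd] using hco') hq
  apply Prod.ext
  · rw [hx, hx', this.1, hgg]
  · rw [hy, hy', this.2, hgg]

theorem ratio_card (S : Finset (ℤ × ℤ)) (g0 : ℕ) (hpos : ∀ a ∈ S, 0 < a.1 ∧ 0 < a.2)
    (hg : ∀ a ∈ S, Int.gcd a.1 a.2 ≤ g0) :
    S.card ≤ g0 * (S.image (fun a => (a.1 : ℚ) / a.2)).card := by
  apply Finset.card_le_mul_card_image
  intro q hq
  have : (S.filter (fun a => (a.1 : ℚ) / a.2 = q)).card ≤ (Finset.Icc 1 g0).card := by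
    apply Finset.card_le_card_of_injOn (fun a => Int.gcd a.1 a.2)
    · intro a ha
      have ha := Finset.mem_filter.mp ha
      simp only [coe_Icc, Set.mem_Icc]
      exact ⟨Int.gcd_pos_of_ne_zero_left _ (hpos a ha.1).1.ne', hg a ha.1⟩
    · intro a ha b hb h
      have ha := Finset.mem_filter.mp ha
      have hb := Finset.mem_filter.mp hb
      exact ratio_gcd_inj a b (hpos a ha.1).1 (hpos a ha.1).2 (hpos b hb.1).1 (hpos b hb.1).2 (ha.2.trans hb.2.symm) h
  simpa using this

/-- two integer forms agreeing at many directions agree -/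
theorem form_agree (d : ℕ) (c c' : ℕ → ℤ) (S : Finset (ℤ × ℤ)) (hpos : ∀ a ∈ S, 0 < a.2)
    (hS : d < (S.image (fun a => (a.1 : ℚ) / a.2)).card)
    (h : ∀ a ∈ S, hev d c a.1 a.2 = hev d c' a.1 a.2) : ∀ i ≤ d, c i = c' i := by
  obtain ⟨P, hP, hPc, hPe⟩ := hev_poly d c (1:ℚ)
  obtain ⟨Q, hQ, hQc, hQe⟩ := hev_poly d c' (1:ℚ)
  have : P - Q = 0 := by
    by_contra h0
    have := card_roots_le' (S.image (fun a => (a.1 : ℚ) / a.2)) (P - Q) h0 d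
      ((Polynomial.natDegree_sub_le _ _).trans (max_le hP hQ)) (by
        intro s hs
        rw [Finset.mem_image] at hs
        obtain ⟨a, ha, rfl⟩ := hs
        have h2 : (a.2 : ℚ) ≠ 0 := by exact_mod_cast (hpos a ha).ne'
        have h3 : (hev d c (a.1:ℚ) (a.2:ℚ)) = hev d c' (a.1:ℚ) (a.2:ℚ) := by
          rw [hev_intCast, hev_intCast, h a ha]
        rw [hev_div _ _ _ _ h2, hev_div _ c' _ _ h2] at h3
        rw [Polynomial.eval_sub, hPe, hQe, mul_left_cancel₀ (pow_ne_zero _ h2) h3, sub_self])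
    omega
  intro i hi
  have h1 := hPc i hi
  have h2 := hQc i hi
  rw [sub_eq_zero.mp this] at h1
  rw [h1] at h2
  simpa using h2

theorem hev_congr {R : Type*} [CommRing R] (d : ℕ) (c c' : ℕ → ℤ) (h : ∀ i ≤ d, c i = c' i) (x y : R) :
    hev d c x y = hev d c' x y := by
  unfold hev
  apply Finset.sum_congr rfl
  intro i hi
  rw [h i (by simp at hi; omega)]

theorem s6 (d : ℕ) (hd : 1 ≤ d) (g1 g2 f1 f2 : ℕ → ℤ) (W : Finset (ℤ × ℤ)) (c : ℤ × ℤ → ℤ × ℤ)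
    (R C g0 l : ℕ) (hW : ∀ a ∈ W, 1 ≤ a.1 ∧ a.1 ≤ R ∧ 1 ≤ a.2 ∧ a.2 ≤ R) (hg : ∀ a ∈ W, Int.gcd a.1 a.2 ≤ g0)
    (hc : ∀ a ∈ W, |(c a).1| ≤ C ∧ |(c a).2| ≤ C)
    (e1 : ∀ a ∈ W, hev d g1 a.1 a.2 = hev d f1 (c a).1 (c a).2)
    (e2 : ∀ a ∈ W, hev d g2 a.1 a.2 = hev d f2 (c a).1 (c a).2)
    (hl : l.Prime) (hlR : R < l) (hlC : 6 * R^2 * C < l^2)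
    (i j : ℕ) (hi : i ≤ d) (hj : j ≤ d) (hm : ¬ (l:ℤ) ∣ g1 i * g2 j - g1 j * g2 i)
    (hcard : 2 * d * R + l * (d^2 + d) * (d * g0) < W.card) :
    ∃ a ∈ W, ∃ m1 m2 m3 m4 : ℚ, m1 * a.1 + m2 * a.2 = (c a).1 ∧ m3 * a.1 + m4 * a.2 = (c a).2 ∧
      ∀ x y : ℚ, hev d f1 (m1 * x + m2 * y) (m3 * x + m4 * y) = hev d g1 x y := by
  classical
  haveI : Fact l.Prime := ⟨hl⟩
  have hunit : ∀ n : ℤ, 1 ≤ n → n ≤ R → (n : ZMod l) ≠ 0 := by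
    intro n h1 h2 h0
    rw [ZMod.intCast_zmod_eq_zero_iff_dvd] at h0
    have := Int.le_of_dvd (by omega) h0
    omega
  set t : ℤ × ℤ → ZMod l := fun a => (a.1 : ZMod l) / a.2 with ht
  set s : ℤ × ℤ → ZMod l × ZMod l := fun a => (((c a).1 : ZMod l) / a.2, ((c a).2 : ZMod l) / a.2) with hs
  have E : ∀ (g f : ℕ → ℤ), (∀ a ∈ W, hev d g a.1 a.2 = hev d f (c a).1 (c a).2) → ∀ a ∈ W,
      hev d g (t a) 1 = hev d f (s a).1 (s a).2 := by
    intro g f h a ha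
    have h2 := hunit a.2 (hW a ha).2.2.1 (hW a ha).2.2.2
    have h3 : (hev d g (a.1 : ZMod l) (a.2 : ZMod l)) = hev d f ((c a).1 : ZMod l) ((c a).2 : ZMod l) := by
      rw [hev_intCast, hev_intCast, h a ha]
    rw [hev_div _ _ _ _ h2] at h3
    have h4 : hev d f ((c a).1 : ZMod l) ((c a).2 : ZMod l) = (a.2 : ZMod l)^d * hev d f (s a).1 (s a).2 := by
      rw [← hev_scale]
      congr 1 <;> simp only [hs] <;> field_simp
    rw [h4] at h3
    exact mul_left_cancel₀ (pow_ne_zero _ h2) h3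
  have E1 := E g1 f1 e1
  have E2 := E g2 f2 e2
  obtain ⟨P1, hP1, hP1c, hP1e⟩ := hev_poly d g1 (1 : ZMod l)
  obtain ⟨P2, hP2, hP2c, hP2e⟩ := hev_poly d g2 (1 : ZMod l)
  have hm' : (g1 i : ZMod l) * g2 j - g1 j * g2 i ≠ 0 := by
    intro h0
    apply hm
    rw [← ZMod.intCast_zmod_eq_zero_iff_dvd]
    push_cast; exact h0
  have hlin : ∀ A B : ZMod l, Polynomial.C A * P2 - Polynomial.C B * P1 = 0 → A = 0 ∧ B = 0 := by
    intro A B h0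
    have hi' := congrArg (fun P => Polynomial.coeff P i) h0
    have hj' := congrArg (fun P => Polynomial.coeff P j) h0
    simp [hP1c i hi, hP2c i hi] at hi'
    simp [hP1c j hj, hP2c j hj] at hj'
    constructor
    · have : A * ((g1 i : ZMod l) * g2 j - g1 j * g2 i) = 0 := by linear_combination (g1 i : ZMod l) * hj' - (g1 j : ZMod l) * hi'
      exact (mul_eq_zero.mp this).resolve_right hm'
    · have : B * ((g1 i : ZMod l) * g2 j - g1 j * g2 i) = 0 := by linear_combination (g2 i : ZMod l) * hj' - (g2 j : ZMod l) * hi'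
      exact (mul_eq_zero.mp this).resolve_right hm'
  have hP10 : P1 ≠ 0 := by
    intro h0
    have := hlin 0 1 (by simp [h0])
    exact one_ne_zero this.2
  -- the bad polynomial
  obtain ⟨Bp, hBp0, hBpd, hBg⟩ : ∃ Bp : Polynomial (ZMod l), Bp ≠ 0 ∧ Bp.natDegree ≤ 2 * d ∧
      ∀ a ∈ W, Bp.eval (t a) ≠ 0 → hev d g1 (t a) 1 ≠ 0 ∧ ∃ k ≤ d,
        (f1 k : ZMod l) * hev d g2 (t a) 1 - f2 k * hev d g1 (t a) 1 ≠ 0 := by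
    by_cases hz : ∃ k ≤ d, ¬ ((f1 k : ZMod l) = 0 ∧ (f2 k : ZMod l) = 0)
    · obtain ⟨k, hk, hne⟩ := hz
      refine ⟨P1 * (Polynomial.C (f1 k : ZMod l) * P2 - Polynomial.C (f2 k : ZMod l) * P1), ?_, ?_, ?_⟩
      · apply mul_ne_zero hP10
        intro h0; exact hne (hlin _ _ h0)
      · apply Polynomial.natDegree_mul_le.trans
        have : (Polynomial.C (f1 k : ZMod l) * P2 - Polynomial.C (f2 k : ZMod l) * P1).natDegree ≤ d := by
          apply (Polynomial.natDegree_sub_le _ _).trans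
          exact max_le ((Polynomial.natDegree_C_mul_le _ _).trans hP2) ((Polynomial.natDegree_C_mul_le _ _).trans hP1)
        omega
      · intro a ha h0
        simp only [Polynomial.eval_mul, Polynomial.eval_sub, Polynomial.eval_C, hP1e, hP2e] at h0
        exact ⟨left_ne_zero_of_mul h0, k, hk, right_ne_zero_of_mul h0⟩
    · push Not at hz
      refine ⟨P1, hP10, by omega, ?_⟩
      intro a ha h0
      exfalso; apply h0
      rw [hP1e, E1 a ha, hev]
      apply Finset.sum_eq_zero
      intro k hk
      rw [(hz k (by simp at hk; omega)).1]; ring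
  -- counting
  set Wb := W.filter (fun a => Bp.eval (t a) = 0) with hWb
  set Wg := W.filter (fun a => ¬ Bp.eval (t a) = 0) with hWg
  have hsum : W.card = Wb.card + Wg.card := (Finset.card_filter_add_card_filter_not _).symm
  have hbad : Wb.card ≤ 2 * d * R := by
    have hr : (Wb.image t).card ≤ 2 * d := by
      apply card_roots_le' _ Bp hBp0 _ hBpd
      intro q hq
      rw [Finset.mem_image] at hq
      obtain ⟨a, ha, rfl⟩ := hq
      exact (Finset.mem_filter.mp ha).2
    have := Finset.card_le_mul_card_image (f := t) Wb R (by
      intro q hq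
      have : (Wb.filter (fun a => t a = q)).card ≤ (Finset.Icc (1:ℤ) R).card := by
        apply Finset.card_le_card_of_injOn (fun a => a.2)
        · intro a ha
          have ha := (Finset.mem_filter.mp (Finset.mem_filter.mp ha).1).1
          simp only [coe_Icc, Set.mem_Icc]
          exact (hW a ha).2.2
        · intro a ha b hb hab
          have ha := Finset.mem_filter.mp ha
          have hb := Finset.mem_filter.mp hb
          have ha' := (Finset.mem_filter.mp ha.1).1
          have hb' := (Finset.mem_filter.mp hb.1).1
          have hab : a.2 = b.2 := hab
          have h2 := hunit a.2 (hW a ha').2.2.1 (hW a ha').2.2.2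
          have h3 := ha.2.trans hb.2.symm
          simp only [ht] at h3
          rw [← hab] at h3
          have h4 : ((a.1 - b.1 : ℤ) : ZMod l) = 0 := by
            push_cast
            field_simp at h3
            rw [h3]; ring
          rw [ZMod.intCast_zmod_eq_zero_iff_dvd] at h4
          have h5 := Int.eq_zero_of_abs_lt_dvd h4 (by
            have := hW a ha'; have := hW b hb'
            rw [abs_lt]; constructor <;> omega)
          exact Prod.ext (by omega) hab
      simpa using this)
    calc Wb.card ≤ R * (Wb.image t).card := this
      _ ≤ R * (2 * d) := Nat.mul_le_mul_left _ hr
      _ = _ := by ring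
  -- a big class
  obtain ⟨κ, hκ, hbig⟩ : ∃ κ : ZMod l × (ZMod l × ZMod l), κ ∈ Wg.image (fun a => (t a, s a)) ∧
      d * g0 < (Wg.filter (fun a => (t a, s a) = κ)).card := by
    by_contra! hcon
    have h1 := Finset.card_le_mul_card_image (f := fun a => (t a, s a)) Wg (d * g0) hcon
    set I := Wg.image (fun a => (t a, s a)) with hI
    have h2 : I.card ≤ (d^2 + d) * (I.image Prod.fst).card := by
      apply Finset.card_le_mul_card_image
      intro q hq
      rw [Finset.mem_image] at hq
      obtain ⟨⟨q', s'⟩, hq', rfl⟩ := hq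
      rw [hI, Finset.mem_image] at hq'
      obtain ⟨a0, ha0, h0⟩ := hq'
      have ha0' := Finset.mem_filter.mp ha0
      obtain ⟨hA, k, hk, hK⟩ := hBg a0 ha0'.1 ha0'.2
      have hq0 : t a0 = q' := congrArg Prod.fst h0
      rw [hq0] at hA hK
      have : (I.filter (fun x => x.1 = q')).card = ((I.filter (fun x => x.1 = q')).image Prod.snd).card := by
        rw [Finset.card_image_of_injOn]
        intro x hx y hy hxy
        exact Prod.ext ((Finset.mem_filter.mp hx).2.trans (Finset.mem_filter.mp hy).2.symm) hxy
      change (I.filter (fun x => x.1 = q')).card ≤ _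
      rw [this]
      have hmem : ∀ p ∈ (I.filter (fun x => x.1 = q')).image Prod.snd, ∃ a ∈ W, t a = q' ∧ s a = p := by
        intro p hp
        rw [Finset.mem_image] at hp
        obtain ⟨x, hx, rfl⟩ := hp
        rw [Finset.mem_filter, hI, Finset.mem_image] at hx
        obtain ⟨⟨a, ha, rfl⟩, h⟩ := hx
        exact ⟨a, (Finset.mem_filter.mp ha).1, h, rfl⟩
      apply count_uv d hd f1 f2 (hev d g1 q' 1) (hev d g2 q' 1) hA k hk hK
      · intro p hp
        obtain ⟨a, ha, h, h'⟩ := hmem p hp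
        rw [← h', ← h, E1 a ha]
      · intro p hp
        obtain ⟨a, ha, h, h'⟩ := hmem p hp
        rw [← h', ← h, E2 a ha]
    have h3 : (I.image Prod.fst).card ≤ l := by
      have := Finset.card_le_univ (I.image Prod.fst)
      rwa [ZMod.card] at this
    have h4 : Wg.card ≤ l * (d^2 + d) * (d * g0) := by
      calc Wg.card ≤ d * g0 * I.card := h1
        _ ≤ d * g0 * ((d^2 + d) * l) := by gcongr; exact h2.trans (by gcongr)
        _ = _ := by ring
    omega
  set T := Wg.filter (fun a => (t a, s a) = κ) with hT
  have hTW : ∀ a ∈ T, a ∈ W := fun a ha => (Finset.mem_filter.mp (Finset.mem_filter.mp ha).1).1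
  have hTκ : ∀ a ∈ T, t a = κ.1 ∧ s a = κ.2 := fun a ha => by
    have := (Finset.mem_filter.mp ha).2
    exact ⟨congrArg Prod.fst this, congrArg Prod.snd this⟩
  have hTpos : ∀ a ∈ T, 0 < a.1 ∧ 0 < a.2 := fun a ha => by
    have := hW a (hTW a ha); omega
  have hTc := ratio_card T g0 hTpos (fun a ha => hg a (hTW a ha))
  have hTi : d < (T.image (fun a => (a.1 : ℚ) / a.2)).card := by
    by_contra hle
    push Not at hle
    have : g0 * (T.image (fun a => (a.1 : ℚ) / a.2)).card ≤ g0 * d := Nat.mul_le_mul_left _ hle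
    rw [mul_comm d g0] at hbig
    omega
  -- two nonparallel
  obtain ⟨q1, hq1, q2, hq2, hq12⟩ := Finset.one_lt_card.mp (lt_of_le_of_lt hd hTi)
  rw [Finset.mem_image] at hq1 hq2
  obtain ⟨a, ha, rfl⟩ := hq1
  obtain ⟨b, hb, rfl⟩ := hq2
  have hδ : a.1 * b.2 - b.1 * a.2 ≠ 0 := by
    intro h0
    apply hq12
    have h1 : (a.2 : ℚ) ≠ 0 := by exact_mod_cast (hTpos a ha).2.ne'
    have h2 : (b.2 : ℚ) ≠ 0 := by exact_mod_cast (hTpos b hb).2.ne'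
    rw [div_eq_div_iff h1 h2]
    have : a.1 * b.2 = b.1 * a.2 := by linarith
    exact_mod_cast this
  set δ := a.1 * b.2 - b.1 * a.2 with hδd
  obtain ⟨tt, htt⟩ := ZMod.intCast_surjective κ.1
  obtain ⟨s1, hs1⟩ := ZMod.intCast_surjective κ.2.1
  obtain ⟨s2, hs2⟩ := ZMod.intCast_surjective κ.2.2
  have hlin3 : ∀ x ∈ T, δ * (c x).1 = ((c a).1 * b.2 - (c b).1 * a.2) * x.1 + (- (c a).1 * b.1 + (c b).1 * a.1) * x.2 ∧
      δ * (c x).2 = ((c a).2 * b.2 - (c b).2 * a.2) * x.1 + (- (c a).2 * b.1 + (c b).2 * a.1) * x.2 := by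
    intro x hx
    have B : ∀ x ∈ T, |x.1| ≤ R ∧ |x.2| ≤ R ∧ (x.2 : ZMod l) ≠ 0 := by
      intro x hx
      have := hW x (hTW x hx)
      refine ⟨?_, ?_, hunit _ this.2.2.1 this.2.2.2⟩ <;> rw [abs_le] <;> constructor <;> omega
    obtain ⟨ba, ba', ba''⟩ := B a ha
    obtain ⟨bb, bb', bb''⟩ := B b hb
    obtain ⟨bx, bx', bx''⟩ := B x hx
    have ca := hc a (hTW a ha)
    have cb := hc b (hTW b hb)
    have cx := hc x (hTW x hx)
    obtain ⟨ta, sa⟩ := hTκ a ha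
    obtain ⟨tb, sb⟩ := hTκ b hb
    obtain ⟨tx, sx⟩ := hTκ x hx
    rw [← htt] at ta tb tx
    constructor
    · have := det3_zero l R C hlC a.1 a.2 (c a).1 b.1 b.2 (c b).1 x.1 x.2 (c x).1 tt s1 ba'' bb'' bx'' ta tb tx
        (by rw [hs1, ← sa]) (by rw [hs1, ← sb]) (by rw [hs1, ← sx]) ba bb bx ba' bb' bx' ca.1 cb.1 cx.1
      rw [hδd]; linear_combination this
    · have := det3_zero l R C hlC a.1 a.2 (c a).2 b.1 b.2 (c b).2 x.1 x.2 (c x).2 tt s2 ba'' bb'' bx'' ta tb tx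
        (by rw [hs2, ← sa]) (by rw [hs2, ← sb]) (by rw [hs2, ← sx]) ba bb bx ba' bb' bx' ca.2 cb.2 cx.2
      rw [hδd]; linear_combination this
  set n1 := ((c a).1 * b.2 - (c b).1 * a.2) with hn1
  set n2 := (- (c a).1 * b.1 + (c b).1 * a.1) with hn2
  set n3 := ((c a).2 * b.2 - (c b).2 * a.2) with hn3
  set n4 := (- (c a).2 * b.1 + (c b).2 * a.1) with hn4
  obtain ⟨c', hc'⟩ := hev_comp d n1 n2 n3 n4 f1
  have hag := form_agree d c' (fun i => δ^d * g1 i) T (fun a ha => (hTpos a ha).2) hTi (by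
    intro x hx
    have h1 := hc' ℤ x.1 x.2
    simp only [Int.cast_id] at h1
    rw [h1, hev_smul, ← (hlin3 x hx).1, ← (hlin3 x hx).2, hev_scale, e1 x (hTW x hx)]
    simp)
  have hδq : (δ : ℚ) ≠ 0 := by exact_mod_cast hδ
  refine ⟨a, hTW a ha, n1 / δ, n2 / δ, n3 / δ, n4 / δ, ?_, ?_, ?_⟩
  · have := (hlin3 a ha).1
    have : (δ:ℚ) * (c a).1 = n1 * a.1 + n2 * a.2 := by exact_mod_cast this
    field_simp; rw [this]
  · have := (hlin3 a ha).2
    have : (δ:ℚ) * (c a).2 = n3 * a.1 + n4 * a.2 := by exact_mod_cast this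
    field_simp; rw [this]
  · intro x y
    have h1 := hc' ℚ x y
    rw [hev_congr d _ _ hag, hev_smul] at h1
    apply mul_left_cancel₀ (pow_ne_zero d hδq)
    rw [← hev_scale]
    push_cast at h1
    rw [h1]
    congr 1 <;> field_simp
end PartP6b

section PartP3
open NumberField Filter Topology

section IdealCount
variable (K : Type*) [Field K] [NumberField K]

noncomputable def idf (n : ℕ) : Finset (Ideal (𝓞 K)) :=
  (Ideal.finite_setOfPred_absNorm_le (S := 𝓞 K) n).toFinset

theorem mem_idf (n : ℕ) (I : Ideal (𝓞 K)) : I ∈ idf K n ↔ Ideal.absNorm I ≤ n := by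
  simp [idf]

theorem idf_tendsto : ∃ c : ℝ, 0 < c ∧ Tendsto (fun n : ℕ => ((idf K n).card : ℝ) / n) atTop (𝓝 c) := by
  refine ⟨dedekindZeta_residue K, dedekindZeta_residue_pos K, ?_⟩
  have := (NumberField.Ideal.tendsto_norm_le_div_atTop K).comp tendsto_natCast_atTop_atTop
  rw [← dedekindZeta_residue_def] at this
  refine this.congr fun n => ?_
  simp only [Function.comp_apply, Nat.cast_le]
  congr 2
  have h2 : Nat.card (idf K n : Set (Ideal (𝓞 K))) = (idf K n).card := by
    rw [Nat.card_coe_set_eq, Set.ncard_coe_finset]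
  rw [← h2]
  apply Nat.card_congr
  exact Equiv.subtypeEquivRight (fun I => by simp [mem_idf])

theorem idf_le : ∃ C : ℝ, 0 < C ∧ ∀ n : ℕ, 1 ≤ n → ((idf K n).card : ℝ) ≤ C * n := by
  obtain ⟨c, hc, h⟩ := idf_tendsto K
  obtain ⟨B, hB⟩ := h.bddAbove_range
  refine ⟨max B 1, by positivity, fun n hn => ?_⟩
  have h1 := hB ⟨n, rfl⟩
  have hn' : (0:ℝ) < n := by exact_mod_cast hn
  simp only at h1
  rw [div_le_iff₀ hn'] at h1
  exact h1.trans (by gcongr; exact le_max_left _ _)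

open Classical in
theorem smooth_card (s : Finset (Ideal (𝓞 K))) (j : ℕ) :
    ((idf K (2^j)).filter (fun I => I ≠ ⊥ ∧ ∀ p : Ideal (𝓞 K), Prime p → p ∣ I → p ∈ s)).card
      ≤ (j+1)^s.card := by
  have hpi : (Fintype.piFinset (fun _ : s => Finset.range (j+1))).card = (j+1)^s.card := by
    simp
  rw [← hpi]
  apply Finset.card_le_card_of_injOn
    (fun I => fun p : s => (UniqueFactorizationMonoid.normalizedFactors I).count (p : Ideal (𝓞 K)))
  · intro I hI
    simp only [Finset.coe_filter, mem_idf, Set.mem_ofPred_eq] at hI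
    obtain ⟨hn, h0, hp⟩ := hI
    simp only [Finset.mem_coe, Fintype.mem_piFinset, Finset.mem_range]
    intro p
    by_cases hpm : (p : Ideal (𝓞 K)) ∈ UniqueFactorizationMonoid.normalizedFactors I
    · have hpp := UniqueFactorizationMonoid.prime_of_normalized_factor _ hpm
      set k := (UniqueFactorizationMonoid.normalizedFactors I).count (p : Ideal (𝓞 K))
      have hdvd : (p : Ideal (𝓞 K))^k ∣ I := by
        have h1 : Multiset.replicate k (p : Ideal (𝓞 K)) ≤ UniqueFactorizationMonoid.normalizedFactors I :=
          Multiset.le_count_iff_replicate_le.1 le_rfl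
        have := Multiset.prod_dvd_prod_of_le h1
        rw [Multiset.prod_replicate, Ideal.prod_normalizedFactors_eq_self h0] at this
        exact this
      have h2 := map_dvd Ideal.absNorm hdvd
      rw [map_pow] at h2
      have hI0 : 0 < Ideal.absNorm I := by
        rw [Nat.pos_iff_ne_zero, Ne, Ideal.absNorm_eq_zero_iff]; exact h0
      have h3 := Nat.le_of_dvd hI0 h2
      have hp2 : 2 ≤ Ideal.absNorm (p : Ideal (𝓞 K)) := by
        have a : Ideal.absNorm (p : Ideal (𝓞 K)) ≠ 0 := by
          rw [Ne, Ideal.absNorm_eq_zero_iff]; exact hpp.ne_zero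
        have b : Ideal.absNorm (p : Ideal (𝓞 K)) ≠ 1 := by
          rw [Ne, Ideal.absNorm_eq_one_iff]
          intro h; apply hpp.not_isUnit; rw [h]; exact Ideal.isUnit_iff.2 rfl
        omega
      have h4 : 2^k ≤ 2^j := (Nat.pow_le_pow_left hp2 k).trans (h3.trans hn)
      have := (Nat.pow_le_pow_iff_right (by norm_num : 1 < 2)).1 h4
      omega
    · rw [Multiset.count_eq_zero.2 hpm]; omega
  · intro I hI J hJ hIJ
    simp only [Finset.coe_filter, mem_idf, Set.mem_ofPred_eq] at hI hJ
    obtain ⟨hn, h0, hp⟩ := hI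
    obtain ⟨hn', h0', hp'⟩ := hJ
    have : UniqueFactorizationMonoid.normalizedFactors I = UniqueFactorizationMonoid.normalizedFactors J := by
      ext p
      by_cases hps : p ∈ s
      · exact congrFun hIJ ⟨p, hps⟩
      · rw [Multiset.count_eq_zero.2, Multiset.count_eq_zero.2]
        · intro h
          exact hps (hp' p (UniqueFactorizationMonoid.prime_of_normalized_factor _ h)
            (UniqueFactorizationMonoid.dvd_of_mem_normalizedFactors h))
        · intro h
          exact hps (hp p (UniqueFactorizationMonoid.prime_of_normalized_factor _ h)
            (UniqueFactorizationMonoid.dvd_of_mem_normalizedFactors h))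
    rw [← Ideal.prod_normalizedFactors_eq_self h0, this, Ideal.prod_normalizedFactors_eq_self h0']

open Classical in
noncomputable def wid (I : Ideal (𝓞 K)) : ℝ := if Prime I then 1 / (Ideal.absNorm I : ℝ) else 0

open Classical in
theorem not_summable_wid : ¬ Summable (wid K) := by
  intro hs
  obtain ⟨c, hc, hlim⟩ := idf_tendsto K
  obtain ⟨C, hC, hCn⟩ := idf_le K
  obtain ⟨s, hsv⟩ := (summable_iff_vanishing_norm.1 hs) (c/(2*C)) (by positivity)
  have key : ∀ j : ℕ, ((idf K (2^j)).card : ℝ) ≤ 1 + ((j+1)^s.card : ℕ) + (c/2) * (2^j : ℕ) := by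
    intro j
    set n := 2^j with hn
    set Pn := (idf K n).filter (fun I => Prime I ∧ I ∉ s) with hPn
    have hsub : idf K n ⊆ ({⊥} ∪ (idf K (2^j)).filter (fun I => I ≠ ⊥ ∧ ∀ p : Ideal (𝓞 K), Prime p → p ∣ I → p ∈ s))
        ∪ Pn.biUnion (fun p => (idf K (n / Ideal.absNorm p)).image (fun J => p * J)) := by
      intro I hI
      simp only [Finset.mem_union, Finset.mem_singleton, Finset.mem_filter, Finset.mem_biUnion,
        Finset.mem_image]
      by_cases h0 : I = ⊥
      · exact Or.inl (Or.inl h0)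
      by_cases hsm : ∀ p : Ideal (𝓞 K), Prime p → p ∣ I → p ∈ s
      · exact Or.inl (Or.inr ⟨hI, h0, hsm⟩)
      · right
        push Not at hsm
        obtain ⟨p, hp, ⟨J, hJ⟩, hps⟩ := hsm
        rw [mem_idf] at hI
        have hN : Ideal.absNorm I = Ideal.absNorm p * Ideal.absNorm J := by rw [hJ, map_mul]
        have hI0 : Ideal.absNorm I ≠ 0 := by rw [Ne, Ideal.absNorm_eq_zero_iff]; exact h0
        have hp0 : 0 < Ideal.absNorm p := by
          rw [Nat.pos_iff_ne_zero]; intro h; rw [h] at hN; simp at hN; exact hI0 hN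
        have hJ0 : 0 < Ideal.absNorm J := by
          rw [Nat.pos_iff_ne_zero]; intro h; rw [h] at hN; simp at hN; exact hI0 hN
        refine ⟨p, ?_, J, ?_, hJ.symm⟩
        · rw [hPn, Finset.mem_filter, mem_idf]
          refine ⟨?_, hp, hps⟩
          nlinarith
        · rw [mem_idf, Nat.le_div_iff_mul_le hp0]
          rw [mul_comm, ← hN]; exact hI
    have h1 := Finset.card_le_card hsub
    have h2 := (Finset.card_union_le ({⊥} ∪ (idf K (2^j)).filter (fun I => I ≠ ⊥ ∧ ∀ p : Ideal (𝓞 K), Prime p → p ∣ I → p ∈ s))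
       (Pn.biUnion (fun p => (idf K (n / Ideal.absNorm p)).image (fun J => p * J))))
    have h3 := Finset.card_union_le ({⊥} : Finset (Ideal (𝓞 K))) ((idf K (2^j)).filter (fun I => I ≠ ⊥ ∧ ∀ p : Ideal (𝓞 K), Prime p → p ∣ I → p ∈ s))
    have h4 := smooth_card K s j
    have h5 : ((Pn.biUnion (fun p => (idf K (n / Ideal.absNorm p)).image (fun J => p * J))).card : ℝ)
        ≤ (c/2) * n := by
      calc ((Pn.biUnion (fun p => (idf K (n / Ideal.absNorm p)).image (fun J => p * J))).card : ℝ)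
          ≤ ((∑ p ∈ Pn, ((idf K (n / Ideal.absNorm p)).image (fun J => p * J)).card : ℕ) : ℝ) := by
            exact_mod_cast Finset.card_biUnion_le
        _ ≤ ∑ p ∈ Pn, (C * n) * wid K p := by
            push_cast
            apply Finset.sum_le_sum
            intro p hp
            rw [hPn, Finset.mem_filter, mem_idf] at hp
            have hp0 : 0 < Ideal.absNorm p := by
              rw [Nat.pos_iff_ne_zero, Ne, Ideal.absNorm_eq_zero_iff]
              exact hp.2.1.ne_zero
            have hq : 1 ≤ n / Ideal.absNorm p := (Nat.one_le_div_iff hp0).2 hp.1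
            have e1 : (((idf K (n / Ideal.absNorm p)).image (fun J => p * J)).card : ℝ)
              ≤ (idf K (n / Ideal.absNorm p)).card := by exact_mod_cast Finset.card_image_le
            refine e1.trans ((hCn _ hq).trans ?_)
            have e2 : ((n / Ideal.absNorm p : ℕ) : ℝ) ≤ n / (Ideal.absNorm p : ℝ) := Nat.cast_div_le
            rw [wid, if_pos hp.2.1, mul_assoc]
            gcongr
            rw [mul_one_div]; exact e2
        _ = (C * n) * ∑ p ∈ Pn, wid K p := by rw [Finset.mul_sum]
        _ ≤ (C * n) * (c/(2*C)) := by
            gcongr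
            have := hsv Pn (by
              rw [Finset.disjoint_left]; intro p hp
              rw [hPn, Finset.mem_filter] at hp; exact hp.2.2)
            exact (le_abs_self _).trans (by simpa using this.le)
        _ = (c/2) * n := by field_simp
    have h6 : (idf K n).card ≤ 1 + (j+1)^s.card + (Pn.biUnion (fun p => (idf K (n / Ideal.absNorm p)).image (fun J => p * J))).card := by
      simp only [Finset.card_singleton] at h3
      omega
    have h7 : ((idf K n).card : ℝ) ≤ 1 + ((j+1)^s.card : ℕ) + ((Pn.biUnion (fun p => (idf K (n / Ideal.absNorm p)).image (fun J => p * J))).card : ℝ) := by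
      exact_mod_cast h6
    linarith
  have l1 : Tendsto (fun j : ℕ => ((idf K (2^j)).card : ℝ) / ((2^j : ℕ) : ℝ)) atTop (𝓝 c) :=
    hlim.comp (tendsto_pow_atTop_atTop_of_one_lt (by norm_num : 1 < 2))
  have l2 : Tendsto (fun j : ℕ => (1:ℝ)/2^j) atTop (𝓝 0) := by
    have := tendsto_pow_atTop_nhds_zero_of_lt_one (by norm_num : (0:ℝ) ≤ 1/2) (by norm_num)
    simpa using this
  have l3 : Tendsto (fun j : ℕ => (((j+1 : ℕ):ℝ)^s.card)/2^j) atTop (𝓝 0) := by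
    have := (tendsto_pow_const_div_const_pow_of_one_lt s.card (by norm_num : (1:ℝ) < 2)).comp (tendsto_add_atTop_nat 1)
    have := this.const_mul 2
    rw [mul_zero] at this
    refine this.congr fun j => ?_
    simp only [Function.comp_apply]
    rw [pow_succ]; field_simp
  have l4 := (l2.add l3).add_const (c/2)
  have := le_of_tendsto_of_tendsto' l1 l4 (fun j => by
    have hp : (0:ℝ) < 2^j := by positivity
    have := key j
    rw [div_le_iff₀ (by positivity)]
    push_cast at this ⊢
    have e : (1 / 2 ^ j + ((j:ℝ) + 1) ^ s.card / 2 ^ j + c / 2) * 2^j = 1 + ((j:ℝ) + 1) ^ s.card + c/2 * 2^j := by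
      field_simp
    linarith)
  linarith

end IdealCount
end PartP3

section PartP3b
open NumberField Filter Topology

theorem hev_one {R : Type*} [CommRing R] (h : Polynomial ℤ) (x : R) :
    hev h.natDegree h.coeff x 1 = Polynomial.aeval x h := by
  rw [Polynomial.aeval_eq_sum_range]
  unfold hev
  apply Finset.sum_congr rfl
  intro i _
  simp

theorem root_of_deg_one {K : Type*} [Field K] [NumberField K] (h : Polynomial ℤ) (θ : K)
    (hθ : Polynomial.aeval θ h = 0) (I : Ideal (𝓞 K)) (p : ℕ) (hp : p.Prime) (hpI : Ideal.absNorm I = p)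
    (hpa : ¬ (p:ℤ) ∣ h.leadingCoeff) : ∃ r : ℤ, (p:ℤ) ∣ h.eval r := by
  have hintgl : IsIntegral ℤ (h.leadingCoeff • θ) := isIntegral_leadingCoeff_smul h θ hθ
  set α : 𝓞 K := ⟨h.leadingCoeff • θ, hintgl⟩ with hα
  set a := h.leadingCoeff with ha
  set d := h.natDegree with hd
  have e1 : hev d h.coeff α (a : 𝓞 K) = 0 := by
    apply RingOfIntegers.coe_injective
    rw [← hev_map, map_zero]
    have : (algebraMap (𝓞 K) K) α = (a:K) * θ := by
      show a • θ = _
      simp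
    rw [this, map_intCast]
    have h2 := hev_scale d h.coeff (a:K) θ 1
    rw [mul_one] at h2
    rw [h2, hev_one, hθ, mul_zero]
  have hfin : Finite (𝓞 K ⧸ I) := by
    have : Nat.card (𝓞 K ⧸ I) = p := hpI
    exact Nat.finite_of_card_ne_zero (by rw [this]; exact hp.ne_zero)
  have := Fintype.ofFinite (𝓞 K ⧸ I)
  have hcard : Fintype.card (𝓞 K ⧸ I) = p := by
    rw [← Nat.card_eq_fintype_card]; exact hpI
  let e := ZMod.ringEquivOfPrime (𝓞 K ⧸ I) hp hcard
  have : Fact p.Prime := ⟨hp⟩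
  have e2 : hev d h.coeff (e.symm (Ideal.Quotient.mk I α)) (a : ZMod p) = 0 := by
    have := hev_map (e.symm.toRingHom.comp (Ideal.Quotient.mk I)) d h.coeff α (a : 𝓞 K)
    rw [e1, map_zero, map_intCast] at this
    exact this
  set z := e.symm (Ideal.Quotient.mk I α)
  have ha0 : (a : ZMod p) ≠ 0 := by
    rw [Ne, ZMod.intCast_zmod_eq_zero_iff_dvd]; exact hpa
  have e3 := hev_scale d h.coeff (a:ZMod p) (z/a) 1
  rw [mul_one, mul_div_cancel₀ _ ha0, e2, hev_one] at e3
  have e4 : Polynomial.aeval (z / (a:ZMod p)) h = 0 := by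
    rcases mul_eq_zero.1 e3.symm with h1 | h1
    · exact absurd h1 (pow_ne_zero _ ha0)
    · exact h1
  obtain ⟨r, hr⟩ := ZMod.intCast_surjective (z / (a:ZMod p))
  refine ⟨r, ?_⟩
  rw [← ZMod.intCast_zmod_eq_zero_iff_dvd]
  rw [← hr] at e4
  rw [← e4, Polynomial.aeval_def, ← eq_intCast (algebraMap ℤ (ZMod p)) r, Polynomial.eval₂_at_apply]
  simp

theorem primes_above_card {K : Type*} [Field K] [NumberField K] (p : ℕ) (hp : p.Prime) (T : Finset (Ideal (𝓞 K)))
   (hT : ∀ I ∈ T, Prime I ∧ (p : 𝓞 K) ∈ I ∧ p ≤ Ideal.absNorm I) : T.card ≤ Module.finrank ℤ (𝓞 K) := by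
  have h1 : ∏ I ∈ T, I ∣ Ideal.span {(p : 𝓞 K)} :=
    Finset.prod_primes_dvd _ (fun I hI => (hT I hI).1) (fun I hI => by
      rw [Ideal.dvd_span_singleton]; exact (hT I hI).2.1)
  have h2 := map_dvd Ideal.absNorm h1
  rw [map_prod, Ideal.absNorm_span_natCast] at h2
  have h3 := Nat.le_of_dvd (pow_pos hp.pos _) h2
  have h4 : p^T.card ≤ ∏ I ∈ T, Ideal.absNorm I := Finset.pow_card_le_prod _ _ _ (fun I hI => (hT I hI).2.2)
  exact (Nat.pow_le_pow_iff_right hp.one_lt).1 (h4.trans h3)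

open Classical in
theorem not_summable_roots (h : Polynomial ℤ) (hirr : Irreducible (h.map (Int.castRingHom ℚ))) :
    ¬ Summable (fun p : ℕ => if p.Prime ∧ ∃ r : ℤ, (p:ℤ) ∣ h.eval r then (1:ℝ)/p else 0) := by
  intro hs
  have hF : Fact (Irreducible (h.map (Int.castRingHom ℚ))) := ⟨hirr⟩
  set K := AdjoinRoot (h.map (Int.castRingHom ℚ)) with hK
  set θ : K := AdjoinRoot.root _ with hθ
  have hroot : Polynomial.aeval θ h = 0 := by
    have h1 := AdjoinRoot.eval₂_root (h.map (Int.castRingHom ℚ))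
    rw [Polynomial.eval₂_map] at h1
    rw [Polynomial.aeval_def]
    have e : algebraMap ℤ K = (AdjoinRoot.of (h.map (Int.castRingHom ℚ))).comp (Int.castRingHom ℚ) :=
      RingHom.ext_int _ _
    rw [e]; exact h1
  have hh0 : h ≠ 0 := by
    rintro rfl
    simp at hirr
  set a := h.leadingCoeff with ha
  have ha0 : a ≠ 0 := Polynomial.leadingCoeff_ne_zero.2 hh0
  apply not_summable_wid K
  set u : ℕ → ℝ := fun p => (if p.Prime ∧ ∃ r : ℤ, (p:ℤ) ∣ h.eval r then (1:ℝ)/p else 0)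
     + (if p ∈ a.natAbs.divisors then 1 else 0) + 1/(p:ℝ)^2 with hu
  have hu0 : ∀ p, 0 ≤ u p := by
    intro p
    simp only [hu]
    positivity
  have hus : Summable u := by
    refine (hs.add ?_).add ?_
    · apply summable_of_finite_support
      refine (a.natAbs.divisors.finite_toSet).subset ?_
      intro p hp
      simp only [Function.mem_support, ne_eq, ite_eq_right_iff, not_forall] at hp
      exact hp.1
    · exact Real.summable_one_div_nat_pow.2 (by norm_num)
  have hπ : ∀ I : Ideal (𝓞 K), ∃ p : ℕ, Prime I → p.Prime ∧ (p : 𝓞 K) ∈ I ∧ p ≤ Ideal.absNorm I ∧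
      wid K I ≤ u p := by
    intro I
    by_cases hI : Prime I
    · have hIp := Ideal.isPrime_of_prime hI
      have : I.IsMaximal := hIp.isMaximal hI.ne_zero
      obtain ⟨p, n, hn, hpI, hp, hN⟩ := Ideal.exists_prime_and_absNorm_eq_pow I
      refine ⟨p, fun _ => ⟨hp, hpI, ?_, ?_⟩⟩
      · rw [hN]; exact Nat.le_self_pow hn.ne' p
      · rw [wid, if_pos hI]
        have hp1 : (1:ℝ) ≤ p := by exact_mod_cast hp.one_lt.le
        by_cases hpa : (p:ℤ) ∣ a
        · have : p ∈ a.natAbs.divisors := by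
            rw [Nat.mem_divisors]
            exact ⟨Int.natCast_dvd.1 hpa, by simpa using ha0⟩
          simp only [hu]
          rw [if_pos this]
          have h1 : (1:ℝ) / (Ideal.absNorm I) ≤ 1 := by
            rw [hN]; push_cast
            rw [div_le_one (by positivity)]
            exact one_le_pow₀ hp1
          have h2 : (0:ℝ) ≤ (if p.Prime ∧ ∃ r : ℤ, (p:ℤ) ∣ h.eval r then (1:ℝ)/p else 0) := by positivity
          have h3 : (0:ℝ) ≤ 1/(p:ℝ)^2 := by positivity
          linarith
        · by_cases hn1 : n = 1
          · have hN1 : Ideal.absNorm I = p := by rw [hN, hn1, pow_one]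
            have := root_of_deg_one h θ hroot I p hp hN1 hpa
            simp only [hu]
            rw [if_pos ⟨hp, this⟩, hN1]
            have h2 : (0:ℝ) ≤ (if p ∈ a.natAbs.divisors then 1 else 0) := by positivity
            have h3 : (0:ℝ) ≤ 1/(p:ℝ)^2 := by positivity
            linarith
          · simp only [hu]
            have h1 : (1:ℝ) / (Ideal.absNorm I) ≤ 1/(p:ℝ)^2 := by
              rw [hN]; push_cast
              apply one_div_le_one_div_of_le (by positivity)
              exact pow_le_pow_right₀ hp1 (by omega)
            have h2 : (0:ℝ) ≤ (if p.Prime ∧ ∃ r : ℤ, (p:ℤ) ∣ h.eval r then (1:ℝ)/p else 0) := by positivity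
            have h3 : (0:ℝ) ≤ (if p ∈ a.natAbs.divisors then 1 else 0) := by positivity
            linarith
    · exact ⟨0, fun h => absurd h hI⟩
  choose π hπ using hπ
  have hw0 : ∀ I, 0 ≤ wid K I := by
    intro I; unfold wid; positivity
  refine summable_of_sum_le (c := Module.finrank ℤ (𝓞 K) * ∑' p, u p) hw0 (fun T => ?_)
  set T' := T.filter (fun I => Prime I)
  have e1 : ∑ I ∈ T, wid K I = ∑ I ∈ T', wid K I := by
    rw [Finset.sum_filter]
    apply Finset.sum_congr rfl
    intro I _
    unfold wid; split_ifs <;> rfl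
  rw [e1, ← Finset.sum_fiberwise_of_maps_to (g := π) (t := T'.image π) (fun I hI => Finset.mem_image_of_mem _ hI)]
  calc ∑ p ∈ T'.image π, ∑ I ∈ T' with π I = p, wid K I
      ≤ ∑ p ∈ T'.image π, (Module.finrank ℤ (𝓞 K) : ℝ) * u p := by
        apply Finset.sum_le_sum
        intro p hp
        have hpp : p.Prime := by
          obtain ⟨I, hI, rfl⟩ := Finset.mem_image.1 hp
          exact (hπ I (Finset.mem_filter.1 hI).2).1
        have hc := primes_above_card p hpp (T'.filter (fun I => π I = p)) (by
          intro I hI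
          rw [Finset.mem_filter, Finset.mem_filter] at hI
          obtain ⟨⟨_, hI⟩, rfl⟩ := hI
          exact ⟨hI, (hπ I hI).2.1, (hπ I hI).2.2.1⟩)
        have h1 : ∑ I ∈ T' with π I = p, wid K I ≤ (T'.filter (fun I => π I = p)).card • u p := by
          apply Finset.sum_le_card_nsmul
          intro I hI
          rw [Finset.mem_filter, Finset.mem_filter] at hI
          obtain ⟨⟨_, hI⟩, rfl⟩ := hI
          exact (hπ I hI).2.2.2
        rw [nsmul_eq_mul] at h1
        refine h1.trans ?_
        have := hu0 p
        gcongr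
    _ = (Module.finrank ℤ (𝓞 K) : ℝ) * ∑ p ∈ T'.image π, u p := by rw [Finset.mul_sum]
    _ ≤ _ := by
        gcongr
        exact hus.sum_le_tsum _ (fun p _ => hu0 p)
end PartP3b

section PartP3c
open Classical in
theorem dyadic_primes (P : ℕ → Prop) (hs : ¬ Summable (fun p : ℕ => if P p then (1:ℝ)/p else 0)) (k0 : ℕ) :
    ∃ k, k0 ≤ k ∧ 2^k ≤ k^2 * ((Finset.Ico (2^k) (2^(k+1))).filter P).card := by
  by_contra hcon
  push Not at hcon
  apply hs
  set v : ℕ → ℝ := fun k => (1:ℝ)/(k:ℝ)^2 + (if k ∈ Finset.range (k0+1) then 1 else 0) with hv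
  have hv0 : ∀ k, 0 ≤ v k := by intro k; simp only [hv]; positivity
  have hvs : Summable v := by
    refine Summable.add (Real.summable_one_div_nat_pow.2 (by norm_num)) ?_
    apply summable_of_hasFiniteSupport
    refine ((Finset.range (k0+1)).finite_toSet).subset ?_
    intro p hp
    simp only [Function.mem_support, ne_eq, ite_eq_right_iff, not_forall] at hp
    exact hp.1
  refine summable_of_sum_le (c := ∑' k, v k) (fun p => by dsimp; positivity) (fun T => ?_)
  rw [← Finset.sum_fiberwise_of_maps_to (g := Nat.log 2) (t := T.image (Nat.log 2)) (fun I hI => Finset.mem_image_of_mem _ hI)]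
  refine le_trans (Finset.sum_le_sum ?_) (hvs.sum_le_tsum (T.image (Nat.log 2)) (fun p _ => hv0 p))
  intro k _
  have h1 : ∑ p ∈ T with Nat.log 2 p = k, (if P p then (1:ℝ)/p else 0) ≤
      ∑ p ∈ (Finset.Ico (2^k) (2^(k+1))).filter P, (1:ℝ)/2^k := by
    rw [Finset.sum_filter, Finset.sum_filter]
    have : ∀ p, (if Nat.log 2 p = k then (if P p then (1:ℝ)/p else 0) else 0) ≤
       if p ∈ Finset.Ico (2^k) (2^(k+1)) then (if P p then (1:ℝ)/2^k else 0) else 0 := by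
      intro p
      by_cases hp0 : p = 0
      · subst hp0
        have : (0:ℝ) ≤ if 0 ∈ Finset.Ico (2^k) (2^(k+1)) then (if P 0 then (1:ℝ)/2^k else 0) else 0 := by positivity
        simpa using this
      by_cases hk : Nat.log 2 p = k
      · have h2 := Nat.pow_log_le_self 2 hp0
        have h3 := Nat.lt_pow_succ_log_self (by norm_num : 1 < 2) p
        rw [hk] at h2 h3
        rw [if_pos hk, if_pos (Finset.mem_Ico.2 ⟨h2, h3⟩)]
        split_ifs
        · apply one_div_le_one_div_of_le (by positivity)
          exact_mod_cast h2
        · exact le_rfl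
      · rw [if_neg hk]; positivity
    refine (Finset.sum_le_sum (fun p _ => this p)).trans ?_
    rw [← Finset.sum_filter, Finset.filter_mem_eq_inter]
    apply Finset.sum_le_sum_of_subset_of_nonneg Finset.inter_subset_right
    intro p _ _
    positivity
  rw [Finset.sum_const, nsmul_eq_mul, mul_one_div] at h1
  refine h1.trans ?_
  simp only [hv]
  by_cases hk : k < k0 + 1
  · rw [if_pos (Finset.mem_range.2 hk)]
    have h2 : ((Finset.Ico (2^k) (2^(k+1))).filter P).card ≤ 2^k := by
      refine (Finset.card_filter_le _ _).trans ?_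
      rw [Nat.card_Ico, pow_succ]; omega
    have h3 : (((Finset.Ico (2^k) (2^(k+1))).filter P).card : ℝ) / 2^k ≤ 1 := by
      rw [div_le_one (by positivity)]; exact_mod_cast h2
    have : (0:ℝ) ≤ 1/(k:ℝ)^2 := by positivity
    linarith
  · rw [if_neg (by simpa using hk), add_zero]
    have h2 := hcon k (by omega)
    have hk0 : (0:ℝ) < k := by exact_mod_cast (by omega : 0 < k)
    rw [div_le_div_iff₀ (by positivity) (by positivity)]
    have : ((k^2 * ((Finset.Ico (2^k) (2^(k+1))).filter P).card : ℕ) : ℝ) ≤ ((2^k : ℕ) : ℝ) := by exact_mod_cast h2.le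
    push_cast at this
    linarith
end PartP3c

section PartP9
/-- coefficients of `α^k` in the power basis -/
def ered (d : ℕ) (m : ℕ → ℤ) : ℕ → ℕ → ℤ
  | 0, r => if r = 0 then 1 else 0
  | k+1, r => (if r = 0 then 0 else ered d m k (r-1)) - ered d m k (d-1) * m r

theorem ered_bound (d : ℕ) (m : ℕ → ℤ) (E : ℕ) (hE : ∀ r < d, 1 + |m r| ≤ E) (hd : 1 ≤ d) (k : ℕ) :
    ∀ r < d, |ered d m k r| ≤ E^k := by
  induction k with
  | zero => intro r _; simp only [ered]; split_ifs <;> simp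
  | succ k ih =>
    intro r hr
    simp only [ered]
    have h1 : |if r = 0 then 0 else ered d m k (r-1)| ≤ (E:ℤ)^k := by
      split_ifs
      · simp
      · exact ih _ (by omega)
    have h2 := ih (d-1) (by omega)
    have h3 := hE r hr
    calc _ ≤ |if r = 0 then 0 else ered d m k (r-1)| + |ered d m k (d-1) * m r| := abs_sub _ _
      _ ≤ (E:ℤ)^k + (E:ℤ)^k * |m r| := by
        rw [abs_mul]; gcongr
      _ = (E:ℤ)^k * (1 + |m r|) := by ring
      _ ≤ _ := by rw [pow_succ]; gcongr

theorem ered_spec (d : ℕ) (hd : 1 ≤ d) (m : ℕ → ℤ) (α : ℂ) (hα : α^d + ∑ r ∈ Finset.range d, (m r : ℂ) * α^r = 0) (k : ℕ) :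
    α^k = ∑ r ∈ Finset.range d, (ered d m k r : ℂ) * α^r := by
  induction k with
  | zero =>
    rw [Finset.sum_eq_single 0]
    · simp [ered]
    · intro b _ hb; simp [ered, hb]
    · intro h; simp at h; omega
  | succ k ih =>
    obtain ⟨d, rfl⟩ : ∃ d', d = d' + 1 := ⟨d-1, by omega⟩
    rw [pow_succ, ih, Finset.sum_mul]
    simp only [ered, Nat.add_sub_cancel]
    push_cast
    simp only [sub_mul]
    rw [Finset.sum_sub_distrib, Finset.sum_range_succ' (fun r => (if r = 0 then (0:ℂ) else (ered (d+1) m k (r-1) : ℂ)) * α^r)]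
    rw [Finset.sum_range_succ]
    simp only [Nat.add_one_ne_zero, if_false, Nat.add_sub_cancel, if_true, zero_mul, add_zero]
    have e1 : ∑ r ∈ Finset.range (d+1), (ered (d+1) m k d : ℂ) * (m r) * α^r = - (ered (d+1) m k d : ℂ) * α^(d+1) := by
      rw [neg_mul, ← mul_neg, ← eq_neg_of_add_eq_zero_right hα, Finset.mul_sum]
      apply Finset.sum_congr rfl; intros; ring
    rw [e1]
    have e2 : ∑ r ∈ Finset.range d, (ered (d+1) m k r : ℂ) * α^r * α = ∑ r ∈ Finset.range d, (ered (d+1) m k r : ℂ) * α^(r+1) := by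
      apply Finset.sum_congr rfl; intros; ring
    rw [e2]; ring

open scoped Matrix.Norms.Elementwise

theorem siegel_pow {ι κ : Type*} [Fintype ι] [Fintype κ] [DecidableEq ι] [DecidableEq κ] (M : Matrix ι κ ℤ) (s d H : ℕ) (hs : 1 ≤ s) (hd : 1 ≤ d)
    (h1 : Fintype.card ι = 2 * s * d) (h2 : Fintype.card κ = 2 * s * (d+1)) (hH1 : 1 ≤ H) (hH : ∀ i j, |M i j| ≤ H) :
    ∃ z : κ → ℤ, z ≠ 0 ∧ M.mulVec z = 0 ∧ ∀ k, |z k| ≤ (2*s*(d+1)*H)^d := by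
  obtain ⟨z, hz0, hz1, hz2⟩ := Int.Matrix.exists_ne_zero_int_vec_norm_le M (by rw [h1, h2]; nlinarith) (by rw [h1]; positivity)
  refine ⟨z, hz0, hz1, fun k => ?_⟩
  rw [h1, h2] at hz2
  have hs' : (0:ℝ) < s := by exact_mod_cast hs
  have e : (((2*s*d : ℕ) : ℝ) / (((2*s*(d+1) : ℕ):ℝ) - ((2*s*d : ℕ) : ℝ))) = d := by
    push_cast
    have : (2 * (s:ℝ) * (d+1) - 2 * s * d) = 2 * s := by ring
    rw [this]; field_simp
  rw [e, Real.rpow_natCast] at hz2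
  have hM : max 1 ‖M‖ ≤ H := by
    apply max_le (by exact_mod_cast hH1)
    rw [Matrix.norm_le_iff (by positivity)]
    intro i j
    rw [Int.norm_eq_abs]
    exact_mod_cast hH i j
  have h3 : ‖z k‖ ≤ ‖z‖ := norm_le_pi_norm z k
  have h4 : ‖z k‖ ≤ (((2*s*(d+1) : ℕ):ℝ) * H)^d := h3.trans (hz2.trans (by gcongr))
  rw [Int.norm_eq_abs] at h4
  exact_mod_cast h4

open Polynomial in
theorem taylor_coeff_sum {R : Type*} [CommRing R] (P : R[X]) (n : ℕ) (hP : P.natDegree < n) (x : R) (j : ℕ) :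
    (taylor x P).coeff j = ∑ i ∈ Finset.range n, (i.choose j : R) * P.coeff i * x^(i-j) := by
  rw [taylor_coeff, hasseDeriv_apply, Polynomial.eval_sum, Polynomial.sum_over_range' _ _ _ hP]
  · apply Finset.sum_congr rfl
    intro i _
    rw [eval_monomial]
  · intro n; simp

open Polynomial in
theorem polyOfFin_coeff {n : ℕ} (a : Fin n → ℤ) :
    ∃ P : ℤ[X], (∀ i : Fin n, P.coeff i = a i) ∧ (∀ i, n ≤ i → P.coeff i = 0) := by
  refine ⟨∑ i : Fin n, monomial (i:ℕ) (a i), ?_, ?_⟩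
  · intro i
    rw [finsetSum_coeff, Finset.sum_eq_single i]
    · simp
    · intro b _ hb
      rw [coeff_monomial, if_neg]
      intro h; exact hb (Fin.ext h)
    · simp
  · intro i hi
    rw [finsetSum_coeff]
    apply Finset.sum_eq_zero
    intro b _
    rw [coeff_monomial, if_neg]
    have := b.2; omega

open Polynomial in
theorem thue_aux (d : ℕ) (hd : 1 ≤ d) (m : ℤ[X]) (hm : m.Monic) (hmd : m.natDegree = d) (α : ℂ) (hα : aeval α m = 0) :
    ∃ K : ℕ, 1 ≤ K ∧ ∀ s : ℕ, 1 ≤ s → ∃ A B : ℤ[X], (A ≠ 0 ∨ B ≠ 0) ∧ A.natDegree < (d+1)*s ∧ B.natDegree < (d+1)*s ∧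
      (∀ i, |A.coeff i| ≤ K^s) ∧ (∀ i, |B.coeff i| ≤ K^s) ∧
      (X - C α)^(2*s) ∣ A.map (Int.castRingHom ℂ) - C α * B.map (Int.castRingHom ℂ) := by
  have hα' : α^d + ∑ r ∈ Finset.range d, (m.coeff r : ℂ) * α^r = 0 := by
    rw [aeval_eq_sum_range, hmd, Finset.sum_range_succ] at hα
    have : m.coeff d = 1 := by rw [← hmd]; exact hm
    rw [this] at hα
    simp only [zsmul_eq_mul, Int.cast_one, one_mul] at hα
    rw [add_comm]; exact hα
  set E : ℕ := 1 + ∑ r ∈ Finset.range d, (m.coeff r).natAbs with hE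
  have hEb : ∀ r < d, 1 + |m.coeff r| ≤ E := by
    intro r hr
    have := Finset.single_le_sum (f := fun r => (m.coeff r).natAbs) (fun i _ => Nat.zero_le _) (Finset.mem_range.2 hr)
    rw [hE]; push_cast
    have h2 : ((m.coeff r).natAbs : ℤ) ≤ ((∑ r ∈ Finset.range d, (m.coeff r).natAbs : ℕ) : ℤ) := by exact_mod_cast this
    push_cast at h2
    linarith
  have hE1 : 1 ≤ E := by omega
  have eb := ered_bound d m.coeff E hEb hd
  have es := ered_spec d hd m.coeff α hα'
  refine ⟨(8*E)^((d+1)*d), Nat.one_le_pow _ _ (by omega), fun s hs => ?_⟩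
  set n := (d+1)*s with hn
  let M : Matrix (Fin (2*s) × Fin d) (Fin n ⊕ Fin n) ℤ := fun jr k =>
    match k with
    | Sum.inl i => ((i:ℕ).choose jr.1 : ℤ) * ered d m.coeff (i - jr.1) jr.2
    | Sum.inr i => - (((i:ℕ).choose jr.1 : ℤ) * ered d m.coeff (i - jr.1 + 1) jr.2)
  have hchoose : ∀ (i : Fin n) (j : ℕ), ((i:ℕ).choose j : ℤ) ≤ 2^n := by
    intro i j
    have h1 := Nat.choose_le_two_pow (i:ℕ) j
    have h2 : 2^(i:ℕ) ≤ 2^n := Nat.pow_le_pow_right (by norm_num) i.2.le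
    exact_mod_cast h1.trans h2
  have hent : ∀ (i : Fin n) (j k r: ℕ), k ≤ n → r < d → ((i:ℕ).choose j : ℤ) * |ered d m.coeff k r| ≤ ((2*E)^n : ℕ) := by
    intro i j k r hk hr
    have h1 := eb k r hr
    have h2 : (E:ℤ)^k ≤ (E:ℤ)^n := pow_le_pow_right₀ (by exact_mod_cast hE1) hk
    push_cast
    rw [mul_pow]
    gcongr
    · exact hchoose i j
    · exact h1.trans h2
  have hMH : ∀ jr k, |M jr k| ≤ ((2*E)^n : ℕ) := by
    rintro ⟨j, r⟩ (i | i)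
    · simp only [M, abs_mul, Nat.abs_cast]
      exact hent i j _ r (by have := i.2; omega) r.2
    · simp only [M, abs_neg, abs_mul, Nat.abs_cast]
      exact hent i j _ r (by have := i.2; omega) r.2
  obtain ⟨z, hz0, hz1, hz2⟩ := siegel_pow M s d ((2*E)^n) hs hd (by simp) (by simp [hn]; ring)
    (Nat.one_le_pow _ _ (by omega)) hMH
  have hzb : ∀ k, |z k| ≤ (((8*E)^((d+1)*d) : ℕ) : ℤ)^s := by
    intro k
    refine (hz2 k).trans ?_
    have h1 : 2*s*(d+1) ≤ 4^n := by
      have : n < 2^n := Nat.lt_two_pow_self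
      have h2 : 2*s*(d+1) = 2*n := by rw [hn]; ring
      have h3 : 2 ≤ 2^n := Nat.le_self_pow (by have : 0 < n := by positivity
                                               omega) 2
      have h4 : 4^n = 2^n*2^n := by rw [← mul_pow]; norm_num
      rw [h2, h4]; exact Nat.mul_le_mul h3 this.le
    have h5 : (2*s*(d+1)*(2*E)^n)^d ≤ ((8*E)^((d+1)*d))^s := by
      calc (2*s*(d+1)*(2*E)^n)^d ≤ (4^n*(2*E)^n)^d := by gcongr
        _ = _ := by rw [← mul_pow, ← pow_mul, ← pow_mul, hn]; ring
    exact_mod_cast h5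
  obtain ⟨A, hA1, hA2⟩ := polyOfFin_coeff (fun i => z (Sum.inl i))
  obtain ⟨B, hB1, hB2⟩ := polyOfFin_coeff (fun i => z (Sum.inr i))
  have hn0 : 0 < n := by positivity
  have hAd : A.natDegree < n := by
    by_cases h0 : A = 0
    · rw [h0]; simpa using hn0
    · rw [Polynomial.natDegree_lt_iff_degree_lt h0, Polynomial.degree_lt_iff_coeff_zero]; exact hA2
  have hBd : B.natDegree < n := by
    by_cases h0 : B = 0
    · rw [h0]; simpa using hn0
    · rw [Polynomial.natDegree_lt_iff_degree_lt h0, Polynomial.degree_lt_iff_coeff_zero]; exact hB2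
  refine ⟨A, B, ?_, hAd, hBd, ?_, ?_, ?_⟩
  · by_contra hcon
    push Not at hcon
    apply hz0
    ext (i | i)
    · rw [← hA1, hcon.1]; simp
    · rw [← hB1, hcon.2]; simp
  · intro i
    by_cases hi : i < n
    · have := hA1 ⟨i, hi⟩
      simp only at this
      rw [this]; exact hzb _
    · rw [hA2 i (by omega), abs_zero]; positivity
  · intro i
    by_cases hi : i < n
    · have := hB1 ⟨i, hi⟩
      simp only at this
      rw [this]; exact hzb _
    · rw [hB2 i (by omega), abs_zero]; positivity
  · rw [X_sub_C_pow_dvd_iff, X_pow_dvd_iff]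
    intro j hj
    rw [← taylor_apply, ← smul_eq_C_mul, map_sub, map_smul, coeff_sub, coeff_smul]
    rw [taylor_coeff_sum _ n (lt_of_le_of_lt natDegree_map_le hAd), taylor_coeff_sum _ n (lt_of_le_of_lt natDegree_map_le hBd)]
    rw [smul_eq_mul, Finset.mul_sum, ← Finset.sum_sub_distrib]
    rw [← Fin.sum_univ_eq_sum_range (fun i => (i.choose j : ℂ) * (A.map (Int.castRingHom ℂ)).coeff i * α^(i-j) -
       α * ((i.choose j : ℂ) * (B.map (Int.castRingHom ℂ)).coeff i * α^(i-j)))]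
    have key : ∀ i : Fin n, ((i:ℕ).choose j : ℂ) * (A.map (Int.castRingHom ℂ)).coeff i * α^((i:ℕ)-j) -
       α * (((i:ℕ).choose j : ℂ) * (B.map (Int.castRingHom ℂ)).coeff i * α^((i:ℕ)-j)) =
       ∑ r : Fin d, ((M (⟨j, hj⟩, r) (Sum.inl i) * z (Sum.inl i) + M (⟨j, hj⟩, r) (Sum.inr i) * z (Sum.inr i) : ℤ) : ℂ) * α^(r:ℕ) := by
      intro i
      have e1 := es ((i:ℕ)-j)
      have e2 := es ((i:ℕ)-j+1)
      rw [pow_succ] at e2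
      rw [← Fin.sum_univ_eq_sum_range (fun r => (ered d m.coeff ((i:ℕ)-j) r : ℂ) * α^r)] at e1
      rw [← Fin.sum_univ_eq_sum_range (fun r => (ered d m.coeff ((i:ℕ)-j+1) r : ℂ) * α^r)] at e2
      have e3 : ∑ r : Fin d, ((M (⟨j, hj⟩, r) (Sum.inl i) * z (Sum.inl i) + M (⟨j, hj⟩, r) (Sum.inr i) * z (Sum.inr i) : ℤ) : ℂ) * α^(r:ℕ)
        = ((i:ℕ).choose j : ℂ) * z (Sum.inl i) * ∑ r : Fin d, (ered d m.coeff ((i:ℕ)-j) r : ℂ) * α^(r:ℕ)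
         - ((i:ℕ).choose j : ℂ) * z (Sum.inr i) * ∑ r : Fin d, (ered d m.coeff ((i:ℕ)-j+1) r : ℂ) * α^(r:ℕ) := by
        rw [Finset.mul_sum, Finset.mul_sum, ← Finset.sum_sub_distrib]
        apply Finset.sum_congr rfl
        intro r _
        simp only [M]
        push_cast
        ring
      rw [e3, ← e1, ← e2, coeff_map, coeff_map, hA1, hB1]
      simp only [eq_intCast]
      ring
    rw [Finset.sum_congr rfl (fun i _ => key i), Finset.sum_comm]
    apply Finset.sum_eq_zero
    intro r _
    rw [← Finset.sum_mul]
    have h0 := congrFun hz1 (⟨j, hj⟩, r)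
    simp only [Matrix.mulVec, dotProduct, Fintype.sum_sum_type, Pi.zero_apply] at h0
    rw [← Finset.sum_add_distrib] at h0
    rw [← Int.cast_sum, h0]; simp
end PartP9

section PartP9b
open Polynomial

theorem vanish_deg (m : ℚ[X]) (hirr : Irreducible m) (α : ℂ) (hα : aeval α m = 0) (t : ℕ) :
    ∀ g : ℚ[X], g ≠ 0 → (X - C α)^t ∣ g.map (algebraMap ℚ ℂ) → t * m.natDegree ≤ g.natDegree := by
  induction t with
  | zero => intro g _ _; simp
  | succ t ih =>
    intro g hg hdvd
    have hroot : ∀ c : ℚ[X], (c.map (algebraMap ℚ ℂ)).eval α = 0 → m ∣ c := by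
      intro c hc
      have h1 : aeval α c = 0 := by rw [aeval_def, eval₂_eq_eval_map]; exact hc
      have h2 := minpoly.dvd ℚ α h1
      have h3 := minpoly.dvd ℚ α hα
      have h4 : Associated (minpoly ℚ α) m := by
        apply (minpoly.irreducible (A := ℚ) (x := α) ?_).associated_of_dvd hirr h3
        rw [← isAlgebraic_iff_isIntegral]
        exact ⟨m, hirr.ne_zero, hα⟩
      exact h4.symm.dvd.trans h2
    have hg0 : (g.map (algebraMap ℚ ℂ)).eval α = 0 := by
      rw [← IsRoot.def, ← dvd_iff_isRoot]
      exact (dvd_pow_self _ (Nat.succ_ne_zero t)).trans hdvd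
    obtain ⟨c, rfl⟩ := hroot g hg0
    have hc0 : c ≠ 0 := right_ne_zero_of_mul hg
    have hm0 : m ≠ 0 := left_ne_zero_of_mul hg
    have hmr : (X - C α) ∣ m.map (algebraMap ℚ ℂ) := by
      rw [dvd_iff_isRoot, IsRoot.def, ← eval₂_eq_eval_map, ← aeval_def]; exact hα
    obtain ⟨n, hn⟩ := hmr
    have hsep : (m.map (algebraMap ℚ ℂ)).Separable := hirr.separable.map
    have hcop : IsCoprime (X - C α) n := by
      rw [hn] at hsep
      exact hsep.isCoprime
    have hdvd2 : (X - C α)^t ∣ c.map (algebraMap ℚ ℂ) := by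
      rw [Polynomial.map_mul, hn, pow_succ, mul_comm, mul_assoc] at hdvd
      have h1 := (mul_dvd_mul_iff_left (X_sub_C_ne_zero α)).1 hdvd
      exact (hcop.pow_left).dvd_of_dvd_mul_left h1
    have := ih c hc0 hdvd2
    rw [natDegree_mul hm0 hc0]; linarith

theorem thue_wronskian (d : ℕ) (hd : 2 ≤ d) (m : ℚ[X]) (hirr : Irreducible m) (hmd : m.natDegree = d) (α : ℂ) (hα : aeval α m = 0)
    (s : ℕ) (hs : 1 ≤ s) (A B : ℤ[X]) (hAB : A ≠ 0 ∨ B ≠ 0) (hA : A.natDegree < (d+1)*s) (hB : B.natDegree < (d+1)*s)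
    (hdvd : (X - C α)^(2*s) ∣ A.map (Int.castRingHom ℂ) - C α * B.map (Int.castRingHom ℂ)) : wronskian A B ≠ 0 := by
  intro hW
  set a := A.map (Int.castRingHom ℚ) with ha
  set b := B.map (Int.castRingHom ℚ) with hb
  have hinj : Function.Injective (Int.castRingHom ℚ) := Int.cast_injective
  have hab : a ≠ 0 ∨ b ≠ 0 := by
    rcases hAB with h | h
    · left; rwa [ha, Ne, Polynomial.map_eq_zero_iff hinj]
    · right; rwa [hb, Ne, Polynomial.map_eq_zero_iff hinj]
  have hw : wronskian a b = 0 := by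
    have := congrArg (Polynomial.map (Int.castRingHom ℚ)) hW
    rw [wronskian, Polynomial.map_sub, Polynomial.map_mul, Polynomial.map_mul, ← derivative_map, ← derivative_map, Polynomial.map_zero] at this
    exact this
  classical
  set g := EuclideanDomain.gcd a b with hg
  have hg0 : g ≠ 0 := by
    rw [hg, Ne, EuclideanDomain.gcd_eq_zero_iff]
    rintro ⟨h1, h2⟩
    rcases hab with h | h
    · exact h h1
    · exact h h2
  obtain ⟨a', ha'⟩ := EuclideanDomain.gcd_dvd_left a b
  obtain ⟨b', hb'⟩ := EuclideanDomain.gcd_dvd_right a b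
  rw [← hg] at ha' hb'
  have hcop : IsCoprime a' b' := by
    have h1 := EuclideanDomain.gcd_eq_gcd_ab a b
    rw [← hg] at h1
    refine ⟨EuclideanDomain.gcdA a b, EuclideanDomain.gcdB a b, ?_⟩
    apply mul_left_cancel₀ hg0
    rw [mul_one]
    conv_rhs => rw [h1]
    linear_combination (-EuclideanDomain.gcdA a b) * ha' - (EuclideanDomain.gcdB a b) * hb'
  have hw' : wronskian a' b' = 0 := by
    have : wronskian a b = g^2 * wronskian a' b' := by
      rw [ha', hb']; simp only [wronskian, derivative_mul]; ring
    rw [hw] at this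
    exact (mul_eq_zero.1 this.symm).resolve_left (pow_ne_zero _ hg0)
  obtain ⟨h1, h2⟩ := (hcop.wronskian_eq_zero_iff).1 hw'
  obtain ⟨u, hu⟩ : ∃ u, a' = C u := ⟨_, eq_C_of_derivative_eq_zero h1⟩
  obtain ⟨v, hv⟩ : ∃ v, b' = C v := ⟨_, eq_C_of_derivative_eq_zero h2⟩
  have huv : u ≠ 0 ∨ v ≠ 0 := by
    by_contra hcon
    push Not at hcon
    rw [hu, hv, hcon.1, hcon.2] at hcop
    obtain ⟨x, y, hxy⟩ := hcop
    simp at hxy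
  have hne : (u:ℂ) - α * v ≠ 0 := by
    intro h
    by_cases hv0 : v = 0
    · subst hv0
      simp at h huv
      exact huv h
    · have hα2 : α = ((u/v : ℚ) : ℂ) := by
        push_cast
        have hv1 : (v:ℂ) ≠ 0 := by exact_mod_cast hv0
        field_simp; linear_combination -h
      have h3 : m.eval (u/v) = 0 := by
        have : aeval (((u/v : ℚ)) : ℂ) m = ((m.eval (u/v) : ℚ) : ℂ) := by
          rw [← eq_ratCast (algebraMap ℚ ℂ), aeval_algebraMap_apply, eq_ratCast]; simp
        rw [← hα2, hα] at this
        exact_mod_cast this.symm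
      have := Polynomial.degree_eq_one_of_irreducible_of_root hirr h3
      have : m.natDegree = 1 := natDegree_eq_of_degree_eq_some this
      omega
  have hm : ∀ P : ℤ[X], P.map (Int.castRingHom ℂ) = (P.map (Int.castRingHom ℚ)).map (algebraMap ℚ ℂ) := by
    intro P
    rw [Polynomial.map_map]
    congr 1
  have hdvd2 : (X - C α)^(2*s) ∣ g.map (algebraMap ℚ ℂ) := by
    rw [hm A, hm B, ← ha, ← hb, ha', hb', hu, hv] at hdvd
    have e : (g * C u).map (algebraMap ℚ ℂ) - C α * (g * C v).map (algebraMap ℚ ℂ) = C ((u:ℂ) - α * v) * g.map (algebraMap ℚ ℂ) := by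
      simp only [Polynomial.map_mul, map_C, eq_ratCast, C_sub, C_mul]; ring
    rw [e] at hdvd
    refine hdvd.trans ?_
    rw [(isUnit_C.2 (isUnit_iff_ne_zero.2 hne)).mul_left_dvd]
  have hdeg := vanish_deg m hirr α hα (2*s) g hg0 hdvd2
  rw [hmd] at hdeg
  have hg2 : g.natDegree < (d+1)*s := by
    rcases huv with h | h
    · have : a.natDegree = g.natDegree := by
        rw [ha', hu, mul_comm, natDegree_C_mul h]
      rw [← this]
      exact lt_of_le_of_lt natDegree_map_le hA
    · have : b.natDegree = g.natDegree := by
        rw [hb', hv, mul_comm, natDegree_C_mul h]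
      rw [← this]
      exact lt_of_le_of_lt natDegree_map_le hB
  nlinarith
end PartP9b

section PartP9c
open Polynomial

theorem tb1 (P : ℂ[X]) (n : ℕ) (hP : P.natDegree < n) (H ρ : ℝ) (hH : ∀ i, ‖P.coeff i‖ ≤ H) (x : ℂ) (hx : ‖x‖ ≤ ρ) (hρ : 1 ≤ ρ) (j : ℕ) :
    ‖(taylor x P).coeff j‖ ≤ H * (4*ρ)^n := by
  have hH0 : 0 ≤ H := (norm_nonneg _).trans (hH 0)
  rw [taylor_coeff_sum P n hP]
  refine (norm_sum_le _ _).trans ?_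
  have : ∀ i ∈ Finset.range n, ‖(i.choose j : ℂ) * P.coeff i * x^(i-j)‖ ≤ 2^n * H * ρ^n := by
    intro i hi
    rw [Finset.mem_range] at hi
    rw [norm_mul, norm_mul, norm_pow, Complex.norm_natCast]
    have h1 : (i.choose j : ℝ) ≤ 2^n := by
      have h1 := Nat.choose_le_two_pow i j
      have h2 : 2^i ≤ 2^n := Nat.pow_le_pow_right (by norm_num) hi.le
      exact_mod_cast h1.trans h2
    have h2 : ‖x‖^(i-j) ≤ ρ^n := (pow_le_pow_left₀ (norm_nonneg _) hx _).trans (pow_le_pow_right₀ hρ (by omega))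
    gcongr
    exact hH i
  refine (Finset.sum_le_card_nsmul _ _ _ this).trans ?_
  rw [Finset.card_range, nsmul_eq_mul]
  have h3 : (n:ℝ) ≤ 2^n := by exact_mod_cast Nat.lt_two_pow_self.le
  calc (n:ℝ) * (2^n * H * ρ^n) ≤ 2^n * (2^n * H * ρ^n) := by gcongr
    _ = H * (4*ρ)^n := by rw [show (4:ℝ)*ρ = 2*2*ρ by ring, mul_pow, mul_pow]; ring

theorem tb2 (T : ℂ[X]) (n t : ℕ) (hT : T.natDegree < n) (H : ℝ) (hH : ∀ i, ‖T.coeff i‖ ≤ H) (x : ℂ) (hx : ‖x‖ ≤ 1)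
    (ht : X^t ∣ T) (j : ℕ) : ‖(taylor x T).coeff j‖ ≤ H * 4^n * ‖x‖^(t-j) := by
  have hH0 : 0 ≤ H := (norm_nonneg _).trans (hH 0)
  rw [taylor_coeff_sum T n hT]
  refine (norm_sum_le _ _).trans ?_
  have : ∀ i ∈ Finset.range n, ‖(i.choose j : ℂ) * T.coeff i * x^(i-j)‖ ≤ 2^n * H * ‖x‖^(t-j) := by
    intro i hi
    rw [Finset.mem_range] at hi
    by_cases hit : i < t
    · rw [X_pow_dvd_iff.1 ht i hit]; simp; positivity
    rw [norm_mul, norm_mul, norm_pow, Complex.norm_natCast]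
    have h1 : (i.choose j : ℝ) ≤ 2^n := by
      have h1 := Nat.choose_le_two_pow i j
      have h2 : 2^i ≤ 2^n := Nat.pow_le_pow_right (by norm_num) hi.le
      exact_mod_cast h1.trans h2
    have h2 : ‖x‖^(i-j) ≤ ‖x‖^(t-j) := pow_le_pow_of_le_one (norm_nonneg _) hx (by omega)
    gcongr
    exact hH i
  refine (Finset.sum_le_card_nsmul _ _ _ this).trans ?_
  rw [Finset.card_range, nsmul_eq_mul]
  have h3 : (n:ℝ) ≤ 2^n := by exact_mod_cast Nat.lt_two_pow_self.le
  calc (n:ℝ) * (2^n * H * ‖x‖^(t-j)) ≤ 2^n * (2^n * H * ‖x‖^(t-j)) := by gcongr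
    _ = H * 4^n * ‖x‖^(t-j) := by rw [show (4:ℝ) = 2*2 by norm_num, mul_pow]; ring

theorem wronskian_coeff_bound (A B : ℤ[X]) (n : ℕ) (hA : A.natDegree < n) (hB : B.natDegree < n) (H : ℤ)
    (hAH : ∀ i, |A.coeff i| ≤ H) (hBH : ∀ i, |B.coeff i| ≤ H) (i : ℕ) (hi : i < 2*n) :
    |(wronskian A B).coeff i| ≤ 4 * n^2 * H^2 := by
  have hH0 : 0 ≤ H := (abs_nonneg _).trans (hAH 0)
  have key : ∀ A B : ℤ[X], B.natDegree < n → (∀ i, |A.coeff i| ≤ H) → (∀ i, |B.coeff i| ≤ H) →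
      |(A * derivative B).coeff i| ≤ 2 * n^2*H^2 := by
    intro A B hB hAH hBH
    rw [coeff_mul]
    refine (Finset.abs_sum_le_sum_abs _ _).trans ?_
    have : ∀ x ∈ Finset.HasAntidiagonal.antidiagonal i, |A.coeff x.1 * (derivative B).coeff x.2| ≤ n * H^2 := by
      intro x _
      rw [coeff_derivative, abs_mul]
      by_cases hx : x.2 + 1 < n
      · rw [abs_mul]
        have h1 : |((x.2:ℤ)+1)| ≤ n := by rw [abs_of_nonneg (by positivity)]; exact_mod_cast hx.le
        calc _ ≤ H * (H * n) := by
              gcongr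
              · exact hAH _
              · exact hBH _
          _ = _ := by ring
      · rw [coeff_eq_zero_of_natDegree_lt (p := B) (n := x.2 + 1) (by omega)]
        simp; positivity
    refine (Finset.sum_le_card_nsmul _ _ _ this).trans ?_
    rw [Finset.Nat.card_antidiagonal, nsmul_eq_mul]
    have : ((i+1 : ℕ) : ℤ) ≤ 2*n := by exact_mod_cast hi
    calc ((i+1:ℕ):ℤ) * (n*H^2) ≤ (2*n) * (n*H^2) := by gcongr
      _ = _ := by ring
  have h1 := key A B hB hAH hBH
  have h2 := key B A hA hBH hAH
  rw [wronskian, coeff_sub, mul_comm (derivative A)]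
  calc _ ≤ _ := abs_sub _ _
    _ ≤ _ := add_le_add h1 h2
    _ = _ := by ring

theorem linpow_dvd (W : ℤ[X]) (hW : W ≠ 0) (p q : ℤ) (hq : 0 < q) (hpq : IsCoprime p q) (k : ℕ)
    (h : (X - C ((p:ℚ)/q))^k ∣ W.map (Int.castRingHom ℚ)) : q^k ≤ |W.leadingCoeff| := by
  have hprim : (C q * X + C (-p) : ℤ[X]).IsPrimitive := by
    rw [isPrimitive_iff_isUnit_of_C_dvd]
    intro r hr
    rw [C_dvd_iff_dvd_coeff] at hr
    have h0 := hr 0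
    have h1 := hr 1
    rw [coeff_add, coeff_C_mul, coeff_X_zero, coeff_C_zero, mul_zero, zero_add, dvd_neg] at h0
    rw [coeff_add, coeff_C_mul, coeff_X_one, coeff_C_of_ne_zero one_ne_zero, mul_one, add_zero] at h1
    exact hpq.isUnit_of_dvd' h0 h1
  have hprim2 : ((C q * X + C (-p) : ℤ[X])^k).IsPrimitive := by
    induction k with
    | zero => simp
    | succ k ih => rw [pow_succ]; exact (ih ((pow_dvd_pow _ (Nat.le_succ k)).trans h)).mul hprim
  have hdvd : (C q * X + C (-p) : ℤ[X])^k ∣ W := by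
    rw [IsPrimitive.Int.dvd_iff_map_cast_dvd_map_cast _ _ hprim2]
    refine dvd_trans ?_ h
    have hq' : (q:ℚ) ≠ 0 := by exact_mod_cast hq.ne'
    have e : (C q * X + C (-p) : ℤ[X]).map (Int.castRingHom ℚ) = C (q:ℚ) * (X - C ((p:ℚ)/q)) := by
      simp only [Polynomial.map_add, Polynomial.map_mul, map_C, map_X, eq_intCast]
      rw [mul_sub, ← C_mul, mul_div_cancel₀ _ hq']; simp; ring
    rw [Polynomial.map_pow, e, mul_pow, ← C_pow]
    rw [(isUnit_C.2 (isUnit_iff_ne_zero.2 (pow_ne_zero k hq'))).mul_left_dvd]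
  obtain ⟨V, hV⟩ := hdvd
  have h1 : W.leadingCoeff = q^k * V.leadingCoeff := by
    rw [hV, leadingCoeff_mul, leadingCoeff_pow, leadingCoeff_linear hq.ne']
  have h2 : V ≠ 0 := by rintro rfl; simp at hV; exact hW hV
  have h3 : 1 ≤ |V.leadingCoeff| := Int.one_le_abs (leadingCoeff_ne_zero.2 h2)
  rw [h1, abs_mul, abs_of_nonneg (by positivity : (0:ℤ) ≤ q^k)]
  nlinarith [pow_pos hq k]

theorem thue_step (A B : ℤ[X]) (n t H ρ : ℕ) (hA : A.natDegree < n) (hB : B.natDegree < n)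
    (hAH : ∀ i, |A.coeff i| ≤ H) (hBH : ∀ i, |B.coeff i| ≤ H) (hW : wronskian A B ≠ 0) (α : ℂ)
    (hdvd : (X - C α)^t ∣ A.map (Int.castRingHom ℂ) - C α * B.map (Int.castRingHom ℂ))
    (hρ : 1 + ‖α‖ ≤ ρ) (p1 q1 p2 q2 : ℤ) (hq1 : 0 < q1) (hq2 : 0 < q2) (hcop : IsCoprime p1 q1)
    (h1 : ‖(p1:ℂ)/q1 - α‖ ≤ 1) :
    ∃ j : ℕ, q1^(j-1) ≤ 4*n^2*H^2 ∧
      1 ≤ (q1:ℝ)^n * q2 * (H * ρ * (16*ρ)^n * (‖(p1:ℂ)/q1 - α‖^(t-j) + ‖(p2:ℂ)/q2 - α‖)) := by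
  set a := A.map (Int.castRingHom ℚ) with ha
  set b := B.map (Int.castRingHom ℚ) with hb
  set x1 : ℚ := p1/q1 with hx1
  set x2 : ℚ := p2/q2 with hx2
  have hwab : (wronskian A B).map (Int.castRingHom ℚ) = wronskian (a - C x2 * b) b := by
    simp only [wronskian, Polynomial.map_sub, Polynomial.map_mul, ← derivative_map, ← ha, ← hb, derivative_sub, derivative_mul, derivative_C]
    ring
  have hw0 : (wronskian A B).map (Int.castRingHom ℚ) ≠ 0 := by
    rwa [Ne, Polynomial.map_eq_zero_iff Int.cast_injective]
  set P := a - C x2 * b with hP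
  have hP0 : P ≠ 0 := by
    intro h
    rw [h, wronskian_zero_left] at hwab
    exact hw0 hwab
  set T := taylor x1 P with hT
  have hT0 : T ≠ 0 := by rwa [hT, Ne, taylor_eq_zero]
  set j := T.natTrailingDegree with hj
  have hv : T.coeff j ≠ 0 := by
    have := trailingCoeff_nonzero_iff_nonzero.2 hT0
    exact this
  have hXj : (X - C x1)^j ∣ P := by
    rw [X_sub_C_pow_dvd_iff, X_pow_dvd_iff, ← taylor_apply]
    intro i hi
    exact coeff_eq_zero_of_lt_natTrailingDegree hi
  have han : a.natDegree < n := lt_of_le_of_lt natDegree_map_le hA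
  have hbn : b.natDegree < n := lt_of_le_of_lt natDegree_map_le hB
  refine ⟨j, ?_, ?_⟩
  · have hdvdW : (X - C x1)^(j-1) ∣ (wronskian A B).map (Int.castRingHom ℚ) := by
      rw [hwab, wronskian]
      apply dvd_sub
      · exact ((pow_dvd_pow _ (Nat.sub_le _ _)).trans hXj).mul_right _
      · exact (pow_sub_one_dvd_derivative_of_pow_dvd hXj).mul_right _
    have h2 := linpow_dvd _ hW p1 q1 hq1 hcop (j-1) hdvdW
    have h3 := natDegree_wronskian_lt_add hW
    exact h2.trans (wronskian_coeff_bound A B n hA hB H hAH hBH _ (by omega))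
  · -- lower bound
    have hq1Q : (q1:ℚ) ≠ 0 := by exact_mod_cast hq1.ne'
    have hq2Q : (q2:ℚ) ≠ 0 := by exact_mod_cast hq2.ne'
    have hintgl : ∃ z : ℤ, (q1:ℚ)^n * q2 * T.coeff j = z := by
      have hPn : P.natDegree < n := by
        refine lt_of_le_of_lt (natDegree_sub_le _ _) (max_lt han (lt_of_le_of_lt (natDegree_C_mul_le _ _) hbn))
      refine ⟨∑ i ∈ Finset.range n, (i.choose j : ℤ) * (A.coeff i * q2 - p2 * B.coeff i) * (p1^(i-j) * q1^(n-(i-j))), ?_⟩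
      rw [hT, taylor_coeff_sum P n hPn, Finset.mul_sum]
      push_cast
      apply Finset.sum_congr rfl
      intro i hi
      rw [Finset.mem_range] at hi
      have e : (q1:ℚ)^n = q1^(i-j) * q1^(n-(i-j)) := by rw [← pow_add]; congr 1; omega
      rw [hP, coeff_sub, coeff_C_mul, ha, hb, coeff_map, coeff_map, hx1, hx2, div_pow, e]
      simp only [eq_intCast]
      field_simp
    obtain ⟨z, hz⟩ := hintgl
    have hz0 : z ≠ 0 := by
      rintro rfl
      rw [Int.cast_zero] at hz
      have : (q1:ℚ)^n * q2 ≠ 0 := mul_ne_zero (pow_ne_zero _ hq1Q) hq2Q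
      exact (mul_ne_zero this hv) hz
    have hz1 : (1:ℝ) ≤ ‖((z:ℤ):ℂ)‖ := by
      rw [Complex.norm_intCast]; exact_mod_cast Int.one_le_abs hz0
    have hzc : ((z:ℤ):ℂ) = (q1:ℂ)^n * q2 * ((T.coeff j : ℚ) : ℂ) := by
      have := congrArg (fun r : ℚ => (r:ℂ)) hz
      push_cast at this
      exact this.symm
    have hq1R : (0:ℝ) < q1 := by exact_mod_cast hq1
    have hq2R : (0:ℝ) < q2 := by exact_mod_cast hq2
    rw [hzc, norm_mul, norm_mul, norm_pow, Complex.norm_intCast, Complex.norm_intCast, abs_of_pos hq1R, abs_of_pos hq2R] at hz1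
    refine hz1.trans ?_
    gcongr
    -- upper bound
    set AC := A.map (Int.castRingHom ℂ) with hAC
    set BC := B.map (Int.castRingHom ℂ) with hBC
    have hm : ∀ P : ℤ[X], (P.map (Int.castRingHom ℚ)).map (algebraMap ℚ ℂ) = P.map (Int.castRingHom ℂ) := by
      intro P
      rw [Polynomial.map_map]
      congr 1
    set y1 : ℂ := (p1:ℂ)/q1 with hy1
    set y2 : ℂ := (p2:ℂ)/q2 with hy2
    have hx1c : (algebraMap ℚ ℂ) x1 = y1 := by rw [hx1, hy1]; simp
    have hx2c : (algebraMap ℚ ℂ) x2 = y2 := by rw [hx2, hy2]; simp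
    have hTc : ((T.coeff j : ℚ) : ℂ) = (taylor (y1 - α) (taylor α (AC - C α * BC))).coeff j + (α - y2) * (taylor y1 BC).coeff j := by
      have e1 : ((T.coeff j : ℚ) : ℂ) = (taylor y1 (AC - C y2 * BC)).coeff j := by
        rw [← eq_ratCast (algebraMap ℚ ℂ), ← coeff_map, hT, map_taylor, hP, Polynomial.map_sub, Polynomial.map_mul, map_C, hx1c, hx2c, ha, hb, hm, hm]
      rw [e1, taylor_taylor, sub_add_cancel, ← smul_eq_C_mul, ← smul_eq_C_mul, map_sub, map_sub, map_smul, map_smul]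
      simp only [coeff_sub, coeff_smul, smul_eq_mul]
      ring
    have hρ1 : (1:ℝ) ≤ ρ := by linarith [norm_nonneg α]
    have hACn : AC.natDegree < n := lt_of_le_of_lt natDegree_map_le hA
    have hBCn : BC.natDegree < n := lt_of_le_of_lt natDegree_map_le hB
    have hACH : ∀ i, ‖AC.coeff i‖ ≤ H := by
      intro i; rw [hAC, coeff_map, eq_intCast, Complex.norm_intCast]; exact_mod_cast hAH i
    have hBCH : ∀ i, ‖BC.coeff i‖ ≤ H := by
      intro i; rw [hBC, coeff_map, eq_intCast, Complex.norm_intCast]; exact_mod_cast hBH i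
    have hPCn : (AC - C α * BC).natDegree < n :=
      lt_of_le_of_lt (natDegree_sub_le _ _) (max_lt hACn (lt_of_le_of_lt (natDegree_C_mul_le _ _) hBCn))
    have hPCH : ∀ i, ‖(AC - C α * BC).coeff i‖ ≤ H * ρ := by
      intro i
      rw [coeff_sub, coeff_C_mul]
      calc _ ≤ ‖AC.coeff i‖ + ‖α * BC.coeff i‖ := norm_sub_le _ _
        _ ≤ H + ‖α‖ * H := by rw [norm_mul]; gcongr; exact hACH i; exact hBCH i
        _ = H * (1 + ‖α‖) := by ring
        _ ≤ _ := by gcongr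
    have b1 := tb1 _ n hPCn (H*ρ) ρ hPCH α (by linarith) hρ1
    have b2 := tb2 (taylor α (AC - C α * BC)) n t (by rw [natDegree_taylor]; exact hPCn) _ b1 (y1 - α) h1 (by
      rw [taylor_apply, ← X_sub_C_pow_dvd_iff]; exact hdvd) j
    have b3 := tb1 BC n hBCn H ρ hBCH y1 (by
      calc ‖y1‖ = ‖(y1 - α) + α‖ := by ring_nf
        _ ≤ ‖y1 - α‖ + ‖α‖ := norm_add_le _ _
        _ ≤ ρ := by linarith) hρ1 j
    rw [hTc]
    refine (norm_add_le _ _).trans ?_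
    rw [norm_mul, norm_sub_rev α y2, mul_add]
    have e16 : ((16:ℝ)*ρ)^n = (4*ρ)^n * 4^n := by rw [← mul_pow]; ring
    gcongr ?_ + ?_
    · refine b2.trans (le_of_eq ?_)
      rw [e16]; ring
    · calc ‖y2 - α‖ * ‖(taylor y1 BC).coeff j‖ ≤ ‖y2 - α‖ * (H * (4*ρ)^n) := by gcongr
        _ = (H * (4*ρ)^n) * ‖y2 - α‖ := by ring
        _ ≤ _ := by
          gcongr ?_ * _
          have h4 : (1:ℝ) ≤ 4^n := one_le_pow₀ (by norm_num)
          have h5 : (0:ℝ) ≤ H * (4*ρ)^n := by positivity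
          rw [e16]
          calc (H:ℝ) * (4*ρ)^n = (H * (4*ρ)^n) * (1*1) := by ring
            _ ≤ (H * (4*ρ)^n) * (ρ * 4^n) := by gcongr
            _ = _ := by ring
end PartP9c

section PartP9d
open Polynomial

theorem thue_num (d : ℕ) (hd : 2 ≤ d) (m : ℤ[X]) (hm : m.Monic) (hmd : m.natDegree = d)
    (hirr : Irreducible (m.map (Int.castRingHom ℚ))) (α : ℂ) (hα : aeval α m = 0) :
    ∃ C : ℕ, 1 ≤ C ∧ ∀ s : ℕ, 1 ≤ s → ∀ p1 q1 p2 q2 : ℤ, 0 < q1 → 0 < q2 → IsCoprime p1 q1 →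
      ‖(p1:ℂ)/q1 - α‖ ≤ 1 → ∃ j : ℕ, (q1:ℝ)^(j-1) ≤ (C:ℝ)^s ∧
      (1 ≤ (q1:ℝ)^((d+1)*s) * q2 * C^s * ‖(p1:ℂ)/q1 - α‖^(2*s-j) ∨
       1 ≤ (q1:ℝ)^((d+1)*s) * q2 * C^s * ‖(p2:ℂ)/q2 - α‖) := by
  obtain ⟨K, hK, H⟩ := thue_aux d (by omega) m hm hmd α hα
  obtain ⟨ρ, hρ⟩ := exists_nat_ge (1 + ‖α‖)
  have hρ1 : 1 ≤ ρ := by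
    have : (1:ℝ) ≤ ρ := by linarith [norm_nonneg α]
    exact_mod_cast this
  set C1 := 16*(d+1)^2*K^2 with hC1
  set C2 := 2*K*ρ*(16*ρ)^(d+1) with hC2
  have hC11 : 1 ≤ C1 := Nat.succ_le_of_lt (by positivity)
  have hC21 : 1 ≤ C2 := Nat.succ_le_of_lt (by positivity)
  refine ⟨C1*C2, Nat.one_le_iff_ne_zero.2 (by positivity), ?_⟩
  intro s hs p1 q1 p2 q2 hq1 hq2 hcop hδ
  obtain ⟨A, B, hAB, hA, hB, hAK, hBK, hdvd⟩ := H s hs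
  have hw := thue_wronskian d hd (m.map (Int.castRingHom ℚ)) hirr
    (by rw [natDegree_map_eq_of_injective Int.cast_injective, hmd]) α (by
      have h := aeval_map_algebraMap ℚ α m
      rw [hα] at h
      exact h) s hs A B hAB hA hB hdvd
  obtain ⟨j, hj1, hj2⟩ := thue_step A B ((d+1)*s) (2*s) (K^s) ρ hA hB (by exact_mod_cast hAK) (by exact_mod_cast hBK) hw α hdvd hρ p1 q1 p2 q2 hq1 hq2 hcop hδ
  have hq1R : (0:ℝ) < q1 := by exact_mod_cast hq1
  have hq2R : (0:ℝ) < q2 := by exact_mod_cast hq2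
  refine ⟨j, ?_, ?_⟩
  · have h1 : 4*((d+1)*s)^2*(K^s)^2 ≤ (C1*C2)^s := by
      have e1 : s ≤ 2^s := Nat.lt_two_pow_self.le
      have e2 : 4 ≤ 4^s := by simpa using Nat.pow_le_pow_right (show 0 < 4 by norm_num) hs
      have e3 : (d+1)^2 ≤ ((d+1)^2)^s := by simpa using Nat.pow_le_pow_right (show 0 < (d+1)^2 by positivity) hs
      calc 4*((d+1)*s)^2*(K^s)^2 = 4 * (d+1)^2 * s^2 * (K^2)^s := by ring
        _ ≤ 4^s * ((d+1)^2)^s * (2^s)^2 * (K^2)^s := by gcongr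
        _ = C1^s := by
          rw [hC1, show 16 = 4*2^2 by norm_num]; rw [mul_pow, mul_pow, mul_pow, pow_right_comm 2 s 2, mul_right_comm (4^s)]
        _ ≤ (C1*C2)^s := Nat.pow_le_pow_left (Nat.le_mul_of_pos_right _ hC21) _
    have h2 : q1^(j-1) ≤ (((C1*C2)^s : ℕ) : ℤ) := by
      refine hj1.trans ?_
      exact_mod_cast h1
    have h3 : ((q1^(j-1) : ℤ) : ℝ) ≤ ((((C1*C2)^s : ℕ) : ℤ) : ℝ) := by exact_mod_cast h2
    push_cast at h3 ⊢
    exact h3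
  · have h1 : 2*(K^s * ρ * (16*ρ)^((d+1)*s)) ≤ (C1*C2)^s := by
      have e2 : 2 ≤ 2^s := by simpa using Nat.pow_le_pow_right (show 0 < 2 by norm_num) hs
      have e3 : ρ ≤ ρ^s := by simpa using Nat.pow_le_pow_right hρ1 hs
      calc 2*(K^s * ρ * (16*ρ)^((d+1)*s)) ≤ 2^s * (K^s * ρ^s * (16*ρ)^((d+1)*s)) := by gcongr
        _ = C2^s := by rw [hC2]; rw [mul_pow, mul_pow, mul_pow, ← pow_mul]; ring
        _ ≤ (C1*C2)^s := Nat.pow_le_pow_left (Nat.le_mul_of_pos_left _ hC11) _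
    have h1R : 2*((K:ℝ)^s * ρ * (16*ρ)^((d+1)*s)) ≤ ((C1*C2 : ℕ):ℝ)^s := by exact_mod_cast h1
    set δ1 := ‖(p1:ℂ)/q1 - α‖^(2*s-j) with hδ1
    set δ2 := ‖(p2:ℂ)/q2 - α‖ with hδ2
    have n1 : 0 ≤ δ1 := by positivity
    have n2 : 0 ≤ δ2 := by positivity
    push_cast at hj2
    set U := (K:ℝ)^s * ρ * (16*ρ)^((d+1)*s) with hU
    have hU0 : 0 ≤ U := by positivity
    set V := (q1:ℝ)^((d+1)*s) * q2 with hV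
    have hV0 : 0 ≤ V := by positivity
    set D := ((C1*C2 : ℕ):ℝ)^s with hD
    rcases le_total δ1 δ2 with h | h
    · right
      calc 1 ≤ V * (U * (δ1+δ2)) := hj2
        _ ≤ V * (U * (δ2+δ2)) := by gcongr
        _ = V * (2*U) * δ2 := by ring
        _ ≤ V * D * δ2 := by gcongr
    · left
      calc 1 ≤ V * (U * (δ1+δ2)) := hj2
        _ ≤ V * (U * (δ1+δ1)) := by gcongr
        _ = V * (2*U) * δ1 := by ring
        _ ≤ V * D * δ1 := by gcongr

theorem thue_contra (d : ℕ) (hd : 4 ≤ d) (C s j : ℕ) (hC : 1 ≤ C) (hs : 4*d+8 ≤ s) (q1 q2 δ1 δ2 : ℝ)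
    (h1 : (C:ℝ)^(4*d+3) < q1) (hq2 : 0 < q2) (ha : q1^(2*s) ≤ q2) (hb : q2 < q1^(2*s+2)) (n1 : 0 ≤ δ1) (n2 : 0 ≤ δ2)
    (e1 : δ1^4 * q1^(4*d-1) ≤ 1) (e2 : δ2^4 * q2^(4*d-1) ≤ 1)
    (hj : q1^(j-1) ≤ (C:ℝ)^s)
    (h : 1 ≤ q1^((d+1)*s) * q2 * C^s * δ1^(2*s-j) ∨ 1 ≤ q1^((d+1)*s) * q2 * C^s * δ2) : False := by
  have hCR : (1:ℝ) ≤ C := by exact_mod_cast hC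
  have hC1 : (1:ℝ) ≤ (C:ℝ)^(4*d+3) := one_le_pow₀ hCR
  have hq1 : 1 < q1 := by linarith
  have hq0 : 0 < q1 := by linarith
  rcases h with h | h
  · have hj' : j ≤ s := by
      by_contra hc
      have h3 : q1^s ≤ q1^(j-1) := pow_le_pow_right₀ hq1.le (by omega)
      have h4 : (C:ℝ)^s < q1^s := by
        apply pow_lt_pow_left₀ _ (by positivity) (by omega)
        calc (C:ℝ) = C^1 := by ring
          _ ≤ (C:ℝ)^(4*d+3) := pow_le_pow_right₀ hCR (by omega)
          _ < q1 := h1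
      linarith
    have h4 : (1:ℝ) ≤ (q1^((d+1)*s) * q2 * C^s * δ1^(2*s-j))^4 := one_le_pow₀ h
    have h5 : (δ1^4 * q1^(4*d-1))^(2*s-j) ≤ 1 := pow_le_one₀ (by positivity) e1
    have h6 : q1^((4*d-1)*(2*s-j)) ≤ (q1^((d+1)*s) * q2 * C^s)^4 := by
      calc q1^((4*d-1)*(2*s-j)) = 1 * q1^((4*d-1)*(2*s-j)) := by ring
        _ ≤ (q1^((d+1)*s) * q2 * C^s * δ1^(2*s-j))^4 * q1^((4*d-1)*(2*s-j)) := by gcongr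
        _ = (q1^((d+1)*s) * q2 * C^s)^4 * ((δ1^4 * q1^(4*d-1))^(2*s-j)) := by
          rw [mul_pow (δ1^4), ← pow_mul, ← pow_mul, mul_pow _ (δ1^(2*s-j)), ← pow_mul]; ring
        _ ≤ (q1^((d+1)*s) * q2 * C^s)^4 * 1 := by gcongr
        _ = _ := by ring
    have h7 : q1^((4*d-1)*(2*s-j)) ≤ q1^(4*((d+1)*s) + 4*(2*s+2)) * (C:ℝ)^(4*s) := by
      refine h6.trans ?_
      calc _ ≤ (q1^((d+1)*s) * q1^(2*s+2) * C^s)^4 := by gcongr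
        _ = _ := by rw [mul_pow, mul_pow, ← pow_mul, ← pow_mul, ← pow_mul, pow_add]; ring
    have h8 : q1^j ≤ q1 * (C:ℝ)^s := by
      calc q1^j ≤ q1^(1+(j-1)) := pow_le_pow_right₀ hq1.le (by omega)
        _ = q1 * q1^(j-1) := by rw [pow_add, pow_one]
        _ ≤ _ := by gcongr
    -- multiply by q1^((4*d-1) j)
    have h9 : q1^((4*d-1)*(2*s)) ≤ q1^(4*((d+1)*s) + 4*(2*s+2)) * (C:ℝ)^(4*s) * (q1 * (C:ℝ)^s)^(4*d-1) := by
      calc q1^((4*d-1)*(2*s)) = q1^((4*d-1)*(2*s-j)) * (q1^j)^(4*d-1) := by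
            rw [← pow_mul, ← pow_add]; congr 1
            rw [mul_comm j, ← mul_add]; congr 1; omega
        _ ≤ _ := by gcongr
    have h10 : q1^((4*d-1)*(2*s)) ≤ q1^(4*((d+1)*s) + 4*(2*s+2) + (4*d-1)) * ((C:ℝ)^(4*d+3))^s := by
      refine h9.trans (le_of_eq ?_)
      rw [mul_pow, pow_add _ _ (4*d-1), ← pow_mul, ← pow_mul]
      rw [show (4*d+3)*s = 4*s + s*(4*d-1) by
        obtain ⟨e, rfl⟩ := Nat.exists_eq_add_of_le hd
        rw [show 4*(4+e)-1 = 4*e+15 by omega]; ring, pow_add (C:ℝ)]; ring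
    have h11 : q1^((4*d-1)*(2*s)) < q1^(4*((d+1)*s) + 4*(2*s+2) + (4*d-1) + s) := by
      refine h10.trans_lt ?_
      rw [pow_add _ _ s]
      have : ((C:ℝ)^(4*d+3))^s < q1^s := pow_lt_pow_left₀ h1 (by positivity) (by omega)
      gcongr
    have h12 := (pow_lt_pow_iff_right₀ hq1).1 h11
    obtain ⟨e, rfl⟩ := Nat.exists_eq_add_of_le hd
    rw [show 4*(4+e)-1 = 4*e+15 by omega] at h12
    nlinarith
  · have h4 : (1:ℝ) ≤ (q1^((d+1)*s) * q2 * C^s * δ2)^4 := one_le_pow₀ h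
    have h6 : q2^(4*d-1) ≤ (q1^((d+1)*s) * q2 * C^s)^4 := by
      calc q2^(4*d-1) = 1 * q2^(4*d-1) := by ring
        _ ≤ (q1^((d+1)*s) * q2 * C^s * δ2)^4 * q2^(4*d-1) := by gcongr
        _ = (q1^((d+1)*s) * q2 * C^s)^4 * (δ2^4 * q2^(4*d-1)) := by ring
        _ ≤ (q1^((d+1)*s) * q2 * C^s)^4 * 1 := by gcongr
        _ = _ := by ring
    have h7 : q2^(4*d-5) ≤ (q1^((d+1)*s) * C^s)^4 := by
      have : q2^4 * q2^(4*d-5) ≤ q2^4 * (q1^((d+1)*s) * C^s)^4 := by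
        calc _ = q2^(4*d-1) := by rw [← pow_add]; congr 1; omega
          _ ≤ _ := h6
          _ = _ := by ring
      exact le_of_mul_le_mul_left this (by positivity)
    have h8 : q1^(2*s*(4*d-5)) ≤ q1^(4*((d+1)*s)) * ((C:ℝ)^4)^s := by
      calc q1^(2*s*(4*d-5)) = (q1^(2*s))^(4*d-5) := by rw [pow_mul]
        _ ≤ q2^(4*d-5) := by gcongr
        _ ≤ _ := h7
        _ = _ := by rw [mul_pow, ← pow_mul, ← pow_mul, ← pow_mul]; ring
    have h9 : q1^(2*s*(4*d-5)) < q1^(4*((d+1)*s) + s) := by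
      refine h8.trans_lt ?_
      rw [pow_add _ _ s]
      have h10 : (C:ℝ)^4 < q1 := (pow_le_pow_right₀ hCR (by omega)).trans_lt h1
      have : ((C:ℝ)^4)^s < q1^s := pow_lt_pow_left₀ h10 (by positivity) (by omega)
      gcongr
    have h12 := (pow_lt_pow_iff_right₀ hq1).1 h9
    obtain ⟨e, rfl⟩ := Nat.exists_eq_add_of_le hd
    rw [show 4*(4+e)-5 = 4*e+11 by omega] at h12
    nlinarith

theorem thue_final (d : ℕ) (hd : 4 ≤ d) (m : ℤ[X]) (hm : m.Monic) (hmd : m.natDegree = d)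
    (hirr : Irreducible (m.map (Int.castRingHom ℚ))) (α : ℂ) (hα : aeval α m = 0) :
    ∃ Q : ℕ, ∀ p q : ℤ, (Q:ℤ) < q → IsCoprime p q → 1 ≤ ‖(p:ℂ) - α*q‖^4 * (q:ℝ)^(4*d-5) := by
  obtain ⟨C, hC, H⟩ := thue_num d (by omega) m hm hmd hirr α hα
  suffices hh : ∃ Q : ℕ, ∀ p q : ℤ, (Q:ℤ) < q → IsCoprime p q → 1 < ‖(p:ℂ)/q - α‖^4 * (q:ℝ)^(4*d-1) by
    obtain ⟨Q, hQ⟩ := hh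
    refine ⟨Q, fun p q hq hc => ?_⟩
    refine (hQ p q hq hc).le.trans (le_of_eq ?_)
    have hq0 : 0 < q := by omega
    have hqC : (q:ℂ) ≠ 0 := by exact_mod_cast hq0.ne'
    have hqR : (0:ℝ) < q := by exact_mod_cast hq0
    have : (p:ℂ) - α*q = ((p:ℂ)/q - α)*q := by field_simp
    rw [this, norm_mul, Complex.norm_intCast, abs_of_pos hqR, mul_pow, mul_assoc, ← pow_add]
    congr 2; omega
  by_contra! hcon
  obtain ⟨p1, q1, hq1, hc1, e1⟩ := hcon (C^(4*d+3))
  have hq10 : 0 < q1 := by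
    have : (0:ℤ) ≤ ((C^(4*d+3) : ℕ):ℤ) := by positivity
    omega
  have hq1R : (C:ℝ)^(4*d+3) < q1 := by exact_mod_cast hq1
  have hq11 : 1 < q1 := by
    have : 1 ≤ C^(4*d+3) := Nat.one_le_pow _ _ hC
    omega
  lift q1 to ℕ using hq10.le with n hn
  obtain ⟨p2, q2, hq2, hc2, e2⟩ := hcon (n^(2*(4*d+8)))
  have hq20 : 0 < q2 := by
    have : (0:ℤ) ≤ ((n^(2*(4*d+8)) : ℕ):ℤ) := by positivity
    omega
  lift q2 to ℕ using hq20.le with k hk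
  have hn1 : 1 < n := by exact_mod_cast hq11
  have hn2 : 1 < n^2 := Nat.one_lt_pow (by norm_num) hn1
  have hk0 : k ≠ 0 := by omega
  have hq2' : n^(2*(4*d+8)) < k := by exact_mod_cast hq2
  set s := Nat.log (n^2) k with hs
  have hs1 : 4*d+8 ≤ s := by
    apply Nat.le_log_of_pow_le hn2
    rw [← pow_mul]; exact hq2'.le
  have ha := Nat.pow_log_le_self (n^2) hk0
  have hb := Nat.lt_pow_succ_log_self hn2 k
  rw [← hs, ← pow_mul] at ha
  rw [← hs, ← pow_mul] at hb
  have hδ : ‖(p1:ℂ)/((n:ℤ):ℂ) - α‖ ≤ 1 := by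
    by_contra hc
    push Not at hc
    have h1 : (1:ℝ) < ‖(p1:ℂ)/((n:ℤ):ℂ) - α‖^4 := one_lt_pow₀ hc (by norm_num)
    have h2 : (1:ℝ) ≤ (((n:ℤ):ℝ))^(4*d-1) := one_le_pow₀ (by exact_mod_cast hn1.le)
    nlinarith
  obtain ⟨j, hj, h⟩ := H s (by omega) p1 n p2 k hq10 hq20 hc1 hδ
  exact thue_contra d hd C s j hC hs1 ((n:ℤ):ℝ) ((k:ℤ):ℝ) _ _ hq1R (by exact_mod_cast hq20) (by exact_mod_cast ha)
    (by exact_mod_cast hb) (norm_nonneg _) (norm_nonneg _) e1 e2 hj h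
end PartP9d

section PartP10
open Polynomial

def nm (x y : ℤ) : ℤ := max |x| |y|

/-- complex roots -/
noncomputable def croots (f : ℤ[X]) : Finset ℂ := (f.map (Int.castRingHom ℂ)).roots.toFinset

theorem mem_croots {f : ℤ[X]} (hf : f ≠ 0) (z : ℂ) : z ∈ croots f ↔ aeval z f = 0 := by
  have h0 : f.map (Int.castRingHom ℂ) ≠ 0 := by rwa [Ne, Polynomial.map_eq_zero_iff Int.cast_injective]
  rw [croots, Multiset.mem_toFinset, mem_roots h0, IsRoot.def, eval_map, aeval_def]
  rfl

theorem croots_nodup (f : ℤ[X]) (sf : Squarefree (f.map (Int.castRingHom ℚ))) : (f.map (Int.castRingHom ℂ)).roots.Nodup := by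
  have h1 : (f.map (Int.castRingHom ℚ)).Separable := PerfectField.separable_iff_squarefree.2 sf
  have h2 := h1.map (f := algebraMap ℚ ℂ)
  rw [Polynomial.map_map] at h2
  have : (algebraMap ℚ ℂ).comp (Int.castRingHom ℚ) = Int.castRingHom ℂ := by ext; simp
  rw [this] at h2
  exact nodup_roots h2

theorem croots_card (f : ℤ[X]) (sf : Squarefree (f.map (Int.castRingHom ℚ))) : (croots f).card = f.natDegree := by
  rw [croots, Multiset.toFinset_card_of_nodup (croots_nodup f sf)]
  rw [← (IsAlgClosed.splits (f.map (Int.castRingHom ℂ))).natDegree_eq_card_roots, natDegree_map_eq_of_injective Int.cast_injective]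

theorem hev_y0' {R : Type*} [CommRing R] (d : ℕ) (c : ℕ → ℤ) (x : R) : hev d c x 0 = c d * x^d := by
  unfold hev
  rw [Finset.sum_range_succ, Finset.sum_eq_zero]
  · simp
  · intro i hi
    rw [Finset.mem_range] at hi
    rw [zero_pow (by omega), mul_zero]

theorem hev_prod (f : ℤ[X]) (sf : Squarefree (f.map (Int.castRingHom ℚ))) (x y : ℂ) :
    hev f.natDegree f.coeff x y = f.leadingCoeff * ∏ θ ∈ croots f, (x - θ * y) := by
  by_cases hy : y = 0
  · subst hy
    rw [hev_y0']
    simp [Finset.prod_const, croots_card f sf]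
  · rw [hev_div _ _ _ _ hy, hev_one]
    have h1 := (IsAlgClosed.splits (f.map (Int.castRingHom ℂ))).eq_prod_roots
    have h2 : aeval (x/y) f = eval (x/y) (f.map (Int.castRingHom ℂ)) := by
      rw [eval_map, aeval_def]; rfl
    rw [h2, h1, eval_mul, eval_C, leadingCoeff_map_of_injective Int.cast_injective, eval_multiset_prod, Multiset.map_map]
    have h3 : (Multiset.map (eval (x/y) ∘ fun a => X - C a) (f.map (Int.castRingHom ℂ)).roots).prod = ∏ θ ∈ croots f, (x/y - θ) := by
      rw [Finset.prod, croots, Multiset.toFinset_val, (croots_nodup f sf).dedup]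
      congr 1
      apply Multiset.map_congr rfl
      intro a _
      simp
    rw [h3]
    have h4 : ∏ θ ∈ croots f, (x - θ * y) = y^f.natDegree * ∏ θ ∈ croots f, (x/y - θ) := by
      rw [← croots_card f sf, ← Finset.prod_const, ← Finset.prod_mul_distrib]
      apply Finset.prod_congr rfl
      intro θ _
      field_simp
    rw [h4, eq_intCast]; ring

theorem hev_polymul (h k : ℤ[X]) (hh : h ≠ 0) (hk : k ≠ 0) (x y : ℤ) :
    hev (h*k).natDegree (h*k).coeff x y = hev h.natDegree h.coeff x y * hev k.natDegree k.coeff x y := by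
  have : (hev (h*k).natDegree (h*k).coeff (x:ℚ) (y:ℚ)) = hev h.natDegree h.coeff (x:ℚ) (y:ℚ) * hev k.natDegree k.coeff (x:ℚ) (y:ℚ) := by
    by_cases hy : (y:ℚ) = 0
    · rw [hy, hev_y0', hev_y0', hev_y0', natDegree_mul hh hk]
      have := leadingCoeff_mul h k
      rw [leadingCoeff, natDegree_mul hh hk] at this
      rw [this, leadingCoeff, leadingCoeff]; push_cast; ring
    · rw [hev_div _ _ _ _ hy, hev_one, hev_div _ _ _ _ hy, hev_one, hev_div _ _ _ _ hy, hev_one, natDegree_mul hh hk, map_mul]; ring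
  rw [hev_intCast, hev_intCast, hev_intCast] at this
  exact_mod_cast this

theorem int_factor (f : ℤ[X]) (a b : ℚ[X]) (h : f.map (Int.castRingHom ℚ) = a * b) :
    ∃ c : ℤ, c ≠ 0 ∧ ∃ A B : ℤ[X], C c * f = A * B ∧ (∃ u : ℚ, u ≠ 0 ∧ A.map (Int.castRingHom ℚ) = C u * a) ∧
      (∃ v : ℚ, v ≠ 0 ∧ B.map (Int.castRingHom ℚ) = C v * b) := by
  obtain ⟨u, hu, hA⟩ := IsLocalization.integerNormalization_spec (nonZeroDivisors ℤ) a
  obtain ⟨v, hv, hB⟩ := IsLocalization.integerNormalization_spec (nonZeroDivisors ℤ) b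
  have hu0 : u ≠ 0 := nonZeroDivisors.ne_zero hu
  have hv0 : v ≠ 0 := nonZeroDivisors.ne_zero hv
  have hA' : (IsLocalization.integerNormalization (nonZeroDivisors ℤ) a).map (Int.castRingHom ℚ) = C (u:ℚ) * a := by
    rw [← smul_eq_C_mul, Int.cast_smul_eq_zsmul]; exact hA
  have hB' : (IsLocalization.integerNormalization (nonZeroDivisors ℤ) b).map (Int.castRingHom ℚ) = C (v:ℚ) * b := by
    rw [← smul_eq_C_mul, Int.cast_smul_eq_zsmul]; exact hB
  refine ⟨u*v, mul_ne_zero hu0 hv0, _, _, ?_, ⟨u, by exact_mod_cast hu0, hA'⟩, ⟨v, by exact_mod_cast hv0, hB'⟩⟩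
  apply Polynomial.map_injective (Int.castRingHom ℚ) Int.cast_injective
  rw [Polynomial.map_mul, Polynomial.map_mul, hA', hB', h, map_C, eq_intCast]
  push_cast
  rw [C_mul]; ring

theorem nm_nonneg (x y : ℤ) : 0 ≤ nm x y := (abs_nonneg x).trans (le_max_left _ _)

theorem gap2 (θ θ' : ℂ) (h : θ ≠ θ') : ∃ c : ℝ, 0 < c ∧ ∀ x y : ℤ, ‖(x:ℂ) - θ*y‖ ≤ ‖(x:ℂ) - θ'*y‖ → c * nm x y ≤ ‖(x:ℂ) - θ'*y‖ := by
  have h0 : 0 < ‖θ - θ'‖ := norm_pos_iff.2 (sub_ne_zero.2 h)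
  set a := ‖θ - θ'‖
  refine ⟨1 / (1 + 2/a*(1 + ‖θ'‖)), by positivity, ?_⟩
  intro x y hxy
  set L := ‖(x:ℂ) - θ'*y‖
  have hL : 0 ≤ L := norm_nonneg _
  have h1 : a * |(y:ℝ)| ≤ 2 * L := by
    have : ‖(θ - θ') * y‖ ≤ ‖(x:ℂ) - θ'*y‖ + ‖(x:ℂ) - θ*y‖ := by
      calc _ = ‖((x:ℂ) - θ'*y) - ((x:ℂ) - θ*y)‖ := by ring_nf
        _ ≤ _ := norm_sub_le _ _
    rw [norm_mul, Complex.norm_intCast] at this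
    linarith
  have h2 : |(y:ℝ)| ≤ 2/a * L := by
    rw [div_mul_eq_mul_div, le_div_iff₀ h0]; linarith
  have h3 : |(x:ℝ)| ≤ L + ‖θ'‖ * |(y:ℝ)| := by
    rw [← Complex.norm_intCast, ← Complex.norm_intCast, ← norm_mul]
    calc ‖(x:ℂ)‖ = ‖((x:ℂ) - θ'*y) + θ'*y‖ := by ring_nf
      _ ≤ _ := norm_add_le _ _
  have h4 : ((nm x y : ℤ):ℝ) ≤ (1 + 2/a*(1 + ‖θ'‖)) * L := by
    unfold nm
    push_cast
    have hn := norm_nonneg θ'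
    have h5 : 0 ≤ 2/a*L := by positivity
    have h6 : ‖θ'‖ * |(y:ℝ)| ≤ ‖θ'‖ * (2/a*L) := by gcongr
    have h7 : 0 ≤ ‖θ'‖ * (2/a*L) := by positivity
    apply max_le
    · nlinarith
    · nlinarith
  rw [one_div, inv_mul_le_iff₀ (by positivity)]
  exact h4

theorem gap (R : Finset ℂ) : ∃ c : ℝ, 0 < c ∧ c ≤ 1 ∧ ∀ θ ∈ R, ∀ θ' ∈ R, θ ≠ θ' → ∀ x y : ℤ, ‖(x:ℂ) - θ*y‖ ≤ ‖(x:ℂ) - θ'*y‖ → c * nm x y ≤ ‖(x:ℂ) - θ'*y‖ := by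
  classical
  have H : ∀ p : ℂ × ℂ, ∃ c : ℝ, 0 < c ∧ (p.1 ≠ p.2 → ∀ x y : ℤ, ‖(x:ℂ) - p.1*y‖ ≤ ‖(x:ℂ) - p.2*y‖ → c * nm x y ≤ ‖(x:ℂ) - p.2*y‖) := by
    intro p
    by_cases h : p.1 = p.2
    · exact ⟨1, one_pos, fun h' => absurd h h'⟩
    · obtain ⟨c, hc, h2⟩ := gap2 _ _ h
      exact ⟨c, hc, fun _ => h2⟩
  choose c hc hc2 using H
  have hne : (insert 1 ((R ×ˢ R).image c)).Nonempty := ⟨1, Finset.mem_insert_self _ _⟩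
  refine ⟨(insert 1 ((R ×ˢ R).image c)).min' hne, ?_, Finset.min'_le _ _ (Finset.mem_insert_self _ _), ?_⟩
  · rw [Finset.lt_min'_iff]
    intro z hz
    rw [Finset.mem_insert, Finset.mem_image] at hz
    rcases hz with rfl | ⟨p, _, rfl⟩
    · exact one_pos
    · exact hc p
  · intro θ hθ θ' hθ' hne x y hxy
    refine le_trans ?_ (hc2 (θ, θ') hne x y hxy)
    have : ((nm x y : ℤ) : ℝ) ≥ 0 := by exact_mod_cast nm_nonneg x y
    gcongr
    apply Finset.min'_le
    rw [Finset.mem_insert, Finset.mem_image]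
    exact Or.inr ⟨(θ, θ'), Finset.mem_product.2 ⟨hθ, hθ'⟩, rfl⟩
end PartP10

section PartP10b
open Polynomial

/-- Given an index where linear form is minimal. -/
theorem exists_min_root (R : Finset ℂ) (hR : R.Nonempty) (x y : ℤ) :
    ∃ θ ∈ R, ∀ θ' ∈ R, ‖(x:ℂ) - θ*y‖ ≤ ‖(x:ℂ) - θ'*y‖ :=
  Finset.exists_min_image R (fun θ => ‖(x:ℂ) - θ*y‖) hR

theorem norm_hev_prod (f : ℤ[X]) (sf : Squarefree (f.map (Int.castRingHom ℚ))) (x y : ℤ) :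
    |((hev f.natDegree f.coeff x y : ℤ):ℝ)| = |(f.leadingCoeff:ℝ)| * ∏ θ ∈ croots f, ‖(x:ℂ) - θ * y‖ := by
  have := congrArg norm (hev_prod f sf (x:ℂ) y)
  rw [hev_intCast, norm_mul, norm_prod, Complex.norm_intCast, Complex.norm_intCast] at this
  exact this

theorem lower_F (f : ℤ[X]) (sf : Squarefree (f.map (Int.castRingHom ℚ))) (c : ℝ) (hc : 0 < c) (x y : ℤ) (θ : ℂ) (hθ : θ ∈ croots f)
    (h : ∀ θ' ∈ croots f, θ' ≠ θ → c * nm x y ≤ ‖(x:ℂ) - θ'*y‖) :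
    ‖(x:ℂ) - θ*y‖ * (c * nm x y)^(f.natDegree - 1) ≤ |((hev f.natDegree f.coeff x y : ℤ):ℝ)| := by
  have hf : f ≠ 0 := by rintro rfl; simp at sf
  rw [norm_hev_prod f sf, ← Finset.mul_prod_erase _ _ hθ]
  have h1 : (1:ℝ) ≤ |(f.leadingCoeff:ℝ)| := by
    exact_mod_cast Int.one_le_abs (leadingCoeff_ne_zero.2 hf)
  have hn : (0:ℝ) ≤ nm x y := by exact_mod_cast nm_nonneg x y
  have h2 : (c * nm x y)^(f.natDegree - 1) ≤ ∏ θ' ∈ (croots f).erase θ, ‖(x:ℂ) - θ' * y‖ := by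
    rw [← croots_card f sf, ← Finset.card_erase_of_mem hθ, ← Finset.prod_const]
    apply Finset.prod_le_prod
    · intros; positivity
    · intro θ' hθ'
      rw [Finset.mem_erase] at hθ'
      exact h θ' hθ'.2 hθ'.1
  calc _ ≤ ‖(x:ℂ) - θ*y‖ * ∏ θ' ∈ (croots f).erase θ, ‖(x:ℂ) - θ' * y‖ := by gcongr
    _ ≤ _ := le_mul_of_one_le_left (by positivity) h1

/-- reducible case -/
theorem s1_red (f : ℤ[X]) (sf : Squarefree (f.map (Int.castRingHom ℚ))) (a b : ℚ[X]) (ha : 0 < a.natDegree) (hb : 0 < b.natDegree)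
    (hab : f.map (Int.castRingHom ℚ) = a * b) :
    ∃ K : ℝ, 0 < K ∧ ∀ x y : ℤ, hev f.natDegree f.coeff x y ≠ 0 → (nm x y : ℝ) ≤ K * |((hev f.natDegree f.coeff x y : ℤ):ℝ)| := by
  obtain ⟨l, hl, A, B, hAB, ⟨u, hu, hA⟩, ⟨v, hv, hB⟩⟩ := int_factor f a b hab
  obtain ⟨c, hc, hc1, hgap⟩ := gap (croots f)
  have hf : f ≠ 0 := by rintro rfl; simp at sf
  have hABne : A * B ≠ 0 := by rw [← hAB]; exact mul_ne_zero (by simpa using hl) hf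
  have hA0 : A ≠ 0 := left_ne_zero_of_mul hABne
  have hB0 : B ≠ 0 := right_ne_zero_of_mul hABne
  have hAdeg : 0 < A.natDegree := by
    rw [← natDegree_map_eq_of_injective (f := Int.castRingHom ℚ) Int.cast_injective, hA, natDegree_C_mul hu]; exact ha
  have hBdeg : 0 < B.natDegree := by
    rw [← natDegree_map_eq_of_injective (f := Int.castRingHom ℚ) Int.cast_injective, hB, natDegree_C_mul hv]; exact hb
  have hrel := squarefree_mul_iff.1 (hab ▸ sf)
  have hcu : ∀ {w : ℚ}, w ≠ 0 → IsUnit (C w : ℚ[X]) := fun hw => isUnit_C.2 (isUnit_iff_ne_zero.2 hw)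
  have sA : Squarefree (A.map (Int.castRingHom ℚ)) := by
    rw [hA]; exact (associated_unit_mul_left _ _ (hcu hu)).squarefree_iff.2 hrel.2.1
  have sB : Squarefree (B.map (Int.castRingHom ℚ)) := by
    rw [hB]; exact (associated_unit_mul_left _ _ (hcu hv)).squarefree_iff.2 hrel.2.2
  have hcop : IsCoprime (A.map (Int.castRingHom ℚ)) (B.map (Int.castRingHom ℚ)) := by
    rw [hA, hB]
    exact (isCoprime_mul_unit_left_left (hcu hu) _ _).2 ((isCoprime_mul_unit_left_right (hcu hv) _ _).2 hrel.1.isCoprime)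
  have hnc : ∀ z : ℂ, aeval z A = 0 → aeval z B = 0 → False := by
    intro z h1 h2
    have := aeval_ne_zero_of_isCoprime hcop z
    have e1 := aeval_map_algebraMap ℚ z A
    have e2 := aeval_map_algebraMap ℚ z B
    rw [h1] at e1; rw [h2] at e2
    rcases this with h | h
    · exact h e1
    · exact h e2
  have hl1 : (1:ℝ) ≤ |(l:ℝ)| := by exact_mod_cast Int.one_le_abs hl
  have hval : ∀ x y : ℤ, l * hev f.natDegree f.coeff x y = hev A.natDegree A.coeff x y * hev B.natDegree B.coeff x y := by
    intro x y
    rw [← hev_polymul A B hA0 hB0, ← hAB, natDegree_C_mul hl]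
    have : (C l * f).coeff = fun i => l * f.coeff i := by ext i; simp
    rw [this, hev_smul]; simp
  have sub : ∀ z : ℂ, (aeval z A = 0 ∨ aeval z B = 0) ↔ z ∈ croots f := by
    intro z
    rw [mem_croots hf]
    have := congrArg (aeval z) hAB
    rw [map_mul, map_mul, aeval_C] at this
    rw [← mul_eq_zero, ← this, mul_eq_zero]
    constructor
    · rintro (h | h)
      · simp at h; exact absurd h hl
      · exact h
    · exact Or.inr
  refine ⟨|(l:ℝ)|/c, by positivity, ?_⟩
  intro x y hne
  have hN : (0:ℝ) ≤ nm x y := by exact_mod_cast nm_nonneg x y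
  have hf1 : (1:ℝ) ≤ |((hev f.natDegree f.coeff x y : ℤ):ℝ)| := by exact_mod_cast Int.one_le_abs hne
  have hnz : hev A.natDegree A.coeff x y * hev B.natDegree B.coeff x y ≠ 0 := by
    rw [← hval]; exact mul_ne_zero hl hne
  rcases le_or_gt (c * nm x y) 1 with hsm | hbig
  · rw [div_mul_eq_mul_div, le_div_iff₀ hc]
    nlinarith
  have hRne : (croots f).Nonempty := by
    rw [← Finset.card_pos, croots_card f sf]
    have := natDegree_mul hA0 hB0
    rw [← hAB, natDegree_C_mul hl] at this
    omega
  obtain ⟨θ, hθ, hmin⟩ := exists_min_root (croots f) hRne x y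
  have key : ∀ D E : ℤ[X], D ≠ 0 → E ≠ 0 → 0 < E.natDegree → Squarefree (E.map (Int.castRingHom ℚ)) →
      l * hev f.natDegree f.coeff x y = hev D.natDegree D.coeff x y * hev E.natDegree E.coeff x y →
      (∀ z ∈ croots E, z ∈ croots f ∧ z ≠ θ) → (nm x y : ℝ) ≤ |(l:ℝ)|/c * |((hev f.natDegree f.coeff x y : ℤ):ℝ)| := by
    intro D E hD hE hdeg sE hv' hz
    have hprod0 : hev D.natDegree D.coeff x y ≠ 0 := by
      intro h; rw [h, zero_mul] at hv'; exact (mul_ne_zero hl hne) hv'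
    have hD1 : (1:ℝ) ≤ |((hev D.natDegree D.coeff x y : ℤ):ℝ)| := by exact_mod_cast Int.one_le_abs hprod0
    have hE1 : c * nm x y ≤ |((hev E.natDegree E.coeff x y : ℤ):ℝ)| := by
      rw [norm_hev_prod E sE]
      have h1 : (1:ℝ) ≤ |(E.leadingCoeff:ℝ)| := by
        exact_mod_cast Int.one_le_abs (leadingCoeff_ne_zero.2 hE)
      calc c * nm x y ≤ (c * nm x y)^E.natDegree := le_self_pow₀ hbig.le hdeg.ne'
        _ ≤ ∏ θ' ∈ croots E, ‖(x:ℂ) - θ' * y‖ := by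
          rw [← croots_card E sE, ← Finset.prod_const]
          apply Finset.prod_le_prod
          · intros; positivity
          · intro θ' hθ'
            obtain ⟨h3, h4⟩ := hz θ' hθ'
            exact hgap θ hθ θ' h3 h4.symm x y (hmin θ' h3)
        _ ≤ _ := le_mul_of_one_le_left (by positivity) h1
    have h2 : |(l:ℝ)| * |((hev f.natDegree f.coeff x y : ℤ):ℝ)| = |((hev D.natDegree D.coeff x y : ℤ):ℝ)| * |((hev E.natDegree E.coeff x y : ℤ):ℝ)| := by
      rw [← abs_mul, ← abs_mul]; exact_mod_cast congrArg (fun z : ℤ => |(z:ℝ)|) hv'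
    rw [div_mul_eq_mul_div, le_div_iff₀ hc, h2, mul_comm _ c]
    exact hE1.trans (le_mul_of_one_le_left (abs_nonneg _) hD1)
  by_cases hθA : aeval θ A = 0
  · refine key A B hA0 hB0 hBdeg sB (hval x y) ?_
    intro z hz
    rw [mem_croots hB0] at hz
    exact ⟨(sub z).1 (Or.inr hz), by rintro rfl; exact hnc z hθA hz⟩
  · refine key B A hB0 hA0 hAdeg sA (by rw [hval, mul_comm]) ?_
    intro z hz
    rw [mem_croots hA0] at hz
    exact ⟨(sub z).1 (Or.inl hz), by rintro rfl; exact hθA hz⟩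
end PartP10b

section PartP10c
open Polynomial

theorem thue_root (d : ℕ) (hd : 4 ≤ d) (f : ℤ[X]) (hfd : f.natDegree = d)
    (hirr : Irreducible (f.map (Int.castRingHom ℚ))) (θ : ℂ) (hθ : aeval θ f = 0) :
    ∃ Q : ℕ, ∀ x y : ℤ, (Q:ℤ) < y → IsCoprime x y → 1 ≤ |(f.leadingCoeff:ℝ)|^4 * ‖(x:ℂ) - θ*y‖^4 * (y:ℝ)^(4*d-5) := by
  have hf : f ≠ 0 := by rintro rfl; simp at hfd; omega
  set l := f.leadingCoeff with hl
  have hl0 : l ≠ 0 := leadingCoeff_ne_zero.2 hf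
  set α : ℂ := l * θ with hα
  have hnorm : aeval α (integralNormalization f) = 0 := by
    have := integralNormalization_aeval_eq_zero (A := ℂ) hθ (fun x hx => by simpa using hx)
    simpa [hα] using this
  have hmon := monic_integralNormalization hf
  have hintgl : IsIntegral ℤ α := ⟨_, hmon, hnorm⟩
  have hintQ : IsIntegral ℚ α := hintgl.tower_top
  set m := minpoly ℤ α with hm
  have hmQ : m.map (Int.castRingHom ℚ) = minpoly ℚ α :=
    (minpoly.isIntegrallyClosed_eq_field_fractions' ℚ hintgl).symm
  have hmmon : m.Monic := minpoly.monic hintgl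
  have hmz : aeval α m = 0 := minpoly.aeval _ _
  have hmle : m.natDegree ≤ d := by
    have h1 := minpoly.isIntegrallyClosed_dvd hintgl hnorm
    have h2 := natDegree_le_of_dvd h1 hmon.ne_zero
    refine h2.trans ?_
    rw [← hfd]
    apply natDegree_le_natDegree
    rw [degree_le_iff_coeff_zero]
    intro i hi
    have : i ∉ f.support := by rw [notMem_support_iff]; exact coeff_eq_zero_of_degree_lt hi
    have h3 := fun h => this (support_integralNormalization_subset h)
    exact notMem_support_iff.1 h3
  have hmge : d ≤ m.natDegree := by
    have hcomp : aeval θ ((m.map (Int.castRingHom ℚ)).comp (C (l:ℚ) * X)) = 0 := by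
      rw [aeval_comp]
      have : aeval θ (C (l:ℚ) * X) = α := by simp [hα]
      rw [this, hmQ, minpoly.aeval]
    have hdv : f.map (Int.castRingHom ℚ) ∣ (m.map (Int.castRingHom ℚ)).comp (C (l:ℚ) * X) := by
      have h1 : f.map (Int.castRingHom ℚ) ∣ minpoly ℚ θ := by
        have hz : aeval θ (f.map (Int.castRingHom ℚ)) = 0 := by
          have := aeval_map_algebraMap ℚ θ f
          rw [hθ] at this; exact this
        have h2 := minpoly.dvd ℚ θ hz
        have hirr2 : Irreducible (minpoly ℚ θ) := minpoly.irreducible (by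
          refine ⟨_, monic_mul_leadingCoeff_inv hirr.ne_zero, ?_⟩
          rw [← aeval_def, map_mul, hz, zero_mul])
        exact (hirr2.associated_of_dvd hirr h2).symm.dvd
      exact h1.trans (minpoly.dvd ℚ θ hcomp)
    have hm0 : m.map (Int.castRingHom ℚ) ≠ 0 := (hmmon.map _).ne_zero
    have hlQ : (l:ℚ) ≠ 0 := by exact_mod_cast hl0
    have hdegcomp : ((m.map (Int.castRingHom ℚ)).comp (C (l:ℚ) * X)).natDegree = m.natDegree := by
      rw [natDegree_comp, natDegree_C_mul_X _ hlQ, mul_one, natDegree_map_eq_of_injective Int.cast_injective]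
    have hne : (m.map (Int.castRingHom ℚ)).comp (C (l:ℚ) * X) ≠ 0 := by
      intro h
      rw [h, natDegree_zero] at hdegcomp
      have h5 : m = 1 := hmmon.natDegree_eq_zero.1 hdegcomp.symm
      rw [h5] at hmz
      simp at hmz
    have := natDegree_le_of_dvd hdv hne
    rwa [hdegcomp, natDegree_map_eq_of_injective Int.cast_injective, hfd] at this
  obtain ⟨Q, hQ⟩ := thue_final d hd m hmmon (le_antisymm hmle hmge) (hmQ ▸ minpoly.irreducible hintQ) α hmz
  refine ⟨Q * l.natAbs, fun x y hy hcop => ?_⟩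
  have hy0 : 0 < y := by
    have : (0:ℤ) ≤ ((Q * l.natAbs : ℕ):ℤ) := by positivity
    omega
  obtain ⟨g, p, q, hg, hpq, e1, e2⟩ := Int.exists_gcd_one' (m := l*x) (n := y) (Int.gcd_pos_of_ne_zero_right _ hy0.ne')
  have hgz : (0:ℤ) < g := by exact_mod_cast hg
  have hgl : (g:ℤ) ∣ l := by
    have h1 : IsCoprime (g:ℤ) x := (hcop.symm.of_isCoprime_of_dvd_left ⟨q, by rw [e2]; ring⟩)
    exact h1.dvd_of_dvd_mul_right ⟨p, by rw [e1]; ring⟩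
  have hgle : (g:ℤ) ≤ l.natAbs := by
    rw [Int.natCast_natAbs]
    exact Int.le_of_dvd (abs_pos.2 hl0) ((dvd_abs _ _).2 hgl)
  have hq0 : 0 < q := by
    by_contra hc
    push Not at hc
    nlinarith
  have hqQ : (Q:ℤ) < q := by
    by_contra hc
    push Not at hc
    have : y ≤ Q * l.natAbs := by rw [e2]; gcongr
    push_cast at hy this
    linarith
  have h1 := hQ p q hqQ (Int.isCoprime_iff_gcd_eq_one.2 hpq)
  have hgR : (1:ℝ) ≤ g := by exact_mod_cast hg
  have hqR : (0:ℝ) < q := by exact_mod_cast hq0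
  have e1C : (l:ℂ) * x = p * g := by exact_mod_cast e1
  have e2C : (y:ℂ) = q * g := by exact_mod_cast e2
  have e2R : (y:ℝ) = q * g := by exact_mod_cast e2
  have e3 : |(l:ℝ)| * ‖(x:ℂ) - θ*y‖ = g * ‖(p:ℂ) - α*q‖ := by
    rw [← Complex.norm_intCast, ← norm_mul, mul_sub, e1C, show (l:ℂ) * (θ*y) = α * y by rw [hα]; ring, e2C, show (p:ℂ)*g - α*(q*g) = g * (p - α*q) by ring, norm_mul, Complex.norm_natCast]
  rw [← mul_pow, e3, e2R]
  refine h1.trans ?_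
  gcongr
  · exact le_mul_of_one_le_left (norm_nonneg _) hgR
  · exact le_mul_of_one_le_right hqR.le hgR

theorem s1_irr (d : ℕ) (hd : 4 ≤ d) (f : ℤ[X]) (hfd : f.natDegree = d)
    (hirr : Irreducible (f.map (Int.castRingHom ℚ))) :
    ∃ K : ℝ, 0 < K ∧ ∀ x y : ℤ, IsCoprime x y → hev f.natDegree f.coeff x y ≠ 0 → (nm x y : ℝ) ≤ K * |((hev f.natDegree f.coeff x y : ℤ):ℝ)|^4 := by
  have hf : f ≠ 0 := by rintro rfl; simp at hfd; omega
  have sf : Squarefree (f.map (Int.castRingHom ℚ)) := hirr.squarefree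
  set l := f.leadingCoeff with hl
  have hl0 : l ≠ 0 := leadingCoeff_ne_zero.2 hf
  obtain ⟨c, hc, hc1, hgap⟩ := gap (croots f)
  have H : ∀ θ : ℂ, ∃ K : ℝ, 0 < K ∧ (θ ∈ croots f → ∀ x y : ℤ, 0 ≤ y → IsCoprime x y → hev f.natDegree f.coeff x y ≠ 0 → (∀ θ' ∈ croots f, ‖(x:ℂ) - θ*y‖ ≤ ‖(x:ℂ) - θ'*y‖) →
      (nm x y : ℝ) ≤ K * |((hev f.natDegree f.coeff x y : ℤ):ℝ)|^4) := by
    intro θ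
    by_cases hθ : θ ∈ croots f
    swap
    · exact ⟨1, one_pos, fun h => absurd h hθ⟩
    obtain ⟨Q, hQ⟩ := thue_root d hd f hfd hirr θ ((mem_croots hf θ).1 hθ)
    rw [← hl] at hQ
    set l' : ℝ := |(l:ℝ)| with hl'
    have hl'1 : 1 ≤ l' := by rw [hl']; exact_mod_cast Int.one_le_abs hl0
    refine ⟨l'^4 * (1/c)^(4*(d-1)) + (1/c)^(d-1) + (1 + ‖θ‖*Q + Q), by positivity, ?_⟩
    intro _ x y hy hcop hne hmin
    have hlow := lower_F f sf c hc x y θ hθ (fun θ' h1 h2 => hgap θ hθ θ' h1 h2.symm x y (hmin θ' h1))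
    rw [hfd] at hlow
    set Fv := |((hev f.natDegree f.coeff x y : ℤ):ℝ)| with hFv
    rw [← hfd] at hlow
    rw [← hFv, hfd] at hlow
    have hF1 : (1:ℝ) ≤ Fv := by rw [hFv]; exact_mod_cast Int.one_le_abs hne
    have hF4 : 1 ≤ Fv^4 := one_le_pow₀ hF1
    have hF14 : Fv ≤ Fv^4 := le_self_pow₀ hF1 (by norm_num)
    have hN : (0:ℝ) ≤ nm x y := by exact_mod_cast nm_nonneg x y
    set N : ℝ := ((nm x y : ℤ) : ℝ) with hNd
    set L := ‖(x:ℂ) - θ*y‖ with hL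
    have hL0 : 0 ≤ L := norm_nonneg _
    have p1 : 0 ≤ l'^4 * (1/c)^(4*(d-1)) := by positivity
    have p2 : 0 ≤ (1/c)^(d-1) := by positivity
    have p3 : 0 ≤ 1 + ‖θ‖*Q + Q := by positivity
    have hexp : (l'^4 * (1/c)^(4*(d-1)) + (1/c)^(d-1) + (1 + ‖θ‖*Q + Q)) * Fv^4 = l'^4 * (1/c)^(4*(d-1)) * Fv^4 + (1/c)^(d-1) * Fv^4 + (1 + ‖θ‖*Q + Q) * Fv^4 := by ring
    rw [hexp]
    have q1 : 0 ≤ l'^4 * (1/c)^(4*(d-1)) * Fv^4 := by positivity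
    have q2 : 0 ≤ (1/c)^(d-1) * Fv^4 := by positivity
    have q3 : 1 + ‖θ‖*Q + Q ≤ (1 + ‖θ‖*Q + Q) * Fv^4 := le_mul_of_one_le_right p3 hF4
    have hyN : (y:ℝ) ≤ N := by
      have : y ≤ nm x y := (le_abs_self y).trans (le_max_right _ _)
      rw [hNd]; exact_mod_cast this
    rcases lt_or_ge (Q:ℤ) y with hyQ | hyQ
    · have h1 := hQ x y hyQ hcop
      have hyR : (0:ℝ) ≤ y := by exact_mod_cast hy
      have h2 : N ≤ l'^4 * (1/c)^(4*(d-1)) * Fv^4 := by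
        calc N = N * 1 := by ring
          _ ≤ N * (l'^4 * L^4 * (y:ℝ)^(4*d-5)) := by gcongr
          _ ≤ N * (l'^4 * L^4 * N^(4*d-5)) := by gcongr
          _ = l'^4 * (1/c)^(4*(d-1)) * (L * (c*N)^(d-1))^4 := by
            have e1 : N * N^(4*d-5) = N^(4*(d-1)) := by rw [← pow_succ']; congr 1; omega
            have e2 : (1/c)^(4*(d-1)) * c^(4*(d-1)) = 1 := by rw [← mul_pow, one_div_mul_cancel hc.ne', one_pow]
            calc _ = l'^4 * L^4 * (N * N^(4*d-5)) := by ring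
              _ = l'^4 * L^4 * N^(4*(d-1)) * ((1/c)^(4*(d-1)) * c^(4*(d-1))) := by rw [e1, e2, mul_one]
              _ = _ := by rw [mul_pow L, mul_pow c, mul_pow, ← pow_mul, ← pow_mul, mul_comm (d-1) 4]; ring
          _ ≤ _ := by gcongr
      linarith
    · have hyQR : (y:ℝ) ≤ Q := by exact_mod_cast hyQ
      have hyR : (0:ℝ) ≤ y := by exact_mod_cast hy
      rcases le_or_gt 1 L with hL1 | hL1
      · have h2 : N ≤ (1/c)^(d-1) * Fv^4 := by
          rcases le_or_gt N 1 with hn1 | hn1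
          · have : (1:ℝ) ≤ (1/c)^(d-1) := one_le_pow₀ (by rw [le_div_iff₀ hc]; linarith)
            nlinarith
          calc N ≤ N^(d-1) := le_self_pow₀ hn1.le (by omega)
            _ = 1 * N^(d-1) := by ring
            _ ≤ L * N^(d-1) := by gcongr
            _ = (1/c)^(d-1) * (L * (c*N)^(d-1)) := by
              have e2 : (1/c)^(d-1) * c^(d-1) = 1 := by rw [← mul_pow, one_div_mul_cancel hc.ne', one_pow]
              rw [mul_pow c]
              calc L * N^(d-1) = L * N^(d-1) * ((1/c)^(d-1) * c^(d-1)) := by rw [e2, mul_one]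
                _ = _ := by ring
            _ ≤ (1/c)^(d-1) * Fv := by gcongr
            _ ≤ _ := by gcongr
        linarith
      · have h3 : |(x:ℝ)| ≤ L + ‖θ‖ * |(y:ℝ)| := by
          rw [← Complex.norm_intCast, ← Complex.norm_intCast, ← norm_mul]
          calc ‖(x:ℂ)‖ = ‖((x:ℂ) - θ*y) + θ*y‖ := by ring_nf
            _ ≤ _ := norm_add_le _ _
        rw [abs_of_nonneg hyR] at h3
        have h4 : ‖θ‖ * y ≤ ‖θ‖ * Q := by gcongr
        have h5 : N ≤ 1 + ‖θ‖*Q + Q := by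
          rw [hNd]; unfold nm; push_cast
          have := norm_nonneg θ
          have h6 : 0 ≤ ‖θ‖ * Q := by positivity
          apply max_le
          · have : (0:ℝ) ≤ Q := by positivity
            linarith
          · rw [abs_of_nonneg hyR]; linarith
        linarith
  choose K hK0 hK using H
  have hRne : (croots f).Nonempty := by
    rw [← Finset.card_pos, croots_card f sf]; omega
  refine ⟨∑ θ ∈ croots f, K θ, Finset.sum_pos (fun θ _ => hK0 θ) hRne, ?_⟩
  have main : ∀ x y : ℤ, 0 ≤ y → IsCoprime x y → hev f.natDegree f.coeff x y ≠ 0 → (nm x y : ℝ) ≤ (∑ θ ∈ croots f, K θ) * |((hev f.natDegree f.coeff x y : ℤ):ℝ)|^4 := by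
    intro x y hy hcop hne
    obtain ⟨θ, hθ, hmin⟩ := exists_min_root (croots f) hRne x y
    refine (hK θ hθ x y hy hcop hne hmin).trans ?_
    gcongr
    exact Finset.single_le_sum (f := K) (fun i _ => (hK0 i).le) hθ
  intro x y hcop hne
  rcases le_total 0 y with hy | hy
  · exact main x y hy hcop hne
  · have e : hev f.natDegree f.coeff (-x) (-y) = (-1)^f.natDegree * hev f.natDegree f.coeff x y := by
      rw [← hev_scale]; congr 1 <;> ring
    have := main (-x) (-y) (by omega) hcop.neg_neg (by rw [e]; exact mul_ne_zero (by simp) hne)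
    rw [e] at this
    push_cast at this
    rw [abs_mul, abs_pow, abs_neg, abs_one, one_pow, one_mul] at this
    have e2 : nm (-x) (-y) = nm x y := by simp [nm]
    rwa [e2] at this

theorem s1 (d : ℕ) (hd : 4 ≤ d) (f : ℤ[X]) (hfd : f.natDegree = d) (sf : Squarefree (f.map (Int.castRingHom ℚ))) :
    ∃ K : ℕ, 1 ≤ K ∧ ∀ x y : ℤ, hev d f.coeff x y ≠ 0 → nm x y ≤ K * |hev d f.coeff x y|^4 := by
  have hf : f ≠ 0 := by rintro rfl; simp at hfd; omega
  suffices h : ∃ K : ℝ, ∀ x y : ℤ, IsCoprime x y → hev d f.coeff x y ≠ 0 → (nm x y : ℝ) ≤ K * |((hev d f.coeff x y : ℤ):ℝ)|^4 by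
    obtain ⟨K, hK⟩ := h
    obtain ⟨k, hk⟩ := exists_nat_ge K
    refine ⟨k+1, by omega, ?_⟩
    intro x y hne
    have hxy : x ≠ 0 ∨ y ≠ 0 := by
      by_contra hc
      push Not at hc
      rw [hc.1, hc.2, hev_y0'] at hne
      rw [zero_pow (by omega), mul_zero] at hne
      exact hne rfl
    have hg : 0 < Int.gcd x y := Nat.pos_of_ne_zero (by rw [Ne, Int.gcd_eq_zero_iff]; tauto)
    obtain ⟨g, p, q, hg, hpq, e1, e2⟩ := Int.exists_gcd_one' hg
    have e : hev d f.coeff x y = (g:ℤ)^d * hev d f.coeff p q := by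
      rw [← hev_scale, e1, e2]; congr 1 <;> ring
    have hne' : hev d f.coeff p q ≠ 0 := by
      intro h; rw [h, mul_zero] at e; exact hne e
    have h1 := hK p q (Int.isCoprime_iff_gcd_eq_one.2 hpq) hne'
    have h2 : (nm p q : ℝ) ≤ (k+1) * |((hev d f.coeff p q : ℤ):ℝ)|^4 := h1.trans (by gcongr; linarith)
    have h3 : nm p q ≤ (k+1) * |hev d f.coeff p q|^4 := by exact_mod_cast h2
    have h4 : nm x y = g * nm p q := by
      unfold nm
      rw [e1, e2, abs_mul, abs_mul, ← max_mul_of_nonneg _ _ (abs_nonneg _), abs_of_nonneg (by positivity : (0:ℤ) ≤ g)]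
      ring
    have hg1 : (1:ℤ) ≤ g := by exact_mod_cast hg
    have h5 : (g:ℤ) ≤ ((g:ℤ)^d)^4 := by
      rw [← pow_mul]; exact le_self_pow₀ hg1 (by omega)
    rw [h4, e, abs_mul, mul_pow, abs_of_nonneg (by positivity : (0:ℤ) ≤ (g:ℤ)^d)]
    push_cast
    have h6 : (0:ℤ) ≤ (k+1) * |hev d f.coeff p q|^4 := by positivity
    calc (g:ℤ) * nm p q ≤ g * ((k+1) * |hev d f.coeff p q|^4) := by gcongr
      _ ≤ ((g:ℤ)^d)^4 * ((k+1) * |hev d f.coeff p q|^4) := by gcongr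
      _ = _ := by ring
  by_cases hirr : Irreducible (f.map (Int.castRingHom ℚ))
  · obtain ⟨K, _, hK⟩ := s1_irr d hd f hfd hirr
    rw [hfd] at hK
    exact ⟨K, hK⟩
  · have hfQ : (f.map (Int.castRingHom ℚ)).natDegree = d := by
      rw [natDegree_map_eq_of_injective Int.cast_injective, hfd]
    have hfQ0 : f.map (Int.castRingHom ℚ) ≠ 0 := by rintro h; simp [h] at hfQ; omega
    have hnu : ¬ IsUnit (f.map (Int.castRingHom ℚ)) := by
      intro h; have := natDegree_eq_zero_of_isUnit h; omega
    rw [irreducible_iff] at hirr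
    push Not at hirr
    obtain ⟨a, b, hab, ha, hb⟩ := hirr hnu
    have ha0 : a ≠ 0 := by rintro rfl; simp [hab] at hfQ0
    have hb0 : b ≠ 0 := by rintro rfl; simp [hab] at hfQ0
    have pos : ∀ a : ℚ[X], a ≠ 0 → ¬ IsUnit a → 0 < a.natDegree := by
      intro a ha0 ha
      by_contra hc
      push Not at hc
      exact ha (isUnit_iff_degree_eq_zero.2 (by rw [degree_eq_natDegree ha0]; simp; omega))
    obtain ⟨K, hK0, hK⟩ := s1_red f sf a b (pos a ha0 ha) (pos b hb0 hb) hab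
    rw [hfd] at hK
    refine ⟨K, fun x y _ hne => (hK x y hne).trans ?_⟩
    have : (1:ℝ) ≤ |((hev d f.coeff x y : ℤ):ℝ)| := by exact_mod_cast Int.one_le_abs hne
    gcongr
    exact le_self_pow₀ this (by norm_num)
end PartP10c

section PartP11
open Polynomial

theorem fibre_card (a1 a2 : ℤ) (hc : IsCoprime a1 a2) (n X : ℕ) (hn : 1 ≤ n) (ha : (X:ℤ) < n * nm a1 a2)
    (S : Finset (ℤ × ℤ)) (D : ℤ) (hD : ∀ y ∈ S, a1 * y.2 - a2 * y.1 = D) (hS : ∀ y ∈ S, nm y.1 y.2 ≤ 2*X) : S.card ≤ 9 * n := by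
  classical
  rcases S.eq_empty_or_nonempty with rfl | ⟨z, hz⟩
  · simp
  obtain ⟨u, v, huv⟩ := hc
  -- k = u*(y1 - z1) + v*(y2-z2)
  have hk : ∀ y ∈ S, y.1 - z.1 = (u*(y.1-z.1) + v*(y.2-z.2)) * a1 ∧ y.2 - z.2 = (u*(y.1-z.1) + v*(y.2-z.2)) * a2 := by
    intro y hy
    have h := (hD y hy).trans (hD z hz).symm
    constructor
    · linear_combination (-(y.1-z.1)) * huv - v * h
    · linear_combination (-(y.2-z.2)) * huv + u * h
  have hcard : S.card ≤ (Finset.Icc (-(4*n:ℤ)) (4*n)).card := by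
    apply Finset.card_le_card_of_injOn (fun y => u*(y.1-z.1) + v*(y.2-z.2))
    · intro y hy
      obtain ⟨h1, h2⟩ := hk y hy
      set k := u*(y.1-z.1) + v*(y.2-z.2) with hkd
      rw [Finset.coe_Icc, Set.mem_Icc, ← abs_le]
      have b1 := hS y hy
      have b2 := hS z hz
      unfold nm at b1 b2 ha
      rw [max_le_iff] at b1 b2
      have e1 : |k| * |a1| ≤ 4*X := by
        rw [← abs_mul, ← h1]; exact (abs_sub _ _).trans (by linarith)
      have e2 : |k| * |a2| ≤ 4*X := by
        rw [← abs_mul, ← h2]; exact (abs_sub _ _).trans (by linarith)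
      have e3 : |k| * max |a1| |a2| ≤ 4*X := by
        rcases max_choice |a1| |a2| with h | h <;> rw [h] <;> assumption
      by_contra hcon
      push Not at hcon
      have hn' : (0:ℤ) < n := by exact_mod_cast hn
      have hm : 0 < max |a1| |a2| := by
        by_contra hh
        push Not at hh
        nlinarith
      nlinarith
    · intro y hy y' hy' hyy
      obtain ⟨h1, h2⟩ := hk y hy
      obtain ⟨h3, h4⟩ := hk y' hy'
      simp only at hyy
      rw [hyy] at h1 h2
      ext
      · linarith
      · linarith
  rw [Int.card_Icc] at hcard
  omega

theorem s2_root (d : ℕ) (hd : 4 ≤ d) (f : ℤ[X]) (hfd : f.natDegree = d) (sf : Squarefree (f.map (Int.castRingHom ℚ)))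
    (c : ℝ) (hc : 0 < c) (hgap : ∀ θ ∈ croots f, ∀ θ' ∈ croots f, θ ≠ θ' → ∀ x y : ℤ, ‖(x:ℂ) - θ*y‖ ≤ ‖(x:ℂ) - θ'*y‖ → c * nm x y ≤ ‖(x:ℂ) - θ'*y‖)
    (X T : ℕ) (hX : 1 ≤ X) (hT : 1 ≤ T) (θ : ℂ) (hθ : θ ∈ croots f) (S : Finset (ℤ × ℤ))
    (hS : ∀ y ∈ S, (X:ℤ) < nm y.1 y.2 ∧ nm y.1 y.2 ≤ 2*X ∧ hev d f.coeff y.1 y.2 ≠ 0 ∧ |hev d f.coeff y.1 y.2| ≤ (T:ℤ)^d)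
    (hmin : ∀ y ∈ S, ∀ θ' ∈ croots f, ‖(y.1:ℂ) - θ*y.2‖ ≤ ‖(y.1:ℂ) - θ'*y.2‖) :
    (X:ℝ)^(d-2) * S.card ≤ 72 / c^(d-1) * T^d + 9 * T * X^(d-2) := by
  classical
  rcases S.eq_empty_or_nonempty with rfl | ⟨z, hz⟩
  · simp; positivity
  have hXR : (1:ℝ) ≤ X := by exact_mod_cast hX
  set ε : ℝ := T^d / (c*X)^(d-1) with hε
  have hε0 : 0 ≤ ε := by positivity
  have hL : ∀ y ∈ S, ‖(y.1:ℂ) - θ*y.2‖ ≤ ε := by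
    intro y hy
    obtain ⟨h1, h2, h3, h4⟩ := hS y hy
    have hlow := lower_F f sf c hc y.1 y.2 θ hθ (fun θ' h1 h2 => hgap θ hθ θ' h1 h2.symm y.1 y.2 (hmin y hy θ' h1))
    rw [hfd] at hlow
    rw [hε, le_div_iff₀ (by positivity)]
    have h1R : (X:ℝ) ≤ nm y.1 y.2 := by exact_mod_cast h1.le
    have h4R : |((hev d f.coeff y.1 y.2 : ℤ):ℝ)| ≤ (T:ℝ)^d := by exact_mod_cast h4
    refine le_trans ?_ (hlow.trans h4R)
    gcongr
  obtain ⟨z1, z2, z3, z4⟩ := hS z hz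
  have hz0 : 0 < Int.gcd z.1 z.2 := by
    apply Nat.pos_of_ne_zero
    rw [Ne, Int.gcd_eq_zero_iff]
    rintro ⟨h1, h2⟩
    rw [h1, h2] at z1
    simp [nm] at z1
    omega
  obtain ⟨n, p, q, hn, hpq, e1, e2⟩ := Int.exists_gcd_one' hz0
  have hnT : n ≤ T := by
    have e : hev d f.coeff z.1 z.2 = (n:ℤ)^d * hev d f.coeff p q := by
      rw [← hev_scale, e1, e2]; congr 1 <;> ring
    have hne' : hev d f.coeff p q ≠ 0 := by
      intro h; rw [h, mul_zero] at e; exact z3 e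
    have h1 := Int.one_le_abs hne'
    rw [e, abs_mul, abs_of_nonneg (by positivity : (0:ℤ) ≤ (n:ℤ)^d)] at z4
    have h2 : (n:ℤ)^d ≤ (T:ℤ)^d := le_trans (le_mul_of_one_le_right (by positivity) h1) z4
    have h3 : n^d ≤ T^d := by exact_mod_cast h2
    exact (Nat.pow_le_pow_iff_left (by omega)).1 h3
  have hnz : nm z.1 z.2 = n * nm p q := by
    unfold nm
    rw [e1, e2, abs_mul, abs_mul, ← max_mul_of_nonneg _ _ (abs_nonneg _), abs_of_nonneg (by positivity : (0:ℤ) ≤ n)]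
    ring
  have hnR : (1:ℝ) ≤ n := by exact_mod_cast hn
  set D : ℤ := ⌊4*X*ε/n⌋ with hD
  have hD0 : 0 ≤ D := Int.floor_nonneg.2 (by positivity)
  have himg : (S.image (fun y => p * y.2 - q * y.1)).card ≤ (Finset.Icc (-D) D).card := by
    apply Finset.card_le_card
    intro w hw
    rw [Finset.mem_image] at hw
    obtain ⟨y, hy, rfl⟩ := hw
    rw [Finset.mem_Icc, ← abs_le, hD, Int.le_floor]
    obtain ⟨h1, h2, h3, h4⟩ := hS y hy
    have hy2 : |(y.2:ℝ)| ≤ 2*X := by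
      have : |y.2| ≤ 2*X := (le_max_right _ _).trans h2
      exact_mod_cast this
    have hq2 : n * |(q:ℝ)| ≤ 2*X := by
      have : n * |q| ≤ 2*X := by
        refine le_trans ?_ (hnz ▸ z2)
        gcongr
        exact le_max_right _ _
      exact_mod_cast this
    have hzL : n * ‖(p:ℂ) - θ*q‖ ≤ ε := by
      have := hL z hz
      have e3 : (z.1:ℂ) - θ * z.2 = n * ((p:ℂ) - θ*q) := by
        rw [e1, e2]; push_cast; ring
      rwa [e3, norm_mul, Complex.norm_natCast] at this
    have key : |((p * y.2 - q * y.1 : ℤ):ℝ)| ≤ ‖(p:ℂ) - θ*q‖ * |(y.2:ℝ)| + |(q:ℝ)| * ‖(y.1:ℂ) - θ*y.2‖ := by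
      rw [← Complex.norm_intCast, ← Complex.norm_intCast y.2, ← Complex.norm_intCast q, ← norm_mul, ← norm_mul]
      calc _ = ‖((p:ℂ) - θ*q) * y.2 - q * ((y.1:ℂ) - θ*y.2)‖ := by push_cast; ring_nf
        _ ≤ _ := norm_sub_le _ _
    have hn0 : (0:ℝ) < n := by linarith
    rw [le_div_iff₀ hn0]
    push_cast at key ⊢
    calc |(p:ℝ) * y.2 - q * y.1| * n ≤ (‖(p:ℂ) - θ*q‖ * |(y.2:ℝ)| + |(q:ℝ)| * ‖(y.1:ℂ) - θ*y.2‖) * n := by gcongr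
      _ = (n * ‖(p:ℂ) - θ*q‖) * |(y.2:ℝ)| + (n * |(q:ℝ)|) * ‖(y.1:ℂ) - θ*y.2‖ := by ring
      _ ≤ ε * (2*X) + (2*X) * ε := by gcongr; exact hL y hy
      _ = _ := by ring
  have hcard : S.card ≤ 9*n * (S.image (fun y => p * y.2 - q * y.1)).card := by
    apply Finset.card_le_mul_card_image
    intro b _
    apply fibre_card p q (Int.isCoprime_iff_gcd_eq_one.2 hpq) n X hn (hnz ▸ z1) _ b
    · intro y hy; exact (Finset.mem_filter.1 hy).2
    · intro y hy; exact (hS y (Finset.mem_filter.1 hy).1).2.1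
  have hI : ((Finset.Icc (-D) D).card : ℝ) ≤ 2 * (4*X*ε/n) + 1 := by
    rw [Int.card_Icc]
    have h1 : (((D + 1 - -D).toNat : ℕ) : ℤ) = 2*D+1 := by rw [Int.toNat_of_nonneg (by omega)]; ring
    have h2 : (((D + 1 - -D).toNat : ℕ) : ℝ) = 2*D+1 := by exact_mod_cast h1
    rw [h2]
    have := Int.floor_le (4*X*ε/n)
    rw [← hD] at this
    linarith
  have hfin : (S.card : ℝ) ≤ 72 * (X * ε) + 9*T := by
    have hn0 : (0:ℝ) < n := by linarith
    have hTn : (n:ℝ) ≤ T := by exact_mod_cast hnT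
    calc (S.card:ℝ) ≤ 9*n * (S.image (fun y => p * y.2 - q * y.1)).card := by exact_mod_cast hcard
      _ ≤ 9*n * (Finset.Icc (-D) D).card := by gcongr
      _ ≤ 9*n * (2 * (4*X*ε/n) + 1) := by gcongr
      _ = 72 * (X * ε) + 9*n := by field_simp; ring
      _ ≤ _ := by gcongr
  calc (X:ℝ)^(d-2) * S.card ≤ X^(d-2) * (72 * (X * ε) + 9*T) := by gcongr
    _ = _ := by
      rw [hε, mul_pow]
      have : (X:ℝ)^(d-1) = X^(d-2) * X := by rw [← pow_succ]; congr 1; omega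
      rw [this]
      have hX0 : (X:ℝ) ≠ 0 := by positivity
      have hXp : (X:ℝ)^(d-2) ≠ 0 := by positivity
      field_simp

theorem s2 (d : ℕ) (hd : 4 ≤ d) (f : ℤ[X]) (hfd : f.natDegree = d) (sf : Squarefree (f.map (Int.castRingHom ℚ))) :
    ∃ K : ℕ, 1 ≤ K ∧ ∀ X T : ℕ, 1 ≤ X → 1 ≤ T → ∀ S : Finset (ℤ × ℤ),
      (∀ y ∈ S, (X:ℤ) < nm y.1 y.2 ∧ nm y.1 y.2 ≤ 2*X ∧ hev d f.coeff y.1 y.2 ≠ 0 ∧ |hev d f.coeff y.1 y.2| ≤ (T:ℤ)^d) →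
      X^(d-2) * S.card ≤ K * (T * X^(d-2) + T^d) := by
  classical
  obtain ⟨c, hc, hc1, hgap⟩ := gap (croots f)
  obtain ⟨k, hk⟩ := exists_nat_ge (72 / c^(d-1) + 9)
  have hRne : (croots f).Nonempty := by
    rw [← Finset.card_pos, croots_card f sf]; omega
  refine ⟨d*(k+1), Nat.one_le_iff_ne_zero.2 (by positivity), ?_⟩
  intro X T hX hT S hS
  have hcov : S ⊆ (croots f).biUnion (fun θ => S.filter (fun y => ∀ θ' ∈ croots f, ‖(y.1:ℂ) - θ*y.2‖ ≤ ‖(y.1:ℂ) - θ'*y.2‖)) := by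
    intro y hy
    obtain ⟨θ, hθ, hmin⟩ := exists_min_root (croots f) hRne y.1 y.2
    rw [Finset.mem_biUnion]
    exact ⟨θ, hθ, Finset.mem_filter.2 ⟨hy, hmin⟩⟩
  have h1 : S.card ≤ ∑ θ ∈ croots f, (S.filter (fun y => ∀ θ' ∈ croots f, ‖(y.1:ℂ) - θ*y.2‖ ≤ ‖(y.1:ℂ) - θ'*y.2‖)).card :=
    (Finset.card_le_card hcov).trans Finset.card_biUnion_le
  have h2 : ∀ θ ∈ croots f, X^(d-2) * (S.filter (fun y => ∀ θ' ∈ croots f, ‖(y.1:ℂ) - θ*y.2‖ ≤ ‖(y.1:ℂ) - θ'*y.2‖)).card ≤ (k+1) * (T * X^(d-2) + T^d) := by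
    intro θ hθ
    have := s2_root d hd f hfd sf c hc hgap X T hX hT θ hθ (S.filter (fun y => ∀ θ' ∈ croots f, ‖(y.1:ℂ) - θ*y.2‖ ≤ ‖(y.1:ℂ) - θ'*y.2‖))
      (fun y hy => hS y (Finset.mem_filter.1 hy).1) (fun y hy => (Finset.mem_filter.1 hy).2)
    have h3 : 72 / c^(d-1) * (T:ℝ)^d + 9 * T * X^(d-2) ≤ (k+1) * (T * X^(d-2) + T^d) := by
      have p1 : 0 ≤ 72 / c^(d-1) := by positivity
      have e1 : 72 / c^(d-1) * (T:ℝ)^d ≤ (k+1) * T^d := by gcongr; linarith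
      have e2 : 9 * ((T:ℝ) * X^(d-2)) ≤ (k+1) * (T * X^(d-2)) := by gcongr; linarith
      linarith
    exact_mod_cast this.trans h3
  calc X^(d-2) * S.card ≤ X^(d-2) * ∑ θ ∈ croots f, (S.filter (fun y => ∀ θ' ∈ croots f, ‖(y.1:ℂ) - θ*y.2‖ ≤ ‖(y.1:ℂ) - θ'*y.2‖)).card := by gcongr
    _ ≤ ∑ θ ∈ croots f, (k+1) * (T * X^(d-2) + T^d) := by rw [Finset.mul_sum]; exact Finset.sum_le_sum h2
    _ = _ := by rw [Finset.sum_const, croots_card f sf, hfd, smul_eq_mul]; ring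

theorem s2' (d : ℕ) (hd : 4 ≤ d) (f : ℤ[X]) (hfd : f.natDegree = d) (sf : Squarefree (f.map (Int.castRingHom ℚ))) :
    ∃ K : ℕ, 1 ≤ K ∧ ∀ X T J : ℕ, 1 ≤ X → 1 ≤ T → K * T^(4*d) ≤ X * 2^J → ∀ S : Finset (ℤ × ℤ),
      (∀ y ∈ S, (X:ℤ) < nm y.1 y.2 ∧ hev d f.coeff y.1 y.2 ≠ 0 ∧ |hev d f.coeff y.1 y.2| ≤ (T:ℤ)^d) →
      X^(d-2) * S.card ≤ K * J * (T * X^(d-2) + T^d) := by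
  classical
  obtain ⟨K1, hK1, H1⟩ := s1 d hd f hfd sf
  obtain ⟨K2, hK2, H2⟩ := s2 d hd f hfd sf
  refine ⟨K1*K2, Nat.one_le_iff_ne_zero.2 (by positivity), ?_⟩
  intro X T J hX hT hJ S hS
  have hup : ∀ y ∈ S, nm y.1 y.2 ≤ X * 2^J := by
    intro y hy
    obtain ⟨h1, h2, h3⟩ := hS y hy
    have h4 := H1 y.1 y.2 h2
    have h5 : (K1:ℤ) * |hev d f.coeff y.1 y.2|^4 ≤ K1 * ((T:ℤ)^d)^4 := by gcongr
    have h6 : K1 * T^(4*d) ≤ X * 2^J := le_trans (Nat.mul_le_mul_right _ (Nat.le_mul_of_pos_right _ hK2)) hJ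
    have h7 : (K1:ℤ) * ((T:ℤ)^d)^4 ≤ X * 2^J := by
      rw [← pow_mul, mul_comm d 4]; exact_mod_cast h6
    linarith
  set P : ℕ → Finset (ℤ × ℤ) := fun i => S.filter (fun y => ((X*2^i : ℕ):ℤ) < nm y.1 y.2 ∧ nm y.1 y.2 ≤ 2 * ((X*2^i : ℕ):ℤ)) with hP
  have hcov : S ⊆ (Finset.range J).biUnion P := by
    intro y hy
    rw [Finset.mem_biUnion]
    have hex : ∃ i, nm y.1 y.2 ≤ X * 2^i := ⟨J, hup y hy⟩
    set i := Nat.find hex with hi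
    have hi1 : nm y.1 y.2 ≤ X * 2^i := Nat.find_spec hex
    have hi0 : i ≠ 0 := by
      intro h; rw [h] at hi1
      have := (hS y hy).1
      simp at hi1
      omega
    have hiJ : i ≤ J := Nat.find_min' hex (hup y hy)
    have hi2 : ¬ nm y.1 y.2 ≤ X * 2^(i-1) := Nat.find_min hex (by omega)
    refine ⟨i-1, Finset.mem_range.2 (by omega), ?_⟩
    rw [hP, Finset.mem_filter]
    refine ⟨hy, ?_, ?_⟩
    · push Not at hi2; push_cast; exact hi2
    · refine hi1.trans (le_of_eq ?_)
      obtain ⟨k, hk⟩ := Nat.exists_eq_succ_of_ne_zero hi0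
      rw [hk]; push_cast; rw [Nat.succ_eq_add_one, pow_succ]; ring
  have hpiece : ∀ i ∈ Finset.range J, X^(d-2) * (P i).card ≤ K2 * (T * X^(d-2) + T^d) := by
    intro i _
    have h2p : 1 ≤ 2^i := Nat.one_le_two_pow
    have := H2 (X*2^i) T (by nlinarith) hT (P i) (by
      intro y hy
      rw [hP, Finset.mem_filter] at hy
      obtain ⟨h1, h2, h3⟩ := hS y hy.1
      exact ⟨hy.2.1, hy.2.2, h2, h3⟩)
    rw [mul_pow] at this
    have h3 : 1 ≤ (2^i)^(d-2) := Nat.one_le_pow _ _ h2p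
    apply Nat.le_of_mul_le_mul_left (c := (2^i)^(d-2)) _ (by positivity)
    calc (2^i)^(d-2) * (X^(d-2) * (P i).card) = X^(d-2) * (2^i)^(d-2) * (P i).card := by ring
      _ ≤ _ := this
      _ ≤ K2 * (T * (X^(d-2) * (2^i)^(d-2)) + (2^i)^(d-2) * T^d) := by
        gcongr; exact Nat.le_mul_of_pos_left _ (by positivity)
      _ = _ := by ring
  calc X^(d-2) * S.card ≤ X^(d-2) * ∑ i ∈ Finset.range J, (P i).card := by
        gcongr; exact (Finset.card_le_card hcov).trans Finset.card_biUnion_le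
    _ ≤ ∑ i ∈ Finset.range J, K2 * (T * X^(d-2) + T^d) := by rw [Finset.mul_sum]; exact Finset.sum_le_sum hpiece
    _ = J * (K2 * (T * X^(d-2) + T^d)) := by rw [Finset.sum_const, Finset.card_range, smul_eq_mul]
    _ ≤ K1 * (J * (K2 * (T * X^(d-2) + T^d))) := Nat.le_mul_of_pos_left _ hK1
    _ = _ := by ring
end PartP11

section PartP12
theorem hev_mul_lin_bd (d : ℕ) (a b : ℤ) (c : ℕ → ℤ) (A H : ℤ) (ha : |a| ≤ A) (hb : |b| ≤ A)
    (hc : ∀ i ≤ d, |c i| ≤ H) :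
    ∃ c' : ℕ → ℤ, (∀ (R : Type) [CommRing R] (x y : R),
      hev (d+1) c' x y = (a * x + b * y) * hev d c x y) ∧ ∀ i ≤ d + 1, |c' i| ≤ 2 * A * H := by
  have hA : 0 ≤ A := (abs_nonneg a).trans ha
  have hH : 0 ≤ H := (abs_nonneg _).trans (hc 0 (by omega))
  refine ⟨fun i => (if i = 0 then 0 else a * c (i-1)) + (if i ≤ d then b * c i else 0), ?_, ?_⟩
  · intro R _ x y
    rw [hev_add (c := fun i => (if i = 0 then 0 else a * c (i-1)))
      (c' := fun i => (if i ≤ d then b * c i else 0)), hev_succ]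
    have h1 : hev d (fun i => (if i + 1 = 0 then (0:ℤ) else a * c (i+1-1))) x y = a * hev d c x y := by
      rw [← hev_smul]; simp
    have h2 : hev (d+1) (fun i => (if i ≤ d then b * c i else 0)) x y = y * (b * hev d c x y) := by
      unfold hev
      rw [Finset.sum_range_succ]
      simp only [Finset.mul_sum]
      have : ¬ (d + 1 ≤ d) := by omega
      simp only [this, if_false]
      simp only [Int.cast_zero, zero_mul, add_zero]
      apply Finset.sum_congr rfl
      intro i hi
      have hi' : i ≤ d := by simp at hi; omega
      simp only [hi', if_true]
      have : d + 1 - i = (d - i) + 1 := by omega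
      rw [this]; push_cast; ring
    rw [h1, h2]; simp; ring
  · intro i hi
    have k1 : |(if i = 0 then 0 else a * c (i-1))| ≤ A * H := by
      split_ifs with h
      · simp; positivity
      · rw [abs_mul]; exact mul_le_mul ha (hc _ (by omega)) (abs_nonneg _) hA
    have k2 : |(if i ≤ d then b * c i else 0)| ≤ A * H := by
      split_ifs with h
      · rw [abs_mul]; exact mul_le_mul hb (hc _ (by omega)) (abs_nonneg _) hA
      · simp; positivity
    have := abs_add_le (if i = 0 then 0 else a * c (i-1)) (if i ≤ d then b * c i else 0)
    dsimp only
    linarith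

theorem hev_comp_bd (d : ℕ) (a b e f : ℤ) (A H : ℤ) (ha : |a| ≤ A) (hb : |b| ≤ A) (he : |e| ≤ A)
    (hf : |f| ≤ A) (c : ℕ → ℤ) (hc : ∀ i ≤ d, |c i| ≤ H) :
    ∃ c' : ℕ → ℤ, (∀ (R : Type) [CommRing R] (x y : R),
      hev d c' x y = hev d c (a * x + b * y) (e * x + f * y)) ∧
      ∀ i ≤ d, |c' i| ≤ (d+1) * H * (2 * A)^d := by
  have hA : 0 ≤ A := (abs_nonneg a).trans ha
  induction d generalizing c with
  | zero => exact ⟨c, fun R _ x y => by simp [hev_zero], fun i hi => by simpa using hc i hi⟩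
  | succ d ih =>
    have hH : 0 ≤ H := (abs_nonneg _).trans (hc 0 (by omega))
    obtain ⟨c1, h1, k1⟩ := ih (fun i => c (i+1)) (fun i hi => hc (i+1) (by omega))
    obtain ⟨c2, h2, k2⟩ := hev_mul_lin_bd d a b c1 A _ ha hb k1
    have hp : ∀ n : ℕ, ∃ c3 : ℕ → ℤ, (∀ (R : Type) [CommRing R] (x y : R),
      hev n c3 x y = (e * x + f * y)^n) ∧ ∀ i ≤ n, |c3 i| ≤ (2*A)^n := by
      intro n
      induction n with
      | zero => exact ⟨fun _ => 1, fun R _ x y => by simp [hev_zero], by simp⟩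
      | succ n ih =>
        obtain ⟨c3, h3, k3⟩ := ih
        obtain ⟨c4, h4, k4⟩ := hev_mul_lin_bd n e f c3 A _ he hf k3
        exact ⟨c4, fun R _ x y => by rw [h4, h3]; ring, fun i hi => (k4 i hi).trans (le_of_eq (by ring))⟩
    obtain ⟨c3, h3, k3⟩ := hp (d+1)
    refine ⟨fun i => c2 i + c 0 * c3 i, fun R _ x y => ?_, fun i hi => ?_⟩
    · rw [hev_add (c := c2) (c' := fun i => c 0 * c3 i), hev_smul, h2, h1, h3, hev_succ]
    · have q1 := k2 i hi
      have q2 : |c 0 * c3 i| ≤ H * (2*A)^(d+1) := by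
        rw [abs_mul]
        exact mul_le_mul (hc 0 (by omega)) (k3 i hi) (abs_nonneg _) hH
      have := abs_add_le (c2 i) (c 0 * c3 i)
      dsimp only
      push_cast
      have e1 : 2 * A * ((d+1) * H * (2 * A)^d) = (d+1) * H * (2*A)^(d+1) := by ring
      rw [e1] at q1
      linarith

theorem span_pattern {V Z : Type*} [AddCommGroup V] [Module ℚ V] [FiniteDimensional ℚ V] (n : ℕ)
    (hn : Module.finrank ℚ V ≤ n) (s : Finset Z) (z0 : Z) (hz0 : z0 ∈ s) (v : Z → V) :
    ∃ π : Fin n → Z, (∀ i, π i ∈ s) ∧ ∀ φ : V →ₗ[ℚ] ℚ, (∀ i, φ (v (π i)) = 0) →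
      ∀ z ∈ s, φ (v z) = 0 := by
  classical
  obtain ⟨F, hF1, hF2, hF3⟩ := Submodule.exists_fun_fin_finrank_span_eq ℚ (v '' (s : Set Z))
  have hrn : Module.finrank ℚ (Submodule.span ℚ (v '' (s : Set Z))) ≤ n := (Submodule.finrank_le _).trans hn
  choose G hG1 hG2 using hF1
  refine ⟨fun i => if h : i.1 < Module.finrank ℚ (Submodule.span ℚ (v '' (s : Set Z))) then G ⟨i.1, h⟩ else z0, ?_, ?_⟩
  · intro i
    dsimp only
    split_ifs with h
    · exact hG1 _
    · exact hz0
  · intro φ hφ z hz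
    have h1 : ∀ w ∈ Set.range F, φ w = 0 := by
      rintro _ ⟨j, rfl⟩
      have := hφ ⟨j.1, by have := j.2; omega⟩
      simp only [j.2, dif_pos] at this
      rw [hG2] at this
      exact this
    have h2 : Submodule.span ℚ (Set.range F) ≤ LinearMap.ker φ := by
      rw [Submodule.span_le]
      intro w hw
      exact h1 w hw
    have h3 : v z ∈ Submodule.span ℚ (v '' (s : Set Z)) := Submodule.subset_span ⟨z, hz, rfl⟩
    rw [← hF2] at h3
    exact h2 h3

/-- pattern for pairs of forms -/
theorem form_pattern (d : ℕ) (s : Finset (ℤ × ℤ)) (a0 : ℤ × ℤ) (ha0 : a0 ∈ s) (k : ℤ × ℤ → ℤ × ℤ) :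
    ∃ π : Fin (2*d+2) → ℤ × ℤ, (∀ i, π i ∈ s) ∧ ∀ g f : ℕ → ℤ,
      (∀ i, hev d g (π i).1 (π i).2 = hev d f (k (π i)).1 (k (π i)).2) →
      ∀ a ∈ s, hev d g a.1 a.2 = hev d f (k a).1 (k a).2 := by
  obtain ⟨π, h1, h2⟩ := span_pattern (V := Fin (d+1) ⊕ Fin (d+1) → ℚ) (2*d+2) (by simp; omega) s a0 ha0
    (fun a => Sum.elim (fun i : Fin (d+1) => (a.1:ℚ)^(i:ℕ) * (a.2:ℚ)^(d-i))
      (fun i : Fin (d+1) => ((k a).1:ℚ)^(i:ℕ) * ((k a).2:ℚ)^(d-i)))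
  refine ⟨π, h1, fun g f hgf a ha => ?_⟩
  let φ : (Fin (d+1) ⊕ Fin (d+1) → ℚ) →ₗ[ℚ] ℚ :=
    ∑ i : Fin (d+1), ((g i : ℚ) • LinearMap.proj (Sum.inl i) - (f i : ℚ) • LinearMap.proj (Sum.inr i))
  have key : ∀ a : ℤ × ℤ, φ (Sum.elim (fun i : Fin (d+1) => (a.1:ℚ)^(i:ℕ) * (a.2:ℚ)^(d-i))
      (fun i : Fin (d+1) => ((k a).1:ℚ)^(i:ℕ) * ((k a).2:ℚ)^(d-i))) =
      ((hev d g a.1 a.2 - hev d f (k a).1 (k a).2 : ℤ) : ℚ) := by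
    intro a
    push_cast
    rw [← hev_intCast, ← hev_intCast]
    simp only [φ, hev, Finset.sum_range, LinearMap.sum_apply, LinearMap.sub_apply, LinearMap.smul_apply,
      LinearMap.proj_apply, Sum.elim_inl, Sum.elim_inr, smul_eq_mul, Finset.sum_sub_distrib]
    congr 1 <;> (apply Finset.sum_congr rfl; intro i _; ring)
  have := h2 φ (fun i => by rw [key, hgf i]; simp) a ha
  rw [key] at this
  have h3 : hev d g a.1 a.2 - hev d f (k a).1 (k a).2 = 0 := by exact_mod_cast this
  linarith

theorem quad_three (α β γ x1 y1 x2 y2 x3 y3 : ℂ) (h1 : α*x1^2+β*x1*y1+γ*y1^2 = 0)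
    (h2 : α*x2^2+β*x2*y2+γ*y2^2 = 0) (h3 : α*x3^2+β*x3*y3+γ*y3^2 = 0)
    (h12 : x1*y2-x2*y1 ≠ 0) (h13 : x1*y3-x3*y1 ≠ 0) (h23 : x2*y3-x3*y2 ≠ 0) :
    α = 0 ∧ β = 0 ∧ γ = 0 := by
  have D : (x1*y2-x2*y1)*(x1*y3-x3*y1)*(x2*y3-x3*y2) ≠ 0 := mul_ne_zero (mul_ne_zero h12 h13) h23
  refine ⟨?_, ?_, ?_⟩
  · apply (mul_eq_zero.mp (?_ : α * ((x1*y2-x2*y1)*(x1*y3-x3*y1)*(x2*y3-x3*y2)) = 0)).resolve_right D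
    linear_combination (x2*y3-x3*y2)*y2*y3*h1 - (x1*y3-x3*y1)*y1*y3*h2 + (x1*y2-x2*y1)*y1*y2*h3
  · apply (mul_eq_zero.mp (?_ : β * ((x1*y2-x2*y1)*(x1*y3-x3*y1)*(x2*y3-x3*y2)) = 0)).resolve_right D
    linear_combination -(x2*y3-x3*y2)*(x2*y3+x3*y2)*h1 + (x1*y3-x3*y1)*(x1*y3+x3*y1)*h2 - (x1*y2-x2*y1)*(x1*y2+x2*y1)*h3
  · apply (mul_eq_zero.mp (?_ : γ * ((x1*y2-x2*y1)*(x1*y3-x3*y1)*(x2*y3-x3*y2)) = 0)).resolve_right D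
    linear_combination (x2*y3-x3*y2)*x2*x3*h1 - (x1*y3-x3*y1)*x1*x3*h2 + (x1*y2-x2*y1)*x1*x2*h3
end PartP12

section PartP12b
open Polynomial

theorem hev_root_form (g : ℤ[X]) (d : ℕ) (hd : 1 ≤ d) (hgd : g.natDegree = d) (sg : Squarefree (g.map (Int.castRingHom ℚ)))
    (x y : ℂ) (h : hev d g.coeff x y = 0) (hne : x ≠ 0 ∨ y ≠ 0) : y ≠ 0 ∧ x / y ∈ croots g := by
  have g0 : g ≠ 0 := by rintro rfl; simp at hgd; omega
  subst hgd
  have hy : y ≠ 0 := by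
    rintro rfl
    rw [hev_y0'] at h
    have hx : x ≠ 0 := by simpa using hne
    have : (g.coeff g.natDegree : ℂ) ≠ 0 := by exact_mod_cast leadingCoeff_ne_zero.2 g0
    exact mul_ne_zero this (pow_ne_zero _ hx) h
  refine ⟨hy, ?_⟩
  rw [hev_prod g sg] at h
  have h1 : (g.leadingCoeff : ℂ) ≠ 0 := by exact_mod_cast leadingCoeff_ne_zero.2 g0
  have h2 := (mul_eq_zero.mp h).resolve_left h1
  rw [Finset.prod_eq_zero_iff] at h2
  obtain ⟨θ, hθ, h3⟩ := h2
  have : x / y = θ := by field_simp; linear_combination h3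
  rwa [this]

theorem nonprop (g : ℤ[X]) (d : ℕ) (hd : 3 ≤ d) (hgd : g.natDegree = d) (sg : Squarefree (g.map (Int.castRingHom ℚ)))
    (s : Finset ℕ) (a b c e : ℕ → ℤ) (hpos : ∀ m ∈ s, 0 < m)
    (hdet : ∀ m ∈ s, a m * e m - b m * c m = m ∨ a m * e m - b m * c m = -m)
    (hsq : ∀ m ∈ s, ∀ m' ∈ s, m ≠ m' → ¬ ∃ k : ℤ, k^2 = m * m')
    (m0 : ℕ) (hm0 : m0 ∈ s)
    (hz : ∀ m ∈ s, ∀ x y : ℂ, hev d g.coeff (a m0 * x + b m0 * y) (c m0 * x + e m0 * y) = 0 →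
      hev d g.coeff (a m * x + b m * y) (c m * x + e m * y) = 0) : s.card ≤ d^3 := by
  classical
  by_contra hcard
  push Not at hcard
  have hcr : (croots g).card = d := by rw [croots_card g sg, hgd]
  have g0 : g ≠ 0 := by rintro rfl; simp at hgd; omega
  obtain ⟨t, ht, htc⟩ := Finset.exists_subset_card_eq (s := croots g) (n := 3) (by omega)
  obtain ⟨θ1, θ2, θ3, n12, n13, n23, rfl⟩ := Finset.card_eq_three.1 htc
  have det0 : ∀ m ∈ s, (a m * e m - b m * c m : ℂ) ≠ 0 := by
    intro m hm
    have := hpos m hm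
    have : a m * e m - b m * c m ≠ 0 := by rcases hdet m hm with h | h <;> rw [h] <;> simp <;> omega
    exact_mod_cast this
  set D0 : ℂ := (a m0 * e m0 - b m0 * c m0 : ℂ) with hD0
  have hD0' : D0 ≠ 0 := det0 m0 hm0
  -- points
  let zx : ℂ → ℂ := fun θ => e m0 * θ - b m0
  let zy : ℂ → ℂ := fun θ => -c m0 * θ + a m0
  have zdet : ∀ θ θ', zx θ * zy θ' - zx θ' * zy θ = D0 * (θ - θ') := by
    intro θ θ'; simp only [zx, zy, hD0]; ring
  have hzz : ∀ θ ∈ croots g, ∀ m ∈ s, (c m * zx θ + e m * zy θ) ≠ 0 ∧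
      (a m * zx θ + b m * zy θ) / (c m * zx θ + e m * zy θ) ∈ croots g := by
    intro θ hθ m hm
    apply hev_root_form g d (by omega) hgd sg
    · apply hz m hm
      have e1 : a m0 * zx θ + b m0 * zy θ = D0 * θ := by simp only [zx, zy, hD0]; ring
      have e2 : c m0 * zx θ + e m0 * zy θ = D0 * 1 := by simp only [zx, zy, hD0]; ring
      rw [e1, e2, hev_scale, ← hgd, hev_one, (mem_croots g0 θ).1 hθ, mul_zero]
    · by_contra hcon
      push Not at hcon
      obtain ⟨q1, q2⟩ := hcon
      have r1 : (a m * e m - b m * c m : ℂ) * zx θ = 0 := by linear_combination e m * q1 - b m * q2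
      have r2 : (a m * e m - b m * c m : ℂ) * zy θ = 0 := by linear_combination a m * q2 - c m * q1
      have r1' := (mul_eq_zero.mp r1).resolve_left (det0 m hm)
      have r2' := (mul_eq_zero.mp r2).resolve_left (det0 m hm)
      have : D0 = 0 := by
        have : D0 = a m0 * zx θ - a m0 * (zx θ) + c m0 * zx θ + e m0 * zy θ := by simp only [zx, zy, hD0]; ring
        rw [this, r1', r2']; ring
      exact hD0' this
  let φ : ℂ → ℕ → ℂ := fun θ m => (a m * zx θ + b m * zy θ) / (c m * zx θ + e m * zy θ)
  obtain ⟨m, hm, m', hm', hne, heq⟩ := Finset.exists_ne_map_eq_of_card_lt_of_maps_to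
    (t := croots g ×ˢ croots g ×ˢ croots g) (s := s) (f := fun m => (φ θ1 m, φ θ2 m, φ θ3 m))
    (by simp only [Finset.card_product, hcr]; calc _ = d^3 := by ring
          _ < _ := hcard)
    (by
      intro m hm
      simp only [Finset.mem_coe, Finset.mem_product]
      exact ⟨(hzz θ1 (ht (by simp)) m hm).2, (hzz θ2 (ht (by simp)) m hm).2, (hzz θ3 (ht (by simp)) m hm).2⟩)
  simp only [Prod.mk.injEq] at heq
  have quad : ∀ θ ∈ croots g, φ θ m = φ θ m' →
      (a m * c m' - c m * a m' : ℂ) * (zx θ)^2 + (a m * e m' + b m * c m' - c m * b m' - e m * a m' : ℂ) * zx θ * zy θ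
        + (b m * e m' - e m * b m' : ℂ) * (zy θ)^2 = 0 := by
    intro θ hθ h
    simp only [φ] at h
    rw [div_eq_div_iff (hzz θ hθ m hm).1 (hzz θ hθ m' hm').1] at h
    linear_combination h
  obtain ⟨A1, A2, A3⟩ := quad_three _ _ _ _ _ _ _ _ _ (quad θ1 (ht (by simp)) heq.1)
    (quad θ2 (ht (by simp)) heq.2.1) (quad θ3 (ht (by simp)) heq.2.2)
    (by rw [zdet]; exact mul_ne_zero hD0' (sub_ne_zero.2 n12))
    (by rw [zdet]; exact mul_ne_zero hD0' (sub_ne_zero.2 n13))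
    (by rw [zdet]; exact mul_ne_zero hD0' (sub_ne_zero.2 n23))
  norm_cast at A1 A2 A3
  have sq : (e m * a m' - b m * c m')^2 = (a m * e m - b m * c m) * (a m' * e m' - b m' * c m') := by
    linear_combination (-(e m * a m' - b m * c m')) * A2 - (b m * e m' - e m * b m') * A1
  have p1 : (0:ℤ) < m := by exact_mod_cast hpos m hm
  have p2 : (0:ℤ) < m' := by exact_mod_cast hpos m' hm'
  have p3 : (0:ℤ) < m * m' := mul_pos p1 p2
  apply hsq m hm m' hm' hne
  rcases hdet m hm with h1 | h1 <;> rcases hdet m' hm' with h2 | h2 <;> rw [h1, h2] at sq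
  · exact ⟨_, sq⟩
  · nlinarith [sq_nonneg (e m * a m' - b m * c m')]
  · nlinarith [sq_nonneg (e m * a m' - b m * c m')]
  · exact ⟨_, by rw [sq]; ring⟩
end PartP12b

section PartP12c
open Polynomial

/-- an instance: a lattice of index `m` with many matched vectors -/
def Inst (d : ℕ) (f g : ℤ[X]) (N R C g0 A n : ℕ) (u1 u2 : ℤ) (m : ℕ) (E B : Fin 4 → ℤ) (W : Finset (ℤ × ℤ))
    (k : ℤ × ℤ → ℤ × ℤ) : Prop :=
  (E 0 * E 3 - E 1 * E 2 = m ∨ E 0 * E 3 - E 1 * E 2 = -m) ∧ (∀ i, |E i| ≤ A) ∧ (∀ i, |B i| ≤ A) ∧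
  (∀ w ∈ W, 1 ≤ w.1 ∧ w.1 ≤ R ∧ 1 ≤ w.2 ∧ w.2 ≤ R) ∧ (∀ w ∈ W, Int.gcd w.1 w.2 ≤ g0) ∧
  (∀ w ∈ W, |(k w).1| ≤ C ∧ |(k w).2| ≤ C) ∧
  (∀ w ∈ W, (N:ℤ) ∣ E 0 * w.1 + E 1 * w.2 - u1 ∧ (N:ℤ) ∣ E 2 * w.1 + E 3 * w.2 - u2) ∧
  (∀ w ∈ W, hev d f.coeff (B 0 * (k w).1 + B 1 * (k w).2) (B 2 * (k w).1 + B 3 * (k w).2) =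
    hev d g.coeff (E 0 * w.1 + E 1 * w.2) (E 2 * w.1 + E 3 * w.2)) ∧ n < W.card

theorem finish (d : ℕ) (hd : 3 ≤ d) (f g : ℤ[X]) (hgd : g.natDegree = d)
    (sg : Squarefree (g.map (Int.castRingHom ℚ))) (N R C g0 A n H : ℕ) (u1 u2 : ℤ) (s : Finset ℕ)
    (hpos : ∀ m ∈ s, 0 < m) (hsq : ∀ m ∈ s, ∀ m' ∈ s, m ≠ m' → ¬ ∃ k : ℤ, k^2 = m * m')
    (hI : ∀ m ∈ s, ∃ E B W k, Inst d f g N R C g0 A n u1 u2 m E B W k)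
    (hcard : (R^2*(2*C+1)^2)^(2*d+2) * d^3 < s.card)
    (hH : ∀ i ≤ d, |g.coeff i| ≤ H)
    (hl : ∀ z : ℤ, z ≠ 0 → |z| ≤ 2 * ((d+1) * H * (2*A)^d)^2 → ∃ l : ℕ, l.Prime ∧ R < l ∧ 6*R^2*C < l^2 ∧
      2*d*R + l*(d^2+d)*(d*g0) ≤ n ∧ ¬ (l:ℤ) ∣ z) :
    ∃ w1 w2 y1 y2 : ℤ, (N:ℤ) ∣ w1 - u1 ∧ (N:ℤ) ∣ w2 - u2 ∧ ∃ a b c e : ℚ, a*w1+b*w2 = y1 ∧ c*w1+e*w2 = y2 ∧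
      ∀ x y : ℚ, hev d f.coeff (a*x+b*y) (c*x+e*y) = hev d g.coeff x y := by
  classical
  choose! E B W k hI using hI
  -- coefficient functions
  have hg : ∀ m ∈ s, ∃ c' : ℕ → ℤ, (∀ (R : Type) [CommRing R] (x y : R),
      hev d c' x y = hev d g.coeff (E m 0 * x + E m 1 * y) (E m 2 * x + E m 3 * y)) ∧
      ∀ i ≤ d, |c' i| ≤ (d+1) * H * (2 * A)^d := fun m hm =>
    hev_comp_bd d _ _ _ _ A H ((hI m hm).2.1 0) ((hI m hm).2.1 1) ((hI m hm).2.1 2) ((hI m hm).2.1 3) g.coeff hH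
  choose! gm hgm hgb using hg
  have hf : ∀ m, ∃ c' : ℕ → ℤ, (∀ (R : Type) [CommRing R] (x y : R),
      hev d c' x y = hev d f.coeff (B m 0 * x + B m 1 * y) (B m 2 * x + B m 3 * y)) := fun m =>
    hev_comp d _ _ _ _ f.coeff
  choose fm hfm using hf
  have hWne : ∀ m ∈ s, ∃ a0, a0 ∈ W m := fun m hm => by
    have := (hI m hm).2.2.2.2.2.2.2.2
    exact Finset.card_pos.1 (by omega)
  have heq : ∀ m ∈ s, ∀ a ∈ W m, hev d (gm m) a.1 a.2 = hev d (fm m) (k m a).1 (k m a).2 := by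
    intro m hm a ha
    rw [hgm m hm, hfm]
    have := (hI m hm).2.2.2.2.2.2.2.1 a ha
    push_cast at this ⊢
    exact this.symm
  have hpat : ∀ m ∈ s, ∃ π : Fin (2*d+2) → ℤ × ℤ, (∀ i, π i ∈ W m) ∧ ∀ g f : ℕ → ℤ,
      (∀ i, hev d g (π i).1 (π i).2 = hev d f (k m (π i)).1 (k m (π i)).2) →
      ∀ a ∈ W m, hev d g a.1 a.2 = hev d f (k m a).1 (k m a).2 := fun m hm => by
    obtain ⟨a0, h0⟩ := hWne m hm
    exact form_pattern d (W m) a0 h0 (k m)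
  choose! π hπ1 hπ2 using hpat
  let box : Finset ((ℤ × ℤ) × (ℤ × ℤ)) := ((Finset.Icc 1 (R:ℤ)) ×ˢ (Finset.Icc 1 (R:ℤ))) ×ˢ
    ((Finset.Icc (-(C:ℤ)) C) ×ˢ (Finset.Icc (-(C:ℤ)) C))
  have hbox : box.card = R^2*(2*C+1)^2 := by
    simp only [box, Finset.card_product, Int.card_Icc]
    have : ((C:ℤ) + 1 - -(C:ℤ)).toNat = 2*C+1 := by omega
    rw [this]
    have : ((R:ℤ) + 1 - 1).toNat = R := by omega
    rw [this]; ring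
  obtain ⟨pt, -, hpt⟩ := Finset.exists_lt_card_fiber_of_mul_lt_card_of_maps_to
    (s := s) (t := Fintype.piFinset (fun _ : Fin (2*d+2) => box)) (f := fun m i => (π m i, k m (π m i))) (n := d^3)
    (by
      intro m hm
      rw [Fintype.mem_piFinset]
      intro i
      have h1 := (hI m hm).2.2.2.1 _ (hπ1 m hm i)
      have h2 := (hI m hm).2.2.2.2.2.1 _ (hπ1 m hm i)
      simp only [box, Finset.mem_product, Finset.mem_Icc]
      rw [abs_le, abs_le] at h2
      tauto)
    (by rw [Fintype.card_piFinset]; simp only [Finset.prod_const, Finset.card_univ, Fintype.card_fin, hbox]; exact hcard)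
  set s' := s.filter (fun m => (fun i => (π m i, k m (π m i))) = pt) with hs'
  obtain ⟨m0, hm0⟩ : s'.Nonempty := Finset.card_pos.1 (by omega)
  have hsub : ∀ m ∈ s', m ∈ s := fun m hm => (Finset.mem_filter.1 hm).1
  have hm0s := hsub m0 hm0
  -- same pattern
  have hsame : ∀ m ∈ s', ∀ a ∈ W m0, hev d (gm m) a.1 a.2 = hev d (fm m) (k m0 a).1 (k m0 a).2 := by
    intro m hm
    apply hπ2 m0 hm0s
    intro i
    have h1 : (fun i => (π m i, k m (π m i))) = (fun i => (π m0 i, k m0 (π m0 i))) :=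
      (Finset.mem_filter.1 hm).2.trans (Finset.mem_filter.1 hm0).2.symm
    have h2 := congrFun h1 i
    simp only [Prod.mk.injEq] at h2
    rw [← h2.2, ← h2.1]
    exact heq m (hsub m hm) _ (hπ1 m (hsub m hm) i)
  -- nonproportional
  have hnp : ∃ m ∈ s', ∃ i ≤ d, ∃ j ≤ d, gm m0 i * gm m j - gm m0 j * gm m i ≠ 0 := by
    by_contra hcon
    push Not at hcon
    have : s'.card ≤ d^3 := by
      apply nonprop g d hd hgd sg s' (fun m => E m 0) (fun m => E m 1) (fun m => E m 2) (fun m => E m 3)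
        (fun m hm => hpos m (hsub m hm)) (fun m hm => (hI m (hsub m hm)).1)
        (fun m hm m' hm' => hsq m (hsub m hm) m' (hsub m' hm')) m0 hm0
      intro m hm x y h0
      rw [← hgm m0 hm0s] at h0
      rw [← hgm m (hsub m hm)]
      by_cases hi : ∃ i ≤ d, gm m0 i ≠ 0
      · obtain ⟨i, hi, hne⟩ := hi
        have h1 : ((gm m0 i : ℤ) : ℂ) * hev d (gm m) x y = ((gm m i : ℤ) : ℂ) * hev d (gm m0) x y := by
          rw [← hev_smul, ← hev_smul]
          apply hev_congr
          intro j hj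
          have := hcon m hm i hi j hj
          linarith
        rw [h0, mul_zero] at h1
        exact (mul_eq_zero.mp h1).resolve_left (by exact_mod_cast hne)
      · exfalso
        push Not at hi
        have hall : ∀ x y : ℂ, hev d g.coeff (E m0 0 * x + E m0 1 * y) (E m0 2 * x + E m0 3 * y) = 0 := by
          intro x y
          rw [← hgm m0 hm0s]
          unfold hev
          apply Finset.sum_eq_zero
          intro i hi'
          rw [hi i (by simp at hi'; omega)]; simp
        have h2 := hall (E m0 3) (-(E m0 2))
        have e2 : (E m0 2 * E m0 3 + E m0 3 * (-(E m0 2)) : ℂ) = 0 := by ring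
        rw [e2, hev_y0'] at h2
        have g0 : g ≠ 0 := by rintro rfl; simp at hgd; omega
        have hlc : (g.coeff d : ℂ) ≠ 0 := by rw [← hgd]; exact_mod_cast leadingCoeff_ne_zero.2 g0
        have h3 := pow_eq_zero_iff (by omega) |>.1 ((mul_eq_zero.mp h2).resolve_left hlc)
        have h4 : E m0 0 * E m0 3 - E m0 1 * E m0 2 = 0 := by
          have : (E m0 0 * E m0 3 - E m0 1 * E m0 2 : ℂ) = 0 := by linear_combination h3
          exact_mod_cast this
        have := hpos m0 hm0s
        rcases (hI m0 hm0s).1 with h | h <;> omega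
    omega
  obtain ⟨m, hm, i, hi, j, hj, hij⟩ := hnp
  have hb : |gm m0 i * gm m j - gm m0 j * gm m i| ≤ 2 * ((d+1) * H * (2*A)^d)^2 := by
    have hh : ∀ i ≤ d, ∀ j ≤ d, |gm m0 i * gm m j| ≤ (((d+1) * H * (2*A)^d)^2 : ℤ) := by
      intro i hi j hj
      rw [abs_mul, sq]
      exact mul_le_mul (hgb m0 hm0s i hi) (hgb m (hsub m hm) j hj) (abs_nonneg _) (by positivity)
    have := abs_sub (gm m0 i * gm m j) (gm m0 j * gm m i)
    linarith [hh i hi j hj, hh j hj i hi]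
  obtain ⟨l, hl1, hl2, hl3, hl4, hl5⟩ := hl _ hij hb
  have I0 := hI m0 hm0s
  obtain ⟨a, haW, m1, m2, m3, m4, q1, q2, q3⟩ := s6 d (by omega) (gm m0) (gm m) (fm m0) (fm m) (W m0) (k m0) R C g0 l
    I0.2.2.2.1 I0.2.2.2.2.1 I0.2.2.2.2.2.1 (heq m0 hm0s) (hsame m hm) hl1 hl2 hl3 i j hi hj hl5
    (lt_of_le_of_lt hl4 I0.2.2.2.2.2.2.2.2)
  have hdet : ((E m0 0 : ℚ) * E m0 3 - E m0 1 * E m0 2) ≠ 0 := by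
    have := hpos m0 hm0s
    have : E m0 0 * E m0 3 - E m0 1 * E m0 2 ≠ 0 := by rcases I0.1 with h | h <;> omega
    exact_mod_cast this
  set e0 : ℚ := ((E m0 0 : ℤ) : ℚ)
  set e1 : ℚ := ((E m0 1 : ℤ) : ℚ)
  set e2 : ℚ := ((E m0 2 : ℤ) : ℚ)
  set e3 : ℚ := ((E m0 3 : ℤ) : ℚ)
  set D := e0 * e3 - e1 * e2 with hD
  refine ⟨E m0 0 * a.1 + E m0 1 * a.2, E m0 2 * a.1 + E m0 3 * a.2,
    B m0 0 * (k m0 a).1 + B m0 1 * (k m0 a).2, B m0 2 * (k m0 a).1 + B m0 3 * (k m0 a).2,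
    (I0.2.2.2.2.2.2.1 a haW).1, (I0.2.2.2.2.2.2.1 a haW).2,
    ((B m0 0 * m1 + B m0 1 * m3) * e3 - (B m0 0 * m2 + B m0 1 * m4) * e2) / D,
    (-(B m0 0 * m1 + B m0 1 * m3) * e1 + (B m0 0 * m2 + B m0 1 * m4) * e0) / D,
    ((B m0 2 * m1 + B m0 3 * m3) * e3 - (B m0 2 * m2 + B m0 3 * m4) * e2) / D,
    (-(B m0 2 * m1 + B m0 3 * m3) * e1 + (B m0 2 * m2 + B m0 3 * m4) * e0) / D, ?_, ?_, ?_⟩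
  · push_cast
    rw [← q1, ← q2]
    field_simp
    simp only [hD]; ring
  · push_cast
    rw [← q1, ← q2]
    field_simp
    simp only [hD]; ring
  · intro x y
    have h1 := q3 ((e3 * x - e1 * y)/D) ((-e2 * x + e0 * y)/D)
    rw [hgm m0 hm0s, hfm] at h1
    have r1 : e0 * ((e3 * x - e1 * y)/D) + e1 * ((-e2 * x + e0 * y)/D) = x := by
      field_simp; simp only [hD]; ring
    have r2 : e2 * ((e3 * x - e1 * y)/D) + e3 * ((-e2 * x + e0 * y)/D) = y := by
      field_simp; simp only [hD]; ring
    rw [r1, r2] at h1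
    rw [← h1]
    congr 1 <;> ring
end PartP12c

section PartP13
open Polynomial

theorem fib_card (d : ℕ) (c : ℕ → ℤ) (i : ℕ) (hi1 : 1 ≤ i) (hid : i ≤ d) (hci : c i ≠ 0) (v : ℤ) (Y : Finset ℤ)
    (hY : ∀ y ∈ Y, y ≠ 0 ∨ i = d) (S : Finset (ℤ × ℤ)) (hS : ∀ a ∈ S, a.2 ∈ Y ∧ hev d c a.1 a.2 = v) :
    S.card ≤ d * Y.card := by
  classical
  apply Finset.card_le_mul_card_image_of_maps_to (f := fun a : ℤ × ℤ => a.2) (fun a ha => (hS a ha).1)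
  intro y hy
  obtain ⟨P, hP1, hP2, hP3⟩ := hev_poly d c y
  set P' := P - C v
  have hc : P'.coeff i ≠ 0 := by
    simp only [P', coeff_sub, coeff_C]
    rw [if_neg (by omega), sub_zero, hP2 i hid]
    rcases hY y hy with h | h
    · simp [hci, h]
    · subst h; simp [hci]
  have hP0 : P' ≠ 0 := by intro h; rw [h] at hc; simp at hc
  have hdeg : P'.natDegree ≤ d := by
    refine (natDegree_sub_le _ _).trans ?_
    simp [hP1]
  have hinj : ((S.filter (fun a => a.2 = y)).image (fun a => a.1)).card = (S.filter (fun a => a.2 = y)).card := by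
    apply Finset.card_image_of_injOn
    intro a ha b hb h
    simp at ha hb
    exact Prod.ext h (ha.2.trans hb.2.symm)
  rw [← hinj]
  refine le_trans ?_ ((card_roots' P').trans hdeg)
  refine le_trans (Finset.card_le_card (t := P'.roots.toFinset) ?_) (Multiset.toFinset_card_le _)
  intro x hx
  simp only [Finset.mem_image, Finset.mem_filter] at hx
  obtain ⟨a, ⟨ha, rfl⟩, rfl⟩ := hx
  rw [Multiset.mem_toFinset, mem_roots hP0, IsRoot.def]
  simp only [P', eval_sub, eval_C, hP3, (hS a ha).2, sub_self]

theorem gcoef (g : ℤ[X]) (d : ℕ) (hd : 2 ≤ d) (hgd : g.natDegree = d) (sg : Squarefree (g.map (Int.castRingHom ℚ)))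
    (a b c e : ℤ) (hdet : a * e - b * c ≠ 0) (cc : ℕ → ℤ)
    (hcc : ∀ (R : Type) [CommRing R] (x y : R), hev d cc x y = hev d g.coeff (a * x + b * y) (c * x + e * y)) :
    ∃ i, 1 ≤ i ∧ i ≤ d ∧ cc i ≠ 0 := by
  by_contra hcon
  push Not at hcon
  have hcr : (croots g).card = d := by rw [croots_card g sg, hgd]
  have g0 : g ≠ 0 := by rintro rfl; simp at hgd; omega
  have hlc : (g.coeff d : ℂ) ≠ 0 := by rw [← hgd]; exact_mod_cast leadingCoeff_ne_zero.2 g0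
  have hdet' : (a * e - b * c : ℂ) ≠ 0 := by exact_mod_cast hdet
  have hform : ∀ x y : ℂ, hev d cc x y = cc 0 * y^d := by
    intro x y
    unfold hev
    rw [Finset.sum_eq_single 0]
    · simp
    · intro i hi hi0
      rw [hcon i (by omega) (by simp at hi; omega)]; simp
    · simp
  have hc0 : (cc 0 : ℂ) ≠ 0 := by
    intro h0
    have h2 := hcc ℂ (e:ℂ) (-c:ℂ)
    rw [hform, h0, zero_mul] at h2
    have e2 : (c * e + e * (-c) : ℂ) = 0 := by ring
    rw [e2, hev_y0'] at h2
    have h3 := pow_eq_zero_iff (by omega) |>.1 ((mul_eq_zero.mp h2.symm).resolve_left hlc)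
    exact hdet' (by linear_combination h3)
  have hroot : ∀ θ ∈ croots g, -(c:ℂ) * θ + a = 0 := by
    intro θ hθ
    have h := hcc ℂ (e * θ - b) (-(c:ℂ) * θ + a)
    have e1 : (a * (e * θ - b) + b * (-(c:ℂ) * θ + a)) = (a * e - b * c) * θ := by ring
    have e2 : (c * (e * θ - b) + e * (-(c:ℂ) * θ + a)) = (a * e - b * c) * 1 := by ring
    rw [e1, e2, hev_scale, ← hgd, hev_one, (mem_croots g0 θ).1 hθ, mul_zero, hgd, hform] at h
    exact pow_eq_zero_iff (by omega) |>.1 ((mul_eq_zero.mp h).resolve_left hc0)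
  obtain ⟨θ1, h1, θ2, h2, hne⟩ := Finset.one_lt_card.1 (by omega : 1 < (croots g).card)
  have q1 := hroot θ1 h1
  have q2 := hroot θ2 h2
  have : (c:ℂ) * (θ1 - θ2) = 0 := by linear_combination q2 - q1
  have hc := (mul_eq_zero.mp this).resolve_right (sub_ne_zero.2 hne)
  rw [hc] at q1
  have ha : (a:ℂ) = 0 := by linear_combination q1
  apply hdet'; rw [hc, ha]; ring

theorem prime_div_card (Q n : ℕ) (hQ : 2 ≤ Q) (z : ℤ) (hz : z ≠ 0) (hzb : |z| < (Q:ℤ)^(n+1)) (S : Finset ℕ)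
    (hS : ∀ p ∈ S, p.Prime ∧ Q ≤ p ∧ (p:ℤ) ∣ z) : S.card ≤ n := by
  by_contra hcon
  push Not at hcon
  have h1 : ∏ p ∈ S, p ∣ z.natAbs := by
    apply Finset.prod_primes_dvd
    · intro p hp; exact (hS p hp).1.prime
    · intro p hp; exact Int.natCast_dvd.1 (hS p hp).2.2
  have h2 : Q^(S.card) ≤ ∏ p ∈ S, p := by
    apply Finset.pow_card_le_prod
    intro p hp; exact (hS p hp).2.1
  have h3 := Nat.le_of_dvd (Int.natAbs_pos.2 hz) h1
  have h4 : Q^(n+1) ≤ Q^S.card := Nat.pow_le_pow_right (by omega) (by omega)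
  have h5 : (z.natAbs : ℤ) < (Q:ℤ)^(n+1) := by rwa [Int.natCast_natAbs]
  have h6 : z.natAbs < Q^(n+1) := by exact_mod_cast h5
  omega

theorem pq_square (p q p' q' : ℕ) (hp : p.Prime) (hq : q.Prime) (hp' : p'.Prime) (hq' : q'.Prime) (h : p < q) (h' : p' < q')
    (k : ℤ) (hk : k^2 = (p*q : ℕ) * (p'*q' : ℕ)) : p * q = p' * q' := by
  have aux : ∀ p q p' q' : ℕ, p.Prime → q.Prime → p'.Prime → q'.Prime → p < q →  p' < q' →
    ∀ k : ℕ, k^2 = (p*q) * (p'*q') → p * q ∣ p' * q' := by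
    intro p q p' q' hp hq hp' hq' h h' k hk
    have hcop : Nat.Coprime p q := (Nat.coprime_primes hp hq).2 (by omega)
    have h1 : p ∣ p' * q' := by
      have : p ∣ k := hp.dvd_of_dvd_pow (n := 2) ⟨q * (p'*q'), by rw [hk]; ring⟩
      obtain ⟨j, rfl⟩ := this
      have : p * j^2 = q * (p'*q') := by
        apply Nat.eq_of_mul_eq_mul_left hp.pos; rw [← mul_assoc] at *; nlinarith
      exact hcop.dvd_of_dvd_mul_left ⟨j^2, this.symm⟩
    have h2 : q ∣ p' * q' := by
      have : q ∣ k := hq.dvd_of_dvd_pow (n := 2) ⟨p * (p'*q'), by rw [hk]; ring⟩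
      obtain ⟨j, rfl⟩ := this
      have : q * j^2 = p * (p'*q') := by
        apply Nat.eq_of_mul_eq_mul_left hq.pos; rw [← mul_assoc] at *; nlinarith
      exact hcop.symm.dvd_of_dvd_mul_left ⟨j^2, this.symm⟩
    exact hcop.mul_dvd_of_dvd_of_dvd h1 h2
  have hk' : k.natAbs^2 = (p*q) * (p'*q') := by
    zify
    rw [sq_abs, hk]; push_cast; ring
  exact Nat.dvd_antisymm (aux p q p' q' hp hq hp' hq' h h' _ hk')
    (aux p' q' p q hp' hq' hp hq h' h _ (by rw [hk']; ring))

/-- supply of primes in a dyadic-ish range -/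
theorem prime_supply (B n : ℕ) (hB : 2 ≤ B) : ∃ S : Finset ℕ, S.card = n ∧ ∀ l ∈ S, l.Prime ∧ B < l ∧ l ≤ 2^n * B := by
  classical
  induction n with
  | zero => exact ⟨∅, by simp⟩
  | succ n ih =>
    obtain ⟨S, h1, h2⟩ := ih
    obtain ⟨l, hl, hl1, hl2⟩ := Nat.exists_prime_lt_and_le_two_mul (2^n*B) (by positivity)
    have hp : 1 ≤ 2^n := Nat.one_le_two_pow
    refine ⟨insert l S, ?_, ?_⟩
    · rw [Finset.card_insert_of_notMem, h1]
      intro h; have := (h2 l h).2.2; omega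
    · intro x hx
      rw [Finset.mem_insert] at hx
      have e : 2^(n+1)*B = 2*(2^n*B) := by ring
      rcases hx with rfl | hx
      · refine ⟨hl, ?_, by omega⟩
        nlinarith
      · obtain ⟨a1, a2, a3⟩ := h2 x hx
        exact ⟨a1, a2, by omega⟩

theorem prime_avoid (B n : ℕ) (hB : 2 ≤ B) (hn : 1 ≤ n) (z : ℤ) (hz : z ≠ 0) (hzb : |z| < (B:ℤ)^n) :
    ∃ l : ℕ, l.Prime ∧ B < l ∧ l ≤ 2^n*B ∧ ¬ (l:ℤ) ∣ z := by
  obtain ⟨S, h1, h2⟩ := prime_supply B n hB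
  by_contra hcon
  push Not at hcon
  obtain ⟨k, rfl⟩ : ∃ k, n = k + 1 := ⟨n-1, by omega⟩
  have := prime_div_card B k hB z hz hzb S (fun l hl => ⟨(h2 l hl).1, (h2 l hl).2.1.le,
    hcon l (h2 l hl).1 (h2 l hl).2.1 (h2 l hl).2.2⟩)
  omega
end PartP13

section PartP14
open Polynomial

theorem hev_zero_root' (h : ℤ[X]) (hd : 1 ≤ h.natDegree) (x y : ℤ) (h0 : hev h.natDegree h.coeff x y = 0)
    (hne : ¬ (x = 0 ∧ y = 0)) : (h.map (Int.castRingHom ℚ)).eval ((x:ℚ)/y) = 0 := by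
  have h1 : h ≠ 0 := by rintro rfl; simp at hd
  have hy : y ≠ 0 := by
    rintro rfl
    rw [hev_y0'] at h0
    have : h.coeff h.natDegree ≠ 0 := leadingCoeff_ne_zero.2 h1
    have := (mul_eq_zero.mp h0).resolve_left (by exact_mod_cast this)
    exact hne ⟨pow_eq_zero_iff (by omega) |>.1 this, rfl⟩
  have hy' : (y:ℚ) ≠ 0 := by exact_mod_cast hy
  have h2 : hev h.natDegree h.coeff (x:ℚ) (y:ℚ) = 0 := by rw [hev_intCast, h0]; simp
  have h3 : hev h.natDegree h.coeff (y * ((x:ℚ)/y)) ((y:ℚ) * 1) = 0 := by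
    rw [mul_div_cancel₀ _ hy', mul_one]; exact h2
  rw [hev_scale, hev_one] at h3
  have h4 := (mul_eq_zero.mp h3).resolve_left (pow_ne_zero _ hy')
  rw [eval_map]
  exact h4

theorem natDegree_int_factor (A : ℤ[X]) (a : ℚ[X]) (u : ℚ) (hu : u ≠ 0) (h : A.map (Int.castRingHom ℚ) = C u * a) :
    A.natDegree = a.natDegree := by
  rw [← natDegree_map_eq_of_injective (f := Int.castRingHom ℚ) Int.cast_injective A, h, natDegree_C_mul hu]

theorem linear_mod (A : ℤ[X]) (hA : A.natDegree = 1) (p : ℕ) (hp : p.Prime) (hb : A.leadingCoeff.natAbs < p) :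
    ∃ r : ℤ, (p:ℤ) ∣ A.eval r := by
  have : Fact p.Prime := ⟨hp⟩
  have h0 : A ≠ 0 := by rintro rfl; simp at hA
  have hl : A.coeff 1 ≠ 0 := by rw [← hA]; exact leadingCoeff_ne_zero.2 h0
  have hl' : (A.coeff 1 : ZMod p) ≠ 0 := by
    intro h
    rw [ZMod.intCast_zmod_eq_zero_iff_dvd] at h
    have := Nat.le_of_dvd (Int.natAbs_pos.2 hl) (Int.natCast_dvd.1 h)
    rw [leadingCoeff, hA] at hb
    omega
  refine ⟨(-(A.coeff 0 : ZMod p) / A.coeff 1).val, ?_⟩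
  rw [← ZMod.intCast_zmod_eq_zero_iff_dvd]
  rw [eval_eq_sum_range, hA]
  simp [Finset.sum_range_succ]
  field_simp
  ring

open Classical in
theorem choose_h (g : ℤ[X]) (hd : 2 ≤ g.natDegree) (sg : Squarefree (g.map (Int.castRingHom ℚ))) :
    ∃ h1 h2 k1 k2 : ℤ[X], ∃ c1 c2 : ℤ, c1 ≠ 0 ∧ c2 ≠ 0 ∧ C c1 * g = h1 * k1 ∧ C c2 * g = h2 * k2 ∧
      1 ≤ h1.natDegree ∧ 1 ≤ h2.natDegree ∧
      (∀ x y : ℤ, hev h1.natDegree h1.coeff x y = 0 → hev h2.natDegree h2.coeff x y = 0 → x = 0 ∧ y = 0) ∧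
      ¬ Summable (fun p : ℕ => if p.Prime ∧ (∃ r : ℤ, (p:ℤ) ∣ h1.eval r) ∧ (∃ r : ℤ, (p:ℤ) ∣ h2.eval r)
        then (1:ℝ)/p else 0) := by
  set g' := g.map (Int.castRingHom ℚ) with hg'
  have hdeg : g'.natDegree = g.natDegree := natDegree_map_eq_of_injective Int.cast_injective g
  by_cases hirr : ∃ a : ℚ[X], Irreducible a ∧ a ∣ g' ∧ 2 ≤ a.natDegree
  · obtain ⟨a, ha, ⟨b, hb⟩, ha2⟩ := hirr
    obtain ⟨c, hc, A, B, hAB, ⟨u, hu, hA⟩, -⟩ := int_factor g a b hb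
    have hAd := natDegree_int_factor A a u hu hA
    have hAirr : Irreducible (A.map (Int.castRingHom ℚ)) := by
      rw [hA]
      exact (irreducible_isUnit_mul (isUnit_C.2 (isUnit_iff_ne_zero.2 hu))).2 ha
    refine ⟨A, A, B, B, c, c, hc, hc, hAB, hAB, by omega, by omega, ?_, ?_⟩
    · intro x y h0 _
      by_contra hne
      have := hev_zero_root' A (by omega) x y h0 hne
      have h1 := degree_eq_one_of_irreducible_of_root hAirr this
      have h2 : (A.map (Int.castRingHom ℚ)).natDegree = 1 := natDegree_eq_of_degree_eq_some h1
      rw [natDegree_map_eq_of_injective Int.cast_injective] at h2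
      omega
    · have := not_summable_roots A hAirr
      simpa only [and_self] using this
  · push Not at hirr
    have hlin : ∀ a : ℚ[X], Irreducible a → a ∣ g' → a.natDegree = 1 := by
      intro a ha hag
      have := hirr a ha hag
      have := ha.natDegree_pos
      omega
    have hnu : ¬ IsUnit g' := by
      intro h
      have := natDegree_eq_zero_of_isUnit h
      omega
    have hg0 : g' ≠ 0 := by intro h; rw [h] at hdeg; simp at hdeg; omega
    obtain ⟨a1, ha1, b1, hb1⟩ := WfDvdMonoid.exists_irreducible_factor hnu hg0
    have hb0 : b1 ≠ 0 := by rintro rfl; simp [hb1] at hg0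
    have hd1 : b1.natDegree = g'.natDegree - 1 := by
      have := natDegree_mul ha1.ne_zero hb0
      rw [← hb1, hlin a1 ha1 ⟨b1, hb1⟩] at this
      omega
    have hnu1 : ¬ IsUnit b1 := by
      intro h
      have := natDegree_eq_zero_of_isUnit h
      omega
    obtain ⟨a2, ha2, b2, hb2⟩ := WfDvdMonoid.exists_irreducible_factor hnu1 hb0
    have hg2 : g' = a2 * (a1 * b2) := by rw [hb1, hb2]; ring
    have hcop : IsCoprime a1 a2 := by
      have h1 : Squarefree (a1 * a2) := sg.squarefree_of_dvd ⟨b2, by rw [hg2]; ring⟩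
      exact ((squarefree_mul_iff.1 h1).1).isCoprime
    obtain ⟨c, hc, A, B, hAB, ⟨u, hu, hA⟩, -⟩ := int_factor g a1 b1 hb1
    obtain ⟨c', hc', A', B', hAB', ⟨u', hu', hA'⟩, -⟩ := int_factor g a2 (a1*b2) hg2
    have hAd := (natDegree_int_factor A a1 u hu hA).trans (hlin a1 ha1 ⟨b1, hb1⟩)
    have hAd' := (natDegree_int_factor A' a2 u' hu' hA').trans (hlin a2 ha2 ⟨_, hg2⟩)
    refine ⟨A, A', B, B', c, c', hc, hc', hAB, hAB', by omega, by omega, ?_, ?_⟩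
    · intro x y h0 h0'
      by_contra hne
      have e1 := hev_zero_root' A (by omega) x y h0 hne
      have e2 := hev_zero_root' A' (by omega) x y h0' hne
      rw [hA, eval_mul, eval_C] at e1
      rw [hA', eval_mul, eval_C] at e2
      have e1' := (mul_eq_zero.mp e1).resolve_left hu
      have e2' := (mul_eq_zero.mp e2).resolve_left hu'
      obtain ⟨s, t, hst⟩ := hcop
      have := congrArg (eval ((x:ℚ)/y)) hst
      simp [e1', e2'] at this
    · intro hs
      have hall : Summable (fun p : ℕ => if p.Prime then (1:ℝ)/p else 0) := by
        rw [← summable_nat_add_iff (A.leadingCoeff.natAbs + A'.leadingCoeff.natAbs + 1)] at hs ⊢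
        convert hs using 2 with p
        congr 1
        rw [eq_iff_iff]
        constructor
        · intro hp
          exact ⟨hp, linear_mod A hAd _ hp (by omega), linear_mod A' hAd' _ hp (by omega)⟩
        · intro hp; exact hp.1
      apply not_summable_one_div_on_primes
      convert hall using 2 with p
      simp only [Set.indicator_apply, Set.mem_ofPred_eq]
end PartP14

section PartP15
open Polynomial

theorem hev_bd (d : ℕ) (c : ℕ → ℤ) (H X : ℤ) (hc : ∀ i ≤ d, |c i| ≤ H) (x y : ℤ) (hxy : nm x y ≤ X) :
    |hev d c x y| ≤ (d+1) * H * X^d := by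
  have hX : 0 ≤ X := (nm_nonneg x y).trans hxy
  have hH : 0 ≤ H := (abs_nonneg _).trans (hc 0 (by omega))
  have hx : |x| ≤ X := (le_max_left _ _).trans hxy
  have hy : |y| ≤ X := (le_max_right _ _).trans hxy
  unfold hev
  refine (Finset.abs_sum_le_sum_abs _ _).trans ?_
  have : ∀ i ∈ Finset.range (d+1), |((c i : ℤ) : ℤ) * x^i * y^(d-i)| ≤ H * X^d := by
    intro i hi
    have hid : i ≤ d := by simp at hi; omega
    rw [abs_mul, abs_mul, abs_pow, abs_pow]
    have e : X^d = X^i * X^(d-i) := by rw [← pow_add]; congr 1; omega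
    rw [e, mul_assoc]
    apply mul_le_mul (hc i hid) _ (by positivity) hH
    apply mul_le_mul (pow_le_pow_left₀ (abs_nonneg _) hx _) (pow_le_pow_left₀ (abs_nonneg _) hy _) (by positivity) (by positivity)
  refine (Finset.sum_le_sum this).trans ?_
  simp; ring_nf; rfl

noncomputable def box (B : ℕ) : Finset (ℤ × ℤ) := Finset.Icc (-(B:ℤ)) B ×ˢ Finset.Icc (-(B:ℤ)) B

theorem mem_box (B : ℕ) (e : ℤ × ℤ) : e ∈ box B ↔ nm e.1 e.2 ≤ B := by
  simp only [box, Finset.mem_product, Finset.mem_Icc, nm, max_le_iff, abs_le]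

theorem card_icc (B : ℕ) : (Finset.Icc (-(B:ℤ)) B).card = 2*B+1 := by
  rw [Int.card_Icc]; omega

theorem card_box (B : ℕ) : (box B).card = (2*B+1)^2 := by
  rw [box, Finset.card_product, card_icc]; ring

theorem zero_box (h : ℤ[X]) (hd : 1 ≤ h.natDegree) (B : ℕ) :
    ((box B).filter (fun e => hev h.natDegree h.coeff e.1 e.2 = 0)).card ≤ h.natDegree * (2*B+1) := by
  have h1 : h ≠ 0 := by rintro rfl; simp at hd
  rw [← card_icc B]
  apply fib_card h.natDegree h.coeff h.natDegree hd le_rfl (leadingCoeff_ne_zero.2 h1) 0 _ (fun _ _ => Or.inr rfl)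
  intro a ha
  rw [Finset.mem_filter, box, Finset.mem_product] at ha
  exact ⟨ha.1.2, ha.2⟩

open Classical in
theorem d1_count (h1 h2 : ℤ[X]) (hd1 : 1 ≤ h1.natDegree) (hd2 : 1 ≤ h2.natDegree)
    (hnz : ∀ x y : ℤ, hev h1.natDegree h1.coeff x y = 0 → hev h2.natDegree h2.coeff x y = 0 → x = 0 ∧ y = 0)
    (Q B : ℕ) (hQ : 2 ≤ Q) (hb1 : ∀ x y : ℤ, nm x y ≤ B → |hev h1.natDegree h1.coeff x y| < (Q:ℤ)^(h1.natDegree+1))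
    (hb2 : ∀ x y : ℤ, nm x y ≤ B → |hev h2.natDegree h2.coeff x y| < (Q:ℤ)^(h2.natDegree+1))
    (P : Finset ℕ) (hP : ∀ p ∈ P, p.Prime ∧ Q ≤ p) (hPc : P.card ≤ Q) (D : Finset (ℕ × ℕ))
    (hD : ∀ π ∈ D, π.1 ∈ P ∧ π.2 ∈ P ∧ ∃ x y : ℤ, ¬ (x = 0 ∧ y = 0) ∧ nm x y ≤ B ∧
      (π.1:ℤ) ∣ hev h1.natDegree h1.coeff x y ∧ (π.2:ℤ) ∣ hev h2.natDegree h2.coeff x y) :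
    D.card ≤ h1.natDegree * h2.natDegree * (2 * Q * (2*B+1) + (2*B+1)^2) := by
  classical
  set H1 : ℤ × ℤ → ℤ := fun e => hev h1.natDegree h1.coeff e.1 e.2 with hH1
  set H2 : ℤ × ℤ → ℤ := fun e => hev h2.natDegree h2.coeff e.1 e.2 with hH2
  set bx := (box B).filter (fun e => ¬ (e.1 = 0 ∧ e.2 = 0)) with hbx
  have hsub : D ⊆ bx.biUnion (fun e => (P.filter (fun p : ℕ => (p:ℤ) ∣ H1 e)) ×ˢ (P.filter (fun p : ℕ => (p:ℤ) ∣ H2 e))) := by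
    intro π hπ
    obtain ⟨q1, q2, x, y, hne, hn, q3, q4⟩ := hD π hπ
    simp only [Finset.mem_biUnion, Finset.mem_product, Finset.mem_filter, hbx]
    exact ⟨(x, y), ⟨(mem_box B (x,y)).2 hn, hne⟩, ⟨q1, q3⟩, ⟨q2, q4⟩⟩
  have hpt : ∀ e ∈ bx, ((P.filter (fun p : ℕ => (p:ℤ) ∣ H1 e)) ×ˢ (P.filter (fun p : ℕ => (p:ℤ) ∣ H2 e))).card ≤
      (if H1 e = 0 then Q * h2.natDegree else 0) + (if H2 e = 0 then Q * h1.natDegree else 0)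
        + h1.natDegree * h2.natDegree := by
    intro e he
    rw [hbx, Finset.mem_filter, mem_box] at he
    rw [Finset.card_product]
    have n1 : H1 e ≠ 0 → (P.filter (fun p : ℕ => (p:ℤ) ∣ H1 e)).card ≤ h1.natDegree := fun h =>
      prime_div_card Q _ hQ (H1 e) h (hb1 _ _ he.1) _ (fun p hp => by
        rw [Finset.mem_filter] at hp; exact ⟨(hP p hp.1).1, (hP p hp.1).2, hp.2⟩)
    have n2 : H2 e ≠ 0 → (P.filter (fun p : ℕ => (p:ℤ) ∣ H2 e)).card ≤ h2.natDegree := fun h =>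
      prime_div_card Q _ hQ (H2 e) h (hb2 _ _ he.1) _ (fun p hp => by
        rw [Finset.mem_filter] at hp; exact ⟨(hP p hp.1).1, (hP p hp.1).2, hp.2⟩)
    have t1 : (P.filter (fun p : ℕ => (p:ℤ) ∣ H1 e)).card ≤ Q := (Finset.card_filter_le _ _).trans hPc
    have t2 : (P.filter (fun p : ℕ => (p:ℤ) ∣ H2 e)).card ≤ Q := (Finset.card_filter_le _ _).trans hPc
    by_cases z1 : H1 e = 0
    · have z2 : H2 e ≠ 0 := fun z2 => he.2 (hnz _ _ z1 z2)
      rw [if_pos z1, if_neg z2]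
      have := Nat.mul_le_mul t1 (n2 z2)
      omega
    · by_cases z2 : H2 e = 0
      · rw [if_neg z1, if_pos z2]
        have := Nat.mul_le_mul (n1 z1) t2
        rw [mul_comm h1.natDegree Q] at this
        omega
      · have := Nat.mul_le_mul (n1 z1) (n2 z2)
        omega
  refine (Finset.card_le_card hsub).trans (Finset.card_biUnion_le.trans ((Finset.sum_le_sum hpt).trans ?_))
  rw [Finset.sum_add_distrib, Finset.sum_add_distrib, ← Finset.sum_filter, ← Finset.sum_filter]
  simp only [Finset.sum_const, smul_eq_mul]
  have c1 : (bx.filter (fun e => H1 e = 0)).card ≤ h1.natDegree * (2*B+1) :=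
    (Finset.card_le_card (Finset.filter_subset_filter _ (Finset.filter_subset _ _))).trans (zero_box h1 hd1 B)
  have c2 : (bx.filter (fun e => H2 e = 0)).card ≤ h2.natDegree * (2*B+1) :=
    (Finset.card_le_card (Finset.filter_subset_filter _ (Finset.filter_subset _ _))).trans (zero_box h2 hd2 B)
  have c3 : bx.card ≤ (2*B+1)^2 := by rw [← card_box]; exact Finset.card_filter_le _ _
  calc _ ≤ h1.natDegree * (2*B+1) * (Q * h2.natDegree) + h2.natDegree * (2*B+1) * (Q * h1.natDegree) +
        (2*B+1)^2 * (h1.natDegree * h2.natDegree) := by gcongr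
    _ = _ := by ring

open Classical in
theorem d2_count (f : ℤ[X]) (d : ℕ) (Q B : ℕ) (hQ : 2 ≤ Q)
    (hb : ∀ x y : ℤ, nm x y ≤ B → |hev d f.coeff x y| < (Q:ℤ)^(d+1))
    (P : Finset ℕ) (hP : ∀ p ∈ P, p.Prime ∧ Q ≤ p) (D : Finset (ℕ × ℕ))
    (hD : ∀ π ∈ D, π.1 ∈ P ∧ π.2 ∈ P ∧ ∃ x y : ℤ, nm x y ≤ B ∧ hev d f.coeff x y ≠ 0 ∧
      (π.1:ℤ) ∣ hev d f.coeff x y ∧ (π.2:ℤ) ∣ hev d f.coeff x y) :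
    D.card ≤ (2*B+1)^2 * d^2 := by
  classical
  set F : ℤ × ℤ → ℤ := fun e => hev d f.coeff e.1 e.2 with hF
  set bx := (box B).filter (fun e => F e ≠ 0) with hbx
  have hsub : D ⊆ bx.biUnion (fun e => (P.filter (fun p : ℕ => (p:ℤ) ∣ F e)) ×ˢ (P.filter (fun p : ℕ => (p:ℤ) ∣ F e))) := by
    intro π hπ
    obtain ⟨q1, q2, x, y, hn, hne, q3, q4⟩ := hD π hπ
    simp only [Finset.mem_biUnion, Finset.mem_product, Finset.mem_filter, hbx]
    exact ⟨(x, y), ⟨(mem_box B (x,y)).2 hn, hne⟩, ⟨q1, q3⟩, ⟨q2, q4⟩⟩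
  have hpt : ∀ e ∈ bx, ((P.filter (fun p : ℕ => (p:ℤ) ∣ F e)) ×ˢ (P.filter (fun p : ℕ => (p:ℤ) ∣ F e))).card ≤ d^2 := by
    intro e he
    rw [hbx, Finset.mem_filter, mem_box] at he
    have n1 : (P.filter (fun p : ℕ => (p:ℤ) ∣ F e)).card ≤ d :=
      prime_div_card Q _ hQ (F e) he.2 (hb _ _ he.1) _ (fun p hp => by
        rw [Finset.mem_filter] at hp; exact ⟨(hP p hp.1).1, (hP p hp.1).2, hp.2⟩)
    rw [Finset.card_product, sq]
    exact Nat.mul_le_mul n1 n1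
  refine (Finset.card_le_card hsub).trans (Finset.card_biUnion_le.trans ((Finset.sum_le_sum hpt).trans ?_))
  simp only [Finset.sum_const, smul_eq_mul]
  have c3 : bx.card ≤ (2*B+1)^2 := by rw [← card_box]; exact Finset.card_filter_le _ _
  gcongr

theorem ap_card (N R : ℕ) (hN : 0 < N) (α : ℤ) : R / N ≤ ((Finset.Icc 1 (R:ℤ)).filter (fun x => (N:ℤ) ∣ x - α)).card := by
  classical
  have hN' : (0:ℤ) < N := by exact_mod_cast hN
  have hm1 := Int.emod_nonneg (α - 1) hN'.ne'
  have hm2 := Int.emod_lt_of_pos (α - 1) hN'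
  have : ((Finset.range (R/N)).image (fun j : ℕ => (α - 1) % N + 1 + (N:ℤ) * j)).card = R / N := by
    rw [Finset.card_image_of_injective, Finset.card_range]
    intro a b hab
    simp only [add_right_inj] at hab
    have := mul_left_cancel₀ hN'.ne' hab
    exact_mod_cast this
  conv_lhs => rw [← this]
  apply Finset.card_le_card
  intro x hx
  simp only [Finset.mem_image, Finset.mem_range] at hx
  obtain ⟨j, hj, rfl⟩ := hx
  simp only [Finset.mem_filter, Finset.mem_Icc]
  have h1 : N * (j+1) ≤ R := by
    calc N * (j+1) ≤ N * (R/N) := Nat.mul_le_mul_left _ hj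
      _ ≤ R := Nat.mul_div_le R N
  have h1' : (N:ℤ) * (j+1) ≤ R := by exact_mod_cast h1
  have h2 : (0:ℤ) ≤ N * j := by positivity
  refine ⟨⟨by linarith, by linarith⟩, ?_⟩
  have e := Int.emod_add_mul_ediv (α - 1) N
  refine ⟨j - (α-1)/N, ?_⟩
  linear_combination e

theorem gcd_card (R g0 : ℕ) (hg0 : 0 < g0) :
    g0 * ((Finset.Icc 1 (R:ℤ) ×ˢ Finset.Icc 1 (R:ℤ)).filter (fun a => g0 < Int.gcd a.1 a.2)).card ≤ R^2 := by
  classical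
  have hm : ∀ n : ℕ, 0 < n → ((Finset.Icc 1 (R:ℤ)).filter (fun x => (n:ℤ) ∣ x)).card ≤ R / n := by
    intro n hn
    have : ((Finset.Icc 1 (R/n)).image (fun j : ℕ => (n:ℤ) * j)).card ≤ R / n :=
      Finset.card_image_le.trans (by simp)
    refine le_trans (Finset.card_le_card ?_) this
    intro x hx
    simp only [Finset.mem_filter, Finset.mem_Icc] at hx
    obtain ⟨⟨h1, h2⟩, j, rfl⟩ := hx
    have hn' : (0:ℤ) < n := by exact_mod_cast hn
    have hj : 0 < j := by by_contra h; nlinarith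
    lift j to ℕ using hj.le
    simp only [Finset.mem_image, Finset.mem_Icc]
    refine ⟨j, ⟨by exact_mod_cast hj, ?_⟩, rfl⟩
    rw [Nat.le_div_iff_mul_le hn, mul_comm]
    exact_mod_cast h2
  have hsub : ((Finset.Icc 1 (R:ℤ) ×ˢ Finset.Icc 1 (R:ℤ)).filter (fun a => g0 < Int.gcd a.1 a.2)) ⊆
      (Finset.Ioc g0 R).biUnion (fun n => ((Finset.Icc 1 (R:ℤ)).filter (fun x => (n:ℤ) ∣ x)) ×ˢ
        ((Finset.Icc 1 (R:ℤ)).filter (fun x => (n:ℤ) ∣ x))) := by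
    intro a ha
    simp only [Finset.mem_filter, Finset.mem_product, Finset.mem_Icc] at ha
    simp only [Finset.mem_biUnion, Finset.mem_product, Finset.mem_filter, Finset.mem_Icc, Finset.mem_Ioc]
    refine ⟨Int.gcd a.1 a.2, ⟨ha.2, ?_⟩, ⟨ha.1.1, Int.gcd_dvd_left _ _⟩, ⟨ha.1.2, Int.gcd_dvd_right _ _⟩⟩
    have := Int.le_of_dvd (by omega) (Int.gcd_dvd_left a.1 a.2)
    omega
  have h1 : ((Finset.Icc 1 (R:ℤ) ×ˢ Finset.Icc 1 (R:ℤ)).filter (fun a => g0 < Int.gcd a.1 a.2)).card ≤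
      ∑ n ∈ Finset.Ioc g0 R, (R/n)^2 := by
    refine (Finset.card_le_card hsub).trans (Finset.card_biUnion_le.trans (Finset.sum_le_sum ?_))
    intro n hn
    rw [Finset.mem_Ioc] at hn
    rw [Finset.card_product, sq]
    exact Nat.mul_le_mul (hm n (by omega)) (hm n (by omega))
  by_cases hR : g0 ≤ R
  · have h2 : ((∑ n ∈ Finset.Ioc g0 R, (R/n)^2 : ℕ) : ℚ) ≤ (R:ℚ)^2 * (g0:ℚ)⁻¹ := by
      push_cast
      have h3 := sum_Ioc_inv_sq_le_sub (α := ℚ) hg0.ne' hR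
      have h4 : ∑ n ∈ Finset.Ioc g0 R, ((R/n : ℕ) : ℚ)^2 ≤ ∑ n ∈ Finset.Ioc g0 R, (R:ℚ)^2 * ((n:ℚ)^2)⁻¹ := by
        apply Finset.sum_le_sum
        intro n hn
        have := Nat.cast_div_le (α := ℚ) (m := R) (n := n)
        calc ((R/n : ℕ) : ℚ)^2 ≤ ((R:ℚ)/n)^2 := by gcongr
          _ = _ := by rw [div_pow, div_eq_mul_inv]
      rw [← Finset.mul_sum] at h4
      refine h4.trans ?_
      gcongr
      have : (0:ℚ) ≤ (R:ℚ)⁻¹ := by positivity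
      linarith
    have hg : (0:ℚ) < g0 := by exact_mod_cast hg0
    have h5 : (g0:ℚ) * ((∑ n ∈ Finset.Ioc g0 R, (R/n)^2 : ℕ) : ℚ) ≤ R^2 := by
      calc _ ≤ (g0:ℚ) * ((R:ℚ)^2 * (g0:ℚ)⁻¹) := by gcongr
        _ = _ := by field_simp
    have h6 : g0 * (∑ n ∈ Finset.Ioc g0 R, (R/n)^2) ≤ R^2 := by exact_mod_cast h5
    exact (Nat.mul_le_mul_left _ h1).trans h6
  · rw [Finset.Ioc_eq_empty (by omega), Finset.sum_empty] at h1
    have : ((Finset.Icc 1 (R:ℤ) ×ˢ Finset.Icc 1 (R:ℤ)).filter (fun a => g0 < Int.gcd a.1 a.2)).card = 0 := by omega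
    rw [this]; simp
end PartP15

section PartP16
open Polynomial

theorem W_exists (g : ℤ[X]) (d : ℕ) (hd : 2 ≤ d) (hgd : g.natDegree = d) (sg : Squarefree (g.map (Int.castRingHom ℚ)))
    (E : Fin 4 → ℤ) (m N : ℕ) (hm : 0 < m) (hN : 0 < N) (hdet : E 0 * E 3 - E 1 * E 2 = m ∨ E 0 * E 3 - E 1 * E 2 = -m)
    (hmN : Nat.Coprime m N) (u1 u2 : ℤ) (R g0 : ℕ) (hg0 : 0 < g0) :
    ∃ W : Finset (ℤ × ℤ), (∀ w ∈ W, 1 ≤ w.1 ∧ w.1 ≤ R ∧ 1 ≤ w.2 ∧ w.2 ≤ R) ∧ (∀ w ∈ W, Int.gcd w.1 w.2 ≤ g0) ∧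
      (∀ w ∈ W, (N:ℤ) ∣ E 0 * w.1 + E 1 * w.2 - u1 ∧ (N:ℤ) ∣ E 2 * w.1 + E 3 * w.2 - u2) ∧
      (∀ w ∈ W, hev d g.coeff (E 0 * w.1 + E 1 * w.2) (E 2 * w.1 + E 3 * w.2) ≠ 0) ∧
      g0 * (R/N)^2 ≤ g0 * W.card + R^2 + g0 * (d * R) := by
  classical
  set D := E 0 * E 3 - E 1 * E 2 with hD
  have hD0 : D ≠ 0 := by rcases hdet with h | h <;> rw [h] <;> simp <;> omega
  obtain ⟨D', z, hDz⟩ : ∃ D' z : ℤ, D * D' = 1 + N * z := by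
    obtain ⟨x, y, hxy⟩ := Nat.isCoprime_iff_coprime.2 hmN
    rcases hdet with h | h
    · exact ⟨x, -y, by rw [h]; linear_combination hxy⟩
    · exact ⟨-x, -y, by rw [h]; linear_combination hxy⟩
  set α1 := D' * (E 3 * u1 - E 1 * u2) with hα1
  set α2 := D' * (-E 2 * u1 + E 0 * u2) with hα2
  set I := Finset.Icc 1 (R:ℤ) with hI
  set W1 := (I.filter (fun x => (N:ℤ) ∣ x - α1)) ×ˢ (I.filter (fun x => (N:ℤ) ∣ x - α2)) with hW1
  set bg := (I ×ˢ I).filter (fun a => g0 < Int.gcd a.1 a.2) with hbg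
  set bz := (I ×ˢ I).filter (fun a => hev d g.coeff (E 0 * a.1 + E 1 * a.2) (E 2 * a.1 + E 3 * a.2) = 0) with hbz
  have hc1 : (R/N)^2 ≤ W1.card := by
    rw [hW1, Finset.card_product, sq]
    exact Nat.mul_le_mul (ap_card N R hN α1) (ap_card N R hN α2)
  have hc2 : g0 * bg.card ≤ R^2 := gcd_card R g0 hg0
  have hc3 : bz.card ≤ d * R := by
    obtain ⟨cc, hcc⟩ := hev_comp d (E 0) (E 1) (E 2) (E 3) g.coeff
    obtain ⟨i, hi1, hi2, hi3⟩ := gcoef g d hd hgd sg _ _ _ _ hD0 cc hcc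
    have hIc : I.card = R := by rw [hI, Int.card_Icc]; omega
    rw [← hIc]
    apply fib_card d cc i hi1 hi2 hi3 0 I
    · intro y hy
      left
      rw [hI, Finset.mem_Icc] at hy
      omega
    · intro a ha
      rw [hbz, Finset.mem_filter, Finset.mem_product] at ha
      refine ⟨ha.1.2, ?_⟩
      rw [hcc]
      exact ha.2
  refine ⟨(W1 \ bg) \ bz, ?_, ?_, ?_, ?_, ?_⟩
  · intro w hw
    simp only [Finset.mem_sdiff, hW1, Finset.mem_product, Finset.mem_filter, hI, Finset.mem_Icc] at hw
    tauto
  · intro w hw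
    simp only [Finset.mem_sdiff, hW1, Finset.mem_product, Finset.mem_filter, hbg] at hw
    by_contra hcon
    exact hw.1.2 ⟨⟨hw.1.1.1.1, hw.1.1.2.1⟩, not_le.1 hcon⟩
  · intro w hw
    simp only [Finset.mem_sdiff, hW1, Finset.mem_product, Finset.mem_filter] at hw
    obtain ⟨s, hs⟩ := hw.1.1.1.2
    obtain ⟨t, ht⟩ := hw.1.1.2.2
    constructor
    · refine ⟨E 0 * s + E 1 * t + z * u1, ?_⟩
      have : E 0 * α1 + E 1 * α2 = D * D' * u1 := by rw [hα1, hα2, hD]; ring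
      linear_combination E 0 * hs + E 1 * ht + this + u1 * hDz
    · refine ⟨E 2 * s + E 3 * t + z * u2, ?_⟩
      have : E 2 * α1 + E 3 * α2 = D * D' * u2 := by rw [hα1, hα2, hD]; ring
      linear_combination E 2 * hs + E 3 * ht + this + u2 * hDz
  · intro w hw h0
    simp only [Finset.mem_sdiff, hW1, Finset.mem_product, Finset.mem_filter, hbz] at hw
    exact hw.2 ⟨⟨hw.1.1.1.1, hw.1.1.2.1⟩, h0⟩
  · have k1 := Finset.le_card_sdiff bg W1
    have k2 := Finset.le_card_sdiff bz (W1 \ bg)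
    have k3 : (R/N)^2 ≤ ((W1 \ bg) \ bz).card + bg.card + d * R := by omega
    calc g0 * (R/N)^2 ≤ g0 * (((W1 \ bg) \ bz).card + bg.card + d * R) := Nat.mul_le_mul_left _ k3
      _ = g0 * ((W1 \ bg) \ bz).card + g0 * bg.card + g0 * (d * R) := by ring
      _ ≤ _ := by omega

theorem zero_bound (f : ℤ[X]) (d : ℕ) (hd : 1 ≤ d) (hfd : f.natDegree = d) (sf : Squarefree (f.map (Int.castRingHom ℚ))) :
    ∃ K : ℕ, 1 ≤ K ∧ ∀ x y : ℤ, IsCoprime x y → hev d f.coeff x y = 0 → nm x y ≤ K := by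
  have f0 : f ≠ 0 := by rintro rfl; simp at hfd; omega
  have hlc : f.coeff d ≠ 0 := by rw [← hfd]; exact leadingCoeff_ne_zero.2 f0
  set M : ℝ := ∑ θ ∈ croots f, ‖θ‖ with hM
  obtain ⟨n, hn⟩ := exists_nat_ge M
  refine ⟨(n + 1) * (f.coeff d).natAbs, Nat.mul_pos (by omega) (Int.natAbs_pos.2 hlc), ?_⟩
  intro x y hxy h0
  have hyd : y ∣ f.coeff d := by
    have h1 : y ∣ f.coeff d * x^d := by
      have : y ∣ hev d f.coeff x y - f.coeff d * x^d := by
        unfold hev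
        rw [Finset.sum_range_succ]
        simp only [Nat.sub_self, pow_zero, mul_one, Int.cast_id, add_sub_cancel_right]
        apply Finset.dvd_sum
        intro i hi
        rw [Finset.mem_range] at hi
        exact Dvd.dvd.mul_left (dvd_pow_self y (by omega)) _
      rw [h0, zero_sub] at this
      exact (dvd_neg.1 this)
    exact (hxy.symm.pow_right).dvd_of_dvd_mul_right h1
  have hy : |y| ≤ (f.coeff d).natAbs := by
    rw [Int.natCast_natAbs]
    exact Int.le_of_dvd (abs_pos.2 hlc) ((abs_dvd_abs _ _).2 hyd)
  have h0' : hev d f.coeff (x:ℂ) (y:ℂ) = 0 := by rw [hev_intCast, h0]; simp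
  obtain ⟨hy0, hr⟩ := hev_root_form f d hd hfd sf (x:ℂ) (y:ℂ) h0' (by
    by_contra hcon
    push Not at hcon
    have hx : x = 0 := by exact_mod_cast hcon.1
    have hy : y = 0 := by exact_mod_cast hcon.2
    rw [hx, hy] at hxy
    exact not_isCoprime_zero_zero hxy)
  have hle : ‖(x:ℂ)/y‖ ≤ M := Finset.single_le_sum (f := fun θ : ℂ => ‖θ‖) (fun θ _ => norm_nonneg θ) hr
  have hx : |x| ≤ n * |y| := by
    have : ‖(x:ℂ)‖ ≤ n * ‖(y:ℂ)‖ := by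
      rw [norm_div, div_le_iff₀ (norm_pos_iff.2 hy0)] at hle
      exact hle.trans (by gcongr)
    rw [Complex.norm_intCast, Complex.norm_intCast] at this
    exact_mod_cast this
  have hb : (0:ℤ) ≤ (f.coeff d).natAbs := by positivity
  apply max_le
  · push_cast
    have : (n:ℤ) * |y| ≤ n * (f.coeff d).natAbs := by gcongr
    simp only [Int.natCast_natAbs] at *
    linarith
  · push_cast
    have : 0 ≤ (n:ℤ) * (f.coeff d).natAbs := by positivity
    simp only [Int.natCast_natAbs] at *
    linarith

theorem hev_mod (d : ℕ) (c : ℕ → ℤ) (p t x y : ℤ) (h : p ∣ x - t * y) (h1 : p ∣ hev d c t 1) : p ∣ hev d c x y := by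
  have e1 : hev d c (y * t) (y * 1) = y^d * hev d c t 1 := hev_scale d c y t 1
  have h2 : p ∣ hev d c x y - hev d c (y*t) (y*1) := by
    unfold hev
    rw [← Finset.sum_sub_distrib]
    apply Finset.dvd_sum
    intro i _
    have : p ∣ x^i - (y*t)^i := (by rw [mul_comm y t]; exact h : p ∣ x - y*t).trans (sub_dvd_pow_sub_pow _ _ _)
    obtain ⟨k, hk⟩ := this
    refine ⟨c i * k * y^(d-i), ?_⟩
    simp only [Int.cast_id, mul_one]
    linear_combination c i * y^(d-i) * hk
  rw [e1] at h2
  have h3 := dvd_add h2 (Dvd.dvd.mul_left h1 (y^d))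
  simpa using h3

theorem short_basis (Q S m : ℤ) (hQ : 0 < Q) (hS : 0 ≤ S) (hm0 : 0 ≤ m) (hm : m ≤ 4 * Q^2) (a b c e : ℤ)
    (h1 : 3*(a^2+b^2)*(c^2+e^2) ≤ 4*m^2) (h2 : a^2+b^2 ≤ c^2+e^2) (h3 : Q < nm a b * S) :
    |a| ≤ 5*Q*S ∧ |b| ≤ 5*Q*S ∧ |c| ≤ 5*Q*S ∧ |e| ≤ 5*Q*S := by
  have hn : (nm a b)^2 ≤ a^2 + b^2 := by
    unfold nm
    rcases max_choice |a| |b| with h | h <;> rw [h, sq_abs] <;> nlinarith [sq_nonneg a, sq_nonneg b]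
  have hm2 : m^2 ≤ 16 * Q^4 := by
    have : m^2 ≤ (4*Q^2)^2 := pow_le_pow_left₀ hm0 hm 2
    linarith [this, (by ring : (4*Q^2)^2 = 16*Q^4)]
  have hq : Q^2 ≤ (nm a b)^2 * S^2 := by
    rw [← mul_pow]; exact pow_le_pow_left₀ hQ.le h3.le 2
  have hce : 0 ≤ c^2+e^2 := by positivity
  have k1 : 3 * Q^2 * (c^2+e^2) ≤ 64 * Q^4 * S^2 := by
    have t1 : Q^2 * (c^2+e^2) ≤ ((nm a b)^2 * S^2) * (c^2+e^2) := mul_le_mul_of_nonneg_right hq hce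
    have t2 : ((nm a b)^2 * (S^2 * (c^2+e^2))) ≤ (a^2+b^2) * (S^2 * (c^2+e^2)) :=
      mul_le_mul_of_nonneg_right hn (by positivity)
    have t3 : (3*(a^2+b^2)*(c^2+e^2)) * S^2 ≤ 4*m^2 * S^2 := mul_le_mul_of_nonneg_right h1 (by positivity)
    have t4 : m^2 * S^2 ≤ 16*Q^4 * S^2 := mul_le_mul_of_nonneg_right hm2 (by positivity)
    nlinarith
  have k2 : c^2 + e^2 ≤ (5*Q*S)^2 := by
    have hQ2 : 0 < Q^2 := by positivity
    have : Q^2 * (3 * (c^2+e^2)) ≤ Q^2 * (64 * Q^2 * S^2) := by nlinarith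
    have := le_of_mul_le_mul_left this hQ2
    nlinarith [mul_nonneg (sq_nonneg Q) (sq_nonneg S)]
  have h0 : 0 ≤ 5*Q*S := by positivity
  refine ⟨?_, ?_, ?_, ?_⟩ <;> apply abs_le_of_sq_le_sq _ h0 <;> nlinarith [sq_nonneg a, sq_nonneg b, sq_nonneg c, sq_nonneg e]
end PartP16

section PartP17
open Polynomial

/-- a prime `p` not dividing the leading coefficient and not dividing both coordinates -/
theorem y2_unit (d : ℕ) (c : ℕ → ℤ) (p : ℕ) (hp : p.Prime) (hlc : ¬ (p:ℤ) ∣ c d) (x y : ℤ)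
    (h : (p:ℤ) ∣ hev d c x y) (hxy : ¬ ((p:ℤ) ∣ x ∧ (p:ℤ) ∣ y)) : ¬ (p:ℤ) ∣ y := by
  intro hy
  apply hxy
  refine ⟨?_, hy⟩
  have : Fact p.Prime := ⟨hp⟩
  rw [← ZMod.intCast_zmod_eq_zero_iff_dvd] at *
  rw [← hev_intCast, hy, hev_y0'] at h
  exact eq_zero_of_pow_eq_zero ((mul_eq_zero.mp h).resolve_left hlc)

theorem roots_mod_card (f : ℤ[X]) (d : ℕ) (hfd : f.natDegree = d) (p : ℕ) [Fact p.Prime] :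
    ((f.map (Int.castRingHom (ZMod p))).roots.toFinset).card ≤ d := by
  refine (Multiset.toFinset_card_le _).trans ((card_roots' _).trans ?_)
  rw [← hfd]; exact natDegree_map_le

theorem ratio_root (f : ℤ[X]) (d : ℕ) (hfd : f.natDegree = d) (p : ℕ) [Fact p.Prime] (hlc : ¬ (p:ℤ) ∣ f.coeff d)
    (x y : ℤ) (hy : ¬ (p:ℤ) ∣ y) (h : (p:ℤ) ∣ hev d f.coeff x y) :
    ((x:ZMod p) / (y:ZMod p)) ∈ (f.map (Int.castRingHom (ZMod p))).roots.toFinset := by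
  rw [← ZMod.intCast_zmod_eq_zero_iff_dvd] at *
  have h0 : f.map (Int.castRingHom (ZMod p)) ≠ 0 := by
    intro h0
    have := congrArg (fun P => coeff P d) h0
    simp at this
    exact hlc this
  rw [Multiset.mem_toFinset, mem_roots h0, IsRoot.def, eval_map]
  have h3 : hev f.natDegree f.coeff ((y:ZMod p) * ((x:ZMod p)/y)) ((y:ZMod p) * 1) = 0 := by
    rw [mul_div_cancel₀ _ hy, mul_one, hfd, hev_intCast]; exact h
  rw [hev_scale, hev_one] at h3
  exact (mul_eq_zero.mp h3).resolve_left (pow_ne_zero _ hy)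

set_option maxHeartbeats 1000000 in
theorem near_inst (f : ℤ[X]) (d : ℕ) (hd : 2 ≤ d) (hfd : f.natDegree = d)
    (H K0 Q L S : ℕ) (hH : ∀ i ≤ d, |f.coeff i| ≤ H)
    (hK0 : ∀ x y : ℤ, IsCoprime x y → hev d f.coeff x y = 0 → nm x y ≤ K0)
    (p q : ℕ) (hp : p.Prime) (hq : q.Prime) (hpq : p ≠ q) (hp1 : Q ≤ p) (hp2 : p < 2*Q) (hq1 : Q ≤ q) (hq2 : q < 2*Q)
    (hpl : ¬ (p:ℤ) ∣ f.coeff d) (hql : ¬ (q:ℤ) ∣ f.coeff d) (hS : 2 ≤ S)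
    (hL1 : (d+1)*H*L^d < Q) (hL2 : 2*K0*L < Q)
    (hD2 : ∀ x y : ℤ, nm x y * S ≤ Q → hev d f.coeff x y ≠ 0 → ¬ ((p:ℤ) ∣ hev d f.coeff x y ∧ (q:ℤ) ∣ hev d f.coeff x y))
    (W : Finset (ℤ × ℤ)) (y : ℤ × ℤ → ℤ × ℤ) (hy1 : ∀ a ∈ W, nm (y a).1 (y a).2 ≤ L * Q)
    (hy0 : ∀ a ∈ W, hev d f.coeff (y a).1 (y a).2 ≠ 0)
    (hyp : ∀ a ∈ W, (p:ℤ) ∣ hev d f.coeff (y a).1 (y a).2) (hyq : ∀ a ∈ W, (q:ℤ) ∣ hev d f.coeff (y a).1 (y a).2)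
    (n : ℕ) (hn : d^2 * n < W.card) :
    ∃ B : Fin 4 → ℤ, (∀ i, |B i| ≤ 5*Q*S) ∧ ∃ W0 ⊆ W, n < W0.card ∧ ∃ k : ℤ × ℤ → ℤ × ℤ, ∀ a ∈ W0,
      (y a).1 = B 0 * (k a).1 + B 1 * (k a).2 ∧ (y a).2 = B 2 * (k a).1 + B 3 * (k a).2 ∧
      |(k a).1| ≤ 10*L*S ∧ |(k a).2| ≤ 10*L*S := by
  classical
  have hQ : 0 < Q := by omega
  have fp : Fact p.Prime := ⟨hp⟩
  have fq : Fact q.Prime := ⟨hq⟩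
  have f0 : f ≠ 0 := by rintro rfl; simp at hfd; omega
  have hlc : f.coeff d ≠ 0 := by rw [← hfd]; exact leadingCoeff_ne_zero.2 f0
  have hcopN : Nat.Coprime p q := (Nat.coprime_primes hp hq).2 hpq
  have hcop : IsCoprime (p:ℤ) q := Nat.isCoprime_iff_coprime.2 hcopN
  -- no common divisor
  have nodiv : ∀ p q : ℕ, p.Prime → q.Prime → p ≠ q → Q ≤ p → Q ≤ q → ∀ a ∈ W, (q:ℤ) ∣ hev d f.coeff (y a).1 (y a).2 →
      ¬ ((p:ℤ) ∣ (y a).1 ∧ (p:ℤ) ∣ (y a).2) := by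
    intro p q hp hq hpq hp1 hq1 a ha hqd ⟨⟨s, hs⟩, ⟨t, ht⟩⟩
    have hF0 := hy0 a ha
    have hnm := hy1 a ha
    rw [hs, ht] at hqd hF0 hnm
    rw [hev_scale] at hqd hF0
    have hF' : hev d f.coeff s t ≠ 0 := right_ne_zero_of_mul hF0
    have hqp : Prime (q:ℤ) := Nat.prime_iff_prime_int.1 hq
    have hqF : (q:ℤ) ∣ hev d f.coeff s t := by
      rcases hqp.dvd_or_dvd hqd with h | h
      · exfalso
        have h1 := hqp.dvd_of_dvd_pow h
        have h2 : q ∣ p := by exact_mod_cast h1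
        exact hpq ((Nat.prime_dvd_prime_iff_eq hq hp).1 h2).symm
      · exact h
    have hnm' : nm s t ≤ L := by
      have hp' : (Q:ℤ) ≤ p := by exact_mod_cast hp1
      have hQ' : (0:ℤ) < Q := by exact_mod_cast hQ
      have e : nm (p*s) (p*t) = p * nm s t := by
        unfold nm
        rw [abs_mul, abs_mul, Nat.abs_cast, ← mul_max_of_nonneg _ _ (by positivity)]
      rw [e] at hnm
      have h0 := nm_nonneg s t
      by_contra hc
      push Not at hc
      have e1 : (Q:ℤ) * nm s t ≤ p * nm s t := mul_le_mul_of_nonneg_right hp' h0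
      have e2 : (Q:ℤ) * L < Q * nm s t := mul_lt_mul_of_pos_left hc hQ'
      linarith
    have hb := hev_bd d f.coeff H L hH s t hnm'
    have hle := Int.le_of_dvd (abs_pos.2 hF') ((dvd_abs _ _).2 hqF)
    have : ((q:ℕ):ℤ) ≤ (((d+1)*H*L^d : ℕ) : ℤ) := by push_cast; linarith
    have : q ≤ (d+1)*H*L^d := by exact_mod_cast this
    omega
  have up : ∀ a ∈ W, ¬ (p:ℤ) ∣ (y a).2 := fun a ha =>
    y2_unit d f.coeff p hp hpl _ _ (hyp a ha) (nodiv p q hp hq hpq hp1 hq1 a ha (hyq a ha))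
  have uq : ∀ a ∈ W, ¬ (q:ℤ) ∣ (y a).2 := fun a ha =>
    y2_unit d f.coeff q hq hql _ _ (hyq a ha) (nodiv q p hq hp hpq.symm hq1 hp1 a ha (hyp a ha))
  -- popular class
  obtain ⟨⟨s1, s2⟩, hs12, hfib⟩ := Finset.exists_lt_card_fiber_of_mul_lt_card_of_maps_to
    (s := W) (t := (f.map (Int.castRingHom (ZMod p))).roots.toFinset ×ˢ (f.map (Int.castRingHom (ZMod q))).roots.toFinset)
    (f := fun a => ((((y a).1:ZMod p) / ((y a).2:ZMod p)), (((y a).1:ZMod q) / ((y a).2:ZMod q)))) (n := n)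
    (by
      intro a ha
      rw [Finset.mem_product]
      exact ⟨ratio_root f d hfd p hpl _ _ (up a ha) (hyp a ha), ratio_root f d hfd q hql _ _ (uq a ha) (hyq a ha)⟩)
    (by
      rw [Finset.card_product]
      refine lt_of_le_of_lt ?_ hn
      rw [sq]
      exact Nat.mul_le_mul_right _ (Nat.mul_le_mul (roots_mod_card f d hfd p) (roots_mod_card f d hfd q)))
  set W0 := W.filter (fun a => ((((y a).1:ZMod p) / ((y a).2:ZMod p)), (((y a).1:ZMod q) / ((y a).2:ZMod q))) = (s1, s2)) with hW0
  have hW0W : W0 ⊆ W := Finset.filter_subset _ _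
  obtain ⟨t, ht1, ht2⟩ := Nat.chineseRemainder hcopN s1.val s2.val
  have tp : ((t:ℤ) : ZMod p) = s1 := by
    have := (ZMod.natCast_eq_natCast_iff _ _ _).2 ht1
    rw [ZMod.natCast_zmod_val] at this
    simpa using this
  have tq : ((t:ℤ) : ZMod q) = s2 := by
    have := (ZMod.natCast_eq_natCast_iff _ _ _).2 ht2
    rw [ZMod.natCast_zmod_val] at this
    simpa using this
  have hcong : ∀ a ∈ W0, ((p*q : ℕ):ℤ) ∣ (y a).1 - t * (y a).2 := by
    intro a ha
    rw [hW0, Finset.mem_filter] at ha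
    obtain ⟨haW, heq⟩ := ha
    rw [Prod.mk.injEq] at heq
    push_cast
    apply hcop.mul_dvd
    · have := up a haW
      rw [← ZMod.intCast_zmod_eq_zero_iff_dvd] at *
      have e := heq.1
      rw [div_eq_iff this] at e
      push_cast at tp ⊢
      rw [e, tp]; ring
    · have := uq a haW
      rw [← ZMod.intCast_zmod_eq_zero_iff_dvd] at *
      have e := heq.2
      rw [div_eq_iff this] at e
      push_cast at tq ⊢
      rw [e, tq]; ring
  have hroot_p : (p:ℤ) ∣ hev d f.coeff (t:ℤ) 1 := by
    rw [← ZMod.intCast_zmod_eq_zero_iff_dvd, ← hev_intCast, tp, ← hfd, Int.cast_one, hev_one]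
    have := (Finset.mem_product.1 hs12).1
    rw [Multiset.mem_toFinset] at this
    have := (mem_roots'.1 this).2
    rw [IsRoot.def, eval_map] at this
    exact this
  have hroot_q : (q:ℤ) ∣ hev d f.coeff (t:ℤ) 1 := by
    rw [← ZMod.intCast_zmod_eq_zero_iff_dvd, ← hev_intCast, tq, ← hfd, Int.cast_one, hev_one]
    have := (Finset.mem_product.1 hs12).2
    rw [Multiset.mem_toFinset] at this
    have := (mem_roots'.1 this).2
    rw [IsRoot.def, eval_map] at this
    exact this
  have hm : 0 < p*q := Nat.mul_pos hp.pos hq.pos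
  obtain ⟨a, b, c, e, b1, b2, b3, b4, b5⟩ := s4 (p*q) hm t
  have hmQ : (Q:ℤ)^2 ≤ ((p*q : ℕ):ℤ) := by
    have : Q*Q ≤ p*q := Nat.mul_le_mul hp1 hq1
    rw [sq]; exact_mod_cast this
  have hmQ2 : ((p*q : ℕ):ℤ) ≤ 4*(Q:ℤ)^2 := by
    have : p*q ≤ (2*Q)*(2*Q) := Nat.mul_le_mul hp2.le hq2.le
    have : ((p*q:ℕ):ℤ) ≤ ((2*Q)*(2*Q) : ℕ) := by exact_mod_cast this
    push_cast at this ⊢; linarith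
  have pdvd : (p:ℤ) ∣ ((p*q:ℕ):ℤ) := by push_cast; exact dvd_mul_right _ _
  have qdvd : (q:ℤ) ∣ ((p*q:ℕ):ℤ) := by push_cast; exact dvd_mul_left _ _
  have hQ' : (0:ℤ) < Q := by exact_mod_cast hQ
  obtain ⟨a0, ha0⟩ : W0.Nonempty := Finset.card_pos.1 (by omega)
  have hlong : (Q:ℤ) < nm a b * S := by
    by_contra hcon
    push Not at hcon
    have hpF := hev_mod d f.coeff p t a b (pdvd.trans b1) hroot_p
    have hqF := hev_mod d f.coeff q t a b (qdvd.trans b1) hroot_q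
    have hF : hev d f.coeff a b = 0 := by
      by_contra h
      exact hD2 a b hcon h ⟨hpF, hqF⟩
    have hgpos : 0 < Int.gcd a b := by
      rw [Int.gcd_pos_iff]
      by_contra h
      push Not at h
      rw [h.1, h.2] at b3
      have : (0:ℤ) < ((p*q:ℕ):ℤ) := by exact_mod_cast hm
      rcases b3 with h | h <;> linarith
    obtain ⟨γ, r1, r2, hg, hr, hr1, hr2⟩ := Int.exists_gcd_one' hgpos
    have hrc : IsCoprime r1 r2 := Int.isCoprime_iff_gcd_eq_one.2 hr
    have hγ : (0:ℤ) < γ := by exact_mod_cast hg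
    have hFr : hev d f.coeff r1 r2 = 0 := by
      rw [hr1, hr2, mul_comm r1, mul_comm r2, hev_scale] at hF
      exact (mul_eq_zero.mp hF).resolve_left (pow_ne_zero _ hγ.ne')
    have hrb := hK0 r1 r2 hrc hFr
    have hr20 : r2 ≠ 0 := by
      rintro rfl
      rw [hev_y0'] at hFr
      have := (mul_eq_zero.mp hFr).resolve_left hlc
      have := (pow_eq_zero_iff (by omega)).1 this
      rw [this] at hrc
      exact not_isCoprime_zero_zero hrc
    -- γ is small
    have hγb : 2 * (γ:ℤ) ≤ Q := by
      have h1 : (γ:ℤ) ≤ nm a b := by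
        unfold nm
        refine le_trans ?_ (le_max_right _ _)
        rw [hr2, abs_mul, abs_of_pos hγ]
        have := Int.one_le_abs hr20
        exact le_mul_of_one_le_left hγ.le this
      have hS' : (2:ℤ) ≤ S := by exact_mod_cast hS
      have e1 : (γ:ℤ) * 2 ≤ γ * S := mul_le_mul_of_nonneg_left hS' hγ.le
      have e2 : (γ:ℤ) * S ≤ nm a b * S := mul_le_mul_of_nonneg_right h1 (by positivity)
      linarith
    have hγp : ∀ p : ℕ, p.Prime → Q ≤ p → (p:ℤ) ∣ a - t*b → (p:ℤ) ∣ r1 - t*r2 := by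
      intro p hp hp1 h
      have e1 : a - t*b = γ * (r1 - t*r2) := by rw [hr1, hr2]; ring
      rw [e1] at h
      rcases (Nat.prime_iff_prime_int.1 hp).dvd_or_dvd h with h | h
      · have := Int.le_of_dvd hγ h
        have hp' : (Q:ℤ) ≤ p := by exact_mod_cast hp1
        linarith
      · exact h
    have hpr : ((p*q:ℕ):ℤ) ∣ r1 - t*r2 := by
      push_cast
      exact hcop.mul_dvd (hγp p hp hp1 (pdvd.trans b1)) (hγp q hq hq1 (qdvd.trans b1))
    have hdet : ((p*q:ℕ):ℤ) ∣ r1 * (y a0).2 - r2 * (y a0).1 := by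
      have := dvd_sub (Dvd.dvd.mul_right hpr (y a0).2) (Dvd.dvd.mul_left (hcong a0 ha0) r2)
      have e1 : (r1 - t*r2) * (y a0).2 - r2 * ((y a0).1 - t * (y a0).2) = r1 * (y a0).2 - r2 * (y a0).1 := by ring
      rwa [e1] at this
    have hdet0 : r1 * (y a0).2 - r2 * (y a0).1 = 0 := by
      by_contra hne
      have h1 := Int.le_of_dvd (abs_pos.2 hne) ((dvd_abs _ _).2 hdet)
      have h2 : |r1 * (y a0).2 - r2 * (y a0).1| ≤ K0 * (L*Q) + K0 * (L*Q) := by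
        refine (abs_sub _ _).trans ?_
        rw [abs_mul, abs_mul]
        have q1 := (le_max_left _ _).trans hrb
        have q2 := (le_max_right _ _).trans hrb
        have q3 := (le_max_left _ _).trans (hy1 a0 (hW0W ha0))
        have q4 := (le_max_right _ _).trans (hy1 a0 (hW0W ha0))
        gcongr
      have h3 : (2*K0*L:ℤ) < Q := by exact_mod_cast hL2
      have h4 : (2*K0*L:ℤ) * Q < Q * Q := mul_lt_mul_of_pos_right h3 hQ'
      have h5 : (K0:ℤ) * (L*Q) + K0 * (L*Q) = 2*K0*L*Q := by ring
      have h6 : (Q:ℤ)^2 = Q*Q := sq _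
      linarith
    have hFy : hev d f.coeff (y a0).1 (y a0).2 = 0 := by
      have h1 : hev d f.coeff (r2 * (y a0).1) (r2 * (y a0).2) = 0 := by
        have : r2 * (y a0).1 = (y a0).2 * r1 := by linarith
        rw [this, mul_comm r2, hev_scale, hFr, mul_zero]
      rw [hev_scale] at h1
      exact (mul_eq_zero.mp h1).resolve_left (pow_ne_zero _ hr20)
    exact hy0 a0 (hW0W ha0) hFy
  obtain ⟨ba, bb, bc, be⟩ := short_basis Q S _ hQ' (by positivity) (by positivity) hmQ2 a b c e b4 b5 hlong
  have hcoord : ∀ w ∈ W0, ∃ u : ℤ × ℤ, (y w).1 = a * u.1 + c * u.2 ∧ (y w).2 = b * u.1 + e * u.2 ∧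
      |u.1| ≤ 10*L*S ∧ |u.2| ≤ 10*L*S := by
    intro w hw
    obtain ⟨u, v, c1, c2, c3, c4⟩ := s4_coord (p*q) hm t a b c e b1 b2 b3 _ _ (hcong w hw)
    have q3 := (le_max_left _ _).trans (hy1 w (hW0W hw))
    have q4 := (le_max_right _ _).trans (hy1 w (hW0W hw))
    have bnd : ∀ s t z1 z2 : ℤ, |s| ≤ L*Q → |t| ≤ L*Q → |z1| ≤ 5*Q*S → |z2| ≤ 5*Q*S → |s*z1 - t*z2| ≤ 10*L*S*(Q:ℤ)^2 := by
      intro s t z1 z2 h1 h2 h3 h4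
      refine (abs_sub _ _).trans ?_
      rw [abs_mul, abs_mul]
      calc |s| * |z1| + |t| * |z2| ≤ (L*Q)*(5*Q*S) + (L*Q)*(5*Q*S) := by gcongr
        _ = _ := by ring
    have fin : ∀ u : ℤ, ((p*q:ℕ):ℤ) * |u| ≤ 10*L*S*(Q:ℤ)^2 → |u| ≤ 10*L*S := by
      intro u h
      have h1 : (Q:ℤ)^2 * |u| ≤ (Q:ℤ)^2 * (10*L*S) := by
        have := mul_le_mul_of_nonneg_right hmQ (abs_nonneg u)
        linarith
      exact le_of_mul_le_mul_left h1 (by positivity)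
    refine ⟨(u, v), c1, c2, fin u ?_, fin v ?_⟩
    · rw [c3]; exact bnd _ _ _ _ q3 q4 be bc
    · rw [c4]
      have := bnd (y w).2 (y w).1 a b q4 q3 ba bb
      rwa [mul_comm a, mul_comm b]
  choose! k hk using hcoord
  refine ⟨![a, c, b, e], ?_, W0, hW0W, hfib, k, ?_⟩
  · intro i
    fin_cases i
    · exact ba
    · exact bc
    · exact bb
    · exact be
  · intro w hw
    exact hk w hw
end PartP17

section PartP18
open Polynomial

theorem dvd_G (g h k : ℤ[X]) (c : ℤ) (hc : c ≠ 0) (hg0 : g ≠ 0) (hk : C c * g = h * k) (p : ℕ) (hp : p.Prime)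
    (hpc : ¬ (p:ℤ) ∣ c) (x y : ℤ) (hd : (p:ℤ) ∣ hev h.natDegree h.coeff x y) :
    (p:ℤ) ∣ hev g.natDegree g.coeff x y := by
  have hne : C c * g ≠ 0 := mul_ne_zero (C_ne_zero.2 hc) hg0
  have hh : h ≠ 0 := by rintro rfl; rw [zero_mul] at hk; exact hne hk
  have hk0 : k ≠ 0 := by rintro rfl; rw [mul_zero] at hk; exact hne hk
  have e := hev_polymul h k hh hk0 x y
  rw [← hk, natDegree_C_mul hc] at e
  have e2 : (C c * g).coeff = fun i => c * g.coeff i := by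
    funext i; simp
  rw [e2, hev_smul] at e
  have : (p:ℤ) ∣ c * hev g.natDegree g.coeff x y := by
    have e' : c * hev g.natDegree g.coeff x y = _ := e
    rw [e']; exact Dvd.dvd.mul_right hd _
  exact ((Nat.prime_iff_prime_int.1 hp).dvd_or_dvd this).resolve_left hpc

theorem E_exists (g h1 h2 k1 k2 : ℤ[X]) (c1 c2 : ℤ) (hc1 : c1 ≠ 0) (hc2 : c2 ≠ 0) (hg0 : g ≠ 0)
    (e1 : C c1 * g = h1 * k1) (e2 : C c2 * g = h2 * k2) (Q S p q : ℕ) (hp : p.Prime) (hq : q.Prime) (hpq : p ≠ q)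
    (hQ : 0 < Q) (hp2 : p < 2*Q) (hq2 : q < 2*Q) (hpc : ¬ (p:ℤ) ∣ c1) (hqc : ¬ (q:ℤ) ∣ c2)
    (hr1 : ∃ r : ℤ, (p:ℤ) ∣ h1.eval r) (hr2 : ∃ r : ℤ, (q:ℤ) ∣ h2.eval r)
    (hD1 : ∀ x y : ℤ, ¬ (x = 0 ∧ y = 0) → nm x y * S ≤ Q →
      ¬ ((p:ℤ) ∣ hev h1.natDegree h1.coeff x y ∧ (q:ℤ) ∣ hev h2.natDegree h2.coeff x y)) :
    ∃ E : Fin 4 → ℤ, (E 0 * E 3 - E 1 * E 2 = (p*q:ℕ) ∨ E 0 * E 3 - E 1 * E 2 = -(p*q:ℕ)) ∧ (∀ i, |E i| ≤ 5*Q*S) ∧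
      ∀ u v : ℤ, (p:ℤ) ∣ hev g.natDegree g.coeff (E 0 * u + E 1 * v) (E 2 * u + E 3 * v) ∧
        (q:ℤ) ∣ hev g.natDegree g.coeff (E 0 * u + E 1 * v) (E 2 * u + E 3 * v) := by
  have hcopN : Nat.Coprime p q := (Nat.coprime_primes hp hq).2 hpq
  have hcop : IsCoprime (p:ℤ) q := Nat.isCoprime_iff_coprime.2 hcopN
  obtain ⟨r1, hr1⟩ := hr1
  obtain ⟨r2, hr2⟩ := hr2
  obtain ⟨α, β, hαβ⟩ := hcop
  set t : ℤ := r1 * (β * q) + r2 * (α * p) with ht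
  have tp : (p:ℤ) ∣ t - r1 := ⟨α * (r2 - r1), by rw [ht]; linear_combination r1 * hαβ⟩
  have tq : (q:ℤ) ∣ t - r2 := ⟨β * (r1 - r2), by rw [ht]; linear_combination r2 * hαβ⟩
  have ht1 : (p:ℤ) ∣ hev h1.natDegree h1.coeff t 1 := by
    refine hev_mod _ _ _ r1 _ _ (by simpa using tp) ?_
    rw [hev_one]; simpa using hr1
  have ht2 : (q:ℤ) ∣ hev h2.natDegree h2.coeff t 1 := by
    refine hev_mod _ _ _ r2 _ _ (by simpa using tq) ?_
    rw [hev_one]; simpa using hr2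
  have hm : 0 < p*q := Nat.mul_pos hp.pos hq.pos
  have hm' : (0:ℤ) < ((p*q:ℕ):ℤ) := by exact_mod_cast hm
  obtain ⟨a, b, c, e, b1, b2, b3, b4, b5⟩ := s4 (p*q) hm t
  have pdvd : (p:ℤ) ∣ ((p*q:ℕ):ℤ) := by push_cast; exact dvd_mul_right _ _
  have qdvd : (q:ℤ) ∣ ((p*q:ℕ):ℤ) := by push_cast; exact dvd_mul_left _ _
  have hQ' : (0:ℤ) < Q := by exact_mod_cast hQ
  have hmQ2 : ((p*q : ℕ):ℤ) ≤ 4*(Q:ℤ)^2 := by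
    have : p*q ≤ (2*Q)*(2*Q) := Nat.mul_le_mul hp2.le hq2.le
    have : ((p*q:ℕ):ℤ) ≤ ((2*Q)*(2*Q) : ℕ) := by exact_mod_cast this
    push_cast at this ⊢; linarith
  have hlong : (Q:ℤ) < nm a b * S := by
    by_contra hcon
    push Not at hcon
    refine hD1 a b ?_ hcon ⟨hev_mod _ _ _ t _ _ (pdvd.trans b1) ht1, hev_mod _ _ _ t _ _ (qdvd.trans b1) ht2⟩
    rintro ⟨rfl, rfl⟩
    rcases b3 with h | h <;> linarith
  obtain ⟨ba, bb, bc, be⟩ := short_basis Q S _ hQ' (by positivity) (by positivity) hmQ2 a b c e b4 b5 hlong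
  refine ⟨![a, c, b, e], ?_, ?_, ?_⟩
  · show a * e - c * b = _ ∨ a * e - c * b = _
    rw [mul_comm c b]; exact b3
  · intro i
    fin_cases i
    · exact ba
    · exact bc
    · exact bb
    · exact be
  · intro u v
    show (p:ℤ) ∣ hev g.natDegree g.coeff (a * u + c * v) (b * u + e * v) ∧ (q:ℤ) ∣ hev g.natDegree g.coeff (a * u + c * v) (b * u + e * v)
    have hd : ((p*q:ℕ):ℤ) ∣ (a * u + c * v) - t * (b * u + e * v) := by
      have := dvd_add (Dvd.dvd.mul_right b1 u) (Dvd.dvd.mul_right b2 v)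
      have e1 : (a - t * b) * u + (c - t * e) * v = (a * u + c * v) - t * (b * u + e * v) := by ring
      rwa [e1] at this
    exact ⟨dvd_G g h1 k1 c1 hc1 hg0 e1 p hp hpc _ _ (hev_mod _ _ _ t _ _ (pdvd.trans hd) ht1),
      dvd_G g h2 k2 c2 hc2 hg0 e2 q hq hqc _ _ (hev_mod _ _ _ t _ _ (qdvd.trans hd) ht2)⟩
end PartP18

section PartP19
open Polynomial

theorem fib_R (g : ℤ[X]) (d : ℕ) (hd : 2 ≤ d) (hgd : g.natDegree = d) (sg : Squarefree (g.map (Int.castRingHom ℚ)))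
    (E : Fin 4 → ℤ) (hdet : E 0 * E 3 - E 1 * E 2 ≠ 0) (R : ℕ) (v : ℤ) (S : Finset (ℤ × ℤ))
    (hS : ∀ w ∈ S, (1 ≤ w.2 ∧ w.2 ≤ R) ∧ hev d g.coeff (E 0 * w.1 + E 1 * w.2) (E 2 * w.1 + E 3 * w.2) = v) :
    S.card ≤ d * R := by
  obtain ⟨cc, hcc⟩ := hev_comp d (E 0) (E 1) (E 2) (E 3) g.coeff
  obtain ⟨i, hi1, hi2, hi3⟩ := gcoef g d hd hgd sg (E 0) (E 1) (E 2) (E 3) hdet cc hcc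
  have := fib_card d cc i hi1 hi2 hi3 v (Finset.Icc 1 (R:ℤ)) (by
      intro y hy
      rw [Finset.mem_Icc] at hy
      left; omega) S (by
      intro w hw
      obtain ⟨h1, h2⟩ := hS w hw
      refine ⟨Finset.mem_Icc.2 h1, ?_⟩
      rw [hcc]; simpa using h2)
  simpa using this

theorem far_count (f g : ℤ[X]) (d : ℕ) (hd : 2 ≤ d) (hgd : g.natDegree = d) (sg : Squarefree (g.map (Int.castRingHom ℚ)))
    (Q R X T : ℕ) (hQ : 2 ≤ Q) (hT : T^d < Q^(d+1)) (PP : Finset (ℕ × ℕ))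
    (hPP : ∀ π ∈ PP, (π.1.Prime ∧ Q ≤ π.1) ∧ (π.2.Prime ∧ Q ≤ π.2))
    (E : ℕ × ℕ → Fin 4 → ℤ) (hdet : ∀ π ∈ PP, E π 0 * E π 3 - E π 1 * E π 2 ≠ 0)
    (W : ℕ × ℕ → Finset (ℤ × ℤ)) (hW : ∀ π ∈ PP, ∀ w ∈ W π, 1 ≤ w.2 ∧ w.2 ≤ R)
    (y : ℕ × ℕ → ℤ × ℤ → ℤ × ℤ)
    (hy : ∀ π ∈ PP, ∀ w ∈ W π, hev d f.coeff (y π w).1 (y π w).2 =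
      hev d g.coeff (E π 0 * w.1 + E π 1 * w.2) (E π 2 * w.1 + E π 3 * w.2))
    (hy0 : ∀ π ∈ PP, ∀ w ∈ W π, hev d f.coeff (y π w).1 (y π w).2 ≠ 0)
    (hyT : ∀ π ∈ PP, ∀ w ∈ W π, |hev d f.coeff (y π w).1 (y π w).2| ≤ (T:ℤ)^d)
    (hyp : ∀ π ∈ PP, ∀ w ∈ W π, (π.1:ℤ) ∣ hev d f.coeff (y π w).1 (y π w).2)
    (hyq : ∀ π ∈ PP, ∀ w ∈ W π, (π.2:ℤ) ∣ hev d f.coeff (y π w).1 (y π w).2) :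
    ∃ Y : Finset (ℤ × ℤ), (∀ y ∈ Y, (X:ℤ) < nm y.1 y.2 ∧ hev d f.coeff y.1 y.2 ≠ 0 ∧ |hev d f.coeff y.1 y.2| ≤ (T:ℤ)^d) ∧
      ∑ π ∈ PP, ((W π).filter (fun w => (X:ℤ) < nm (y π w).1 (y π w).2)).card ≤ d^3 * R * Y.card := by
  classical
  set Z := PP.sigma (fun π => (W π).filter (fun w => (X:ℤ) < nm (y π w).1 (y π w).2)) with hZ
  have memZ : ∀ z ∈ Z, z.1 ∈ PP ∧ z.2 ∈ W z.1 ∧ (X:ℤ) < nm (y z.1 z.2).1 (y z.1 z.2).2 := by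
    intro z hz
    rw [hZ, Finset.mem_sigma, Finset.mem_filter] at hz
    exact hz
  refine ⟨Z.image (fun z => y z.1 z.2), ?_, ?_⟩
  · intro v hv
    obtain ⟨z, hz, rfl⟩ := Finset.mem_image.1 hv
    obtain ⟨a1, a2, a3⟩ := memZ z hz
    exact ⟨a3, hy0 _ a1 _ a2, hyT _ a1 _ a2⟩
  · rw [← Finset.card_sigma]
    refine Finset.card_le_mul_card_image _ _ ?_
    intro v hv
    obtain ⟨z0, hz0, hv0⟩ := Finset.mem_image.1 hv
    obtain ⟨a1, a2, a3⟩ := memZ z0 hz0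
    have hv1 : hev d f.coeff v.1 v.2 ≠ 0 := by rw [← hv0]; exact hy0 _ a1 _ a2
    have hv2 : |hev d f.coeff v.1 v.2| < (Q:ℤ)^(d+1) := by
      rw [← hv0]
      exact lt_of_le_of_lt (hyT _ a1 _ a2) (by exact_mod_cast hT)
    set V := Z.filter (fun z => y z.1 z.2 = v) with hV
    have memV : ∀ z ∈ V, z.1 ∈ PP ∧ z.2 ∈ W z.1 ∧ y z.1 z.2 = v := by
      intro z hz
      rw [hV, Finset.mem_filter] at hz
      exact ⟨(memZ z hz.1).1, (memZ z hz.1).2.1, hz.2⟩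
    have c1 : V.card ≤ (d*R) * (V.image Sigma.fst).card := by
      refine Finset.card_le_mul_card_image _ _ ?_
      intro π hπ
      obtain ⟨z1, hz1, hπ1⟩ := Finset.mem_image.1 hπ
      have hπP : π ∈ PP := hπ1 ▸ (memV z1 hz1).1
      have := fib_R g d hd hgd sg (E π) (hdet π hπP) R (hev d f.coeff v.1 v.2)
        ((V.filter (fun z => z.1 = π)).image Sigma.snd) (by
          intro w hw
          obtain ⟨⟨π', w'⟩, hz, rfl⟩ := Finset.mem_image.1 hw
          obtain ⟨hzV, hzπ⟩ := Finset.mem_filter.1 hz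
          obtain ⟨b1, b2, b3⟩ := memV _ hzV
          simp only at hzπ b1 b2 b3 ⊢
          subst hzπ
          exact ⟨hW _ b1 _ b2, by rw [← hy _ b1 _ b2, b3]⟩)
      rwa [Finset.card_image_of_injOn] at this
      rintro ⟨π1, w1⟩ h1 ⟨π2, w2⟩ h2 h
      have e1 := (Finset.mem_filter.1 h1).2
      have e2 := (Finset.mem_filter.1 h2).2
      simp only at e1 e2 h
      subst e1 e2 h
      rfl
    have c2 : (V.image Sigma.fst).card ≤ d * d := by
      have p1 : ((V.image Sigma.fst).image Prod.fst).card ≤ d :=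
        prime_div_card Q d hQ _ hv1 hv2 _ (by
          intro p hp
          obtain ⟨π, hπ, rfl⟩ := Finset.mem_image.1 hp
          obtain ⟨z, hz, rfl⟩ := Finset.mem_image.1 hπ
          obtain ⟨b1, b2, b3⟩ := memV z hz
          refine ⟨(hPP _ b1).1.1, (hPP _ b1).1.2, ?_⟩
          rw [← b3]; exact hyp _ b1 _ b2)
      have p2 : ((V.image Sigma.fst).image Prod.snd).card ≤ d :=
        prime_div_card Q d hQ _ hv1 hv2 _ (by
          intro p hp
          obtain ⟨π, hπ, rfl⟩ := Finset.mem_image.1 hp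
          obtain ⟨z, hz, rfl⟩ := Finset.mem_image.1 hπ
          obtain ⟨b1, b2, b3⟩ := memV z hz
          refine ⟨(hPP _ b1).2.1, (hPP _ b1).2.2, ?_⟩
          rw [← b3]; exact hyq _ b1 _ b2)
      calc (V.image Sigma.fst).card ≤ (((V.image Sigma.fst).image Prod.fst) ×ˢ ((V.image Sigma.fst).image Prod.snd)).card :=
            Finset.card_le_card Finset.subset_product
        _ ≤ d * d := by rw [Finset.card_product]; exact Nat.mul_le_mul p1 p2
    calc V.card ≤ (d*R) * (V.image Sigma.fst).card := c1
      _ ≤ (d*R) * (d*d) := Nat.mul_le_mul_left _ c2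
      _ = d^3*R := by ring
end PartP19

section PartP20
open Polynomial

theorem pq_inj (p q p' q' : ℕ) (hp : p.Prime) (hq : q.Prime) (hp' : p'.Prime) (hq' : q'.Prime) (h : p < q) (h' : p' < q')
    (e : p * q = p' * q') : p = p' ∧ q = q' := by
  have h1 : p ∣ p' * q' := e ▸ dvd_mul_right _ _
  rcases (Nat.Prime.dvd_mul hp).1 h1 with h1 | h1
  · have := (Nat.prime_dvd_prime_iff_eq hp hp').1 h1
    subst this
    exact ⟨rfl, Nat.eq_of_mul_eq_mul_left hp.pos e⟩
  · have := (Nat.prime_dvd_prime_iff_eq hp hq').1 h1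
    subst this
    rw [mul_comm p' p] at e
    have := Nat.eq_of_mul_eq_mul_left hp.pos e
    omega

theorem pairs_card (P : Finset ℕ) : P.card * P.card ≤ P.card + 2 * ((P ×ˢ P).filter (fun π => π.1 < π.2)).card := by
  classical
  have h1 : (P ×ˢ P).card ≤ P.card + ((P ×ˢ P).filter (fun π => π.1 < π.2)).card +
      ((P ×ˢ P).filter (fun π => π.1 < π.2)).card := by
    have : P ×ˢ P ⊆ (P.image (fun p => (p, p)) ∪ (P ×ˢ P).filter (fun π => π.1 < π.2)) ∪
        ((P ×ˢ P).filter (fun π => π.1 < π.2)).image Prod.swap := by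
      rintro ⟨a, b⟩ h
      rw [Finset.mem_product] at h
      simp only [Finset.mem_union, Finset.mem_image, Finset.mem_filter, Finset.mem_product]
      rcases lt_trichotomy a b with hab | hab | hab
      · left; right; exact ⟨h, hab⟩
      · left; left; exact ⟨a, h.1, by rw [hab]⟩
      · right; exact ⟨(b, a), ⟨⟨h.2, h.1⟩, hab⟩, rfl⟩
    refine (Finset.card_le_card this).trans ?_
    refine (Finset.card_union_le _ _).trans ?_
    refine Nat.add_le_add ((Finset.card_union_le _ _).trans ?_) Finset.card_image_le
    exact Nat.add_le_add_right Finset.card_image_le _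
  rw [Finset.card_product] at h1
  omega

theorem hb_small (h : ℤ[X]) (e d H Q B : ℕ) (he : e ≤ d) (hH : ∀ i, |h.coeff i| ≤ H) (hB : B ≤ Q) (hQ : (d+1)*H < Q)
    (x y : ℤ) (hxy : nm x y ≤ B) : |hev e h.coeff x y| < (Q:ℤ)^(e+1) := by
  have h1 := hev_bd e h.coeff H B (fun i _ => hH i) x y hxy
  refine lt_of_le_of_lt h1 ?_
  have h2 : (e+1)*H*B^e ≤ (d+1)*H*Q^e := by gcongr
  have h3 : (d+1)*H*Q^e < Q*Q^e := Nat.mul_lt_mul_of_pos_right hQ (by have : 0 < Q := by omega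
                                                                      positivity)
  have : (e+1)*H*B^e < Q^(e+1) := by rw [pow_succ, mul_comm (Q^e)]; omega
  exact_mod_cast this

theorem not_dvd_small (p Q : ℕ) (h : Q ≤ p) (c : ℤ) (hc : c ≠ 0) (hcQ : |c| < Q) : ¬ (p:ℤ) ∣ c := by
  intro hd
  apply hc
  apply Int.eq_zero_of_abs_lt_dvd hd
  have : (Q:ℤ) ≤ p := by exact_mod_cast h
  linarith

theorem nm_le_div (x y : ℤ) (Q S : ℕ) (hS : 0 < S) (h : nm x y * S ≤ Q) : nm x y ≤ ((Q/S : ℕ) : ℤ) := by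
  rw [Int.natCast_div]
  exact Int.le_ediv_of_mul_le (by exact_mod_cast hS) h

set_option maxHeartbeats 2000000 in
theorem core (d : ℕ) (hd : 4 ≤ d) (f g : ℤ[X]) (hf : f.natDegree = d) (hg : g.natDegree = d)
    (sg : Squarefree (g.map (Int.castRingHom ℚ)))
    (hsub : ∀ w1 w2 : ℤ, ∃ y1 y2 : ℤ, hev d f.coeff y1 y2 = hev d g.coeff w1 w2)
    (N : ℕ) (hN : 0 < N) (u1 u2 : ℤ)
    (h1 h2 k1 k2 : ℤ[X]) (c1 c2 : ℤ) (hc1 : c1 ≠ 0) (hc2 : c2 ≠ 0) (e1 : C c1 * g = h1 * k1) (e2 : C c2 * g = h2 * k2)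
    (d1 : 1 ≤ h1.natDegree) (d2 : 1 ≤ h2.natDegree) (d1' : h1.natDegree ≤ d) (d2' : h2.natDegree ≤ d)
    (hnz : ∀ x y : ℤ, hev h1.natDegree h1.coeff x y = 0 → hev h2.natDegree h2.coeff x y = 0 → x = 0 ∧ y = 0)
    (H K0 : ℕ) (Hf : ∀ i, |f.coeff i| ≤ H) (Hg : ∀ i, |g.coeff i| ≤ H) (H1 : ∀ i, |h1.coeff i| ≤ H) (H2 : ∀ i, |h2.coeff i| ≤ H)
    (Hc1 : |c1| ≤ H) (Hc2 : |c2| ≤ H)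
    (hK0 : ∀ x y : ℤ, IsCoprime x y → hev d f.coeff x y = 0 → nm x y ≤ K0)
    (Q S R L T g0 n far0 Ymax : ℕ) (PR : Finset ℕ)
    (hPR : ∀ p ∈ PR, p.Prime ∧ (Q ≤ p ∧ p < 2*Q) ∧ (∃ r : ℤ, (p:ℤ) ∣ h1.eval r) ∧ (∃ r : ℤ, (p:ℤ) ∣ h2.eval r))
    (hQ : 2 ≤ Q) (hQN : N < Q) (hQH : (d+1)*H < Q) (hS : 2 ≤ S) (hg0 : 0 < g0)
    (hL1 : (d+1)*H*L^d < Q) (hL2 : 2*K0*L < Q) (hT : T^d < Q^(d+1)) (hGT : (d+1)*H*(10*Q*S*R)^d ≤ T^d)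
    (hY : ∀ Y : Finset (ℤ × ℤ), (∀ y ∈ Y, ((L*Q : ℕ):ℤ) < nm y.1 y.2 ∧ hev d f.coeff y.1 y.2 ≠ 0 ∧ |hev d f.coeff y.1 y.2| ≤ (T:ℤ)^d) →
      Y.card ≤ Ymax)
    (hWn : ∀ w : ℕ, g0 * (R/N)^2 ≤ g0 * w + R^2 + g0 * (d * R) → d^2 * n + far0 < w)
    (bad1 bad2 bad3 : ℕ) (hb1 : d * d * (2*Q*(2*(Q/S)+1) + (2*(Q/S)+1)^2) ≤ bad1)
    (hb2 : (2*(Q/S)+1)^2 * d^2 ≤ bad2) (hb3 : d^3 * R * Ymax ≤ (far0+1) * bad3)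
    (hcount : PR.card + 2 * (bad1 + bad2 + bad3 + (R^2*(2*(10*L*S)+1)^2)^(2*d+2) * d^3) < PR.card * PR.card)
    (hl : ∀ z : ℤ, z ≠ 0 → |z| ≤ 2 * ((d+1) * H * (2*(5*Q*S : ℕ))^d)^2 → ∃ l : ℕ, l.Prime ∧ R < l ∧ 6*R^2*(10*L*S) < l^2 ∧
      2*d*R + l*(d^2+d)*(d*g0) ≤ n ∧ ¬ (l:ℤ) ∣ z) :
    ∃ w1 w2 y1 y2 : ℤ, (N:ℤ) ∣ w1 - u1 ∧ (N:ℤ) ∣ w2 - u2 ∧ ∃ a b c e : ℚ, a*w1+b*w2 = y1 ∧ c*w1+e*w2 = y2 ∧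
      ∀ x y : ℚ, hev d f.coeff (a*x+b*y) (c*x+e*y) = hev d g.coeff x y := by
  classical
  have f0 : f ≠ 0 := by rintro rfl; simp at hf; omega
  have gne : g ≠ 0 := by rintro rfl; simp at hg; omega
  have hlc : f.coeff d ≠ 0 := by rw [← hf]; exact leadingCoeff_ne_zero.2 f0
  have hHQ : H < Q := lt_of_le_of_lt (Nat.le_mul_of_pos_left H (Nat.succ_pos d)) hQH
  have hHQ' : (H:ℤ) < Q := by exact_mod_cast hHQ
  have hPRc : PR.card ≤ Q := by
    have : PR ⊆ Finset.Ico Q (2*Q) := by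
      intro p hp
      rw [Finset.mem_Ico]; exact (hPR p hp).2.1
    refine (Finset.card_le_card this).trans ?_
    simp; omega
  have hPR' : ∀ p ∈ PR, p.Prime ∧ Q ≤ p := fun p hp => ⟨(hPR p hp).1, (hPR p hp).2.1.1⟩
  have hBQ : Q / S ≤ Q := Nat.div_le_self _ _
  set PP0 := (PR ×ˢ PR).filter (fun π => π.1 < π.2) with hPP0
  have mem0 : ∀ π ∈ PP0, π.1 ∈ PR ∧ π.2 ∈ PR ∧ π.1 < π.2 := by
    intro π hπ
    rw [hPP0, Finset.mem_filter, Finset.mem_product] at hπ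
    exact ⟨hπ.1.1, hπ.1.2, hπ.2⟩
  set D1 := PP0.filter (fun π => ∃ x y : ℤ, ¬(x = 0 ∧ y = 0) ∧ nm x y ≤ ((Q/S:ℕ):ℤ) ∧
    (π.1:ℤ) ∣ hev h1.natDegree h1.coeff x y ∧ (π.2:ℤ) ∣ hev h2.natDegree h2.coeff x y) with hD1
  set D2 := PP0.filter (fun π => ∃ x y : ℤ, nm x y ≤ ((Q/S:ℕ):ℤ) ∧ hev d f.coeff x y ≠ 0 ∧
    (π.1:ℤ) ∣ hev d f.coeff x y ∧ (π.2:ℤ) ∣ hev d f.coeff x y) with hD2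
  have cD1 : D1.card ≤ bad1 := by
    refine le_trans (d1_count h1 h2 d1 d2 hnz Q (Q/S) hQ (fun x y h => hb_small h1 _ d H Q _ d1' H1 hBQ hQH x y h)
      (fun x y h => hb_small h2 _ d H Q _ d2' H2 hBQ hQH x y h) PR hPR' hPRc D1 ?_) (le_trans ?_ hb1)
    · intro π hπ
      rw [hD1, Finset.mem_filter] at hπ
      exact ⟨(mem0 π hπ.1).1, (mem0 π hπ.1).2.1, hπ.2⟩
    · gcongr
  have cD2 : D2.card ≤ bad2 := by
    refine le_trans (d2_count f d Q (Q/S) hQ (fun x y h => hb_small f _ d H Q _ le_rfl Hf hBQ hQH x y h) PR hPR' D2 ?_) hb2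
    intro π hπ
    rw [hD2, Finset.mem_filter] at hπ
    exact ⟨(mem0 π hπ.1).1, (mem0 π hπ.1).2.1, hπ.2⟩
  set PP := PP0 \ (D1 ∪ D2) with hPP
  have memP : ∀ π ∈ PP, π ∈ PP0 ∧ π ∉ D1 ∧ π ∉ D2 := by
    intro π hπ
    rw [hPP, Finset.mem_sdiff, Finset.mem_union] at hπ
    tauto
  have exE : ∀ π ∈ PP, ∃ E : Fin 4 → ℤ, (E 0 * E 3 - E 1 * E 2 = (π.1*π.2:ℕ) ∨ E 0 * E 3 - E 1 * E 2 = -(π.1*π.2:ℕ)) ∧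
      (∀ i, |E i| ≤ 5*Q*S) ∧
      ∀ u v : ℤ, (π.1:ℤ) ∣ hev g.natDegree g.coeff (E 0 * u + E 1 * v) (E 2 * u + E 3 * v) ∧
        (π.2:ℤ) ∣ hev g.natDegree g.coeff (E 0 * u + E 1 * v) (E 2 * u + E 3 * v) := by
    intro π hπ
    obtain ⟨m0, m1, m2⟩ := memP π hπ
    obtain ⟨p1, p2, p3⟩ := mem0 π m0
    obtain ⟨q1, q2, q3, q4⟩ := hPR _ p1
    obtain ⟨r1, r2, r3, r4⟩ := hPR _ p2
    refine E_exists g h1 h2 k1 k2 c1 c2 hc1 hc2 gne e1 e2 Q S π.1 π.2 q1 r1 p3.ne (by omega) q2.2 r2.2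
      (not_dvd_small _ Q q2.1 _ hc1 (by linarith)) (not_dvd_small _ Q r2.1 _ hc2 (by linarith)) q3 r4 ?_
    intro x y hxy hn hdv
    apply m1
    rw [hD1, Finset.mem_filter]
    exact ⟨m0, x, y, hxy, nm_le_div x y Q S (by omega) hn, hdv⟩
  choose! E hEdet hEA hEdvd using exE
  have posm : ∀ π ∈ PP, 0 < π.1 * π.2 := by
    intro π hπ
    obtain ⟨p1, p2, p3⟩ := mem0 π (memP π hπ).1
    exact Nat.mul_pos (hPR _ p1).1.pos (hPR _ p2).1.pos
  have exW : ∀ π ∈ PP, ∃ W : Finset (ℤ × ℤ), (∀ w ∈ W, 1 ≤ w.1 ∧ w.1 ≤ R ∧ 1 ≤ w.2 ∧ w.2 ≤ R) ∧ (∀ w ∈ W, Int.gcd w.1 w.2 ≤ g0) ∧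
      (∀ w ∈ W, (N:ℤ) ∣ E π 0 * w.1 + E π 1 * w.2 - u1 ∧ (N:ℤ) ∣ E π 2 * w.1 + E π 3 * w.2 - u2) ∧
      (∀ w ∈ W, hev d g.coeff (E π 0 * w.1 + E π 1 * w.2) (E π 2 * w.1 + E π 3 * w.2) ≠ 0) ∧
      d^2 * n + far0 < W.card := by
    intro π hπ
    obtain ⟨p1, p2, p3⟩ := mem0 π (memP π hπ).1
    obtain ⟨q1, q2, -, -⟩ := hPR _ p1
    obtain ⟨r1, r2, -, -⟩ := hPR _ p2
    have cop : ∀ p : ℕ, p.Prime → Q ≤ p → Nat.Coprime p N := fun p hp hpQ =>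
      (Nat.Prime.coprime_iff_not_dvd hp).2 (Nat.not_dvd_of_pos_of_lt hN (by omega))
    obtain ⟨W, w1, w2, w3, w4, w5⟩ := W_exists g d (by omega) hg sg (E π) (π.1*π.2) N (posm π hπ) hN (hEdet π hπ)
      (Nat.Coprime.mul_left (cop _ q1 q2.1) (cop _ r1 r2.1)) u1 u2 R g0 hg0
    exact ⟨W, w1, w2, w3, w4, hWn _ w5⟩
  choose! W hW1 hW2 hW3 hW4 hW5 using exW
  choose y1 y2 hy12 using hsub
  set y : ℕ × ℕ → ℤ × ℤ → ℤ × ℤ := fun π w => (y1 (E π 0 * w.1 + E π 1 * w.2) (E π 2 * w.1 + E π 3 * w.2),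
    y2 (E π 0 * w.1 + E π 1 * w.2) (E π 2 * w.1 + E π 3 * w.2)) with hy_def
  have hyE : ∀ π w, hev d f.coeff (y π w).1 (y π w).2 =
      hev d g.coeff (E π 0 * w.1 + E π 1 * w.2) (E π 2 * w.1 + E π 3 * w.2) := fun π w => hy12 _ _
  clear_value y
  have hdet0 : ∀ π ∈ PP, E π 0 * E π 3 - E π 1 * E π 2 ≠ 0 := by
    intro π hπ h
    have hm : (0:ℤ) < ((π.1*π.2:ℕ):ℤ) := by exact_mod_cast posm π hπ
    rcases hEdet π hπ with h' | h' <;> omega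
  have hy0 : ∀ π ∈ PP, ∀ w ∈ W π, hev d f.coeff (y π w).1 (y π w).2 ≠ 0 := by
    intro π hπ w hw
    rw [hyE]; exact hW4 π hπ w hw
  have hyp : ∀ π ∈ PP, ∀ w ∈ W π, (π.1:ℤ) ∣ hev d f.coeff (y π w).1 (y π w).2 := by
    intro π hπ w hw
    rw [hyE, ← hg]; exact (hEdvd π hπ _ _).1
  have hyq : ∀ π ∈ PP, ∀ w ∈ W π, (π.2:ℤ) ∣ hev d f.coeff (y π w).1 (y π w).2 := by
    intro π hπ w hw
    rw [hyE, ← hg]; exact (hEdvd π hπ _ _).2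
  have hyT : ∀ π ∈ PP, ∀ w ∈ W π, |hev d f.coeff (y π w).1 (y π w).2| ≤ (T:ℤ)^d := by
    intro π hπ w hw
    rw [hyE]
    obtain ⟨w1, w2, w3, w4⟩ := hW1 π hπ w hw
    have bd : ∀ z1 z2 : ℤ, |z1| ≤ 5*Q*S → |z2| ≤ 5*Q*S → |z1 * w.1 + z2 * w.2| ≤ 10*Q*S*R := by
      intro z1 z2 b1 b2
      refine (abs_add_le _ _).trans ?_
      rw [abs_mul, abs_mul, abs_of_pos (by omega : 0 < w.1), abs_of_pos (by omega : 0 < w.2)]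
      calc |z1| * w.1 + |z2| * w.2 ≤ (5*Q*S) * R + (5*Q*S) * R := by
            have : 0 < w.1 := by omega
            have : 0 < w.2 := by omega
            gcongr
        _ = 10*Q*S*R := by ring
    have := hev_bd d g.coeff H (10*Q*S*R) (fun i _ => Hg i) _ _
      (max_le (bd _ _ (hEA π hπ 0) (hEA π hπ 1)) (bd _ _ (hEA π hπ 2) (hEA π hπ 3)))
    refine this.trans ?_
    exact_mod_cast hGT
  obtain ⟨Y, hY1, hY2⟩ := far_count f g d (by omega) hg sg Q R (L*Q) T hQ hT PP
    (fun π hπ => ⟨hPR' _ (mem0 π (memP π hπ).1).1, hPR' _ (mem0 π (memP π hπ).1).2.1⟩) E hdet0 W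
    (fun π hπ w hw => (hW1 π hπ w hw).2.2) y (fun π _ w _ => hyE π w) hy0 hyT hyp hyq
  set far : ℕ × ℕ → Finset (ℤ × ℤ) := fun π => (W π).filter (fun w => ((L*Q:ℕ):ℤ) < nm (y π w).1 (y π w).2) with hfar
  set D3 := PP.filter (fun π => far0 < (far π).card) with hD3
  have cD3 : D3.card ≤ bad3 := by
    have s1 : D3.card • (far0+1) ≤ ∑ π ∈ D3, (far π).card := by
      apply Finset.card_nsmul_le_sum
      intro π hπ
      exact (Finset.mem_filter.1 hπ).2
    have s2 : ∑ π ∈ D3, (far π).card ≤ ∑ π ∈ PP, (far π).card :=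
      Finset.sum_le_sum_of_subset (Finset.filter_subset _ _)
    have s3 : d^3*R*Y.card ≤ d^3*R*Ymax := Nat.mul_le_mul_left _ (hY Y hY1)
    have s4 : (far0+1) * D3.card ≤ (far0+1)*bad3 := by
      rw [smul_eq_mul, mul_comm] at s1
      exact s1.trans (s2.trans (hY2.trans (s3.trans hb3)))
    exact Nat.le_of_mul_le_mul_left s4 (Nat.succ_pos _)
  set good := PP \ D3 with hgood
  have memG : ∀ π ∈ good, π ∈ PP ∧ (far π).card ≤ far0 := by
    intro π hπ
    rw [hgood, Finset.mem_sdiff, hD3, Finset.mem_filter] at hπ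
    refine ⟨hπ.1, ?_⟩
    by_contra h
    exact hπ.2 ⟨hπ.1, by omega⟩
  have cgood : PP0.card ≤ good.card + bad1 + bad2 + bad3 := by
    have a1 : PP0.card ≤ PP.card + (D1 ∪ D2).card := by
      have := Finset.le_card_sdiff (D1 ∪ D2) PP0
      rw [← hPP] at this; omega
    have a2 : PP.card ≤ good.card + D3.card := by
      have := Finset.le_card_sdiff D3 PP
      rw [← hgood] at this; omega
    have a3 := Finset.card_union_le D1 D2
    omega
  have hcg : (R^2*(2*(10*L*S)+1)^2)^(2*d+2) * d^3 < good.card := by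
    have := pairs_card PR
    rw [← hPP0] at this
    omega
  have prG : ∀ π ∈ good, π.1.Prime ∧ π.2.Prime ∧ π.1 < π.2 := by
    intro π hπ
    obtain ⟨p1, p2, p3⟩ := mem0 π (memP π (memG π hπ).1).1
    exact ⟨(hPR _ p1).1, (hPR _ p2).1, p3⟩
  refine finish d (by omega) f g hg sg N R (10*L*S) g0 (5*Q*S) n H u1 u2 (good.image (fun π => π.1*π.2)) ?_ ?_ ?_ ?_
    (fun i _ => Hg i) hl
  · intro m hm
    obtain ⟨π, hπ, rfl⟩ := Finset.mem_image.1 hm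
    exact posm π (memG π hπ).1
  · intro m hm m' hm' hne ⟨k, hk⟩
    obtain ⟨π, hπ, rfl⟩ := Finset.mem_image.1 hm
    obtain ⟨π', hπ', rfl⟩ := Finset.mem_image.1 hm'
    obtain ⟨a1, a2, a3⟩ := prG π hπ
    obtain ⟨b1, b2, b3⟩ := prG π' hπ'
    exact hne (pq_square _ _ _ _ a1 a2 b1 b2 a3 b3 k hk)
  · intro m hm
    obtain ⟨π, hπ, rfl⟩ := Finset.mem_image.1 hm
    obtain ⟨hπP, hfarc⟩ := memG π hπ
    obtain ⟨m0, m1, m2⟩ := memP π hπP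
    obtain ⟨p1, p2, p3⟩ := mem0 π m0
    obtain ⟨q1, q2, -, -⟩ := hPR _ p1
    obtain ⟨r1, r2, -, -⟩ := hPR _ p2
    have hnear : d^2*n < (W π \ far π).card := by
      have := Finset.le_card_sdiff (far π) (W π)
      have := hW5 π hπP
      omega
    have memn : ∀ w ∈ W π \ far π, w ∈ W π ∧ nm (y π w).1 (y π w).2 ≤ L*Q := by
      intro w hw
      rw [Finset.mem_sdiff, hfar, Finset.mem_filter] at hw
      refine ⟨hw.1, ?_⟩
      by_contra h
      push Not at h
      exact hw.2 ⟨hw.1, by push_cast; exact h⟩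
    have hlcf : |f.coeff d| < Q := lt_of_le_of_lt (Hf d) hHQ'
    obtain ⟨B, hB, W0, hW0, hW0c, k, hk⟩ := near_inst f d (by omega) hf H K0 Q L S (fun i _ => Hf i) hK0 π.1 π.2 q1 r1 p3.ne
      q2.1 q2.2 r2.1 r2.2 (not_dvd_small _ Q q2.1 _ hlc hlcf) (not_dvd_small _ Q r2.1 _ hlc hlcf) hS hL1 hL2
      (by
        intro a b hn h0 hdv
        apply m2
        rw [hD2, Finset.mem_filter]
        exact ⟨m0, a, b, nm_le_div a b Q S (by omega) hn, h0, hdv⟩)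
      (W π \ far π) (y π) (fun w hw => (memn w hw).2) (fun w hw => hy0 π hπP w (memn w hw).1)
      (fun w hw => hyp π hπP w (memn w hw).1) (fun w hw => hyq π hπP w (memn w hw).1) n hnear
    have hsubW : ∀ w ∈ W0, w ∈ W π := fun w hw => (memn w (hW0 hw)).1
    refine ⟨E π, B, W0, k, hEdet π hπP, ?_, ?_, fun w hw => hW1 π hπP w (hsubW w hw), fun w hw => hW2 π hπP w (hsubW w hw),
      ?_, fun w hw => hW3 π hπP w (hsubW w hw), ?_, hW0c⟩
    · intro i; push_cast; exact hEA π hπP i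
    · intro i; push_cast; exact hB i
    · intro w hw
      obtain ⟨-, -, t1, t2⟩ := hk w hw
      push_cast; exact ⟨t1, t2⟩
    · intro w hw
      obtain ⟨t1, t2, -, -⟩ := hk w hw
      rw [← t1, ← t2]; exact hyE π w
  · rw [Finset.card_image_of_injOn]
    · exact hcg
    · intro π hπ π' hπ' h
      obtain ⟨a1, a2, a3⟩ := prG π hπ
      obtain ⟨b1, b2, b3⟩ := prG π' hπ'
      exact Prod.ext_iff.2 (pq_inj _ _ _ _ a1 a2 b1 b2 a3 b3 h)
end PartP20

section PartP21
theorem num_L1 (ρ Q M c d : ℕ) (h : c < ρ) (hM : 1+320*d ≤ M) (hQ : ρ^M ≤ Q) : c*(ρ^320)^d < Q := by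
  have hρ : 0 < ρ := by omega
  calc c*(ρ^320)^d < ρ*(ρ^320)^d := Nat.mul_lt_mul_of_pos_right h (by positivity)
    _ = ρ^(1+320*d) := by rw [pow_add, pow_mul, pow_one]
    _ ≤ ρ^M := Nat.pow_le_pow_right hρ hM
    _ ≤ Q := hQ

theorem num_T (ρ Q M d : ℕ) (hρ : 2 ≤ ρ) (hM : 204*d < M) (hQ : ρ^M ≤ Q) : (ρ^204*Q)^d < Q^(d+1) := by
  have hρ0 : 0 < ρ := by omega
  have hQ0 : 0 < Q := lt_of_lt_of_le (by positivity) hQ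
  have : ρ^(204*d) < Q := lt_of_lt_of_le (Nat.pow_lt_pow_right hρ hM) hQ
  calc (ρ^204*Q)^d = ρ^(204*d) * Q^d := by rw [mul_pow, ← pow_mul]
    _ < Q * Q^d := Nat.mul_lt_mul_of_pos_right this (by positivity)
    _ = Q^(d+1) := by rw [pow_succ, mul_comm]

theorem num_GT (ρ Q c d : ℕ) (hd : 1 ≤ d) (h : c*10^d ≤ ρ) (hρ : 1 ≤ ρ) :
    c*(10*Q*ρ^3*ρ^200)^d ≤ (ρ^204*Q)^d := by
  calc c*(10*Q*ρ^3*ρ^200)^d = (c*10^d)*(Q*ρ^203)^d := by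
        rw [mul_assoc c, ← mul_pow]; congr 2; ring
    _ ≤ ρ^d*(Q*ρ^203)^d := Nat.mul_le_mul_right _ (h.trans (Nat.le_self_pow (by omega) ρ))
    _ = (ρ^204*Q)^d := by rw [← mul_pow]; congr 1; ring

theorem num_s2 (ρ Q M K d k : ℕ) (hQ2 : Q = 2^k) (h : K ≤ ρ) (hM : 1+816*d ≤ M) (hρ : 1 ≤ ρ) (hQ : ρ^M ≤ Q) :
    K*(ρ^204*Q)^(4*d) ≤ (ρ^320*Q)*2^((4*d+1)*k) := by
  have h1 : K*(ρ^204)^(4*d) ≤ Q := by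
    calc K*(ρ^204)^(4*d) ≤ ρ*(ρ^204)^(4*d) := Nat.mul_le_mul_right _ h
      _ = ρ^(1+816*d) := by rw [pow_add, pow_one, ← pow_mul]; congr 2; ring
      _ ≤ ρ^M := Nat.pow_le_pow_right hρ hM
      _ ≤ Q := hQ
  have h2 : 2^((4*d+1)*k) = Q^(4*d)*Q := by
    rw [hQ2, ← pow_succ, ← pow_mul]; congr 1; ring
  rw [h2, mul_pow, ← mul_assoc]
  have h3 : 1 ≤ ρ^320 := Nat.one_le_pow _ _ hρ
  calc K*(ρ^204)^(4*d)*Q^(4*d) ≤ Q*Q^(4*d) := Nat.mul_le_mul_right _ h1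
    _ ≤ Q * Q^(4*d) * (ρ^320*Q) := Nat.le_mul_of_pos_right _ (by
        have : 0 < Q := by rw [hQ2]; positivity
        positivity)
    _ = _ := by ring

theorem num_Y (ρ Q M K J d y : ℕ) (hd : 4 ≤ d) (hρ : 1 ≤ ρ) (hJ : 2*K*J ≤ ρ) (hM : 28 ≤ M) (hQ : ρ^M ≤ Q)
    (h : (ρ^320*Q)^(d-2)*y ≤ K*J*((ρ^204*Q)*(ρ^320*Q)^(d-2) + (ρ^204*Q)^d)) : y ≤ ρ^177*Q^2 := by
  have hQ0 : 0 < Q := lt_of_lt_of_le (by positivity) hQ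
  obtain ⟨e, rfl⟩ : ∃ e, d = e + 4 := ⟨d-4, by omega⟩
  have e2 : e + 4 - 2 = e + 2 := by omega
  rw [e2] at h
  have t1 : ρ^204*Q ≤ ρ^176*Q^2 := by
    have : ρ^28 ≤ Q := (Nat.pow_le_pow_right hρ hM).trans hQ
    calc ρ^204*Q = ρ^176*Q*ρ^28 := by ring
      _ ≤ ρ^176*Q*Q := Nat.mul_le_mul_left _ this
      _ = _ := by ring
  have t2 : (ρ^204*Q)^(e+4) ≤ ρ^176*Q^2*(ρ^320*Q)^(e+2) := by
    calc (ρ^204*Q)^(e+4) = ρ^(204*e+816)*Q^(e+4) := by rw [mul_pow, ← pow_mul]; congr 2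
      _ ≤ ρ^(320*e+816)*Q^(e+4) := Nat.mul_le_mul_right _ (Nat.pow_le_pow_right hρ (by omega))
      _ = _ := by rw [mul_pow, ← pow_mul]; ring
  have hpos : 0 < (ρ^320*Q)^(e+2) := by positivity
  refine Nat.le_of_mul_le_mul_left (h.trans ?_) hpos
  calc K*J*((ρ^204*Q)*(ρ^320*Q)^(e+2) + (ρ^204*Q)^(e+4)) ≤ K*J*(ρ^176*Q^2*(ρ^320*Q)^(e+2) + ρ^176*Q^2*(ρ^320*Q)^(e+2)) :=
        Nat.mul_le_mul_left _ (Nat.add_le_add (Nat.mul_le_mul_right _ t1) t2)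
    _ = (2*K*J)*(ρ^176*Q^2*(ρ^320*Q)^(e+2)) := by ring
    _ ≤ ρ*(ρ^176*Q^2*(ρ^320*Q)^(e+2)) := Nat.mul_le_mul_right _ hJ
    _ = _ := by ring

theorem num_W (ρ N d w : ℕ) (hN : 0 < N) (h : 4*N^2*(d^2+d+2) < ρ)
    (hw : ρ^10*(ρ^200/N)^2 ≤ ρ^10*w + (ρ^200)^2 + ρ^10*(d*ρ^200)) : d^2*ρ^396 + ρ^399 < w := by
  have hρ : 0 < ρ := by omega
  by_contra hcon
  push Not at hcon
  have hNρ : N ≤ ρ^200 := by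
    have : N ≤ ρ := by nlinarith [Nat.zero_le (d^2+d)]
    exact this.trans (Nat.le_self_pow (by norm_num) ρ)
  have hq1 : 1 ≤ ρ^200/N := (Nat.one_le_div_iff hN).2 hNρ
  have hq2 : ρ^200 < N * (ρ^200/N + 1) := by exact Nat.lt_mul_div_succ _ hN
  have hq3 : ρ^200 ≤ 2*N*(ρ^200/N) := by nlinarith
  have h4 : (ρ^200)^2 ≤ 4*N^2*(ρ^200/N)^2 := by
    calc (ρ^200)^2 ≤ (2*N*(ρ^200/N))^2 := Nat.pow_le_pow_left hq3 2
      _ = _ := by ring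
  have p1 : ρ^406 ≤ ρ^409 := Nat.pow_le_pow_right hρ (by norm_num)
  have p2 : ρ^400 ≤ ρ^409 := Nat.pow_le_pow_right hρ (by norm_num)
  have p3 : ρ^210 ≤ ρ^409 := Nat.pow_le_pow_right hρ (by norm_num)
  have h5 : ρ^410 ≤ 4*N^2*((d^2+d+2)*ρ^409) := by
    calc ρ^410 = ρ^10*(ρ^200)^2 := by ring
      _ ≤ ρ^10*(4*N^2*(ρ^200/N)^2) := Nat.mul_le_mul_left _ h4
      _ = 4*N^2*(ρ^10*(ρ^200/N)^2) := by ring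
      _ ≤ 4*N^2*(ρ^10*w + (ρ^200)^2 + ρ^10*(d*ρ^200)) := Nat.mul_le_mul_left _ hw
      _ ≤ 4*N^2*(ρ^10*(d^2*ρ^396 + ρ^399) + (ρ^200)^2 + ρ^10*(d*ρ^200)) := by gcongr
      _ = 4*N^2*(d^2*ρ^406 + ρ^409 + ρ^400 + d*ρ^210) := by ring
      _ ≤ 4*N^2*(d^2*ρ^409 + ρ^409 + ρ^409 + d*ρ^409) := by gcongr
      _ = _ := by ring
  have h6 : 4*N^2*((d^2+d+2)*ρ^409) < ρ*ρ^409 := by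
    rw [← mul_assoc]; exact Nat.mul_lt_mul_of_pos_right h (by positivity)
  have h7 : ρ*ρ^409 = ρ^410 := by ring
  omega

theorem num_bad3 (ρ Q d M : ℕ) (hρ : 1 ≤ ρ) (hM : 3 ≤ M) (hQ : ρ^M ≤ Q) : ∃ bad3, d^3*ρ^200*(ρ^177*Q^2) ≤ (ρ^399+1)*bad3 ∧ ρ^3*bad3 ≤ (d^3+1)*Q^2 := by
  have hQ0 : 0 < Q := lt_of_lt_of_le (by positivity) hQ
  refine ⟨d^3*ρ^200*(ρ^177*Q^2)/(ρ^399+1)+1, (Nat.lt_mul_div_succ _ (by positivity)).le, ?_⟩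
  have h1 : (ρ^399) * (d^3*ρ^200*(ρ^177*Q^2)/(ρ^399+1)) ≤ d^3*ρ^200*(ρ^177*Q^2) :=
    (Nat.mul_le_mul_right _ (Nat.le_succ _)).trans (Nat.mul_div_le _ _)
  set b := d^3*ρ^200*(ρ^177*Q^2)/(ρ^399+1)
  have h2 : ρ^22*b ≤ d^3*Q^2 := by
    have hp : 0 < ρ^377 := by positivity
    refine Nat.le_of_mul_le_mul_left ?_ hp
    calc ρ^377*(ρ^22*b) = ρ^399*b := by ring
      _ ≤ _ := h1
      _ = _ := by ring
  have h3 : ρ^3*b ≤ ρ^22*b := Nat.mul_le_mul_right _ (Nat.pow_le_pow_right hρ (by norm_num))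
  have h4 : ρ^3 ≤ Q := (Nat.pow_le_pow_right hρ hM).trans hQ
  have h5 : Q ≤ Q^2 := Nat.le_self_pow (by norm_num) Q
  calc ρ^3*(b+1) = ρ^3*b + ρ^3 := by ring
    _ ≤ d^3*Q^2 + Q^2 := by omega
    _ = _ := by ring

theorem num_count (ρ Q d M k c bad3 : ℕ) (hM : M = 2000*(d+1)) (hQ : ρ^M ≤ Q) (hcQ : c ≤ Q) (hk : Q ≤ k^2*c)
    (hkρ : k^4 ≤ ρ) (hb3 : ρ^3*bad3 ≤ (d^3+1)*Q^2) (h21 : 21 ≤ ρ)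
    (hZ : 1 + 2*(15*d^2 + 9*d^2 + (d^3+1) + d^3) < ρ) :
    c + 2*(d*d*(2*Q*(2*(Q/ρ^3)+1) + (2*(Q/ρ^3)+1)^2) + (2*(Q/ρ^3)+1)^2*d^2 + bad3 +
      ((ρ^200)^2*(2*(10*ρ^320*ρ^3)+1)^2)^(2*d+2)*d^3) < c*c := by
  have hρ : 0 < ρ := by omega
  have hQ0 : 0 < Q := lt_of_lt_of_le (by positivity) hQ
  have hQ3 : ρ^3 ≤ Q := (Nat.pow_le_pow_right hρ (by omega)).trans hQ
  set b := 2*(Q/ρ^3)+1 with hb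
  have hb1 : ρ^3*b ≤ 3*Q := by
    have := Nat.mul_div_le Q (ρ^3)
    rw [hb]
    calc ρ^3*(2*(Q/ρ^3)+1) = 2*(ρ^3*(Q/ρ^3)) + ρ^3 := by ring
      _ ≤ 3*Q := by omega
  have hb2 : b ≤ 3*Q := (Nat.le_mul_of_pos_left b (by positivity)).trans hb1
  have hb3' : ρ^3*b^2 ≤ 9*Q^2 := by
    calc ρ^3*b^2 = (ρ^3*b)*b := by ring
      _ ≤ (3*Q)*(3*Q) := Nat.mul_le_mul hb1 hb2
      _ = _ := by ring
  have hlast : ρ^3*((ρ^200)^2*(2*(10*ρ^320*ρ^3)+1)^2)^(2*d+2) ≤ Q^2 := by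
    have q1 : 2*(10*ρ^320*ρ^3)+1 ≤ ρ^324 := by
      have : 1 ≤ ρ^323 := Nat.one_le_pow _ _ hρ
      calc 2*(10*ρ^320*ρ^3)+1 = 20*ρ^323+1 := by ring
        _ ≤ 21*ρ^323 := by omega
        _ ≤ ρ*ρ^323 := Nat.mul_le_mul_right _ h21
        _ = ρ^324 := by ring
    calc ρ^3*((ρ^200)^2*(2*(10*ρ^320*ρ^3)+1)^2)^(2*d+2) ≤ ρ^3*((ρ^200)^2*(ρ^324)^2)^(2*d+2) := by gcongr
      _ = ρ^3*(ρ^1048)^(2*d+2) := by congr 2; rw [← pow_mul, ← pow_mul, ← pow_add]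
      _ = ρ^(3+1048*(2*d+2)) := by rw [← pow_mul, ← pow_add]
      _ ≤ ρ^(M*2) := Nat.pow_le_pow_right hρ (by omega)
      _ = (ρ^M)^2 := by rw [pow_mul]
      _ ≤ Q^2 := Nat.pow_le_pow_left hQ 2
  set V := ((ρ^200)^2*(2*(10*ρ^320*ρ^3)+1)^2)^(2*d+2)
  by_contra hcon
  push Not at hcon
  have h1 : ρ^3*(c*c) ≤ (1 + 2*(15*d^2 + 9*d^2 + (d^3+1) + d^3))*Q^2 := by
    calc ρ^3*(c*c) ≤ ρ^3*(c + 2*(d*d*(2*Q*b + b^2) + b^2*d^2 + bad3 + V*d^3)) := Nat.mul_le_mul_left _ hcon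
      _ = ρ^3*c + 2*(d^2*(2*Q*(ρ^3*b) + ρ^3*b^2) + d^2*(ρ^3*b^2) + ρ^3*bad3 + d^3*(ρ^3*V)) := by ring
      _ ≤ Q*Q + 2*(d^2*(2*Q*(3*Q) + 9*Q^2) + d^2*(9*Q^2) + (d^3+1)*Q^2 + d^3*Q^2) := by gcongr
      _ = _ := by ring
  have h2 : ρ^3*Q^2 ≤ k^4*((1 + 2*(15*d^2 + 9*d^2 + (d^3+1) + d^3))*Q^2) := by
    calc ρ^3*Q^2 ≤ ρ^3*(k^2*c)^2 := by gcongr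
      _ = k^4*(ρ^3*(c*c)) := by ring
      _ ≤ _ := Nat.mul_le_mul_left _ h1
  have h3 : k^4*((1 + 2*(15*d^2 + 9*d^2 + (d^3+1) + d^3))*Q^2) ≤ ρ*(ρ*Q^2) := by gcongr
  have h4 : ρ*(ρ*Q^2) < ρ^3*Q^2 := by
    have : 0 < ρ^2*Q^2 := by positivity
    calc ρ*(ρ*Q^2) = 1*(ρ^2*Q^2) := by ring
      _ < ρ*(ρ^2*Q^2) := Nat.mul_lt_mul_of_pos_right (by omega) this
      _ = _ := by ring
  omega

theorem num_l (ρ Q d M c : ℕ) (hd : 1 ≤ d) (hM : M = 2000*(d+1)) (hQ : ρ^M ≤ Q) (hQ2 : Q ≤ ρ^(M+1))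
    (hc : 2*(c*10^d)^2 < ρ) (h2n : 2^((M+1)*(2*d+1)) ≤ ρ) (hρ : 61 ≤ ρ) (hd2 : 2*d + (d^2+d)*d ≤ ρ)
    (z : ℤ) (hz : z ≠ 0) (hzb : |z| ≤ 2*((c:ℤ)*(2*(5*Q*ρ^3 : ℕ))^d)^2) :
    ∃ l : ℕ, l.Prime ∧ ρ^200 < l ∧ 6*(ρ^200)^2*(10*ρ^320*ρ^3) < l^2 ∧
      2*d*ρ^200 + l*(d^2+d)*(d*ρ^10) ≤ ρ^396 ∧ ¬ (l:ℤ) ∣ z := by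
  have hρ0 : 0 < ρ := by omega
  have hQ0 : 0 < Q := lt_of_lt_of_le (by positivity) hQ
  have hb : 2*(c*(2*(5*Q*ρ^3))^d)^2 < ρ^((M+1)*(2*d+1)) := by
    calc 2*(c*(2*(5*Q*ρ^3))^d)^2 = (2*(c*10^d)^2)*((Q*ρ^3)^d)^2 := by
          have : (2*(5*Q*ρ^3))^d = 10^d*(Q*ρ^3)^d := by rw [← mul_pow]; congr 1; ring
          rw [this]; ring
      _ < ρ*((Q*ρ^3)^d)^2 := Nat.mul_lt_mul_of_pos_right hc (by positivity)
      _ = Q^(2*d)*ρ^(1+6*d) := by rw [mul_pow, ← pow_mul, mul_pow, ← pow_mul, ← pow_mul]; ring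
      _ ≤ Q^(2*d)*ρ^M := Nat.mul_le_mul_left _ (Nat.pow_le_pow_right hρ0 (by omega))
      _ ≤ Q^(2*d)*Q := Nat.mul_le_mul_left _ hQ
      _ = Q^(2*d+1) := (pow_succ _ _).symm
      _ ≤ (ρ^(M+1))^(2*d+1) := Nat.pow_le_pow_left hQ2 _
      _ = _ := by rw [pow_mul]
  have hb' : |z| < ((ρ^363:ℕ):ℤ)^((M+1)*(2*d+1)) := by
    refine lt_of_le_of_lt hzb ?_
    have h1 : ρ^((M+1)*(2*d+1)) ≤ (ρ^363)^((M+1)*(2*d+1)) :=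
      Nat.pow_le_pow_left (Nat.le_self_pow (by norm_num) ρ) _
    exact_mod_cast lt_of_lt_of_le hb h1
  obtain ⟨l, l1, l2, l3, l4⟩ := prime_avoid (ρ^363) ((M+1)*(2*d+1))
    ((by omega : 2 ≤ ρ).trans (Nat.le_self_pow (by norm_num) ρ)) (by
      have : 0 < (M+1)*(2*d+1) := by positivity
      omega) z hz hb'
  have l5 : l ≤ ρ^364 := by
    calc l ≤ _ := l3
      _ ≤ ρ*ρ^363 := Nat.mul_le_mul_right _ h2n
      _ = ρ^364 := by ring
  refine ⟨l, l1, lt_of_le_of_lt (Nat.pow_le_pow_right hρ0 (by norm_num)) l2, ?_, ?_, l4⟩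
  · have p : 0 < ρ^723 := by positivity
    calc 6*(ρ^200)^2*(10*ρ^320*ρ^3) = 60*ρ^723 := by ring
      _ < ρ*ρ^723 := Nat.mul_lt_mul_of_pos_right (by omega) p
      _ = ρ^724 := by ring
      _ ≤ ρ^726 := Nat.pow_le_pow_right hρ0 (by norm_num)
      _ = (ρ^363)^2 := by ring
      _ ≤ l^2 := Nat.pow_le_pow_left l2.le 2
  · have p1 : ρ^200 ≤ ρ^374 := Nat.pow_le_pow_right hρ0 (by norm_num)
    calc 2*d*ρ^200 + l*(d^2+d)*(d*ρ^10) ≤ 2*d*ρ^374 + ρ^364*(d^2+d)*(d*ρ^10) := by gcongr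
      _ = (2*d + (d^2+d)*d)*ρ^374 := by ring
      _ ≤ ρ*ρ^374 := Nat.mul_le_mul_right _ hd2
      _ = ρ^375 := by ring
      _ ≤ ρ^396 := Nat.pow_le_pow_right hρ0 (by norm_num)

theorem poly_lt_pow (c : ℕ) : ∃ j0, ∀ j, j0 ≤ j → c*(j+1)^4 ≤ 2^j := by
  have h := tendsto_pow_const_div_const_pow_of_one_lt 4 (by norm_num : (1:ℝ) < 2)
  have h' := (Filter.tendsto_add_atTop_iff_nat 1).2 h
  have ev := h'.eventually (gt_mem_nhds (by positivity : (0:ℝ) < 1/(2*(c+1))))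
  obtain ⟨j0, hj0⟩ := Filter.eventually_atTop.1 ev
  refine ⟨j0, fun j hj => ?_⟩
  have h1 := hj0 j hj
  rw [div_lt_div_iff₀ (by positivity) (by positivity)] at h1
  have h2 : (c:ℝ)*((j:ℝ)+1)^4 ≤ 2^j := by
    push_cast at h1
    rw [pow_succ (2:ℝ)] at h1
    have h3 : (0:ℝ) ≤ ((j:ℝ)+1)^4 := by positivity
    rw [one_mul] at h1
    have : ((j:ℝ)+1)^4*(2*(c+1)) = 2*((c:ℝ)*((j:ℝ)+1)^4) + 2*((j:ℝ)+1)^4 := by ring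
    linarith
  exact_mod_cast h2
end PartP21

section PartP22
open Polynomial

theorem coeff_bdd (f : ℤ[X]) : ∃ H : ℕ, ∀ i, |f.coeff i| ≤ H := by
  refine ⟨∑ i ∈ f.support, (f.coeff i).natAbs, fun i => ?_⟩
  by_cases hi : i ∈ f.support
  · have := Finset.single_le_sum (f := fun i => (f.coeff i).natAbs) (fun _ _ => Nat.zero_le _) hi
    rw [Int.abs_eq_natAbs]
    exact_mod_cast this
  · rw [notMem_support_iff.1 hi, abs_zero]
    positivity

theorem natDegree_le_of_factor (g h k : ℤ[X]) (c : ℤ) (hc : c ≠ 0) (hg : g ≠ 0) (e : C c * g = h * k) :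
    h.natDegree ≤ g.natDegree := by
  have hne : C c * g ≠ 0 := mul_ne_zero (C_ne_zero.2 hc) hg
  rw [← natDegree_C_mul (p := g) hc, e]
  rw [e] at hne
  rw [natDegree_mul (left_ne_zero_of_mul hne) (right_ne_zero_of_mul hne)]
  omega

open Classical in
theorem primes_set0 (P : ℕ → Prop) (hns : ¬ Summable (fun p : ℕ => if P p then (1:ℝ)/p else 0)) (k0 : ℕ) :
    ∃ k, k0 ≤ k ∧ ∃ PR : Finset ℕ, 2^k ≤ k^2 * PR.card ∧ PR.card ≤ 2^k ∧ ∀ p ∈ PR, (2^k ≤ p ∧ p < 2*2^k) ∧ P p := by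
  obtain ⟨k, hk, hkc⟩ := dyadic_primes P hns k0
  refine ⟨k, hk, _, hkc, ?_, ?_⟩
  · refine (Finset.card_filter_le _ _).trans ?_
    rw [Nat.card_Ico, pow_succ]; omega
  · intro p hp
    rw [Finset.mem_filter, Finset.mem_Ico, pow_succ] at hp
    exact ⟨⟨hp.1.1, by omega⟩, hp.2⟩

open Classical in
theorem primes_set (h1 h2 : ℤ[X]) (hns : ¬ Summable (fun p : ℕ => if p.Prime ∧ (∃ r : ℤ, (p:ℤ) ∣ h1.eval r) ∧
    (∃ r : ℤ, (p:ℤ) ∣ h2.eval r) then (1:ℝ)/p else 0)) (k0 : ℕ) :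
    ∃ k, k0 ≤ k ∧ ∃ PR : Finset ℕ, 2^k ≤ k^2 * PR.card ∧ PR.card ≤ 2^k ∧
      ∀ p ∈ PR, p.Prime ∧ (2^k ≤ p ∧ p < 2*2^k) ∧ (∃ r : ℤ, (p:ℤ) ∣ h1.eval r) ∧ (∃ r : ℤ, (p:ℤ) ∣ h2.eval r) := by
  obtain ⟨k, hk, PR, hkc, hc, hm⟩ := primes_set0 (fun p : ℕ => p.Prime ∧ (∃ r : ℤ, (p:ℤ) ∣ h1.eval r) ∧ (∃ r : ℤ, (p:ℤ) ∣ h2.eval r))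
    (by convert hns) k0
  exact ⟨k, hk, PR, hkc, hc, fun p hp => ⟨(hm p hp).2.1, (hm p hp).1, (hm p hp).2.2⟩⟩

set_option maxHeartbeats 1000000 in
theorem propA (d : ℕ) (hd : 4 ≤ d) (f g : Polynomial ℤ) (hf : f.natDegree = d) (hg : g.natDegree = d)
    (sf : Squarefree (f.map (Int.castRingHom ℚ))) (sg : Squarefree (g.map (Int.castRingHom ℚ)))
    (hsub : ∀ w1 w2 : ℤ, ∃ y1 y2 : ℤ, hev d f.coeff y1 y2 = hev d g.coeff w1 w2)
    (N : ℕ) (hN : 0 < N) (u1 u2 : ℤ) :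
    ∃ w1 w2 y1 y2 : ℤ, (N:ℤ) ∣ w1 - u1 ∧ (N:ℤ) ∣ w2 - u2 ∧ ∃ a b c e : ℚ, a*w1+b*w2 = y1 ∧ c*w1+e*w2 = y2 ∧
      ∀ x y : ℚ, hev d f.coeff (a*x+b*y) (c*x+e*y) = hev d g.coeff x y := by
  classical
  have gne : g ≠ 0 := by rintro rfl; simp at hg; omega
  obtain ⟨h1, h2, k1, k2, c1, c2, hc1, hc2, e1, e2, d1, d2, hnz, hns⟩ := choose_h g (by omega) sg
  obtain ⟨K, hK, hs2⟩ := s2' d hd f hf sf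
  obtain ⟨K0, -, hK0⟩ := zero_bound f d (by omega) hf sf
  obtain ⟨Hf, hHf⟩ := coeff_bdd f
  obtain ⟨Hg, hHg⟩ := coeff_bdd g
  obtain ⟨H1, hH1⟩ := coeff_bdd h1
  obtain ⟨H2, hH2⟩ := coeff_bdd h2
  obtain ⟨H, hH⟩ : ∃ H : ℕ, H = Hf + Hg + H1 + H2 + c1.natAbs + c2.natAbs := ⟨_, rfl⟩
  have bH : ∀ (z : ℤ) (h : ℕ), |z| ≤ h → h ≤ H → |z| ≤ H := fun z h h1 h2 => h1.trans (by exact_mod_cast h2)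
  obtain ⟨M, hM⟩ : ∃ M, M = 2000*(d+1) := ⟨_, rfl⟩
  obtain ⟨cc, hcc⟩ : ∃ cc, cc = (d+1)*H := ⟨_, rfl⟩
  obtain ⟨Z, z1, z2, z3, z4, z5, z6, z7, z8, z9, z10⟩ : ∃ Z, 61 + N ≤ Z ∧ cc*10^d + 1 ≤ Z ∧ 2*(cc*10^d)^2 + 1 ≤ Z ∧
      2*K*(4*d+1) ≤ Z ∧ 2*K0 + 1 ≤ Z ∧ 4*N^2*(d^2+d+2) + 1 ≤ Z ∧ 1 + 2*(15*d^2 + 9*d^2 + (d^3+1) + d^3) + 1 ≤ Z ∧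
      2*d + (d^2+d)*d ≤ Z ∧ 2^((M+1)*(2*d+1)) ≤ Z ∧ K ≤ Z := by
    generalize 61 + N = a1
    generalize cc*10^d + 1 = a2
    generalize 2*(cc*10^d)^2 + 1 = a3
    generalize 2*K*(4*d+1) = a4
    generalize 2*K0 + 1 = a5
    generalize 4*N^2*(d^2+d+2) + 1 = a6
    generalize 1 + 2*(15*d^2 + 9*d^2 + (d^3+1) + d^3) + 1 = a7
    generalize 2*d + (d^2+d)*d = a8
    generalize 2^((M+1)*(2*d+1)) = a9
    refine ⟨a1 + a2 + a3 + a4 + a5 + a6 + a7 + a8 + a9 + K, ?_, ?_, ?_, ?_, ?_, ?_, ?_, ?_, ?_, ?_⟩ <;> omega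
  obtain ⟨j0, hj0⟩ := poly_lt_pow (Z*M^4)
  obtain ⟨k, hk0, PR, hkc, hPRc, hPRm⟩ := primes_set h1 h2 hns (M*(j0+M))
  have hMpos : 0 < M := by omega
  obtain ⟨j, hj⟩ : ∃ j, j = k / M := ⟨_, rfl⟩
  have hj1 : j0 + M ≤ j := by
    rw [hj, Nat.le_div_iff_mul_le hMpos, mul_comm]; exact hk0
  have hj2 : M*j ≤ k := by rw [hj]; exact Nat.mul_div_le _ _
  have hj3 : k < M*(j+1) := by rw [hj]; exact Nat.lt_mul_div_succ _ hMpos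
  obtain ⟨ρ, hρ⟩ : ∃ ρ, ρ = 2^j := ⟨_, rfl⟩
  obtain ⟨Q, hQ⟩ : ∃ Q, Q = 2^k := ⟨_, rfl⟩
  have hkpos : 1 ≤ k := by
    have : 0 < M*(j0+M) := by positivity
    omega
  have hρk : Z*k^4 ≤ ρ := by
    have h := hj0 j (by omega)
    rw [hρ]
    refine le_trans ?_ h
    calc Z*k^4 ≤ Z*(M*(j+1))^4 := by gcongr
      _ = _ := by ring
  have hZpos : 1 ≤ Z := by omega
  have hk4 : 1 ≤ k^4 := Nat.one_le_pow _ _ hkpos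
  have hZρ : Z ≤ ρ := le_trans (Nat.le_mul_of_pos_right Z hk4) hρk
  have hkρ : k^4 ≤ ρ := le_trans (Nat.le_mul_of_pos_left _ hZpos) hρk
  have hρ61 : 61 ≤ ρ := by omega
  have hQ1 : ρ^M ≤ Q := by
    rw [hρ, hQ, ← pow_mul, mul_comm]
    exact Nat.pow_le_pow_right (by norm_num) hj2
  have hQ2 : Q ≤ ρ^(M+1) := by
    rw [hρ, hQ, ← pow_mul]
    refine Nat.pow_le_pow_right (by norm_num) ?_
    have : M*(j+1) = M*j + M := by ring
    have : j*(M+1) = M*j + j := by ring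
    omega
  have hρQ : ρ ≤ Q := le_trans (Nat.le_self_pow (by omega) ρ) hQ1
  have hcc10 : cc ≤ cc*10^d := Nat.le_mul_of_pos_right _ (by positivity)
  have hccρ : cc < ρ := by omega
  rw [← hQ] at hkc hPRc hPRm
  have hρ0 : 0 < ρ := by omega
  have hQ0 : 0 < Q := by omega
  have y0 : 1 ≤ ρ := by omega
  have y1 : 1 + 320*d ≤ M := by omega
  have y2 : 204*d < M := by omega
  have y3 : cc*10^d ≤ ρ := by omega
  have y4 : 1+816*d ≤ M := by omega
  have y5 : K ≤ ρ := by omega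
  have y6 : 2*K*((4*d+1)*k) ≤ ρ := by
    calc 2*K*((4*d+1)*k) = (2*K*(4*d+1))*k := by ring
      _ ≤ Z*k^4 := Nat.mul_le_mul z4 (Nat.le_self_pow (by norm_num) k)
      _ ≤ ρ := hρk
  have y7 : 4*N^2*(d^2+d+2) < ρ := by omega
  have y8 : 1 + 2*(15*d^2 + 9*d^2 + (d^3+1) + d^3) < ρ := by omega
  have y9 : 2*(cc*10^d)^2 < ρ := by omega
  have y10 : 2^((M+1)*(2*d+1)) ≤ ρ := by omega
  have y11 : 2*d + (d^2+d)*d ≤ ρ := by omega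
  have y12 : 28 ≤ M := by omega
  have y13 : 2*K0 < ρ := by omega
  have y14 : 1 + 320*1 ≤ M := by omega
  have y15 : 2 ≤ ρ := by omega
  have y16 : 21 ≤ ρ := by omega
  have y17 : 1 ≤ d := by omega
  have y18 : 3 ≤ M := by omega
  have x1 : 2 ≤ Q := by omega
  have x2 : N < Q := by omega
  have x3 : (d+1)*H < Q := by omega
  obtain ⟨S, hS⟩ : ∃ S, S = ρ^3 := ⟨_, rfl⟩
  obtain ⟨R, hR⟩ : ∃ R, R = ρ^200 := ⟨_, rfl⟩
  obtain ⟨L, hL⟩ : ∃ L, L = ρ^320 := ⟨_, rfl⟩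
  obtain ⟨T, hT⟩ : ∃ T, T = ρ^204*Q := ⟨_, rfl⟩
  obtain ⟨g0, hg0⟩ : ∃ g0, g0 = ρ^10 := ⟨_, rfl⟩
  obtain ⟨n, hn⟩ : ∃ n, n = ρ^396 := ⟨_, rfl⟩
  obtain ⟨fr, hfr⟩ : ∃ fr, fr = ρ^399 := ⟨_, rfl⟩
  obtain ⟨Ym, hYm⟩ : ∃ Ym, Ym = ρ^177*Q^2 := ⟨_, rfl⟩
  have b1 := num_bad3 ρ Q d M y0 y18 hQ1
  have b2 := num_L1 ρ Q M cc d hccρ y1 hQ1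
  have b3 := num_L1 ρ Q M (2*K0) 1 y13 y14 hQ1
  have b4 := num_T ρ Q M d y15 y2 hQ1
  have b5 := num_GT ρ Q cc d y17 y3 y0
  have b6 := num_s2 ρ Q M K d k hQ y5 y4 y0 hQ1
  have b7 := fun y => num_Y ρ Q M K ((4*d+1)*k) d y hd y0 y6 y12 hQ1
  have b8 := fun w => num_W ρ N d w hN y7
  have b9 := fun bad3 h => num_count ρ Q d M k PR.card bad3 hM hQ1 hPRc hkc hkρ h y16 y8
  have b10 := num_l ρ Q d M cc y17 hM hQ1 hQ2 y9 y10 hρ61 y11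
  have b11 : 2 ≤ S := hS ▸ y15.trans (Nat.le_self_pow (by norm_num) ρ)
  have b12 : 0 < g0 := hg0 ▸ Nat.pow_pos hρ0
  have b13 : 1 ≤ L*Q := hL ▸ Nat.mul_pos (Nat.pow_pos hρ0) hQ0
  have b14 : 1 ≤ T := hT ▸ Nat.mul_pos (Nat.pow_pos hρ0) hQ0
  simp only [← hS, ← hR, ← hL, ← hT, ← hg0, ← hn, ← hfr, ← hYm] at b1 b2 b3 b4 b5 b6 b7 b8 b9 b10
  obtain ⟨bad3, hb3, hb3'⟩ := b1
  clear hS hR hL hT hg0 hn hfr hYm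
  refine core d hd f g hf hg sg hsub N hN u1 u2 h1 h2 k1 k2 c1 c2 hc1 hc2 e1 e2 d1 d2
    (hg ▸ natDegree_le_of_factor g h1 k1 c1 hc1 gne e1) (hg ▸ natDegree_le_of_factor g h2 k2 c2 hc2 gne e2) hnz H K0
    (fun i => bH _ _ (hHf i) (by omega)) (fun i => bH _ _ (hHg i) (by omega)) (fun i => bH _ _ (hH1 i) (by omega))
    (fun i => bH _ _ (hH2 i) (by omega)) (bH _ c1.natAbs (by rw [Int.abs_eq_natAbs]) (by omega))
    (bH _ c2.natAbs (by rw [Int.abs_eq_natAbs]) (by omega)) hK0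
    Q S R L T g0 n fr Ym PR hPRm x1 x2 x3 b11 b12 ?_ ?_ b4 ?_ ?_ b8 _ _ bad3 le_rfl le_rfl hb3 (b9 bad3 hb3') ?_
  · rw [← hcc]; exact b2
  · rw [pow_one] at b3; exact b3
  · rw [← hcc]; exact b5
  · intro Y hY
    exact b7 _ (hs2 (L*Q) T ((4*d+1)*k) b13 b14 b6 Y hY)
  · intro z hz hzb
    refine b10 z hz ?_
    rw [hcc]; push_cast at hzb ⊢; exact hzb
end PartP22

open Matrix

theorem compForm_eval_eq {F G : MvPolynomial (Fin 2) ℚ} {σ : Matrix (Fin 2) (Fin 2) ℚ}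
    (h : ∀ x y, MvPolynomial.eval ![σ 0 0 * x + σ 0 1 * y, σ 1 0 * x + σ 1 1 * y] F = MvPolynomial.eval ![x, y] G) :
    compForm F σ = G := by
  apply MvPolynomial.funext
  intro v
  rw [eval_compForm, vec2_eta v, ← h]
  congr 2
  ext i; fin_cases i <;> simp [Matrix.mulVec, dotProduct, Fin.sum_univ_two]

theorem cover (d : ℕ) (hd : 4 ≤ d) (F G : MvPolynomial (Fin 2) ℚ) (hF : IsBinForm d F) (hG : IsBinForm d G)
    (hval : valueSet G ⊆ valueSet F) (N : ℕ) (hN : 0 < N) (u1 u2 : ℤ) :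
    ∃ w1 w2 y1 y2 : ℤ, (N:ℤ) ∣ w1 - u1 ∧ (N:ℤ) ∣ w2 - u2 ∧ ∃ σ : Matrix (Fin 2) (Fin 2) ℚ,
      compForm F σ = G ∧ σ 0 0 * w1 + σ 0 1 * w2 = y1 ∧ σ 1 0 * w1 + σ 1 1 * w2 = y2 := by
  obtain ⟨D1, hD1, k1, h1⟩ := toPoly d F hF.1 hF.2
  obtain ⟨D2, hD2, k2, h2⟩ := toPoly d G hG.1 hG.2
  obtain ⟨f, fd, fs, hf⟩ := h1 D2 hD2
  obtain ⟨g, gd, gs, hg⟩ := h2 D1 hD1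
  have hD : ((D2 * D1 : ℕ) : ℚ) ≠ 0 := by positivity
  have hD' : ((D1 * D2 : ℕ) : ℚ) = ((D2 * D1 : ℕ) : ℚ) := by rw [mul_comm]
  have hsub : ∀ w1 w2 : ℤ, ∃ y1 y2 : ℤ, hev d f.coeff y1 y2 = hev d g.coeff w1 w2 := by
    intro w1 w2
    have : MvPolynomial.eval ![(w1:ℚ), ((k2 * w1 + w2 : ℤ):ℚ)] G ∈ valueSet F := hval ⟨_, _, rfl⟩
    obtain ⟨y1, y2, hy⟩ := this
    refine ⟨y1, y2 - k1 * y1, ?_⟩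
    have h3 : ((hev d f.coeff y1 (y2 - k1 * y1) : ℤ) : ℚ) = ((hev d g.coeff w1 w2 : ℤ) : ℚ) := by
      rw [← hev_intCast, ← hev_intCast, hf, hg, hD']
      congr 1
      push_cast at hy ⊢
      rw [← hy]
      congr 3
      ring
    exact_mod_cast h3
  obtain ⟨w1, w2, y1, y2, hw1, hw2, a, b, c, e, e1, e2, hfg⟩ :=
    propA d hd f g fd gd fs gs hsub N hN u1 (u2 - k2 * u1)
  refine ⟨w1, k2 * w1 + w2, y1, k1 * y1 + y2, hw1, ?_, !![a - b * k2, b; k1 * (a - b * k2) + c - e * k2, k1 * b + e], ?_, ?_, ?_⟩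
  · have := dvd_add (hw1.mul_left k2) hw2
    have e : k2 * w1 + w2 - u2 = k2 * (w1 - u1) + (w2 - (u2 - k2 * u1)) := by ring
    rw [e]; exact this
  · apply compForm_eval_eq
    intro x y
    have h4 := hfg x (y - k2 * x)
    rw [hf, hg, hD'] at h4
    have h5 := mul_left_cancel₀ hD h4
    rw [show (k2:ℚ) * x + (y - k2 * x) = y by ring] at h5
    rw [← h5]
    congr 2
    ext i; fin_cases i <;> simp <;> ring
  · simp; rw [← e1]; ring
  · simp; rw [← e1, ← e2]; ring

theorem sigma_det (d : ℕ) (hd : 4 ≤ d) (F G : MvPolynomial (Fin 2) ℚ) (hF : IsBinForm d F) (hG : IsBinForm d G)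
    (σ : Matrix (Fin 2) (Fin 2) ℚ) (h : compForm F σ = G) : σ.det ≠ 0 := by
  intro h0
  have h1 : σ 0 0 * σ 1 1 = σ 0 1 * σ 1 0 := by
    rw [Matrix.det_fin_two] at h0; linarith
  -- find p, q, r, s with σ = (p,q)ᵀ (r,s)
  obtain ⟨p, q, r, s, e00, e01, e10, e11⟩ : ∃ p q r s : ℚ, σ 0 0 = p * r ∧ σ 0 1 = p * s ∧ σ 1 0 = q * r ∧ σ 1 1 = q * s := by
    by_cases ha : σ 0 0 = 0
    · by_cases hb : σ 0 1 = 0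
      · exact ⟨0, 1, σ 1 0, σ 1 1, by simp [ha], by simp [hb], by simp, by simp⟩
      · refine ⟨1, σ 1 1 / σ 0 1, σ 0 0, σ 0 1, by simp, by simp, ?_, ?_⟩
        · field_simp; linarith
        · field_simp
    · refine ⟨1, σ 1 0 / σ 0 0, σ 0 0, σ 0 1, by simp, by simp, ?_, ?_⟩
      · field_simp
      · field_simp; linarith
  set L : MvPolynomial (Fin 2) ℚ := MvPolynomial.C r * MvPolynomial.X 0 + MvPolynomial.C s * MvPolynomial.X 1 with hL
  have hGL : G = L * L * (L ^ (d - 2) * MvPolynomial.C (MvPolynomial.eval ![p, q] F)) := by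
    apply MvPolynomial.funext
    intro v
    have hv : σ *ᵥ v = ![(r * v 0 + s * v 1) * p, (r * v 0 + s * v 1) * q] := by
      ext i; fin_cases i
      · simp [Matrix.mulVec, dotProduct, Fin.sum_univ_two, e00, e01]; ring
      · simp [Matrix.mulVec, dotProduct, Fin.sum_univ_two, e10, e11]; ring
    rw [← h, eval_compForm, hv, eval_scale d F hF.1]
    have : d = 2 + (d - 2) := by omega
    conv_lhs => rw [this, pow_add]
    simp [hL]
    ring
  have hu := hG.2 L ⟨_, hGL⟩
  rw [MvPolynomial.isUnit_iff_eq_C_of_isReduced] at hu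
  obtain ⟨a, ha, hu⟩ := hu
  have := congrArg (MvPolynomial.eval ![0,0]) hu
  simp [hL] at this
  rw [← this] at ha
  simp at ha

theorem no_extraordinary_form_D4 (d : ℕ) (hd : 3 ≤ d)
    (F G : MvPolynomial (Fin 2) ℚ) (hF : IsBinForm d F) (hG : IsBinForm d G)
    (hAut : ∃ lam : Matrix (Fin 2) (Fin 2) ℚ, lam.det ≠ 0 ∧
      AutQ F = (fun M => lam⁻¹ * M * lam) '' D4)
    (hval : valueSet F = valueSet G) :
    ∃ a b c e : ℤ, (a * e - b * c = 1 ∨ a * e - b * c = -1) ∧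
      compForm F !![(a : ℚ), (b : ℚ); (c : ℚ), (e : ℚ)] = G := by
  obtain ⟨lam, hlam, hAut⟩ := hAut
  rw [D4_eq_T8] at hAut
  have hlu : IsUnit lam.det := isUnit_iff_ne_zero.mpr hlam
  have hT : ∀ τ ∈ T8, compForm F (lam⁻¹ * τ * lam) = F := by
    intro τ hτ
    have : lam⁻¹ * τ * lam ∈ AutQ F := by rw [hAut]; exact ⟨τ, hτ, rfl⟩
    exact this.2
  have hTdet : ∀ τ ∈ T8, τ.det = 1 ∨ τ.det = -1 := by
    intro τ hτ
    rcases hτ with rfl | rfl | rfl | rfl | rfl | rfl | rfl | rfl <;>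
      simp [sS, sW, Matrix.det_fin_two]
  have hF0 : F ≠ 0 := hF.2.ne_zero
  have hd4 : 4 ≤ d := by
    by_contra hlt
    have hd3 : d = 3 := by omega
    subst hd3
    have h1 := hT (-1) (by simp [T8])
    have h2 : lam⁻¹ * (-1) * lam = -1 := by
      rw [Matrix.mul_neg, Matrix.mul_one, Matrix.neg_mul, Matrix.nonsing_inv_mul _ hlu]
    rw [h2] at h1
    apply hF0
    apply MvPolynomial.funext
    intro v
    have h3 : MvPolynomial.eval v F = - MvPolynomial.eval v F := by
      conv_lhs => rw [← h1, eval_compForm, Matrix.neg_mulVec, Matrix.one_mulVec]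
      have := eval_scale 3 F hF.1 (-1) (v 0) (v 1)
      rw [← vec2_eta v] at this
      have e : -v = ![-1 * v 0, -1 * v 1] := by ext i; fin_cases i <;> simp
      rw [e, this]; ring
    rw [map_zero]; linarith
  obtain ⟨_, _, _, _, _, _, σ0, hσ0, _, _⟩ := cover d hd4 F G hF hG hval.symm.subset 1 one_pos 0 0
  have hdσ := sigma_det d hd4 F G hF hG σ0 hσ0
  have hσu : IsUnit σ0.det := isUnit_iff_ne_zero.mpr hdσ
  have hGF : compForm G σ0⁻¹ = F := by
    rw [← hσ0, ← compForm_mul, Matrix.mul_nonsing_inv _ hσu, compForm_one]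
  -- isos from F to G
  have iso1 : ∀ σ, compForm F σ = G → ∃ τ ∈ T8, σ = lam⁻¹ * τ * (lam * σ0) := by
    intro σ hσ
    have hds := sigma_det d hd4 F G hF hG σ hσ
    have : σ * σ0⁻¹ ∈ AutQ F := by
      refine ⟨?_, ?_⟩
      · rw [Matrix.det_mul]
        apply mul_ne_zero hds
        rw [Matrix.det_nonsing_inv]; simpa using hdσ
      · rw [compForm_mul, hσ, hGF]
    rw [hAut] at this
    obtain ⟨τ, hτ, h⟩ := this
    refine ⟨τ, hτ, ?_⟩
    have h' : lam⁻¹ * τ * lam = σ * σ0⁻¹ := h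
    rw [← Matrix.mul_assoc, h', Matrix.mul_assoc, Matrix.nonsing_inv_mul _ hσu, Matrix.mul_one]
  have iso2 : ∀ σ, compForm G σ = F → ∃ τ ∈ T8, σ = σ0⁻¹ * lam⁻¹ * τ * lam := by
    intro σ hσ
    have hds := sigma_det d hd4 G F hG hF σ hσ
    have : σ0 * σ ∈ AutQ F := by
      refine ⟨?_, ?_⟩
      · rw [Matrix.det_mul]
        exact mul_ne_zero hdσ hds
      · rw [compForm_mul, hσ0, hσ]
    rw [hAut] at this
    obtain ⟨τ, hτ, h⟩ := this
    refine ⟨τ, hτ, ?_⟩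
    have h' : lam⁻¹ * τ * lam = σ0 * σ := h
    rw [Matrix.mul_assoc, Matrix.mul_assoc, ← Matrix.mul_assoc lam⁻¹, h', ← Matrix.mul_assoc, Matrix.nonsing_inv_mul _ hσu, Matrix.one_mul]
  -- integrality on all vectors
  have key : ∀ F G : MvPolynomial (Fin 2) ℚ, IsBinForm d F → IsBinForm d G → valueSet G ⊆ valueSet F →
      ∀ X Y : Matrix (Fin 2) (Fin 2) ℚ, (∀ σ, compForm F σ = G → ∃ τ ∈ T8, σ = X * τ * Y) →
      ∀ x : Fin 2 → ℕ, ∃ τ ∈ T8, ∀ i, ∃ n : ℤ, ((X*τ*Y) *ᵥ (fun i => (x i:ℚ))) i = n := by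
    intro F G hF hG hv X Y hXY x
    obtain ⟨N, hN, hNd⟩ := mat_common_den ((fun τ => X * τ * Y) '' T8) (T8_finite.image _)
    obtain ⟨w1, w2, y1, y2, hw1, hw2, σ, hσ, e1, e2⟩ := cover d hd4 F G hF hG hv N hN (x 0) (x 1)
    obtain ⟨τ, hτ, rfl⟩ := hXY σ hσ
    refine ⟨τ, hτ, ?_⟩
    have hd := hNd (X * τ * Y) ⟨τ, hτ, rfl⟩
    obtain ⟨t1, ht1⟩ := hw1
    obtain ⟨t2, ht2⟩ := hw2
    have ht1' : (x 0 : ℚ) = w1 - N * t1 := by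
      have : ((w1 - x 0 : ℤ) : ℚ) = ((N * t1 : ℤ) : ℚ) := by rw [ht1]
      push_cast at this; linarith
    have ht2' : (x 1 : ℚ) = w2 - N * t2 := by
      have : ((w2 - x 1 : ℤ) : ℚ) = ((N * t2 : ℤ) : ℚ) := by rw [ht2]
      push_cast at this; linarith
    intro i
    obtain ⟨n0, hn0⟩ := hd i 0
    obtain ⟨n1, hn1⟩ := hd i 1
    have hy : ∃ y : ℤ, (X * τ * Y) i 0 * w1 + (X * τ * Y) i 1 * w2 = y := by
      fin_cases i
      · exact ⟨y1, e1⟩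
      · exact ⟨y2, e2⟩
    obtain ⟨y, hy⟩ := hy
    refine ⟨y - n0 * t1 - n1 * t2, ?_⟩
    simp only [Matrix.mulVec, dotProduct, Fin.sum_univ_two]
    rw [ht1', ht2']
    push_cast
    rw [← hy, ← hn0, ← hn1]
    ring
  have hlam0 : lam ≠ 0 := by rintro rfl; simp at hlam
  have hli : lam⁻¹.det ≠ 0 := by rw [Matrix.det_nonsing_inv]; simpa using hlam
  have hsi : σ0⁻¹.det ≠ 0 := by rw [Matrix.det_nonsing_inv]; simpa using hdσ
  have ne0 : ∀ M : Matrix (Fin 2) (Fin 2) ℚ, M.det ≠ 0 → M ≠ 0 := by rintro M hM rfl; simp at hM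
  obtain ⟨τ1, hτ1, hM1⟩ := s7_global lam⁻¹ (lam * σ0) (ne0 _ hli)
    (ne0 _ (by rw [Matrix.det_mul]; exact mul_ne_zero hlam hdσ))
    (key F G hF hG hval.symm.subset _ _ iso1)
  obtain ⟨τ2, hτ2, hM2⟩ := s7_global (σ0⁻¹ * lam⁻¹) lam
    (ne0 _ (by rw [Matrix.det_mul]; exact mul_ne_zero hsi hli)) hlam0
    (key G F hG hF hval.subset _ _ iso2)
  have hc : compForm F (lam⁻¹ * τ1 * (lam * σ0)) = G := by
    rw [← Matrix.mul_assoc, compForm_mul, hT τ1 hτ1, hσ0]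
  have hdl : lam⁻¹.det * lam.det = 1 := by
    rw [← Matrix.det_mul, Matrix.nonsing_inv_mul _ hlu, Matrix.det_one]
  have hds : σ0⁻¹.det * σ0.det = 1 := by
    rw [← Matrix.det_mul, Matrix.nonsing_inv_mul _ hσu, Matrix.det_one]
  have d1 : (lam⁻¹ * τ1 * (lam * σ0)).det = τ1.det * σ0.det := by
    simp only [Matrix.det_mul]
    linear_combination (τ1.det * σ0.det) * hdl
  have d2 : (σ0⁻¹ * lam⁻¹ * τ2 * lam).det = τ2.det * σ0⁻¹.det := by
    simp only [Matrix.det_mul]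
    linear_combination (τ2.det * σ0⁻¹.det) * hdl
  have hintgl : ∀ M : Matrix (Fin 2) (Fin 2) ℚ, (∀ i j, ∃ n : ℤ, M i j = n) → ∃ a b c e : ℤ, M = !![(a : ℚ), (b : ℚ); (c : ℚ), (e : ℚ)] := by
    intro M hM
    obtain ⟨a, ha⟩ := hM 0 0
    obtain ⟨b, hb⟩ := hM 0 1
    obtain ⟨c, hc⟩ := hM 1 0
    obtain ⟨e, he⟩ := hM 1 1
    refine ⟨a, b, c, e, ?_⟩
    ext i j; fin_cases i <;> fin_cases j <;> simp [ha, hb, hc, he]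
  obtain ⟨a, b, c, e, hM1⟩ := hintgl _ hM1
  obtain ⟨a', b', c', e', hM2⟩ := hintgl _ hM2
  refine ⟨a, b, c, e, ?_, by rw [← hM1]; exact hc⟩
  rw [hM1] at d1
  rw [hM2] at d2
  have hprod : ((a * e - b * c : ℤ) : ℚ) * ((a' * e' - b' * c' : ℤ) : ℚ) = τ1.det * τ2.det := by
    simp only [Matrix.det_fin_two_of] at d1 d2
    push_cast
    rw [d1, d2]
    linear_combination (τ1.det * τ2.det) * hds
  have hpm : (a * e - b * c) * (a' * e' - b' * c') = 1 ∨ (a * e - b * c) * (a' * e' - b' * c') = -1 := by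
    have : τ1.det * τ2.det = 1 ∨ τ1.det * τ2.det = -1 := by
      rcases hTdet τ1 hτ1 with h | h <;> rcases hTdet τ2 hτ2 with h' | h' <;> simp [h, h']
    rcases this with h | h
    · left; rw [h] at hprod; exact_mod_cast hprod
    · right; rw [h] at hprod; exact_mod_cast hprod
  apply Int.isUnit_iff.mp
  rcases hpm with h | h
  · exact IsUnit.of_mul_eq_one _ h
  · exact IsUnit.of_mul_eq_one (-(a' * e' - b' * c')) (by rw [mul_neg, h, neg_neg])
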